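/- Let W be a 2-dimensional complex vector space. A map Z : 𝒦(W) → 𝒦(W*) is a continuous, translation invariant and SL(W,ℂ)-contravariant Minkowski valuation if and only if there exist convex bodies M, N ∈ 𝒦(ℂ) such that ZK = D̃_M K + Π_N K for all K ∈ 𝒦(W). Moreover, M and N are unique up to translations. -/

import Mathlib

open scoped Pointwise
open MeasureTheory Module

noncomputable section

section CommonDefs

variable {V V' A : Type*}
variable [NormedAddCommGroup V] [NormedSpace ℝ V]
variable [NormedAddCommGroup V'] [NormedSpace ℝ V']
variable [NormedAddCommGroup A] [NormedSpace ℝ A]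

/-- The supremum of a (pairing) functional over a convex body; used to express the
support function `h(K, ξ) = sup_{x ∈ K} ⟨ξ, x⟩` for the various pairings `p = ⟨ξ, ·⟩`. -/
def hSupp (K : ConvexBody V) (p : V → ℝ) : ℝ := sSup (p '' (K : Set V))

/-- The translate `x + K` of a convex body. -/
def ConvexBody.translate (K : ConvexBody V) (x : V) : ConvexBody V :=
  ⟨(fun y => x + y) '' (K : Set V), K.convex.translate x,
    K.isCompact.image (continuous_const.add continuous_id),
    K.nonempty.image _⟩

/-- The image of a convex body under a continuous linear map. -/
def ConvexBody.mapCLM (f : V →L[ℝ] V') (K : ConvexBody V) : ConvexBody V' :=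
  ⟨f '' (K : Set V), K.convex.linear_image (f : V →ₗ[ℝ] V'),
    K.isCompact.image f.continuous, K.nonempty.image _⟩

/-- The reflection `-K` of a convex body about the origin. -/
def ConvexBody.neg (K : ConvexBody V) : ConvexBody V :=
  K.mapCLM (-(ContinuousLinearMap.id ℝ V))

/-- The union of two convex bodies (a convex body provided it is convex). -/
def ConvexBody.union (K L : ConvexBody V) (h : Convex ℝ ((K : Set V) ∪ (L : Set V))) :
    ConvexBody V :=
  ⟨(K : Set V) ∪ (L : Set V), h, K.isCompact.union L.isCompact,
    K.nonempty.mono Set.subset_union_left⟩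

/-- The intersection of two convex bodies (a convex body provided it is nonempty). -/
def ConvexBody.inter (K L : ConvexBody V) (h : ((K : Set V) ∩ (L : Set V)).Nonempty) :
    ConvexBody V :=
  ⟨(K : Set V) ∩ (L : Set V), K.convex.inter L.convex,
    K.isCompact.inter_right L.isClosed, h⟩

/-- A Minkowski valuation: `Z(K ∪ L) + Z(K ∩ L) = Z(K) + Z(L)` (Minkowski addition)
whenever `K, L, K ∪ L` are convex bodies. -/
def IsMinkowskiValuation (Z : ConvexBody V → ConvexBody A) : Prop :=
  ∀ (K L : ConvexBody V) (hU : Convex ℝ ((K : Set V) ∪ (L : Set V)))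
    (hI : ((K : Set V) ∩ (L : Set V)).Nonempty),
    Z (K.union L hU) + Z (K.inter L hI) = Z K + Z L

/-- A real-valued valuation: `φ(K ∪ L) + φ(K ∩ L) = φ(K) + φ(L)`
whenever `K, L, K ∪ L` are convex bodies. -/
def IsValuation (φ : ConvexBody V → ℝ) : Prop :=
  ∀ (K L : ConvexBody V) (hU : Convex ℝ ((K : Set V) ∪ (L : Set V)))
    (hI : ((K : Set V) ∩ (L : Set V)).Nonempty),
    φ (K.union L hU) + φ (K.inter L hI) = φ K + φ L

/-- Translation invariance of a map defined on convex bodies. -/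
def IsTranslationInvariant {α : Type*} (Z : ConvexBody V → α) : Prop :=
  ∀ (K : ConvexBody V) (x : V), Z (K.translate x) = Z K

/-- The mixed volume (w.r.t. the Lebesgue (Haar) measure `μ`) of an `n`-tuple of convex
bodies, given by the polarization formula
`V(K₁, …, Kₙ) = (1/n!) ∑_{S ⊆ {1,…,n}} (-1)^{n - |S|} vol(∑_{i ∈ S} K_i)`. -/
def mixedVol [MeasurableSpace V] (μ : Measure V) {n : ℕ} (K : Fin n → ConvexBody V) : ℝ :=
  (n.factorial : ℝ)⁻¹ *
    ∑ S : Finset (Fin n), (-1 : ℝ) ^ (n - S.card) * (μ (∑ i ∈ S, (K i : Set V))).toReal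

/-- The extension `V(K, …, K, f)` (with `n - 1` copies of `K`) of the mixed volume to
continuous positively `1`-homogeneous functions `f` on the dual space, defined via
Aleksandrov's variational formula: `V(K,…,K,f)` is `1/n` times the right derivative at
`t = 0` of the volume of the Wulff shape (aka Aleksandrov body) of `h_K + t f`.
For `f = h_L` the Wulff shape is `K + t L`, so this indeed extends `L ↦ V(K, …, K, L)`. -/
def mixedVolFn [MeasurableSpace V] (μ : Measure V) (K : ConvexBody V)
    (f : (V →L[ℝ] ℝ) → ℝ) : ℝ :=
  (Module.finrank ℝ V : ℝ)⁻¹ *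
    derivWithin (fun t : ℝ =>
        (μ {x : V | ∀ ξ : V →L[ℝ] ℝ, ξ x ≤ hSupp K ξ + t * f ξ}).toReal)
      (Set.Ici 0) 0

/-- The dimension of a convex body: the dimension of (the direction of) its affine hull. -/
def bodyDim (K : ConvexBody V) : ℕ := Module.finrank ℝ (vectorSpan ℝ (K : Set V))

/-- A convex body contained in a subspace `E`, viewed as a convex body of `E`. -/
def bodyIn (E : Submodule ℝ V) (K : ConvexBody V) (h : (K : Set V) ⊆ (E : Set V)) :
    ConvexBody ↥E :=
  ⟨Subtype.val ⁻¹' (K : Set V),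
    K.convex.linear_preimage (E.subtype),
    by
      rw [Topology.IsEmbedding.subtypeVal.isCompact_iff,
        Set.image_preimage_eq_of_subset (by rw [Subtype.range_coe]; exact h)]
      exact K.isCompact,
    by obtain ⟨x, hx⟩ := K.nonempty; exact ⟨⟨x, h hx⟩, hx⟩⟩

/-- The properties of the components of McMullen's decomposition of (the support function
of) a Minkowski valuation: each `fᵢ(·, u)` is a continuous, translation invariant
valuation, homogeneous of degree `i`, and each `fᵢ(K, ·)` is continuous and positively
`1`-homogeneous. -/
def McMullenProps (f : ℕ → ConvexBody V → V → ℝ) : Prop :=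
  (∀ (i : ℕ) (u : V), Continuous fun K : ConvexBody V => f i K u) ∧
  (∀ (i : ℕ) (u : V), IsValuation fun K : ConvexBody V => f i K u) ∧
  (∀ (i : ℕ) (u : V), IsTranslationInvariant fun K : ConvexBody V => f i K u) ∧
  (∀ (i : ℕ) (K : ConvexBody V) (u : V) (t : ℝ), 0 < t → f i (t • K) u = t ^ i * f i K u) ∧
  (∀ (i : ℕ) (K : ConvexBody V), Continuous fun u : V => f i K u) ∧
  (∀ (i : ℕ) (K : ConvexBody V) (u : V) (t : ℝ), 0 < t → f i K (t • u) = t * f i K u)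

end CommonDefs

/-- The surface area measure `S(M, ·)` on `S¹ ⊆ ℂ` of a planar convex body `M`,
characterized (uniquely) by the property that it is a finite measure concentrated on the
unit circle with `∫_{S¹} h(L, α) dσ(α) = 2 V(M, L)` for every planar convex body `L`. -/
def IsSurfaceAreaMeasure (M : ConvexBody ℂ) (σ : Measure ℂ) : Prop :=
  IsFiniteMeasure σ ∧ σ (Metric.sphere (0 : ℂ) 1)ᶜ = 0 ∧
    ∀ L : ConvexBody ℂ,
      (∫ α, hSupp L (fun c => (c * (starRingEnd ℂ) α).re) ∂σ) = 2 * mixedVol volume ![M, L]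

section ComplexDefs

variable {W : Type*} [NormedAddCommGroup W] [NormedSpace ℂ W] [FiniteDimensional ℂ W]

/-- The determinant pairing `det(u, v)` on a 2-dimensional complex vector space,
with respect to a fixed basis `b`. -/
def cdet (b : Basis (Fin 2) ℂ W) (u v : W) : ℂ :=
  b.coord 0 u * b.coord 1 v - b.coord 1 u * b.coord 0 v

/-- `det(·, w) : W → ℂ` as a continuous real-linear map. -/
def cdetCLM (b : Basis (Fin 2) ℂ W) (w : W) : W →L[ℝ] ℂ :=
  LinearMap.toContinuousLinearMap
    (((b.coord 1 w) • (b.coord 0 : W →ₗ[ℂ] ℂ)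
      - (b.coord 0 w) • (b.coord 1 : W →ₗ[ℂ] ℂ)).restrictScalars ℝ)

/-- `det(K, w) = {det(k, w) : k ∈ K} ⊆ ℂ`. -/
def detBody (b : Basis (Fin 2) ℂ W) (K : ConvexBody W) (w : W) : ConvexBody ℂ :=
  K.mapCLM (cdetCLM b w)

/-- `N · w = {c • w : c ∈ N} ⊆ W` for a planar convex body `N ⊆ ℂ`. -/
def dotBody (N : ConvexBody ℂ) (w : W) : ConvexBody W :=
  N.mapCLM (LinearMap.toContinuousLinearMap ((LinearMap.toSpanSingleton ℂ W w).restrictScalars ℝ))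

/-- A complex-linear endomorphism, as a continuous real-linear map. -/
def cReal (g : W →ₗ[ℂ] W) : W →L[ℝ] W :=
  LinearMap.toContinuousLinearMap (g.restrictScalars ℝ)

/-- Precomposition `ξ ↦ ξ ∘ g` on the complex dual `W* = W →L[ℂ] ℂ`,
as a continuous real-linear map. The adjoint of `g` is `precompDual g`, and
`g^{-*} = precompDual g⁻¹`. -/
def precompDual (g : W →L[ℂ] W) : (W →L[ℂ] ℂ) →L[ℝ] (W →L[ℂ] ℂ) :=
  LinearMap.toContinuousLinearMap
    { toFun := fun ξ => ξ.comp g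
      map_add' := fun ξ η => ContinuousLinearMap.add_comp ξ η g
      map_smul' := fun r ξ => ContinuousLinearMap.smul_comp r ξ g }

/-- `Z : 𝒦(W) → 𝒦(W*)` is `SL(W,ℂ)`-contravariant: `Z(gK) = g^{-*} Z(K)` for every
`g ∈ SL(W,ℂ)`. -/
def IsSLContravariant (Z : ConvexBody W → ConvexBody (W →L[ℂ] ℂ)) : Prop :=
  ∀ g : W ≃L[ℂ] W, LinearMap.det ((g : W →L[ℂ] W) : W →ₗ[ℂ] W) = 1 →
    ∀ K : ConvexBody W,
      Z (K.mapCLM (cReal (g : W →ₗ[ℂ] W))) =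
        (Z K).mapCLM (precompDual (g.symm : W →L[ℂ] W))

/-- `Z : 𝒦(W) → 𝒦(W)` is `SL(W,ℂ)`-covariant: `Z(gK) = g Z(K)` for every
`g ∈ SL(W,ℂ)`. -/
def IsSLCovariant (Z : ConvexBody W → ConvexBody W) : Prop :=
  ∀ g : W ≃L[ℂ] W, LinearMap.det ((g : W →L[ℂ] W) : W →ₗ[ℂ] W) = 1 →
    ∀ K : ConvexBody W,
      Z (K.mapCLM (cReal (g : W →ₗ[ℂ] W))) = (Z K).mapCLM (cReal (g : W →ₗ[ℂ] W))

end ComplexDefs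

set_option linter.unusedSectionVars false

section Basics

variable {V V' : Type*}
variable [NormedAddCommGroup V] [NormedSpace ℝ V]
variable [NormedAddCommGroup V'] [NormedSpace ℝ V']

namespace ConvexBody

theorem mem_coe {K : ConvexBody V} {x : V} : x ∈ (K : Set V) ↔ x ∈ K := Iff.rfl

@[simp] theorem mem_mk' {s : Set V} {h₁ h₂ h₃} {x : V} :
    x ∈ (ConvexBody.mk s h₁ h₂ h₃ : ConvexBody V) ↔ x ∈ s := Iff.rfl

@[simp] theorem mem_mapCLM {f : V →L[ℝ] V'} {K : ConvexBody V} {y : V'} :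
    y ∈ K.mapCLM f ↔ ∃ x ∈ K, f x = y := Iff.rfl

@[simp] theorem mem_translate {K : ConvexBody V} {x y : V} :
    y ∈ K.translate x ↔ ∃ z ∈ K, x + z = y := Iff.rfl

@[simp] theorem coe_mapCLM {f : V →L[ℝ] V'} {K : ConvexBody V} :
    (K.mapCLM f : Set V') = f '' K := rfl

@[simp] theorem coe_translate {K : ConvexBody V} {x : V} :
    (K.translate x : Set V) = (fun y => x + y) '' K := rfl

@[simp] theorem coe_union {K L : ConvexBody V} (h) : (K.union L h : Set V) = (K : Set V) ∪ L := rfl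

@[simp] theorem coe_inter {K L : ConvexBody V} (h) : (K.inter L h : Set V) = (K : Set V) ∩ L := rfl

theorem mem_add {K L : ConvexBody V} {x : V} : x ∈ K + L ↔ ∃ k ∈ K, ∃ l ∈ L, k + l = x := by
  rw [← mem_coe, coe_add, Set.mem_add]; rfl

theorem mem_smul {K : ConvexBody V} {t : ℝ} {x : V} : x ∈ t • K ↔ ∃ k ∈ K, t • k = x := by
  rw [← mem_coe, coe_smul, Set.mem_smul_set]; rfl

theorem mem_union {K L : ConvexBody V} {h} {x : V} : x ∈ K.union L h ↔ x ∈ K ∨ x ∈ L := Iff.rfl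

/-- The one-point body. -/
def point (x : V) : ConvexBody V := ⟨{x}, convex_singleton x, isCompact_singleton, ⟨x, rfl⟩⟩

@[simp] theorem coe_point (x : V) : (point x : Set V) = {x} := rfl

@[simp] theorem mem_point {x y : V} : y ∈ point x ↔ y = x := Iff.rfl

theorem translate_eq_add (K : ConvexBody V) (x : V) : K.translate x = point x + K := by
  ext y; simp

theorem smul_convex_add (K : ConvexBody V) {s t : ℝ} (hs : 0 ≤ s) (ht : 0 ≤ t) :
    (s + t) • K = s • K + t • K := by
  apply ConvexBody.ext
  rw [coe_add, coe_smul, coe_smul, coe_smul]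
  exact K.convex.add_smul hs ht

theorem mapCLM_add (f : V →L[ℝ] V') (K L : ConvexBody V) :
    (K + L).mapCLM f = K.mapCLM f + L.mapCLM f := by
  apply ConvexBody.ext
  rw [coe_add, coe_mapCLM, coe_mapCLM, coe_mapCLM, coe_add]
  exact Set.image_add f

theorem mapCLM_smul (f : V →L[ℝ] V') (K : ConvexBody V) (t : ℝ) :
    (t • K).mapCLM f = t • K.mapCLM f := by
  apply ConvexBody.ext
  rw [coe_smul, coe_mapCLM, coe_mapCLM, coe_smul]
  exact Set.image_smul_comm _ _ _ (fun x => by simp)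

theorem mapCLM_translate (f : V →L[ℝ] V') (K : ConvexBody V) (x : V) :
    (K.translate x).mapCLM f = (K.mapCLM f).translate (f x) := by
  apply ConvexBody.ext
  simp only [coe_mapCLM, coe_translate, Set.image_image, map_add]

theorem mapCLM_mapCLM {V'' : Type*} [NormedAddCommGroup V''] [NormedSpace ℝ V'']
    (g : V' →L[ℝ] V'') (f : V →L[ℝ] V') (K : ConvexBody V) :
    (K.mapCLM f).mapCLM g = K.mapCLM (g.comp f) := by
  ext y; simp

theorem mapCLM_id (K : ConvexBody V) : K.mapCLM (ContinuousLinearMap.id ℝ V) = K := by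
  ext y; simp

theorem mapCLM_congr {f g : V →L[ℝ] V'} {K : ConvexBody V} (h : ∀ x ∈ K, f x = g x) :
    K.mapCLM f = K.mapCLM g := by
  apply ConvexBody.ext
  exact Set.image_congr h

theorem smul_eq_mapCLM (K : ConvexBody V) (t : ℝ) :
    t • K = K.mapCLM (t • ContinuousLinearMap.id ℝ V) := by
  ext y; simp

theorem zero_smul' (K : ConvexBody V) : (0 : ℝ) • K = 0 := by
  apply ConvexBody.ext
  rw [coe_smul, coe_zero]
  exact Set.zero_smul_set K.nonempty

theorem zero_eq_point : (0 : ConvexBody V) = point 0 := rfl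

theorem smul_point (t : ℝ) (x : V) : t • point x = point (t • x) := by
  ext y; simp

theorem translate_add (K L : ConvexBody V) (x : V) :
    (K + L).translate x = K.translate x + L := by
  rw [translate_eq_add, translate_eq_add, add_assoc]

theorem smul_translate (K : ConvexBody V) (t : ℝ) (x : V) :
    t • K.translate x = (t • K).translate (t • x) := by
  rw [translate_eq_add, translate_eq_add, smul_add, smul_point]

/-! ### Metric -/

theorem dist_le_of_forall {K L : ConvexBody V} {r : ℝ} (hr : 0 ≤ r)
    (h₁ : ∀ x ∈ K, ∃ y ∈ L, dist x y ≤ r) (h₂ : ∀ y ∈ L, ∃ x ∈ K, dist x y ≤ r) :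
    dist K L ≤ r := by
  rw [← hausdorffDist_coe]
  refine Metric.hausdorffDist_le_of_mem_dist hr h₁ fun y hy => ?_
  obtain ⟨x, hx, h⟩ := h₂ y hy
  exact ⟨x, hx, by rwa [dist_comm]⟩

theorem exists_dist_le {K L : ConvexBody V} {x : V} (hx : x ∈ K) :
    ∃ y ∈ L, dist x y ≤ dist K L := by
  obtain ⟨y, hy, h⟩ := L.isCompact.exists_infDist_eq_dist L.nonempty x
  refine ⟨y, hy, ?_⟩
  rw [← h, ← hausdorffDist_coe]
  exact Metric.infDist_le_hausdorffDist_of_mem hx hausdorffEDist_ne_top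

theorem exists_dist_le' {K L : ConvexBody V} {y : V} (hy : y ∈ L) :
    ∃ x ∈ K, dist x y ≤ dist K L := by
  obtain ⟨x, hx, h⟩ := exists_dist_le (L := K) hy
  exact ⟨x, hx, by rwa [dist_comm, dist_comm K L]⟩

theorem dist_mapCLM_le (f : V →L[ℝ] V') (K L : ConvexBody V) :
    dist (K.mapCLM f) (L.mapCLM f) ≤ ‖f‖ * dist K L := by
  refine dist_le_of_forall (by positivity) ?_ ?_
  · rintro _ ⟨x, hx, rfl⟩
    obtain ⟨y, hy, h⟩ := exists_dist_le (L := L) hx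
    exact ⟨f y, ⟨y, hy, rfl⟩, (f.dist_le_opNorm x y).trans (by gcongr)⟩
  · rintro _ ⟨x, hx, rfl⟩
    obtain ⟨y, hy, h⟩ := exists_dist_le' (K := K) hx
    exact ⟨f y, ⟨y, hy, rfl⟩, (f.dist_le_opNorm y x).trans (by gcongr)⟩

theorem continuous_mapCLM (f : V →L[ℝ] V') :
    Continuous fun K : ConvexBody V => K.mapCLM f :=
  (LipschitzWith.of_dist_le_mul (K := ‖f‖₊) fun K L => dist_mapCLM_le f K L).continuous

theorem dist_add_le (K L K' L' : ConvexBody V) :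
    dist (K + L) (K' + L') ≤ dist K K' + dist L L' := by
  refine dist_le_of_forall (by positivity) ?_ ?_
  · intro x hx
    obtain ⟨k, hk, l, hl, rfl⟩ := mem_add.1 hx
    obtain ⟨k', hk', h⟩ := exists_dist_le (L := K') hk
    obtain ⟨l', hl', h'⟩ := exists_dist_le (L := L') hl
    exact ⟨k' + l', mem_add.2 ⟨k', hk', l', hl', rfl⟩,
      (_root_.dist_add_add_le k l k' l').trans (add_le_add h h')⟩
  · intro x hx
    obtain ⟨k, hk, l, hl, rfl⟩ := mem_add.1 hx
    obtain ⟨k', hk', h⟩ := exists_dist_le' (K := K) hk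
    obtain ⟨l', hl', h'⟩ := exists_dist_le' (K := L) hl
    exact ⟨k' + l', mem_add.2 ⟨k', hk', l', hl', rfl⟩,
      (_root_.dist_add_add_le k' l' k l).trans (add_le_add h h')⟩

theorem continuous_add' : Continuous fun p : ConvexBody V × ConvexBody V => p.1 + p.2 := by
  refine (LipschitzWith.of_dist_le_mul (K := 2) fun p q => ?_).continuous
  refine (dist_add_le _ _ _ _).trans ?_
  have h1 : dist p.1 q.1 ≤ dist p q := le_max_left _ _
  have h2 : dist p.2 q.2 ≤ dist p q := le_max_right _ _
  simp only [NNReal.coe_ofNat]; linarith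

instance : ContinuousAdd (ConvexBody V) := ⟨continuous_add'⟩

theorem continuous_smul_const (t : ℝ) : Continuous fun K : ConvexBody V => t • K := by
  simp_rw [smul_eq_mapCLM]; exact continuous_mapCLM _

theorem exists_norm_le (K : ConvexBody V) : ∃ R : ℝ, 0 < R ∧ ∀ x ∈ K, ‖x‖ ≤ R := by
  obtain ⟨R, hR⟩ := K.isBounded.exists_norm_le
  exact ⟨max R 1, by positivity, fun x hx => (hR x hx).trans (le_max_left _ _)⟩

theorem dist_mapCLM_mapCLM_le {f g : V →L[ℝ] V'} {K : ConvexBody V} {r : ℝ} (hr : 0 ≤ r)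
    (h : ∀ x ∈ K, dist (f x) (g x) ≤ r) : dist (K.mapCLM f) (K.mapCLM g) ≤ r := by
  refine dist_le_of_forall hr ?_ ?_
  · rintro _ ⟨x, hx, rfl⟩
    exact ⟨g x, ⟨x, hx, rfl⟩, h x hx⟩
  · rintro _ ⟨x, hx, rfl⟩
    exact ⟨f x, ⟨x, hx, rfl⟩, h x hx⟩

/-- Joint continuity of the image of a convex body under a linear map. -/
theorem continuous_mapCLM_prod :
    Continuous fun p : (V →L[ℝ] V') × ConvexBody V => p.2.mapCLM p.1 := by
  rw [continuous_iff_continuousAt]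
  rintro ⟨f, K⟩
  rw [ContinuousAt, tendsto_iff_dist_tendsto_zero]
  obtain ⟨R, hR, hK⟩ := K.exists_norm_le
  have hlim : Filter.Tendsto (fun p : (V →L[ℝ] V') × ConvexBody V =>
      ‖p.1‖ * dist p.2 K + ‖p.1 - f‖ * R) (nhds (f, K)) (nhds 0) := by
    have : Continuous (fun p : (V →L[ℝ] V') × ConvexBody V =>
      ‖p.1‖ * dist p.2 K + ‖p.1 - f‖ * R) := by fun_prop
    simpa using this.tendsto (f, K)
  refine squeeze_zero (fun _ => dist_nonneg) (fun p => ?_) hlim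
  refine (dist_triangle _ (K.mapCLM p.1) _).trans (add_le_add (dist_mapCLM_le _ _ _) ?_)
  refine dist_mapCLM_mapCLM_le (by positivity) fun x hx => ?_
  rw [dist_eq_norm, ← sub_apply]
  exact ((p.1 - f).le_opNorm x).trans (by gcongr; exact hK x hx)

theorem continuous_smul' : Continuous fun p : ℝ × ConvexBody V => p.1 • p.2 := by
  simp_rw [smul_eq_mapCLM]
  exact continuous_mapCLM_prod.comp ((continuous_fst.smul continuous_const).prodMk continuous_snd)

instance : ContinuousSMul ℝ (ConvexBody V) := ⟨continuous_smul'⟩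

/-! ### Intersections and unions -/

theorem exists_mem_inter_of_convex_union {K L : ConvexBody V}
    (hU : Convex ℝ ((K : Set V) ∪ (L : Set V))) {k l : V} (hk : k ∈ K) (hl : l ∈ L) :
    ∃ t ∈ Set.Icc (0 : ℝ) 1, (1 - t) • k + t • l ∈ K ∧ (1 - t) • k + t • l ∈ L := by
  have hc : Continuous fun t : ℝ => (1 - t) • k + t • l := by fun_prop
  have hpre := isPreconnected_Icc (a := (0 : ℝ)) (b := 1)
  rw [isPreconnected_closed_iff] at hpre
  obtain ⟨t, ht, h1, h2⟩ := hpre ((fun t : ℝ => (1 - t) • k + t • l) ⁻¹' K)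
    ((fun t : ℝ => (1 - t) • k + t • l) ⁻¹' L) (K.isClosed.preimage hc) (L.isClosed.preimage hc)
    (fun t ht => by
      have := hU (Or.inl hk) (Or.inr hl) (sub_nonneg.2 ht.2) ht.1 (by ring)
      exact this)
    ⟨0, by simp, by simpa using hk⟩ ⟨1, by simp, by simpa using hl⟩
  exact ⟨t, ht, h1, h2⟩

theorem inter_nonempty_of_convex_union {K L : ConvexBody V}
    (hU : Convex ℝ ((K : Set V) ∪ (L : Set V))) : ((K : Set V) ∩ L).Nonempty := by
  obtain ⟨k, hk⟩ := K.nonempty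
  obtain ⟨l, hl⟩ := L.nonempty
  obtain ⟨t, -, h⟩ := exists_mem_inter_of_convex_union hU hk hl
  exact ⟨_, h⟩

theorem image_inter_of_convex_union {K L : ConvexBody V}
    (hU : Convex ℝ ((K : Set V) ∪ (L : Set V))) (f : V →L[ℝ] V') :
    f '' ((K : Set V) ∩ L) = f '' (K : Set V) ∩ f '' (L : Set V) := by
  refine (Set.image_inter_subset _ _ _).antisymm ?_
  rintro _ ⟨⟨k, hk, rfl⟩, l, hl, hkl⟩
  obtain ⟨t, -, h1, h2⟩ := exists_mem_inter_of_convex_union hU hk hl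
  refine ⟨_, ⟨h1, h2⟩, ?_⟩
  rw [map_add, map_smul, map_smul, hkl, ← add_smul]; simp

theorem inter_add_of_convex_union {K L C : ConvexBody V}
    (hU : Convex ℝ ((K : Set V) ∪ (L : Set V))) :
    ((K : Set V) ∩ L) + C = ((K : Set V) + C) ∩ ((L : Set V) + C) := by
  refine Set.inter_add_subset.antisymm ?_
  rintro _ ⟨⟨k, hk, c, hc, rfl⟩, l, hl, d, hd, hkl⟩
  obtain ⟨t, ht, h1, h2⟩ := exists_mem_inter_of_convex_union hU hk hl
  refine ⟨_, ⟨h1, h2⟩, (1 - t) • c + t • d,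
    C.convex hc hd (sub_nonneg.2 ht.2) ht.1 (by ring), ?_⟩
  have hkl' : l + d = k + c := hkl
  have : (1 - t) • k + t • l + ((1 - t) • c + t • d) = (1 - t) • (k + c) + t • (l + d) := by
    simp only [smul_add]; abel
  simp only [this, hkl', ← add_smul]; simp

end ConvexBody

end Basics

section Valuations

variable {V V' : Type*}
variable [NormedAddCommGroup V] [NormedSpace ℝ V]
variable [NormedAddCommGroup V'] [NormedSpace ℝ V']

open ConvexBody

namespace IsValuation

theorem comp_mapCLM {φ : ConvexBody V' → ℝ} (h : IsValuation φ) (f : V →L[ℝ] V') :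
    IsValuation fun K : ConvexBody V => φ (K.mapCLM f) := by
  intro K L hU hI
  have hU' : Convex ℝ ((K.mapCLM f : Set V') ∪ (L.mapCLM f : Set V')) := by
    rw [coe_mapCLM, coe_mapCLM, ← Set.image_union]
    exact hU.linear_image (f : V →ₗ[ℝ] V')
  have hI' : ((K.mapCLM f : Set V') ∩ (L.mapCLM f : Set V')).Nonempty :=
    inter_nonempty_of_convex_union hU'
  dsimp only
  rw [← h _ _ hU' hI']
  congr 2 <;> apply ConvexBody.ext
  · simp [Set.image_union]
  · simp [image_inter_of_convex_union hU]

theorem comp_add {φ : ConvexBody V → ℝ} (h : IsValuation φ) (C : ConvexBody V) :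
    IsValuation fun K : ConvexBody V => φ (K + C) := by
  intro K L hU hI
  have hU' : Convex ℝ (((K + C : ConvexBody V) : Set V) ∪ ((L + C : ConvexBody V) : Set V)) := by
    rw [coe_add, coe_add, ← Set.union_add]
    exact hU.add C.convex
  have hI' : (((K + C : ConvexBody V) : Set V) ∩ ((L + C : ConvexBody V) : Set V)).Nonempty :=
    inter_nonempty_of_convex_union hU'
  dsimp only
  rw [← h _ _ hU' hI']
  congr 2 <;> apply ConvexBody.ext
  · simp only [coe_add, coe_union, Set.union_add]
  · simp only [coe_add, coe_inter, inter_add_of_convex_union hU]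

theorem comp_smul {φ : ConvexBody V → ℝ} (h : IsValuation φ) (t : ℝ) :
    IsValuation fun K : ConvexBody V => φ (t • K) := by
  simp_rw [smul_eq_mapCLM]; exact h.comp_mapCLM _

theorem add {φ ψ : ConvexBody V → ℝ} (h : IsValuation φ) (h' : IsValuation ψ) :
    IsValuation fun K => φ K + ψ K := by
  intro K L hU hI
  have := h K L hU hI; have := h' K L hU hI
  dsimp only; linarith

theorem const_mul {φ : ConvexBody V → ℝ} (h : IsValuation φ) (c : ℝ) :
    IsValuation fun K => c * φ K := by
  intro K L hU hI
  dsimp only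
  rw [← mul_add, h K L hU hI, mul_add]

theorem sub {φ ψ : ConvexBody V → ℝ} (h : IsValuation φ) (h' : IsValuation ψ) :
    IsValuation fun K => φ K - ψ K := by
  intro K L hU hI
  have := h K L hU hI; have := h' K L hU hI
  dsimp only; linarith

theorem const (c : ℝ) : IsValuation fun _ : ConvexBody V => c := fun _ _ _ _ => rfl

theorem sum {ι : Type*} {s : Finset ι} {φ : ι → ConvexBody V → ℝ}
    (h : ∀ i ∈ s, IsValuation (φ i)) : IsValuation fun K => ∑ i ∈ s, φ i K := by
  intro K L hU hI
  dsimp only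
  rw [← Finset.sum_add_distrib, ← Finset.sum_add_distrib]
  exact Finset.sum_congr rfl fun i hi => h i hi K L hU hI

end IsValuation

/-- Continuous translation invariant real valuations. -/
structure IsCTV (φ : ConvexBody V → ℝ) : Prop where
  cont : Continuous φ
  val : IsValuation φ
  trans : IsTranslationInvariant φ

namespace IsCTV

theorem comp_mapCLM {φ : ConvexBody V' → ℝ} (h : IsCTV φ) (f : V →L[ℝ] V') :
    IsCTV fun K : ConvexBody V => φ (K.mapCLM f) :=
  ⟨h.cont.comp (continuous_mapCLM f), h.val.comp_mapCLM f, fun K x => by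
    rw [mapCLM_translate, h.trans]⟩

theorem comp_add {φ : ConvexBody V → ℝ} (h : IsCTV φ) (C : ConvexBody V) :
    IsCTV fun K : ConvexBody V => φ (K + C) :=
  ⟨h.cont.comp (continuous_id.add continuous_const), h.val.comp_add C, fun K x => by
    rw [← ConvexBody.translate_add, h.trans]⟩

theorem comp_smul {φ : ConvexBody V → ℝ} (h : IsCTV φ) (t : ℝ) :
    IsCTV fun K : ConvexBody V => φ (t • K) := by
  simp_rw [smul_eq_mapCLM]; exact h.comp_mapCLM _

theorem add {φ ψ : ConvexBody V → ℝ} (h : IsCTV φ) (h' : IsCTV ψ) :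
    IsCTV fun K => φ K + ψ K :=
  ⟨h.cont.add h'.cont, h.val.add h'.val, fun K x => by rw [h.trans, h'.trans]⟩

theorem sub {φ ψ : ConvexBody V → ℝ} (h : IsCTV φ) (h' : IsCTV ψ) :
    IsCTV fun K => φ K - ψ K :=
  ⟨h.cont.sub h'.cont, h.val.sub h'.val, fun K x => by rw [h.trans, h'.trans]⟩

theorem const_mul {φ : ConvexBody V → ℝ} (h : IsCTV φ) (c : ℝ) :
    IsCTV fun K => c * φ K :=
  ⟨continuous_const.mul h.cont, h.val.const_mul c, fun K x => by rw [h.trans]⟩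

theorem const (c : ℝ) : IsCTV fun _ : ConvexBody V => c :=
  ⟨continuous_const, .const c, fun _ _ => rfl⟩

theorem sum {ι : Type*} {s : Finset ι} {φ : ι → ConvexBody V → ℝ}
    (h : ∀ i ∈ s, IsCTV (φ i)) : IsCTV fun K => ∑ i ∈ s, φ i K :=
  ⟨continuous_finsetSum _ fun i hi => (h i hi).cont, .sum fun i hi => (h i hi).val,
    fun K x => Finset.sum_congr rfl fun i hi => (h i hi).trans K x⟩

end IsCTV

/-! ### Set-level extension of functionals of convex bodies -/

open Classical in
/-- The extension by zero of a functional on convex bodies to all sets. -/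
def hat (φ : ConvexBody V → ℝ) (S : Set V) : ℝ :=
  if h : Convex ℝ S ∧ IsCompact S ∧ S.Nonempty then φ ⟨S, h.1, h.2.1, h.2.2⟩ else 0

@[simp] theorem hat_coe (φ : ConvexBody V → ℝ) (K : ConvexBody V) : hat φ (K : Set V) = φ K := by
  rw [hat, dif_pos ⟨K.convex, K.isCompact, K.nonempty⟩]
  rfl

@[simp] theorem hat_empty (φ : ConvexBody V → ℝ) : hat φ ∅ = 0 := by
  rw [hat, dif_neg (by simp)]

theorem hat_of_convex (φ : ConvexBody V → ℝ) {S : Set V} (h₁ : Convex ℝ S) (h₂ : IsCompact S)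
    (h₃ : S.Nonempty) : hat φ S = φ ⟨S, h₁, h₂, h₃⟩ := by
  rw [hat, dif_pos ⟨h₁, h₂, h₃⟩]

theorem hat_cut {φ : ConvexBody V → ℝ} (hφ : IsValuation φ) {S : Set V} (h₁ : Convex ℝ S)
    (h₂ : IsCompact S) (g : V →L[ℝ] ℝ) (c : ℝ) :
    hat φ S + hat φ (S ∩ {x | g x = c}) =
      hat φ (S ∩ {x | g x ≤ c}) + hat φ (S ∩ {x | c ≤ g x}) := by
  have hle : IsClosed {x | g x ≤ c} := isClosed_le g.continuous continuous_const
  have hge : IsClosed {x | c ≤ g x} := isClosed_le continuous_const g.continuous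
  have cle : Convex ℝ {x | g x ≤ c} := convex_halfSpace_le g.isLinear c
  have cge : Convex ℝ {x | c ≤ g x} := convex_halfSpace_ge g.isLinear c
  have hun : (S ∩ {x | g x ≤ c}) ∪ (S ∩ {x | c ≤ g x}) = S := by
    ext x; simp only [Set.mem_union, Set.mem_inter_iff, Set.mem_ofPred_eq, ← and_or_left]
    simp [le_total]
  have hin : (S ∩ {x | g x ≤ c}) ∩ (S ∩ {x | c ≤ g x}) = S ∩ {x | g x = c} := by
    ext x; simp only [Set.mem_inter_iff, Set.mem_ofPred_eq, le_antisymm_iff]; tauto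
  rcases (S ∩ {x | g x ≤ c}).eq_empty_or_nonempty with e | e
  · rw [e, Set.empty_union] at hun
    rw [e, Set.empty_inter] at hin
    rw [← hin, e, hun]; simp
  rcases (S ∩ {x | c ≤ g x}).eq_empty_or_nonempty with e' | e'
  · rw [e', Set.union_empty] at hun
    rw [e', Set.inter_empty] at hin
    rw [← hin, e', hun]
  let K : ConvexBody V := ⟨_, h₁.inter cle, h₂.inter_right hle, e⟩
  let L : ConvexBody V := ⟨_, h₁.inter cge, h₂.inter_right hge, e'⟩
  have hU : Convex ℝ ((K : Set V) ∪ (L : Set V)) := by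
    change Convex ℝ ((S ∩ {x | g x ≤ c}) ∪ (S ∩ {x | c ≤ g x})); rwa [hun]
  have hI := inter_nonempty_of_convex_union hU
  have := hφ K L hU hI
  rw [← hat_coe φ, ← hat_coe φ, ← hat_coe φ K, ← hat_coe φ L] at this
  simpa only [coe_union, coe_inter, K, L, ConvexBody.coe_mk, hun, hin] using this

end Valuations

section Support

variable {V V' : Type*}
variable [NormedAddCommGroup V] [NormedSpace ℝ V]
variable [NormedAddCommGroup V'] [NormedSpace ℝ V']

open ConvexBody

theorem bddAbove_hSupp (K : ConvexBody V) (g : V →L[ℝ] ℝ) : BddAbove (g '' (K : Set V)) :=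
  (K.isCompact.image g.continuous).bddAbove

theorem le_hSupp {K : ConvexBody V} (g : V →L[ℝ] ℝ) {x : V} (hx : x ∈ K) : g x ≤ hSupp K g :=
  le_csSup (bddAbove_hSupp K g) ⟨x, hx, rfl⟩

theorem hSupp_le {K : ConvexBody V} {g : V → ℝ} {c : ℝ} (h : ∀ x ∈ K, g x ≤ c) :
    hSupp K g ≤ c :=
  csSup_le (K.nonempty.image _) (by rintro _ ⟨x, hx, rfl⟩; exact h x hx)

theorem exists_hSupp_eq (K : ConvexBody V) (g : V →L[ℝ] ℝ) : ∃ x ∈ K, g x = hSupp K g := by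
  obtain ⟨x, hx, h⟩ := K.isCompact.exists_sSup_image_eq K.nonempty g.continuous.continuousOn
  exact ⟨x, hx, h.symm⟩

theorem hSupp_add (K L : ConvexBody V) (g : V →L[ℝ] ℝ) :
    hSupp (K + L) g = hSupp K g + hSupp L g := by
  apply le_antisymm
  · refine hSupp_le fun x hx => ?_
    obtain ⟨k, hk, l, hl, rfl⟩ := mem_add.1 hx
    rw [map_add]; exact add_le_add (le_hSupp g hk) (le_hSupp g hl)
  · obtain ⟨k, hk, h⟩ := exists_hSupp_eq K g
    obtain ⟨l, hl, h'⟩ := exists_hSupp_eq L g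
    rw [← h, ← h', ← map_add]
    exact le_hSupp g (mem_add.2 ⟨k, hk, l, hl, rfl⟩)

theorem hSupp_mapCLM (K : ConvexBody V) (f : V →L[ℝ] V') (g : V' → ℝ) :
    hSupp (K.mapCLM f) g = hSupp K (fun x => g (f x)) := by
  rw [hSupp, hSupp, coe_mapCLM, Set.image_image]

theorem hSupp_point (x : V) (g : V → ℝ) : hSupp (point x) g = g x := by
  simp [hSupp]

theorem hSupp_smul (K : ConvexBody V) {t : ℝ} (ht : 0 ≤ t) (g : V →L[ℝ] ℝ) :
    hSupp (t • K) g = t * hSupp K g := by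
  rw [smul_eq_mapCLM, hSupp_mapCLM]
  simp only [smul_apply, map_smul, ContinuousLinearMap.id_apply, smul_eq_mul]
  rw [hSupp, hSupp, ← Set.image_image (fun y => t * y) g]
  exact Real.sSup_smul_of_nonneg ht _

theorem hSupp_mono {K L : ConvexBody V} (h : (K : Set V) ⊆ L) (g : V →L[ℝ] ℝ) :
    hSupp K g ≤ hSupp L g := hSupp_le fun _ hx => le_hSupp g (h hx)

theorem subset_of_hSupp_le {K L : ConvexBody V} (h : ∀ g : V →L[ℝ] ℝ, hSupp K g ≤ hSupp L g) :
    (K : Set V) ⊆ L := by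
  intro x hx
  by_contra hxL
  obtain ⟨g, u, h1, h2⟩ := geometric_hahn_banach_closed_point L.convex L.isClosed hxL
  have h3 : hSupp L g ≤ u := hSupp_le fun y hy => (h1 y hy).le
  have h4 := le_hSupp g hx
  linarith [h g]

theorem eq_of_hSupp_eq {K L : ConvexBody V} (h : ∀ g : V →L[ℝ] ℝ, hSupp K g = hSupp L g) :
    K = L :=
  ConvexBody.ext ((subset_of_hSupp_le fun g => (h g).le).antisymm
    (subset_of_hSupp_le fun g => (h g).ge))

theorem hSupp_sub_le (K L : ConvexBody V) (g : V →L[ℝ] ℝ) :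
    hSupp K g ≤ hSupp L g + ‖g‖ * dist K L := by
  refine hSupp_le fun x hx => ?_
  obtain ⟨y, hy, h⟩ := exists_dist_le (L := L) hx
  have h1 := le_hSupp g hy
  have h2 : g x - g y ≤ ‖g‖ * dist K L := by
    rw [← map_sub]
    refine (le_abs_self _).trans ((g.le_opNorm _).trans ?_)
    rw [← dist_eq_norm]; gcongr
  linarith

theorem abs_hSupp_sub_le (K L : ConvexBody V) (g : V →L[ℝ] ℝ) :
    |hSupp K g - hSupp L g| ≤ ‖g‖ * dist K L := by
  have h1 := hSupp_sub_le K L g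
  have h2 := hSupp_sub_le L K g
  rw [dist_comm] at h2
  rw [abs_le]; constructor <;> linarith

theorem continuous_hSupp (g : V →L[ℝ] ℝ) : Continuous fun K : ConvexBody V => hSupp K g :=
  (LipschitzWith.of_dist_le_mul (K := ‖g‖₊) fun K L => abs_hSupp_sub_le K L g).continuous

end Support

section Polyhedral

variable {V : Type*} [NormedAddCommGroup V] [NormedSpace ℝ V]

open ConvexBody

/-- Bodies that are finite intersections of half-spaces. -/
def IsPolyhedral (L : ConvexBody V) : Prop :=
  ∃ G : Finset ((V →L[ℝ] ℝ) × ℝ), ∀ x, x ∈ L ↔ ∀ p ∈ G, p.1 x ≤ p.2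

/-- The dimension of the body `L` is at most `d`. -/
def DimLE (d : ℕ) (L : ConvexBody V) : Prop :=
  ∃ E : Submodule ℝ V, FiniteDimensional ℝ E ∧ finrank ℝ E ≤ d ∧ ∀ x ∈ L, ∀ y ∈ L, y - x ∈ E

theorem DimLE.translate {d : ℕ} {L : ConvexBody V} (h : DimLE d L) (x : V) :
    DimLE d (L.translate x) := by
  obtain ⟨E, h1, h2, h3⟩ := h
  refine ⟨E, h1, h2, ?_⟩
  rintro _ ⟨y, hy, rfl⟩ _ ⟨z, hz, rfl⟩
  have := h3 y hy z hz
  simpa using this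

theorem DimLE.mono {d : ℕ} {L L' : ConvexBody V} (h : DimLE d L) (hL : ∀ x ∈ L', x ∈ L) :
    DimLE d L' := by
  obtain ⟨E, h1, h2, h3⟩ := h
  exact ⟨E, h1, h2, fun x hx y hy => h3 x (hL x hx) y (hL y hy)⟩

theorem IsPolyhedral.translate {L : ConvexBody V} (h : IsPolyhedral L) (x : V) : IsPolyhedral (L.translate x) := by
  classical
  obtain ⟨G, hG⟩ := h
  refine ⟨G.image fun p => (p.1, p.2 + p.1 x), fun y => ?_⟩
  have : y ∈ L.translate x ↔ y - x ∈ L := by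
    constructor
    · rintro ⟨z, hz, rfl⟩; simpa using hz
    · intro h; exact ⟨y - x, h, by simp⟩
  rw [this, hG]
  simp only [Finset.mem_image, forall_exists_index, and_imp, forall_apply_eq_imp_iff₂, map_sub,
    sub_le_iff_le_add]

theorem IsPolyhedral.of_inter {L L' : ConvexBody V} (h : IsPolyhedral L) (g : V →L[ℝ] ℝ) (c : ℝ)
    (hL : ∀ x, x ∈ L' ↔ x ∈ L ∧ g x ≤ c) : IsPolyhedral L' := by
  classical
  obtain ⟨G, hG⟩ := h
  refine ⟨insert (g, c) G, fun x => ?_⟩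
  rw [hL, hG]; simp [and_comm]

theorem IsPolyhedral.of_inter_eq {L L' : ConvexBody V} (h : IsPolyhedral L) (g : V →L[ℝ] ℝ) (c : ℝ)
    (hL : ∀ x, x ∈ L' ↔ x ∈ L ∧ g x = c) : IsPolyhedral L' := by
  classical
  obtain ⟨G, hG⟩ := h
  refine ⟨insert (g, c) (insert (-g, -c) G), fun x => ?_⟩
  rw [hL, hG]; simp [le_antisymm_iff]; tauto

/-- `L` is star-shaped about `0`, cut out near its visible boundary by `ℓ ≤ 1`, `ℓ ∈ F`. -/
def IsStar (L : ConvexBody V) (F : Finset (V →L[ℝ] ℝ)) : Prop :=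
  (∀ ℓ ∈ F, ∀ x ∈ L, ℓ x ≤ 1) ∧
    ∀ x ∈ L, ∀ t : ℝ, 0 ≤ t → (∀ ℓ ∈ F, t * ℓ x ≤ 1) → t • x ∈ L

theorem star_induction {d : ℕ} {Φ : ConvexBody V → ℝ} (hΦ : IsValuation Φ)
    (hlow : ∀ L, IsPolyhedral L → ∀ d' < d, DimLE d' L → Φ L = 0)
    (hpyr : ∀ L, IsPolyhedral L → DimLE d L → 0 ∈ L → ∀ ℓ : V →L[ℝ] ℝ, (∀ x ∈ L, ℓ x ≤ 1) →
      (∀ x ∈ L, ∀ t : ℝ, 0 ≤ t → t * ℓ x ≤ 1 → t • x ∈ L) → Φ L = 0) (n : ℕ) :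
    ∀ (F : Finset (V →L[ℝ] ℝ)) (L : ConvexBody V), F.card = n → IsPolyhedral L → DimLE d L → 0 ∈ L →
      IsStar L F → Φ L = 0 := by
  classical
  induction n with
  | zero =>
    intro F L hF hP hd h0 hs
    obtain rfl := Finset.card_eq_zero.1 hF
    exact hpyr L hP hd h0 0 (by simp) fun x hx t ht _ => hs.2 x hx t ht (by simp)
  | succ n ih =>
    intro F L hF hP hd h0 hs
    rcases Nat.eq_zero_or_pos n with rfl | hn
    · obtain ⟨ℓ, rfl⟩ := Finset.card_eq_one.1 hF
      refine hpyr L hP hd h0 ℓ (hs.1 ℓ (by simp)) fun x hx t ht h => hs.2 x hx t ht ?_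
      simpa using h
    obtain ⟨ℓ₁, h₁, ℓ₂, h₂, hne⟩ := Finset.one_lt_card.1 (by omega : 1 < F.card)
    have key : ∀ (ℓ₁ ℓ₂ : V →L[ℝ] ℝ), ℓ₁ ∈ F → ℓ₂ ∈ F → ℓ₁ ≠ ℓ₂ → ∀ L' : ConvexBody V,
        (∀ x, x ∈ L' ↔ x ∈ L ∧ (ℓ₂ - ℓ₁) x ≤ 0) → Φ L' = 0 := by
      intro ℓ₁ ℓ₂ h₁ h₂ hne L' hL'
      refine ih (F.erase ℓ₂) L' ?_ (hP.of_inter _ _ hL') (hd.mono fun x hx => ((hL' x).1 hx).1)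
        ((hL' 0).2 ⟨h0, by simp⟩) ⟨fun ℓ hℓ x hx => hs.1 ℓ (Finset.mem_of_mem_erase hℓ) x
          ((hL' x).1 hx).1, fun x hx t ht h => ?_⟩
      · rw [Finset.card_erase_of_mem h₂, hF]; rfl
      · obtain ⟨hx1, hx2⟩ := (hL' x).1 hx
        rw [sub_apply] at hx2
        rw [hL']
        refine ⟨hs.2 x hx1 t ht fun ℓ hℓ => ?_, ?_⟩
        · by_cases e : ℓ = ℓ₂
          · subst e
            refine le_trans ?_ (h ℓ₁ (Finset.mem_erase.2 ⟨hne, h₁⟩))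
            nlinarith
          · exact h ℓ (Finset.mem_erase.2 ⟨e, hℓ⟩)
        · rw [map_smul, sub_apply, smul_eq_mul]
          nlinarith
    let g := ℓ₂ - ℓ₁
    by_cases hg : ∀ x ∈ L, g x = 0
    · exact key ℓ₁ ℓ₂ h₁ h₂ hne L fun x => ⟨fun h => ⟨h, (hg x h).le⟩, fun h => h.1⟩
    have hcle : IsClosed {x | g x ≤ 0} := isClosed_le g.continuous continuous_const
    have hcge : IsClosed {x | 0 ≤ g x} := isClosed_le continuous_const g.continuous
    have hceq : IsClosed {x | g x = 0} := isClosed_eq g.continuous continuous_const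
    let L₁ : ConvexBody V := ⟨(L : Set V) ∩ {x | g x ≤ 0},
      L.convex.inter (convex_halfSpace_le g.isLinear 0), L.isCompact.inter_right hcle,
      0, h0, by simp⟩
    let L₂ : ConvexBody V := ⟨(L : Set V) ∩ {x | 0 ≤ g x},
      L.convex.inter (convex_halfSpace_ge g.isLinear 0), L.isCompact.inter_right hcge,
      0, h0, by simp⟩
    let L₀ : ConvexBody V := ⟨(L : Set V) ∩ {x | g x = 0},
      L.convex.inter (convex_hyperplane g.isLinear 0), L.isCompact.inter_right hceq,
      0, h0, by simp⟩
    have e := hat_cut hΦ L.convex L.isCompact g 0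
    have e1 : Φ L₁ = 0 := key ℓ₁ ℓ₂ h₁ h₂ hne L₁ fun x => Iff.rfl
    have e2 : Φ L₂ = 0 := key ℓ₂ ℓ₁ h₂ h₁ hne.symm L₂ fun x => by
      change x ∈ L ∧ 0 ≤ (ℓ₂ - ℓ₁) x ↔ _
      simp only [sub_apply, sub_nonneg, sub_nonpos]
    have e0 : Φ L₀ = 0 := by
      obtain ⟨E, hE1, hE2, hE3⟩ := hd
      refine hlow L₀ (hP.of_inter_eq g 0 fun x => Iff.rfl)
        (finrank ℝ (E ⊓ LinearMap.ker (g : V →ₗ[ℝ] ℝ) : Submodule ℝ V)) ?_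
        ⟨_, inferInstance, le_rfl, fun x hx y hy => ⟨hE3 x hx.1 y hy.1, ?_⟩⟩
      · refine lt_of_lt_of_le (Submodule.finrank_lt_finrank_of_lt ?_) hE2
        refine lt_of_le_of_ne inf_le_left fun h => hg fun x hx => ?_
        have hx' : x ∈ E := by simpa using hE3 0 h0 x hx
        rw [← h] at hx'
        exact hx'.2
      · have hx2 : g x = 0 := hx.2
        have hy2 : g y = 0 := hy.2
        simp [hx2, hy2]
    have e0' : hat Φ ((L : Set V) ∩ {x | g x = 0}) = 0 := (hat_coe Φ L₀).trans e0
    have e1' : hat Φ ((L : Set V) ∩ {x | g x ≤ 0}) = 0 := (hat_coe Φ L₁).trans e1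
    have e2' : hat Φ ((L : Set V) ∩ {x | 0 ≤ g x}) = 0 := (hat_coe Φ L₂).trans e2
    rw [← hat_coe Φ L]
    linarith

/-- Vanishing of a valuation on polyhedral bodies reduces to lower dimensional bodies and
pyramids. -/
theorem poly_induction {d : ℕ} {Φ : ConvexBody V → ℝ} (hΦ : IsValuation Φ)
    (htr : IsTranslationInvariant Φ)
    (hlow : ∀ L, IsPolyhedral L → ∀ d' < d, DimLE d' L → Φ L = 0)
    (hpyr : ∀ L, IsPolyhedral L → DimLE d L → 0 ∈ L → ∀ ℓ : V →L[ℝ] ℝ, (∀ x ∈ L, ℓ x ≤ 1) →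
      (∀ x ∈ L, ∀ t : ℝ, 0 ≤ t → t * ℓ x ≤ 1 → t • x ∈ L) → Φ L = 0)
    (L : ConvexBody V) (hP : IsPolyhedral L) (hd : DimLE d L) : Φ L = 0 := by
  classical
  wlog h0 : (0 : V) ∈ L generalizing L
  · obtain ⟨x, hx⟩ := L.nonempty
    rw [← htr L (-x)]
    exact this _ (hP.translate _) (hd.translate _) ⟨x, hx, by simp⟩
  obtain ⟨G, hG⟩ := id hP
  refine star_induction hΦ hlow hpyr _
    ((G.filter fun p => 0 < p.2).image fun p => p.2⁻¹ • p.1) L rfl hP hd h0 ⟨?_, ?_⟩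
  · simp only [Finset.mem_image, Finset.mem_filter, forall_exists_index, and_imp]
    rintro _ p hp hp2 rfl x hx
    have := (hG x).1 hx p hp
    rw [smul_apply, smul_eq_mul, inv_mul_le_iff₀ hp2]
    linarith
  · intro x hx t ht h
    simp only [Finset.mem_image, Finset.mem_filter, forall_exists_index, and_imp] at h
    rw [hG]
    intro p hp
    have hp0 : 0 ≤ p.2 := by simpa using (hG 0).1 h0 p hp
    rcases hp0.eq_or_lt with e | e
    · have := (hG x).1 hx p hp
      rw [map_smul, smul_eq_mul]
      nlinarith
    · have := h _ p hp e rfl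
      rw [smul_apply, smul_eq_mul, mul_left_comm, inv_mul_le_iff₀ e] at this
      rw [map_smul, smul_eq_mul]; linarith

theorem eq_zero_of_forall_smul_mem {L : ConvexBody V} {x : V} (h : ∀ t : ℝ, 0 ≤ t → t • x ∈ L) :
    x = 0 := by
  obtain ⟨R, hR, hL⟩ := L.exists_norm_le
  by_contra hx
  have hx' : 0 < ‖x‖ := norm_pos_iff.2 hx
  have := hL _ (h ((R + 1) / ‖x‖) (by positivity))
  rw [norm_smul, Real.norm_of_nonneg (by positivity), div_mul_cancel₀ _ hx'.ne'] at this
  linarith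

theorem poly_fwdDiff (d : ℕ) : ∀ {φ : ConvexBody V → ℝ}, IsValuation φ →
    IsTranslationInvariant φ → ∀ L : ConvexBody V, IsPolyhedral L → DimLE d L →
      (fwdDiff 1)^[d + 1] (fun n : ℕ => φ ((n : ℝ) • L)) = fun _ => 0 := by
  induction d using Nat.strong_induction_on with
  | _ d ih =>
  intro φ hφ htr L hP hd
  have hval : ∀ y, IsValuation fun L : ConvexBody V =>
      (fwdDiff 1)^[d + 1] (fun n : ℕ => φ ((n : ℝ) • L)) y := by
    intro y
    simp_rw [fwdDiff_iter_eq_sum_shift]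
    refine IsValuation.sum fun i _ => ?_
    simp_rw [zsmul_eq_mul]
    exact (hφ.comp_smul _).const_mul _
  funext y
  refine poly_induction (hval y) ?_ ?_ ?_ L hP hd
  · intro L x
    simp only [smul_translate, htr _ _]
  · intro L hP d' hd' hdL
    obtain ⟨k, rfl⟩ := Nat.exists_eq_add_of_lt hd'
    rw [show d' + k + 1 + 1 = (k + 1) + (d' + 1) by ring, Function.iterate_add_apply,
      ih d' hd' hφ htr L hP hdL]
    exact congrFun (Function.iterate_fixed (fwdDiff_const 1 (0 : ℝ)) _) y
  · intro L hP hd h0 ℓ h1 h2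
    by_cases hF : ∃ f ∈ L, ℓ f = 1
    · have hceq : IsClosed {x | ℓ x = 1} := isClosed_eq ℓ.continuous continuous_const
      let F : ConvexBody V := ⟨(L : Set V) ∩ {x | ℓ x = 1},
        L.convex.inter (convex_hyperplane ℓ.isLinear 1), L.isCompact.inter_right hceq, hF⟩
      have hFP : IsPolyhedral F := hP.of_inter_eq ℓ 1 fun x => Iff.rfl
      have hL : ∀ x ∈ L, ∃ s ∈ Set.Icc (0 : ℝ) 1, ∃ f ∈ F, x = s • f := by
        intro x hx
        rcases le_or_gt (ℓ x) 0 with h | h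
        · have : x = 0 := eq_zero_of_forall_smul_mem (L := L) fun t ht =>
            h2 x hx t ht (by nlinarith)
          obtain ⟨f, hf⟩ := F.nonempty
          exact ⟨0, by simp, f, hf, by simp [this]⟩
        · refine ⟨ℓ x, ⟨h.le, h1 x hx⟩, (ℓ x)⁻¹ • x,
            ⟨h2 x hx _ (by positivity) (by rw [inv_mul_cancel₀ h.ne']), ?_⟩, ?_⟩
          · change ℓ ((ℓ x)⁻¹ • x) = 1
            rw [map_smul, smul_eq_mul, inv_mul_cancel₀ h.ne']
          · rw [smul_smul, mul_inv_cancel₀ h.ne', one_smul]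
      have hFL : ∀ s ∈ Set.Icc (0 : ℝ) 1, ∀ f ∈ F, s • f ∈ L := fun s hs f hf =>
        h2 f hf.1 s hs.1 (by rw [show ℓ f = 1 from hf.2]; linarith [hs.2])
      have hF1 : ∀ f ∈ F, ℓ f = 1 := fun f hf => hf.2
      have hmem : ∀ (r : ℝ), 0 < r → ∀ x, x ∈ r • L ↔ ∃ s ∈ Set.Icc (0 : ℝ) r, ∃ f ∈ F, x = s • f := by
        intro r hr x
        rw [mem_smul]
        constructor
        · rintro ⟨y, hy, rfl⟩
          obtain ⟨s, hs, f, hf, rfl⟩ := hL y hy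
          exact ⟨r * s, ⟨mul_nonneg hr.le hs.1, by nlinarith [hs.2]⟩, f, hf, by rw [smul_smul]⟩
        · rintro ⟨s, hs, f, hf, rfl⟩
          refine ⟨(s / r) • f, hFL _ ⟨div_nonneg hs.1 hr.le, (div_le_one hr).2 hs.2⟩ f hf, ?_⟩
          rw [smul_smul, mul_div_cancel₀ _ hr.ne']
      have hadd : ∀ r : ℝ, 0 < r → ∀ x, x ∈ r • F + L ↔
          ∃ s ∈ Set.Icc r (r + 1), ∃ f ∈ F, x = s • f := by
        intro r hr x
        rw [mem_add]
        constructor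
        · rintro ⟨u, hu, y, hy, rfl⟩
          obtain ⟨f, hf, rfl⟩ := mem_smul.1 hu
          obtain ⟨s, hs, f', hf', rfl⟩ := hL y hy
          have hrs : 0 < r + s := by linarith [hs.1]
          refine ⟨r + s, ⟨by linarith [hs.1], by linarith [hs.2]⟩,
            (r / (r + s)) • f + (s / (r + s)) • f',
            F.convex hf hf' (by have := hs.1; positivity) (by have := hs.1; positivity)
              (by field_simp), ?_⟩
          rw [smul_add, smul_smul, smul_smul, mul_div_cancel₀ _ hrs.ne', mul_div_cancel₀ _ hrs.ne']
        · rintro ⟨s, hs, f, hf, rfl⟩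
          refine ⟨r • f, mem_smul.2 ⟨f, hf, rfl⟩, (s - r) • f,
            hFL _ ⟨by linarith [hs.1], by linarith [hs.2]⟩ f hf, ?_⟩
          rw [← add_smul]; simp
      have hstep : ∀ n : ℕ, φ (((n + 1 : ℕ) : ℝ) • L) + φ ((n : ℝ) • F) =
          φ ((n : ℝ) • L) + φ ((n : ℝ) • F + L) := by
        intro n
        rcases n.eq_zero_or_pos with rfl | hn
        · simp only [zero_add, Nat.cast_one, one_smul, Nat.cast_zero, zero_smul']
          ring
        have hn' : (0 : ℝ) < n := by exact_mod_cast hn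
        have hU : (((n : ℝ) • L : ConvexBody V) : Set V) ∪ (((n : ℝ) • F + L : ConvexBody V) : Set V)
            = ((((n + 1 : ℕ) : ℝ) • L : ConvexBody V) : Set V) := by
          ext x
          rw [Set.mem_union, mem_coe, mem_coe, mem_coe, hmem _ hn', hadd _ hn',
            hmem _ (by positivity)]
          push_cast
          constructor
          · rintro (⟨s, hs, h⟩ | ⟨s, hs, h⟩)
            · exact ⟨s, ⟨hs.1, by linarith [hs.2]⟩, h⟩
            · exact ⟨s, ⟨by linarith [hs.1], hs.2⟩, h⟩
          · rintro ⟨s, hs, h⟩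
            rcases le_total s n with h' | h'
            · exact Or.inl ⟨s, ⟨hs.1, h'⟩, h⟩
            · exact Or.inr ⟨s, ⟨h', hs.2⟩, h⟩
        have hI : (((n : ℝ) • L : ConvexBody V) : Set V) ∩ (((n : ℝ) • F + L : ConvexBody V) : Set V)
            = (((n : ℝ) • F : ConvexBody V) : Set V) := by
          ext x
          rw [Set.mem_inter_iff, mem_coe, mem_coe, mem_coe, hmem _ hn', hadd _ hn', mem_smul]
          constructor
          · rintro ⟨⟨s, hs, f, hf, rfl⟩, s', hs', f', hf', h⟩
            have := congrArg ℓ h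
            rw [map_smul, map_smul, hF1 f hf, hF1 f' hf', smul_eq_mul, smul_eq_mul] at this
            exact ⟨f, hf, by rw [show s = n by linarith [hs.2, hs'.1]]⟩
          · rintro ⟨f, hf, rfl⟩
            exact ⟨⟨n, ⟨hn'.le, le_rfl⟩, f, hf, rfl⟩, n, ⟨le_rfl, by linarith⟩, f, hf, rfl⟩
        have hc : Convex ℝ ((((n : ℝ) • L : ConvexBody V) : Set V) ∪
            (((n : ℝ) • F + L : ConvexBody V) : Set V)) := by rw [hU]; exact ConvexBody.convex _
        have := hφ _ _ hc (inter_nonempty_of_convex_union hc)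
        rw [← this]
        congr 2
        · exact ConvexBody.ext hU.symm
        · exact ConvexBody.ext hI.symm
      obtain ⟨E, hE1, hE2, hE3⟩ := hd
      have hFd : finrank ℝ (E ⊓ LinearMap.ker (ℓ : V →ₗ[ℝ] ℝ) : Submodule ℝ V) < finrank ℝ E := by
        refine Submodule.finrank_lt_finrank_of_lt ?_
        refine lt_of_le_of_ne inf_le_left fun h => ?_
        obtain ⟨f, hf⟩ := F.nonempty
        have hx' : f ∈ E := by simpa using hE3 0 h0 f hf.1
        rw [← h] at hx'
        have h3 : ℓ f = 0 := hx'.2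
        rw [hF1 f hf] at h3
        exact one_ne_zero h3
      obtain ⟨d', rfl⟩ : ∃ d', d = d' + 1 := ⟨d - 1, by omega⟩
      have hFD : DimLE d' F := by
        refine ⟨E ⊓ LinearMap.ker (ℓ : V →ₗ[ℝ] ℝ), inferInstance, by omega,
          fun x hx y hy => ⟨hE3 x hx.1 y hy.1, ?_⟩⟩
        simp [hF1 x hx, hF1 y hy]
      rw [Function.iterate_succ_apply]
      have hΔ : fwdDiff 1 (fun n : ℕ => φ ((n : ℝ) • L)) =
          (fun n : ℕ => φ ((n : ℝ) • F + L)) + (-1 : ℝ) • fun n : ℕ => φ ((n : ℝ) • F) := by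
        funext n
        simp only [fwdDiff, Pi.add_apply, Pi.smul_apply, smul_eq_mul]
        linarith [hstep n]
      rw [hΔ, fwdDiff_iter_add, fwdDiff_iter_const_smul, ih d' (by omega) hφ htr F hFP hFD,
        ih d' (by omega) (hφ.comp_add L)
          (fun K x => by rw [← ConvexBody.translate_add, htr]) F hFP hFD]
      simp
    · have hL : L = 0 := by
        refine ConvexBody.ext (Set.eq_singleton_iff_unique_mem.2 ⟨h0, fun x hx => ?_⟩)
        rcases le_or_gt (ℓ x) 0 with h | h
        · exact eq_zero_of_forall_smul_mem (L := L) fun t ht => h2 x hx t ht (by nlinarith)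
        · exact absurd ⟨(ℓ x)⁻¹ • x, h2 x hx _ (by positivity) (by rw [inv_mul_cancel₀ h.ne']),
            by rw [map_smul, smul_eq_mul, inv_mul_cancel₀ h.ne']⟩ hF
      subst hL
      simp only [smul_zero, Function.iterate_succ_apply, fwdDiff_const]
      exact congrFun (Function.iterate_fixed (fwdDiff_const 1 (0 : ℝ)) _) y

end Polyhedral

section McMullen

variable {V : Type*} [NormedAddCommGroup V] [NormedSpace ℝ V] [FiniteDimensional ℝ V]

open ConvexBody Polynomial

theorem exists_isPolyhedral_dist_le (K : ConvexBody V) {ε : ℝ} (hε : 0 < ε) :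
    ∃ P : ConvexBody V, IsPolyhedral P ∧ (K : Set V) ⊆ P ∧ dist K P ≤ ε := by
  classical
  have : ProperSpace V := FiniteDimensional.proper ℝ V
  have hcont : Continuous fun x => Metric.infDist x (K : Set V) := Metric.continuous_infDist_pt _
  have hbd : ∀ T : Set V, (∀ x ∈ T, Metric.infDist x (K : Set V) ≤ ε) → IsClosed T →
      IsCompact T := by
    intro T hT hc
    refine (K.isCompact.cthickening (r := ε)).of_isClosed_subset hc fun x hx => ?_
    obtain ⟨y, hy, h⟩ := K.isCompact.exists_infDist_eq_dist K.nonempty x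
    exact Metric.mem_cthickening_of_dist_le x y ε _ hy (h ▸ hT x hx)
  have hS : IsCompact {x | Metric.infDist x (K : Set V) = ε} :=
    hbd _ (fun x hx => le_of_eq hx) (isClosed_eq hcont continuous_const)
  have hsep : ∀ x : V, ∃ p : (V →L[ℝ] ℝ) × ℝ, (∀ a ∈ K, p.1 a ≤ p.2) ∧
      (Metric.infDist x (K : Set V) = ε → p.2 < p.1 x) := by
    intro x
    by_cases hx : Metric.infDist x (K : Set V) = ε
    · have hxK : x ∉ (K : Set V) := fun h => by
        rw [Metric.infDist_zero_of_mem h] at hx; exact hε.ne hx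
      obtain ⟨g, u, h1, h2⟩ := geometric_hahn_banach_closed_point K.convex K.isClosed hxK
      exact ⟨(g, u), fun a ha => (h1 a ha).le, fun _ => h2⟩
    · exact ⟨(0, 0), by simp, fun h => absurd h hx⟩
  choose p hp1 hp2 using hsep
  obtain ⟨t, -, ht⟩ := hS.elim_nhds_subcover (fun x => {y | (p x).2 < (p x).1 y}) fun x hx =>
    (isOpen_lt continuous_const (p x).1.continuous).mem_nhds (hp2 x hx)
  let T : Set V := ⋂ x ∈ t, {y | (p x).1 y ≤ (p x).2}
  have hT1 : Convex ℝ T := convex_iInter₂ fun x _ => convex_halfSpace_le (p x).1.isLinear _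
  have hT2 : IsClosed T :=
    isClosed_biInter fun x _ => isClosed_le (p x).1.continuous continuous_const
  have hKT : (K : Set V) ⊆ T := fun a ha => Set.mem_iInter₂.2 fun x _ => hp1 x a ha
  have hT3 : ∀ y ∈ T, Metric.infDist y (K : Set V) ≤ ε := by
    intro y hy
    by_contra! hlt
    obtain ⟨k, hk⟩ := K.nonempty
    have hc : Continuous fun s : ℝ => Metric.infDist ((1 - s) • k + s • y) (K : Set V) :=
      hcont.comp (by fun_prop)
    obtain ⟨s, hs, hs'⟩ := intermediate_value_Icc (zero_le_one' ℝ) hc.continuousOn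
      (show ε ∈ Set.Icc _ _ by
        simp only [sub_zero, one_smul, zero_smul, add_zero, sub_self, zero_add,
          Metric.infDist_zero_of_mem hk]
        exact ⟨hε.le, hlt.le⟩)
    have hz : (1 - s) • k + s • y ∈ T :=
      hT1 (hKT hk) hy (sub_nonneg.2 hs.2) hs.1 (by ring)
    obtain ⟨x, hx, hx'⟩ := Set.mem_iUnion₂.1 (ht hs')
    exact (show (p x).1 _ ≤ _ from Set.mem_iInter₂.1 hz x hx).not_gt hx'
  refine ⟨⟨T, hT1, hbd T hT3 hT2, K.nonempty.mono hKT⟩, ⟨t.image p, fun x => ?_⟩, hKT, ?_⟩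
  · rw [mem_mk']; simp [T]
  · refine dist_le_of_forall hε.le (fun x hx => ⟨x, hKT hx, by simpa using hε.le⟩) fun y hy => ?_
    obtain ⟨x, hx, h⟩ := K.isCompact.exists_infDist_eq_dist K.nonempty y
    exact ⟨x, hx, by rw [dist_comm, ← h]; exact hT3 y hy⟩

/-- Two continuous functionals agreeing on polyhedral bodies agree. -/
theorem eq_of_eq_on_isPolyhedral {φ ψ : ConvexBody V → ℝ} (hφ : Continuous φ) (hψ : Continuous ψ)
    (h : ∀ P, IsPolyhedral P → φ P = ψ P) (K : ConvexBody V) : φ K = ψ K := by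
  have : K ∈ closure {P : ConvexBody V | IsPolyhedral P} := by
    rw [Metric.mem_closure_iff]
    intro ε hε
    obtain ⟨P, hP, -, hd⟩ := exists_isPolyhedral_dist_le K (half_pos hε)
    exact ⟨P, hP, by linarith⟩
  exact (isClosed_eq hφ hψ).closure_subset_iff.2 (fun P hP => h P hP) this

theorem dimLE_finrank (K : ConvexBody V) : DimLE (finrank ℝ V) K :=
  ⟨⊤, inferInstance, by simp, by simp⟩

variable {φ : ConvexBody V → ℝ} {N : ℕ}

theorem IsCTV.fwdDiff_eq_zero (h : IsCTV φ) (K : ConvexBody V)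
    (hN : finrank ℝ V ≤ N) (y : ℕ) :
    (fwdDiff 1)^[N + 1] (fun n : ℕ => φ ((n : ℝ) • K)) y = 0 := by
  refine eq_of_eq_on_isPolyhedral
    (φ := fun K => (fwdDiff 1)^[N + 1] (fun n : ℕ => φ ((n : ℝ) • K)) y)
    (ψ := fun _ => 0) ?_ continuous_const ?_ K
  · simp_rw [fwdDiff_iter_eq_sum_shift, zsmul_eq_mul]
    exact continuous_finsetSum _ fun i _ => continuous_const.mul
      (h.cont.comp (continuous_smul_const _))
  · intro P hP
    obtain ⟨E, h1, h2, h3⟩ := dimLE_finrank P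
    rw [poly_fwdDiff N h.val h.trans P hP ⟨E, h1, h2.trans hN, h3⟩]

/-- The homogeneous components in McMullen's decomposition. -/
def mcm (N : ℕ) (φ : ConvexBody V → ℝ) (i : ℕ) (K : ConvexBody V) : ℝ :=
  ∑ j ∈ Finset.range (N + 1),
    (Lagrange.basis (Finset.range (N + 1)) (fun j : ℕ => (j : ℝ)) j).coeff i * φ ((j : ℝ) • K)

/-- The polynomial `t ↦ φ(tK)`. -/
def mcmPoly (N : ℕ) (φ : ConvexBody V → ℝ) (K : ConvexBody V) : ℝ[X] :=
  Lagrange.interpolate (Finset.range (N + 1)) (fun j : ℕ => (j : ℝ)) fun j => φ ((j : ℝ) • K)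

theorem coeff_mcmPoly (N : ℕ) (φ : ConvexBody V → ℝ) (K : ConvexBody V) (i : ℕ) :
    (mcmPoly N φ K).coeff i = mcm N φ i K := by
  simp only [mcmPoly, Lagrange.interpolate_apply, finsetSum_coeff, coeff_C_mul, mcm]
  exact Finset.sum_congr rfl fun _ _ => mul_comm _ _

theorem natDegree_mcmPoly (N : ℕ) (φ : ConvexBody V → ℝ) (K : ConvexBody V) :
    (mcmPoly N φ K).natDegree < N + 1 := by
  have h := Lagrange.degree_interpolate_lt (s := Finset.range (N + 1))
    (v := fun j : ℕ => (j : ℝ)) (r := fun j => φ ((j : ℝ) • K)) (Nat.cast_injective.injOn)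
  rw [Finset.card_range] at h
  by_cases h0 : mcmPoly N φ K = 0
  · rw [h0]; simp
  · exact (natDegree_lt_iff_degree_lt h0).2 h

theorem eval_mcmPoly (N : ℕ) (φ : ConvexBody V → ℝ) (K : ConvexBody V) (t : ℝ) :
    (mcmPoly N φ K).eval t = ∑ i ∈ Finset.range (N + 1), t ^ i * mcm N φ i K := by
  rw [eval_eq_sum_range' (natDegree_mcmPoly N φ K)]
  exact Finset.sum_congr rfl fun i _ => by rw [coeff_mcmPoly, mul_comm]

theorem Polynomial.eq_of_eval_nat_eq {p q : ℝ[X]} (h : ∀ n : ℕ, p.eval (n : ℝ) = q.eval (n : ℝ)) :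
    p = q := by
  refine eq_of_infinite_eval_eq p q ((Set.infinite_range_of_injective
    (Nat.cast_injective (R := ℝ))).mono ?_)
  rintro _ ⟨n, rfl⟩
  exact h n

theorem IsCTV.eval_mcmPoly_nat (h : IsCTV φ)
    (hN : finrank ℝ V ≤ N) (K : ConvexBody V) (n : ℕ) :
    (mcmPoly N φ K).eval (n : ℝ) = φ ((n : ℝ) • K) := by
  induction n using Nat.strong_induction_on with
  | _ n ih =>
  rcases lt_or_ge n (N + 1) with hn | hn
  · exact Lagrange.eval_interpolate_at_node _ Nat.cast_injective.injOn (Finset.mem_range.2 hn)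
  obtain ⟨m, rfl⟩ := Nat.exists_eq_add_of_le' hn
  have h1 := h.fwdDiff_eq_zero K hN m
  have h2 := congrFun (fwdDiff_iter_eq_zero_of_degree_lt (natDegree_mcmPoly N φ K)) (m : ℝ)
  simp only [fwdDiff_iter_eq_sum_shift, nsmul_eq_mul, mul_one, Pi.zero_apply] at h1 h2
  rw [Finset.sum_range_succ] at h1 h2
  rw [Finset.sum_congr rfl fun k hk => by
    rw [← Nat.cast_add, ih (m + k) (by have := Finset.mem_range.1 hk; omega)]] at h2
  simp at h1 h2 ⊢
  linarith

theorem IsCTV.eval_mcmPoly (h : IsCTV φ)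
    (hN : finrank ℝ V ≤ N) (K : ConvexBody V) {t : ℝ} (ht : 0 ≤ t) :
    (mcmPoly N φ K).eval t = φ (t • K) := by
  have hrat : ∀ (m q : ℕ), 0 < q → (mcmPoly N φ K).eval ((m : ℝ) / q) = φ (((m : ℝ) / q) • K) := by
    intro m q hq
    have hq' : (q : ℝ) ≠ 0 := by positivity
    have e : mcmPoly N φ K = (mcmPoly N φ ((q : ℝ)⁻¹ • K)).comp (C (q : ℝ) * X) := by
      refine Polynomial.eq_of_eval_nat_eq fun n => ?_
      rw [h.eval_mcmPoly_nat hN, eval_comp, eval_mul, eval_C, eval_X]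
      have := h.eval_mcmPoly_nat hN ((q : ℝ)⁻¹ • K) (q * n)
      push_cast at this
      rw [this, smul_smul]
      congr 2; field_simp
    rw [e, eval_comp, eval_mul, eval_C, eval_X, mul_div_cancel₀ _ hq', h.eval_mcmPoly_nat hN,
      smul_smul]
    rfl
  have hlim := (tendsto_nat_floor_mul_div_atTop ht).comp (tendsto_natCast_atTop_atTop (R := ℝ))
  refine tendsto_nhds_unique (((mcmPoly N φ K).continuous.tendsto t).comp hlim)
    (Filter.Tendsto.congr' ?_ (((h.cont.comp (continuous_id.smul continuous_const)).tendsto t).comp hlim))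
  filter_upwards [Filter.eventually_gt_atTop 0] with q hq using (hrat _ q hq).symm

theorem IsCTV.mcm_sum (h : IsCTV φ)
    (hN : finrank ℝ V ≤ N) (K : ConvexBody V) {t : ℝ} (ht : 0 ≤ t) :
    φ (t • K) = ∑ i ∈ Finset.range (N + 1), t ^ i * mcm N φ i K := by
  rw [← h.eval_mcmPoly hN K ht, _root_.eval_mcmPoly]

theorem IsCTV.mcm (h : IsCTV φ) (N i : ℕ) : IsCTV (mcm N φ i) :=
  IsCTV.sum fun _ _ => (h.comp_smul _).const_mul _

/-- Uniqueness of coefficients. -/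
theorem coeff_unique {a b : ℕ → ℝ}
    (h : ∀ t : ℝ, 0 < t → ∑ i ∈ Finset.range (N + 1), t ^ i * a i =
      ∑ i ∈ Finset.range (N + 1), t ^ i * b i) {i : ℕ} (hi : i ≤ N) : a i = b i := by
  have : ∑ i ∈ Finset.range (N + 1), C (a i) * X ^ i = ∑ i ∈ Finset.range (N + 1), C (b i) * X ^ i := by
    refine eq_of_infinite_eval_eq _ _ ((Set.Ioi_infinite (0 : ℝ)).mono fun t ht => ?_)
    simp only [Set.mem_ofPred_eq, eval_finsetSum, eval_mul, eval_C, eval_pow, eval_X]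
    simp_rw [mul_comm (a _), mul_comm (b _)]
    exact h t ht
  have := congrArg (fun p => p.coeff i) this
  simpa [finsetSum_coeff, coeff_C_mul, coeff_X_pow, Nat.lt_succ_of_le hi] using this

theorem IsCTV.mcm_eq (h : IsCTV φ)
    (hN : finrank ℝ V ≤ N) (K : ConvexBody V) {a : ℕ → ℝ}
    (ha : ∀ t : ℝ, 0 < t → φ (t • K) = ∑ i ∈ Finset.range (N + 1), t ^ i * a i) {i : ℕ}
    (hi : i ≤ N) : _root_.mcm N φ i K = a i :=
  coeff_unique (a := fun i => _root_.mcm N φ i K) (b := a)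
    (fun t ht => by rw [← h.mcm_sum hN K ht.le, ha t ht]) hi

theorem IsCTV.mcm_smul (h : IsCTV φ)
    (hN : finrank ℝ V ≤ N) (K : ConvexBody V) {t : ℝ} (ht : 0 ≤ t) {i : ℕ} (hi : i ≤ N) :
    _root_.mcm N φ i (t • K) = t ^ i * _root_.mcm N φ i K := by
  refine h.mcm_eq hN _ (a := fun i => t ^ i * _root_.mcm N φ i K) (fun s hs => ?_) hi
  rw [smul_smul, h.mcm_sum hN K (by positivity)]
  exact Finset.sum_congr rfl fun i _ => by ring

/-- Homogeneous continuous translation invariant valuations. -/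
structure IsHom (k : ℕ) (φ : ConvexBody V → ℝ) : Prop extends IsCTV φ where
  smul : ∀ (K : ConvexBody V) (t : ℝ), 0 ≤ t → φ (t • K) = t ^ k * φ K

theorem IsCTV.mcm_isHom (h : IsCTV φ)
    (hN : finrank ℝ V ≤ N) {i : ℕ} (hi : i ≤ N) : IsHom i (_root_.mcm N φ i) :=
  ⟨h.mcm N i, fun K _ ht => h.mcm_smul hN K ht hi⟩

theorem tendsto_smul_zero (K : ConvexBody V) :
    Filter.Tendsto (fun t : ℝ => t • K) (nhdsWithin 0 (Set.Ioi 0)) (nhds 0) := by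
  have : Continuous fun t : ℝ => t • K := continuous_id.smul continuous_const
  have h := this.tendsto 0
  rw [ConvexBody.zero_smul'] at h
  exact h.mono_left nhdsWithin_le_nhds

variable {k : ℕ}

/-- The coefficients of `t ↦ φ(X + tL)`. -/
def mixCoeff (N : ℕ) (φ : ConvexBody V → ℝ) (i : ℕ) (X L : ConvexBody V) : ℝ :=
  mcm N (fun K => φ (K + X)) i L

theorem IsCTV.mixCoeff (h : IsCTV φ) (N i : ℕ) (L : ConvexBody V) :
    IsCTV fun X => mixCoeff N φ i X L := by
  unfold _root_.mixCoeff _root_.mcm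
  refine IsCTV.sum fun j _ => ?_
  simp_rw [add_comm ((j : ℝ) • L)]
  exact (h.comp_add _).const_mul _

theorem IsCTV.mixCoeff_sum (h : IsCTV φ) (hN : finrank ℝ V ≤ N) (X L : ConvexBody V) {t : ℝ}
    (ht : 0 ≤ t) :
    φ (X + t • L) = ∑ i ∈ Finset.range (N + 1), t ^ i * _root_.mixCoeff N φ i X L := by
  rw [add_comm]
  exact IsCTV.mcm_sum (φ := fun K => φ (K + X)) (h.comp_add X) hN L ht

theorem IsHom.mixCoeff_smul (h : IsHom k φ) (hN : finrank ℝ V ≤ N) (X L : ConvexBody V) {s : ℝ}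
    (hs : 0 < s) {i : ℕ} (hi : i ≤ N) :
    s ^ i * mixCoeff N φ i (s • X) L = s ^ k * mixCoeff N φ i X L := by
  refine coeff_unique (N := N) (a := fun i => s ^ i * mixCoeff N φ i (s • X) L)
    (b := fun i => s ^ k * mixCoeff N φ i X L) (fun t ht => ?_) hi
  have h1 := h.toIsCTV.mixCoeff_sum hN (s • X) L (t := s * t) (by positivity)
  have h2 := h.toIsCTV.mixCoeff_sum hN X L ht.le
  rw [← smul_smul, ← smul_add, h.smul _ _ hs.le, h2, Finset.mul_sum] at h1
  calc _ = _ := Finset.sum_congr rfl fun i _ => by rw [← mul_assoc, ← mul_pow, mul_comm t s]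
    _ = _ := h1.symm
    _ = _ := Finset.sum_congr rfl fun i _ => by ring

theorem IsHom.mixCoeff_zero (h : IsHom k φ) (hN : finrank ℝ V ≤ N) (X L : ConvexBody V) :
    mixCoeff N φ 0 X L = φ X := by
  have := h.toIsCTV.mixCoeff_sum hN X L le_rfl
  rw [zero_smul', add_zero, Finset.sum_range_succ'] at this
  simpa using this.symm

theorem IsHom.mixCoeff_eq_zero (h : IsHom k φ) (hN : finrank ℝ V ≤ N) (X L : ConvexBody V)
    {i : ℕ} (hi : i ≤ N) (hk : k < i) : mixCoeff N φ i X L = 0 := by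
  have hlim : Filter.Tendsto (fun s : ℝ => s ^ (i - k) * mixCoeff N φ i (s • X) L)
      (nhdsWithin 0 (Set.Ioi 0)) (nhds (0 ^ (i - k) * mixCoeff N φ i 0 L)) := by
    refine Filter.Tendsto.mul ?_ (((h.toIsCTV.mixCoeff N i L).cont.tendsto 0).comp
      (tendsto_smul_zero X))
    exact ((continuous_pow (i - k)).tendsto 0).mono_left nhdsWithin_le_nhds
  rw [zero_pow (by omega), zero_mul] at hlim
  refine tendsto_nhds_unique (Filter.Tendsto.congr' ?_ tendsto_const_nhds) hlim
  filter_upwards [self_mem_nhdsWithin] with s hs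
  have h1 := h.mixCoeff_smul hN X L hs hi
  have hs' : (0 : ℝ) < s := hs
  have h2 : s ^ i = s ^ k * s ^ (i - k) := by rw [← pow_add]; congr 1; omega
  rw [h2, mul_assoc] at h1
  exact (mul_left_cancel₀ (by positivity) h1).symm

theorem IsHom.mixCoeff_self (h : IsHom k φ) (hN : finrank ℝ V ≤ N) (hk : k ≤ N)
    (X L : ConvexBody V) : mixCoeff N φ k X L = φ L := by
  have h0 : mixCoeff N φ k 0 L = φ L := by
    refine IsCTV.mcm_eq (h.toIsCTV.comp_add 0) hN L (a := fun i => if i = k then φ L else 0)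
      (fun t ht => ?_) hk |>.trans (by simp)
    rw [add_zero, h.smul _ _ ht.le]
    simp [Nat.lt_succ_of_le hk]
  rw [← h0]
  refine tendsto_nhds_unique (Filter.Tendsto.congr' ?_ tendsto_const_nhds)
    (((h.toIsCTV.mixCoeff N k L).cont.tendsto 0).comp (tendsto_smul_zero X))
  filter_upwards [self_mem_nhdsWithin] with s hs
  have hs' : (0 : ℝ) < s := hs
  exact (mul_left_cancel₀ (by positivity) (h.mixCoeff_smul hN X L hs hk)).symm

theorem IsHom.additive (h : IsHom 1 φ) (K L : ConvexBody V) : φ (K + L) = φ K + φ L := by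
  have hN : finrank ℝ V ≤ finrank ℝ V + 1 := by omega
  have := h.toIsCTV.mixCoeff_sum hN K L zero_le_one
  rw [one_smul, Finset.sum_range_succ', Finset.sum_range_succ', Finset.sum_eq_zero,
    h.mixCoeff_zero hN, zero_add, zero_add, h.mixCoeff_self hN (by omega)] at this
  · linarith
  · intro i hi
    rw [h.mixCoeff_eq_zero hN _ _ (by have := Finset.mem_range.1 hi; omega) (by omega), mul_zero]

/-- The polarization of a valuation of degree two. -/
def polar (φ : ConvexBody V → ℝ) (K L : ConvexBody V) : ℝ := (φ (K + L) - φ K - φ L) / 2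

theorem polar_comm (φ : ConvexBody V → ℝ) (K L : ConvexBody V) : polar φ K L = polar φ L K := by
  rw [polar, polar, add_comm]; ring

theorem IsHom.polar_eq (h : IsHom 2 φ) (K L : ConvexBody V) :
    polar φ K L = mixCoeff (finrank ℝ V + 2) φ 1 K L / 2 := by
  have hN : finrank ℝ V ≤ finrank ℝ V + 2 := by omega
  have := h.toIsCTV.mixCoeff_sum hN K L zero_le_one
  rw [one_smul, Finset.sum_range_succ', Finset.sum_range_succ', Finset.sum_range_succ',
    Finset.sum_eq_zero, h.mixCoeff_zero hN, zero_add, zero_add,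
    h.mixCoeff_self hN (by omega)] at this
  · rw [polar, this]; ring
  · intro i hi
    rw [h.mixCoeff_eq_zero hN _ _ (by have := Finset.mem_range.1 hi; omega) (by omega), mul_zero]

theorem IsHom.polar_isHom (h : IsHom 2 φ) (L : ConvexBody V) :
    IsHom 1 fun K => polar φ K L := by
  have hN : finrank ℝ V ≤ finrank ℝ V + 2 := by omega
  have h1 : IsCTV fun K => polar φ K L := by
    simp_rw [h.polar_eq, div_eq_inv_mul]
    exact (h.toIsCTV.mixCoeff _ _ L).const_mul _
  refine ⟨h1, fun K t ht => ?_⟩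
  rcases ht.eq_or_lt with rfl | ht
  · have := h.smul 0 0 le_rfl
    rw [smul_zero] at this
    simp only [zero_smul', polar, zero_add]
    linarith
  · have := h.mixCoeff_smul hN K L ht (i := 1) (by omega)
    rw [h.polar_eq, h.polar_eq]
    field_simp at this ⊢
    linarith

theorem IsHom.polar_add (h : IsHom 2 φ) (K L M : ConvexBody V) :
    polar φ (K + L) M = polar φ K M + polar φ L M := (h.polar_isHom M).additive K L

theorem IsHom.polar_smul (h : IsHom 2 φ) (K L : ConvexBody V) {t : ℝ} (ht : 0 ≤ t) :
    polar φ (t • K) L = t * polar φ K L := by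
  simpa using (h.polar_isHom L).smul K t ht

theorem IsHom.polar_smul_right (h : IsHom 2 φ) (K L : ConvexBody V) {t : ℝ} (ht : 0 ≤ t) :
    polar φ K (t • L) = t * polar φ K L := by
  rw [polar_comm, h.polar_smul _ _ ht, polar_comm]

theorem IsHom.polar_self (h : IsHom 2 φ) (K : ConvexBody V) : polar φ K K = φ K := by
  have h1 : K + K = (2 : ℝ) • K := by
    have := K.smul_convex_add zero_le_one zero_le_one
    rw [one_smul] at this
    rw [← this]; norm_num
  rw [polar, h1, h.smul _ _ (by norm_num)]; ring

/-- A homogeneous valuation is bounded on bounded sets of bodies. -/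
theorem IsHom.bounded (h : IsHom k φ) (hk : k ≠ 0) (R : ℝ) :
    ∃ C : ℝ, 0 ≤ C ∧ ∀ K : ConvexBody V, (∀ x ∈ K, ‖x‖ ≤ R) → |φ K| ≤ C := by
  have h0 : φ 0 = 0 := by
    have := h.smul 0 0 le_rfl
    rwa [smul_zero, zero_pow hk, zero_mul] at this
  obtain ⟨δ, hδ, hδ'⟩ := Metric.continuous_iff.1 h.cont 0 1 one_pos
  have hR : 0 < |R| + 1 := by positivity
  set s := δ / (2 * (|R| + 1)) with hs
  have hs0 : 0 < s := by positivity
  refine ⟨(s ^ k)⁻¹, by positivity, fun K hK => ?_⟩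
  have hd : dist (s • K) 0 < δ := by
    refine lt_of_le_of_lt (dist_le_of_forall (r := δ / 2) (by positivity) ?_ ?_) (by linarith)
    · rintro _ ⟨x, hx, rfl⟩
      refine ⟨0, rfl, ?_⟩
      rw [dist_zero_right, norm_smul, Real.norm_of_nonneg hs0.le]
      calc s * ‖x‖ ≤ s * (|R| + 1) := by
            gcongr; exact (hK x hx).trans ((le_abs_self R).trans (by linarith))
        _ = δ / 2 := by rw [hs]; field_simp
    · rintro y rfl
      obtain ⟨x, hx⟩ := K.nonempty
      refine ⟨s • x, mem_smul.2 ⟨x, hx, rfl⟩, ?_⟩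
      rw [dist_zero_right, norm_smul, Real.norm_of_nonneg hs0.le]
      calc s * ‖x‖ ≤ s * (|R| + 1) := by
            gcongr; exact (hK x hx).trans ((le_abs_self R).trans (by linarith))
        _ = δ / 2 := by rw [hs]; field_simp
  have := hδ' _ hd
  rw [h0, Real.dist_eq, sub_zero, h.smul _ _ hs0.le, abs_mul, abs_of_pos (by positivity)] at this
  rw [← one_div, le_div_iff₀ (by positivity)]
  linarith

end McMullen

section Sublinear

variable {E : Type*} [NormedAddCommGroup E] [InnerProductSpace ℝ E]

open ConvexBody

/-- The support function of a convex body in an inner product space. -/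
def supp (K : ConvexBody E) (v : E) : ℝ := hSupp K (innerSL ℝ v)

theorem supp_add (K L : ConvexBody E) : supp (K + L) = supp K + supp L := by
  funext v; exact hSupp_add K L _

theorem supp_smul (K : ConvexBody E) {t : ℝ} (ht : 0 ≤ t) : supp (t • K) = t • supp K := by
  funext v; exact hSupp_smul K ht _

theorem inner_le_supp {K : ConvexBody E} {x : E} (hx : x ∈ K) (v : E) :
    inner ℝ v x ≤ supp K v := le_hSupp (innerSL ℝ v) hx

theorem supp_le {K : ConvexBody E} {v : E} {c : ℝ} (h : ∀ x ∈ K, inner ℝ v x ≤ c) :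
    supp K v ≤ c := hSupp_le h

theorem exists_supp_eq (K : ConvexBody E) (v : E) : ∃ x ∈ K, inner ℝ v x = supp K v :=
  exists_hSupp_eq K (innerSL ℝ v)

theorem supp_point (x v : E) : supp (point x) v = inner ℝ v x := hSupp_point x _

theorem supp_zero : supp (0 : ConvexBody E) = 0 := by
  funext v; rw [zero_eq_point, supp_point, inner_zero_right]; rfl

variable [FiniteDimensional ℝ E]

theorem supp_toDual_symm (K : ConvexBody E) (g : E →L[ℝ] ℝ) :
    supp K ((InnerProductSpace.toDual ℝ E).symm g) = hSupp K g :=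
  congrArg (fun g : E →L[ℝ] ℝ => hSupp K g) ((InnerProductSpace.toDual ℝ E).apply_symm_apply g)

theorem eq_of_supp_eq {K L : ConvexBody E} (h : supp K = supp L) : K = L :=
  eq_of_hSupp_eq fun g => by rw [← supp_toDual_symm, h, supp_toDual_symm]

theorem mem_of_inner_le {C : ConvexBody E} {x : E} (hx : ∀ v, inner ℝ v x ≤ supp C v) : x ∈ C := by
  refine subset_of_hSupp_le (K := point x) (L := C) (fun g => ?_) rfl
  rw [← supp_toDual_symm, ← supp_toDual_symm, supp_point]
  exact hx _

/-- Sublinear functionals. -/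
structure IsSublinear (F : E → ℝ) : Prop where
  add_le : ∀ u v, F (u + v) ≤ F u + F v
  smul : ∀ (t : ℝ) (v), 0 ≤ t → F (t • v) = t * F v

theorem isSublinear_supp (K : ConvexBody E) : IsSublinear (supp K) := by
  refine ⟨fun u v => supp_le fun x hx => ?_, fun t v ht => ?_⟩
  · rw [inner_add_left]
    exact add_le_add (inner_le_supp hx u) (inner_le_supp hx v)
  · obtain ⟨x, hx, h⟩ := exists_supp_eq K v
    apply le_antisymm
    · refine supp_le fun y hy => ?_
      rw [real_inner_smul_left]
      exact mul_le_mul_of_nonneg_left (inner_le_supp hy v) ht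
    · rw [← h, ← real_inner_smul_left]
      exact inner_le_supp hx _

namespace IsSublinear

theorem map_zero {F : E → ℝ} (h : IsSublinear F) : F 0 = 0 := by
  have := h.smul 0 0 le_rfl
  rwa [zero_smul, zero_mul] at this

theorem add {F G : E → ℝ} (h : IsSublinear F) (h' : IsSublinear G) : IsSublinear (F + G) :=
  ⟨fun u v => by
    have := h.add_le u v
    have := h'.add_le u v
    simp only [Pi.add_apply]; linarith, fun t v ht => by
    simp only [Pi.add_apply, h.smul t v ht, h'.smul t v ht]; ring⟩

theorem const_smul {F : E → ℝ} (h : IsSublinear F) {c : ℝ} (hc : 0 ≤ c) : IsSublinear (c • F) :=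
  ⟨fun u v => by
    have := mul_le_mul_of_nonneg_left (h.add_le u v) hc
    simp only [Pi.smul_apply, smul_eq_mul]; linarith, fun t v ht => by
    simp only [Pi.smul_apply, h.smul t v ht, smul_eq_mul]; ring⟩

theorem convexOn {F : E → ℝ} (h : IsSublinear F) : ConvexOn ℝ Set.univ F :=
  ⟨convex_univ, fun x _ y _ a b ha hb _ => by
    have := h.add_le (a • x) (b • y)
    rwa [h.smul a x ha, h.smul b y hb] at this⟩

theorem continuous {F : E → ℝ} (h : IsSublinear F) : Continuous F := by
  rw [← continuousOn_univ]
  exact h.convexOn.continuousOn isOpen_univ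

theorem exists_body {F : E → ℝ} (h : IsSublinear F) : ∃ K : ConvexBody E, supp K = F := by
  let S : Set E := {x | ∀ v, inner ℝ v x ≤ F v}
  have hS : ∀ v, ∃ x ∈ S, inner ℝ v x = F v := by
    intro v
    have key : ∃ g : E →ₗ[ℝ] ℝ, g v = F v ∧ ∀ x, g x ≤ F x := by
      obtain ⟨g, hg, hg'⟩ := exists_extension_of_le_sublinear
          (LinearPMap.mkSpanSingleton' (σ := RingHom.id ℝ) v (F v) (fun c hc => by
            rcases smul_eq_zero.1 hc with rfl | rfl
            · simp
            · simp [h.map_zero])) F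
          (fun c hc x => h.smul c x hc.le) h.add_le (by
            rintro ⟨x, hx⟩
            obtain ⟨t, rfl⟩ := Submodule.mem_span_singleton.1 hx
            rw [LinearPMap.mkSpanSingleton'_apply]
            rw [smul_eq_mul, RingHom.id_apply]
            rcases le_total 0 t with ht | ht
            · rw [h.smul t v ht]
            · have h1 := h.add_le (t • v) ((-t) • v)
              rw [← add_smul, add_neg_cancel, zero_smul, h.map_zero,
                h.smul (-t) v (by linarith)] at h1
              change _ ≤ F (t • v)
              linarith)
      refine ⟨g, ?_, hg'⟩
      exact (hg ⟨v, Submodule.mem_span_singleton_self v⟩).trans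
        (LinearPMap.mkSpanSingleton'_apply_self _ _ _ _)
    obtain ⟨g, hg, hg'⟩ := key
    refine ⟨(InnerProductSpace.toDual ℝ E).symm (LinearMap.toContinuousLinearMap g), fun u => ?_, ?_⟩
    all_goals rw [real_inner_comm, InnerProductSpace.toDual_symm_apply]
    exacts [hg' u, hg]
  have e : S = ⋂ v, {x | innerSL ℝ v x ≤ F v} := by ext x; simp [S]
  have hconv : Convex ℝ S :=
    e ▸ convex_iInter fun v => convex_halfSpace_le (innerSL ℝ v).isLinear _
  have hclosed : IsClosed S :=
    e ▸ isClosed_iInter fun v => isClosed_le (innerSL ℝ v).continuous continuous_const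
  obtain ⟨C, hC⟩ := (isCompact_sphere (0 : E) 1).bddAbove_image h.continuous.continuousOn
  have hcomp : IsCompact S := by
    refine (isCompact_closedBall (0 : E) (max C 0)).of_isClosed_subset hclosed fun x hx => ?_
    rw [mem_closedBall_zero_iff]
    by_cases hx0 : x = 0
    · simp [hx0]
    · have h1 := hx (‖x‖⁻¹ • x)
      rw [real_inner_smul_left, real_inner_self_eq_norm_sq] at h1
      have h2 := hC ⟨‖x‖⁻¹ • x, by simp [norm_smul, hx0], rfl⟩
      have h3 : ‖x‖⁻¹ * ‖x‖ ^ 2 = ‖x‖ := by field_simp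
      exact le_max_of_le_left (by linarith)
  obtain ⟨x0, hx0, -⟩ := hS 0
  refine ⟨⟨S, hconv, hcomp, ⟨x0, hx0⟩⟩, ?_⟩
  funext v
  obtain ⟨x, hx, h'⟩ := hS v
  exact (supp_le fun x (hx : x ∈ S) => hx v).antisymm
    (h' ▸ inner_le_supp (K := ⟨S, hconv, hcomp, ⟨x0, hx0⟩⟩) hx v)

end IsSublinear

/-- Two bodies such that the minimum of their support functions is a support function have
convex union, and the minimum and maximum are the support functions of the intersection and
union. -/
theorem union_of_min_sublinear {K L K₀ : ConvexBody E}
    (h : ∀ v, min (supp K v) (supp L v) = supp K₀ v) :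
    ∃ (hU : Convex ℝ ((K : Set E) ∪ (L : Set E))) (hI : ((K : Set E) ∩ (L : Set E)).Nonempty),
      K.inter L hI = K₀ ∧ ∀ v, supp (K.union L hU) v = max (supp K v) (supp L v) := by
  have key : ∀ x, (∀ v, inner ℝ v x ≤ max (supp K v) (supp L v)) → x ∈ K ∨ x ∈ L := by
    intro x hx
    by_contra! hcon
    obtain ⟨u, hu⟩ : ∃ u, supp K u < inner ℝ u x := by
      by_contra! hc; exact hcon.1 (mem_of_inner_le hc)
    obtain ⟨v, hv⟩ : ∃ v, supp L v < inner ℝ v x := by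
      by_contra! hc; exact hcon.2 (mem_of_inner_le hc)
    let w : ℝ → E := fun t => (1 - t) • u + t • v
    have hw : Continuous w := by fun_prop
    have hcK := (isSublinear_supp K).continuous
    have hcL := (isSublinear_supp L).continuous
    have hin : Continuous fun t => inner ℝ (w t) x := hw.inner continuous_const
    have hpc := isPreconnected_closed_iff.1 (isPreconnected_Icc (a := (0 : ℝ)) (b := 1))
      {t | inner ℝ (w t) x ≤ supp K (w t)} {t | inner ℝ (w t) x ≤ supp L (w t)}
      (isClosed_le hin (hcK.comp hw)) (isClosed_le hin (hcL.comp hw))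
      (fun t _ => le_max_iff.1 (hx (w t)))
      ⟨1, by simp, by simpa [w] using (le_max_iff.1 (hx v)).resolve_right (not_le.2 hv)⟩
      ⟨0, by simp, by simpa [w] using (le_max_iff.1 (hx u)).resolve_left (not_le.2 hu)⟩
    obtain ⟨t, ht, htK, htL⟩ := hpc
    have h1 : inner ℝ (w t) x ≤ supp K₀ (w t) := by rw [← h]; exact le_min htK htL
    have h2 := (isSublinear_supp K₀).convexOn.2 (Set.mem_univ u) (Set.mem_univ v)
      (sub_nonneg.2 ht.2) ht.1 (by ring)
    have h3 : supp K₀ u < inner ℝ u x := (h u ▸ min_le_left _ _).trans_lt hu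
    have h4 : supp K₀ v < inner ℝ v x := (h v ▸ min_le_right _ _).trans_lt hv
    simp only [w, inner_add_left, real_inner_smul_left, smul_eq_mul] at h1 h2
    rcases ht.1.eq_or_lt with rfl | ht0
    · simp at h1 h2; linarith
    · nlinarith [mul_lt_mul_of_pos_left h4 ht0, mul_le_mul_of_nonneg_left h3.le (sub_nonneg.2 ht.2)]
  have hm : ∀ v, ∀ z ∈ (K : Set E) ∪ (L : Set E), inner ℝ v z ≤ max (supp K v) (supp L v) := by
    rintro v z (hz | hz)
    · exact le_max_of_le_left (inner_le_supp hz v)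
    · exact le_max_of_le_right (inner_le_supp hz v)
  have hU : Convex ℝ ((K : Set E) ∪ (L : Set E)) := by
    intro x hx y hy a b ha hb hab
    refine key _ fun v => ?_
    rw [inner_add_right, real_inner_smul_right, real_inner_smul_right]
    exact convex_Iic (max (supp K v) (supp L v)) (hm v x hx) (hm v y hy) ha hb hab
  obtain ⟨z, hz⟩ := K₀.nonempty
  have hsub : ∀ z ∈ K₀, z ∈ K ∧ z ∈ L := fun z hz =>
    ⟨mem_of_inner_le fun v => (inner_le_supp hz v).trans (h v ▸ min_le_left _ _),
     mem_of_inner_le fun v => (inner_le_supp hz v).trans (h v ▸ min_le_right _ _)⟩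
  refine ⟨hU, ⟨z, hsub z hz⟩, ?_, fun v => (supp_le (hm v)).antisymm ?_⟩
  · apply ConvexBody.ext
    ext x
    refine ⟨fun hx => mem_of_inner_le fun v => ?_, fun hx => hsub x hx⟩
    rw [← h]
    exact le_min (inner_le_supp hx.1 v) (inner_le_supp hx.2 v)
  · exact max_le (supp_le fun x hx => inner_le_supp (K := K.union L hU) (Or.inl hx) v)
        (supp_le fun x hx => inner_le_supp (K := K.union L hU) (Or.inr hx) v)

end Sublinear

section DC

open ConvexBody

variable {E : Type*} [NormedAddCommGroup E] [InnerProductSpace ℝ E]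

/-- Differences of support functions. -/
def IsDC (F : E → ℝ) : Prop := ∃ A B : ConvexBody E, F = supp A - supp B

open Classical in
/-- The bilinear extension of the polarization of a valuation of degree two to differences of
support functions. -/
def bil (φ : ConvexBody E → ℝ) (F G : E → ℝ) : ℝ :=
  if h : IsDC F ∧ IsDC G then
    polar φ h.1.choose h.2.choose - polar φ h.1.choose h.2.choose_spec.choose
      - polar φ h.1.choose_spec.choose h.2.choose
      + polar φ h.1.choose_spec.choose h.2.choose_spec.choose
  else 0

theorem isDC_supp (K : ConvexBody E) : IsDC (supp K) := ⟨K, 0, by rw [supp_zero, sub_zero]⟩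

theorem isDC_zero : IsDC (0 : E → ℝ) := ⟨0, 0, by rw [sub_self]⟩

theorem IsDC.add {F G : E → ℝ} (hF : IsDC F) (hG : IsDC G) : IsDC (F + G) := by
  obtain ⟨A, B, rfl⟩ := hF
  obtain ⟨C, D, rfl⟩ := hG
  exact ⟨A + C, B + D, by rw [supp_add, supp_add]; abel⟩

theorem IsDC.neg {F : E → ℝ} (hF : IsDC F) : IsDC (-F) := by
  obtain ⟨A, B, rfl⟩ := hF
  exact ⟨B, A, by abel⟩

theorem IsDC.sub {F G : E → ℝ} (hF : IsDC F) (hG : IsDC G) : IsDC (F - G) := by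
  rw [sub_eq_add_neg]; exact hF.add hG.neg

theorem IsDC.smul {F : E → ℝ} (hF : IsDC F) (c : ℝ) : IsDC (c • F) := by
  obtain ⟨A, B, rfl⟩ := hF
  rcases le_total 0 c with hc | hc
  · exact ⟨c • A, c • B, by rw [supp_smul _ hc, supp_smul _ hc, smul_sub]⟩
  · have hc' := neg_nonneg.2 hc
    exact ⟨-c • B, -c • A, by rw [supp_smul _ hc', supp_smul _ hc']; module⟩

variable [FiniteDimensional ℝ E] {φ : ConvexBody E → ℝ}

theorem IsHom.bil_eq (hφ : IsHom 2 φ) (A B C D : ConvexBody E) :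
    bil φ (supp A - supp B) (supp C - supp D) =
      polar φ A C - polar φ A D - polar φ B C + polar φ B D := by
  have h : IsDC (supp A - supp B) ∧ IsDC (supp C - supp D) := ⟨⟨A, B, rfl⟩, ⟨C, D, rfl⟩⟩
  have key : ∀ {A B A' B' : ConvexBody E}, supp A - supp B = supp A' - supp B' →
      ∀ X, polar φ A X - polar φ B X = polar φ A' X - polar φ B' X := by
    intro A B A' B' h X
    have h1 : A + B' = A' + B := by
      apply eq_of_supp_eq
      rw [supp_add, supp_add]
      exact sub_eq_sub_iff_add_eq_add.1 h
    have h2 := congrArg (fun Y => polar φ Y X) h1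
    simp only [hφ.polar_add] at h2
    linarith
  rw [bil, dif_pos h]
  generalize_proofs p1 p2 p3 p4
  have e1 := key p4.choose_spec p2.choose
  have e2 := key p4.choose_spec p3.choose
  have e3 := key p3.choose_spec A
  have e4 := key p3.choose_spec B
  simp only [polar_comm φ _ A, polar_comm φ _ B] at e3 e4
  linarith

variable (hφ : IsHom 2 φ)
include hφ

theorem IsHom.bil_supp (K L : ConvexBody E) : bil φ (supp K) (supp L) = polar φ K L := by
  have h := hφ.bil_eq K 0 L 0
  have h0 : ∀ X, polar φ 0 X = 0 := fun X => by
    have := hφ.polar_smul 0 X le_rfl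
    rwa [smul_zero, zero_mul] at this
  rw [supp_zero, sub_zero, sub_zero, h0, h0, polar_comm φ K 0, h0] at h
  rw [h]; ring

theorem IsHom.bil_supp_self (K : ConvexBody E) : bil φ (supp K) (supp K) = φ K := by
  rw [hφ.bil_supp, hφ.polar_self]

theorem IsHom.bil_comm {F G : E → ℝ} (hF : IsDC F) (hG : IsDC G) : bil φ F G = bil φ G F := by
  obtain ⟨A, B, rfl⟩ := hF
  obtain ⟨C, D, rfl⟩ := hG
  rw [hφ.bil_eq, hφ.bil_eq, polar_comm φ A, polar_comm φ B, polar_comm φ A, polar_comm φ B]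
  ring

theorem IsHom.bil_add {F F' G : E → ℝ} (hF : IsDC F) (hF' : IsDC F') (hG : IsDC G) :
    bil φ (F + F') G = bil φ F G + bil φ F' G := by
  obtain ⟨A, B, rfl⟩ := hF
  obtain ⟨A', B', rfl⟩ := hF'
  obtain ⟨C, D, rfl⟩ := hG
  have : supp A - supp B + (supp A' - supp B') = supp (A + A') - supp (B + B') := by
    rw [supp_add, supp_add]; abel
  rw [this, hφ.bil_eq, hφ.bil_eq, hφ.bil_eq]
  simp only [hφ.polar_add]
  ring

theorem IsHom.bil_smul {F G : E → ℝ} (hF : IsDC F) (hG : IsDC G) (c : ℝ) :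
    bil φ (c • F) G = c * bil φ F G := by
  obtain ⟨A, B, rfl⟩ := hF
  obtain ⟨C, D, rfl⟩ := hG
  rcases le_total 0 c with hc | hc
  · rw [smul_sub, ← supp_smul _ hc, ← supp_smul _ hc, hφ.bil_eq, hφ.bil_eq]
    simp only [hφ.polar_smul _ _ hc]
    ring
  · have hc' := neg_nonneg.2 hc
    rw [← neg_smul_neg, neg_sub, smul_sub, ← supp_smul _ hc', ← supp_smul _ hc', hφ.bil_eq,
      hφ.bil_eq]
    simp only [hφ.polar_smul _ _ hc']
    ring

theorem IsHom.bil_sub {F F' G : E → ℝ} (hF : IsDC F) (hF' : IsDC F') (hG : IsDC G) :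
    bil φ (F - F') G = bil φ F G - bil φ F' G := by
  have := hφ.bil_add (hF.sub hF') hF' hG
  rw [sub_add_cancel] at this
  linarith

theorem IsHom.bil_add_right {F G G' : E → ℝ} (hF : IsDC F) (hG : IsDC G) (hG' : IsDC G') :
    bil φ F (G + G') = bil φ F G + bil φ F G' := by
  rw [hφ.bil_comm hF (hG.add hG'), hφ.bil_add hG hG' hF, hφ.bil_comm hG hF, hφ.bil_comm hG' hF]

theorem IsHom.bil_sub_right {F G G' : E → ℝ} (hF : IsDC F) (hG : IsDC G) (hG' : IsDC G') :
    bil φ F (G - G') = bil φ F G - bil φ F G' := by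
  rw [hφ.bil_comm hF (hG.sub hG'), hφ.bil_sub hG hG' hF, hφ.bil_comm hG hF, hφ.bil_comm hG' hF]

theorem IsHom.bil_smul_right {F G : E → ℝ} (hF : IsDC F) (hG : IsDC G) (c : ℝ) :
    bil φ F (c • G) = c * bil φ F G := by
  rw [hφ.bil_comm hF (hG.smul c), hφ.bil_smul hG hF, hφ.bil_comm hG hF]

omit hφ

/-- Differences of support functions with a quantitative bound. -/
structure DCB (R : ℝ) (F : E → ℝ) : Prop where
  nonneg : 0 ≤ R
  bound : ∀ v, |F v| ≤ R * ‖v‖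
  sub₁ : IsSublinear fun v => R * ‖v‖ + F v
  sub₂ : IsSublinear fun v => R * ‖v‖ - F v

theorem isSublinear_norm {R : ℝ} (hR : 0 ≤ R) : IsSublinear fun v : E => R * ‖v‖ :=
  ⟨fun u v => by have := mul_le_mul_of_nonneg_left (norm_add_le u v) hR; linarith,
    fun t v ht => by rw [norm_smul, Real.norm_of_nonneg ht]; ring⟩

theorem DCB.mono {R R' : ℝ} {F : E → ℝ} (h : DCB R F) (hR : R ≤ R') : DCB R' F := by
  have h0 := h.nonneg
  have hn := isSublinear_norm (E := E) (sub_nonneg.2 hR)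
  refine ⟨h0.trans hR, fun v => (h.bound v).trans (by gcongr), ?_, ?_⟩
  · convert h.sub₁.add hn using 2; simp only [Pi.add_apply]; ring
  · convert h.sub₂.add hn using 2; simp only [Pi.add_apply]; ring

theorem DCB.smul {R : ℝ} {F : E → ℝ} (h : DCB R F) {c : ℝ} (hc : 0 ≤ c) : DCB (c * R) (c • F) := by
  refine ⟨mul_nonneg hc h.nonneg, fun v => ?_, ?_, ?_⟩
  · simp only [Pi.smul_apply, smul_eq_mul, abs_mul, abs_of_nonneg hc, mul_assoc]
    exact mul_le_mul_of_nonneg_left (h.bound v) hc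
  · convert h.sub₁.const_smul hc using 2; simp [mul_add, mul_assoc]
  · convert h.sub₂.const_smul hc using 2; simp [mul_sub, mul_assoc]

/-- The ball as a convex body. -/
def ballBody (R : ℝ) (hR : 0 ≤ R) : ConvexBody E :=
  ⟨Metric.closedBall 0 R, convex_closedBall 0 R, isCompact_closedBall 0 R,
    Metric.nonempty_closedBall.2 hR⟩

theorem supp_ballBody {R : ℝ} (hR : 0 ≤ R) : supp (ballBody (E := E) R hR) = fun v => R * ‖v‖ := by
  funext v
  apply le_antisymm
  · refine supp_le fun x hx => (real_inner_le_norm v x).trans ?_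
    have : ‖x‖ ≤ R := mem_closedBall_zero_iff.1 hx
    rw [mul_comm]; gcongr
  · by_cases hv : v = 0
    · simp [hv, (isSublinear_supp _).map_zero]
    · have hm : (R / ‖v‖) • v ∈ ballBody (E := E) R hR := by
        change _ ∈ Metric.closedBall _ _
        rw [mem_closedBall_zero_iff, norm_smul, norm_div, norm_norm, Real.norm_of_nonneg hR,
          div_mul_cancel₀ _ (norm_ne_zero_iff.2 hv)]
      refine le_trans (le_of_eq ?_) (inner_le_supp hm v)
      rw [real_inner_smul_right, real_inner_self_eq_norm_sq]
      field

theorem norm_le_of_supp_le {K : ConvexBody E} {R : ℝ} (hR : 0 ≤ R)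
    (h : ∀ v, supp K v ≤ R * ‖v‖) {x : E} (hx : x ∈ K) : ‖x‖ ≤ R := by
  by_cases h0 : x = 0
  · simpa [h0] using hR
  · have h1 := (inner_le_supp hx x).trans (h x)
    rw [real_inner_self_eq_norm_sq, pow_two] at h1
    exact le_of_mul_le_mul_right h1 (norm_pos_iff.2 h0)

theorem DCB.exists_body {R : ℝ} {F : E → ℝ} (h : DCB R F) :
    ∃ A : ConvexBody E, F = supp A - supp (ballBody R h.nonneg) ∧ ∀ x ∈ A, ‖x‖ ≤ 2 * R := by
  obtain ⟨A, hA⟩ := h.sub₁.exists_body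
  refine ⟨A, ?_, fun x hx => norm_le_of_supp_le (by linarith [h.nonneg]) (fun v => ?_) hx⟩
  · rw [hA, supp_ballBody]; funext v; simp
  · rw [hA]
    have := (le_abs_self _).trans (h.bound v)
    change R * ‖v‖ + F v ≤ _
    linarith

theorem DCB.isDC {R : ℝ} {F : E → ℝ} (h : DCB R F) : IsDC F := by
  obtain ⟨A, hA, -⟩ := h.exists_body
  exact ⟨_, _, hA⟩

theorem IsHom.bil_zero_left (hφ : IsHom 2 φ) {G : E → ℝ} (hG : IsDC G) :
    bil φ 0 G = 0 := by
  have := hφ.bil_smul isDC_zero hG 0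
  rwa [smul_zero, zero_mul] at this

theorem IsHom.polar_bounded (hφ : IsHom 2 φ) (R : ℝ) :
    ∃ C : ℝ, 0 ≤ C ∧ ∀ K L : ConvexBody E, (∀ x ∈ K, ‖x‖ ≤ R) → (∀ x ∈ L, ‖x‖ ≤ R) →
      |polar φ K L| ≤ C := by
  obtain ⟨C, hC, h⟩ := hφ.bounded two_ne_zero R
  obtain ⟨C', hC', h'⟩ := hφ.bounded two_ne_zero (R + R)
  refine ⟨C' + C + C, by positivity, fun K L hK hL => ?_⟩
  have h1 := h K hK
  have h2 := h L hL
  have h3 := h' (K + L) (by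
    intro x hx
    obtain ⟨a, ha, b, hb, rfl⟩ := mem_add.1 hx
    exact (norm_add_le a b).trans (add_le_add (hK a ha) (hL b hb)))
  rw [polar]
  rw [abs_le] at *
  constructor <;> linarith

theorem IsHom.bil_bounded (hφ : IsHom 2 φ) :
    ∃ C : ℝ, 0 ≤ C ∧ ∀ {R R' : ℝ} {F G : E → ℝ}, DCB R F → DCB R' G →
      |bil φ F G| ≤ C * R * R' := by
  obtain ⟨C, hC, h⟩ := hφ.polar_bounded 2
  have key : ∀ {F G : E → ℝ}, DCB 1 F → DCB 1 G → |bil φ F G| ≤ 4 * C := by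
    intro F G hF hG
    obtain ⟨A, eA, hA⟩ := hF.exists_body
    obtain ⟨B, eB, hB⟩ := hG.exists_body
    rw [mul_one] at hA hB
    have hb : ∀ x ∈ ballBody (E := E) 1 hF.nonneg, ‖x‖ ≤ 2 := fun x hx => by
      have : ‖x‖ ≤ 1 := mem_closedBall_zero_iff.1 hx
      linarith
    rw [eA, eB, hφ.bil_eq]
    have h1 := h _ _ hA hB
    have h2 := h _ _ hA hb
    have h3 := h _ _ hb hB
    have h4 := h _ _ hb hb
    rw [abs_le] at *
    constructor <;> linarith
  have hzero : ∀ {F : E → ℝ}, DCB 0 F → F = 0 := fun h => by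
    funext v
    have := h.bound v
    rw [zero_mul] at this
    exact abs_nonpos_iff.1 this
  refine ⟨4 * C, by positivity, fun {R R' F G} hF hG => ?_⟩
  have hFd := hF.isDC
  have hGd := hG.isDC
  rcases hF.nonneg.eq_or_lt with rfl | hR
  · rw [hzero hF, hφ.bil_zero_left hGd]; simp
  rcases hG.nonneg.eq_or_lt with rfl | hR'
  · rw [hzero hG, hφ.bil_comm hFd isDC_zero, hφ.bil_zero_left hFd]; simp
  have h1 := hF.smul (inv_nonneg.2 hR.le)
  have h2 := hG.smul (inv_nonneg.2 hR'.le)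
  rw [inv_mul_cancel₀ hR.ne'] at h1
  rw [inv_mul_cancel₀ hR'.ne'] at h2
  have h3 := key h1 h2
  rw [hφ.bil_smul hFd (hGd.smul _), hφ.bil_smul_right hFd hGd, abs_mul, abs_mul, abs_inv, abs_inv,
    abs_of_pos hR, abs_of_pos hR'] at h3
  field_simp at h3
  linarith

/-- Functions with disjoint supports are orthogonal for `bil`. -/
theorem IsHom.bil_eq_zero_of_mul_eq_zero (hφ : IsHom 2 φ) {R : ℝ} {A B : E → ℝ}
    (hA : DCB R A) (hB : DCB R B) (hA0 : ∀ v, 0 ≤ A v) (hB0 : ∀ v, 0 ≤ B v)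
    (hAB : ∀ v, A v * B v = 0) : bil φ A B = 0 := by
  obtain ⟨K, hK⟩ := hA.sub₁.exists_body
  obtain ⟨L, hL⟩ := hB.sub₁.exists_body
  set K₀ := ballBody (E := E) R hA.nonneg with hK₀
  have e0 : supp K₀ = fun v => R * ‖v‖ := supp_ballBody _
  obtain ⟨hU, hI, h1, h2⟩ := union_of_min_sublinear (K := K) (L := L) (K₀ := K₀) (fun v => by
    rw [hK, hL, e0]
    rcases mul_eq_zero.1 (hAB v) with h | h <;> simp [h, hA0 v, hB0 v])
  have hval := hφ.val K L hU hI
  rw [h1] at hval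
  have hK' : supp K = supp K₀ + A := by rw [hK, e0]; rfl
  have hL' : supp L = supp K₀ + B := by rw [hL, e0]; rfl
  have hKL : supp (K.union L hU) = supp K₀ + A + B := by
    funext v
    rw [h2, hK', hL']
    simp only [Pi.add_apply]
    rcases mul_eq_zero.1 (hAB v) with h | h <;> simp [h, hA0 v, hB0 v]
  have d0 := isDC_supp K₀
  have dA := hA.isDC
  have dB := hB.isDC
  have d1 := d0.add dA
  rw [← hφ.bil_supp_self, ← hφ.bil_supp_self, ← hφ.bil_supp_self K, ← hφ.bil_supp_self L, hKL,
    hK', hL'] at hval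
  rw [hφ.bil_add d1 dB (d1.add dB), hφ.bil_add_right d1 d1 dB,
    hφ.bil_add_right dB d1 dB, hφ.bil_add_right dB d0 dA, hφ.bil_add d0 dA dB,
    hφ.bil_add_right (d0.add dB) d0 dB, hφ.bil_add d0 dB d0, hφ.bil_add d0 dB dB,
    hφ.bil_comm dB dA] at hval
  linarith

end DC

section SmoothFamilies

open scoped ContDiff

section Defs

variable {P : Type*} [NormedAddCommGroup P] [NormedSpace ℝ P]
variable {E : Type*} [NormedAddCommGroup E] [NormedSpace ℝ E]

/-- Families of positively homogeneous functions of degree one which are smooth away from zero. -/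
structure SHF (Γ : P × E → ℝ) : Prop where
  smooth : ContDiffOn ℝ ∞ Γ {q | q.2 ≠ 0}
  hom : ∀ p v (t : ℝ), 0 ≤ t → Γ (p, t • v) = t * Γ (p, v)

/-- Positively homogeneous functions of degree one which are smooth away from zero. -/
structure SH (f : E → ℝ) : Prop where
  smooth : ContDiffOn ℝ ∞ f {v | v ≠ 0}
  hom : ∀ v (t : ℝ), 0 ≤ t → f (t • v) = t * f v

end Defs

variable {P : Type*} [NormedAddCommGroup P] [NormedSpace ℝ P]
variable {E : Type*} [NormedAddCommGroup E] [InnerProductSpace ℝ E]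

theorem isOpen_snd_ne : IsOpen {q : P × E | q.2 ≠ 0} := isOpen_ne.preimage continuous_snd

theorem IsSublinear.of_support {F : E → ℝ} (hs : ∀ (t : ℝ) v, 0 ≤ t → F (t • v) = t * F v)
    (h : ∀ z, ‖z‖ = 1 → ∃ ℓ : E →ₗ[ℝ] ℝ, ℓ z = F z ∧ ∀ v, ‖v‖ = 1 → ℓ v ≤ F v) :
    IsSublinear F := by
  have h0 : F 0 = 0 := by simpa using hs 0 0 le_rfl
  have hn : ∀ {v : E}, v ≠ 0 → ‖‖v‖⁻¹ • v‖ = 1 := fun hv => by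
    rw [norm_smul, norm_inv, norm_norm, inv_mul_cancel₀ (norm_ne_zero_iff.2 hv)]
  have h' : ∀ z, z ≠ 0 → ∃ ℓ : E →ₗ[ℝ] ℝ, ℓ z = F z ∧ ∀ v, ℓ v ≤ F v := by
    intro z hz
    obtain ⟨ℓ, h1, h2⟩ := h _ (hn hz)
    refine ⟨ℓ, ?_, fun v => ?_⟩
    · rw [map_smul, hs _ _ (by positivity), smul_eq_mul] at h1
      exact mul_left_cancel₀ (inv_ne_zero (norm_ne_zero_iff.2 hz)) h1
    · by_cases hv : v = 0
      · simp [hv, h0]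
      have := h2 _ (hn hv)
      rw [map_smul, hs _ _ (by positivity), smul_eq_mul] at this
      exact le_of_mul_le_mul_left this (inv_pos.2 (norm_pos_iff.2 hv))
  refine ⟨fun u v => ?_, hs⟩
  by_cases huv : u + v = 0
  · by_cases hu : u = 0
    · have hv : v = 0 := by simpa [hu] using huv
      simp [hu, hv, h0]
    · obtain ⟨ℓ, -, h2⟩ := h' u hu
      have := h2 u
      have := h2 v
      have h3 : ℓ u + ℓ v = 0 := by rw [← ℓ.map_add, huv, ℓ.map_zero]
      rw [huv, h0]; linarith
  · obtain ⟨ℓ, h1, h2⟩ := h' _ huv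
    rw [← h1, map_add]
    exact add_le_add (h2 u) (h2 v)

theorem SHF.differentiableAt {Γ : P × E → ℝ} (h : SHF Γ) {q : P × E} (hq : q.2 ≠ 0) :
    DifferentiableAt ℝ Γ q :=
  ((h.smooth.differentiableOn (by simp)) q hq).differentiableAt (isOpen_snd_ne.mem_nhds hq)

theorem SHF.euler {Γ : P × E → ℝ} (h : SHF Γ) {p : P} {z : E} (hz : z ≠ 0) :
    fderiv ℝ Γ (p, z) (0, z) = Γ (p, z) := by
  have h1 : HasDerivAt (fun t : ℝ => ((p, t • z) : P × E)) (0, z) 1 := by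
    have : HasDerivAt (fun t : ℝ => t • z) ((1 : ℝ) • z) 1 := (hasDerivAt_id 1).smul_const z
    rw [one_smul] at this
    exact (hasDerivAt_const _ _).prodMk this
  have h2 : HasFDerivAt Γ (fderiv ℝ Γ (p, z)) ((p, (1 : ℝ) • z) : P × E) := by
    rw [one_smul]; exact (h.differentiableAt hz).hasFDerivAt
  have h3 := h2.comp_hasDerivAt (1 : ℝ) h1
  have h4 : HasDerivAt (fun t : ℝ => t * Γ (p, z)) (Γ (p, z)) 1 := by
    simpa using (hasDerivAt_id (1 : ℝ)).mul_const (Γ (p, z))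
  refine h3.unique (h4.congr_of_eventuallyEq ?_)
  filter_upwards [lt_mem_nhds (show (0 : ℝ) < 1 by norm_num)] with t ht
  exact h.hom p z t ht.le

variable [FiniteDimensional ℝ E]

theorem exists_taylor_bound {X : Type*} [NormedAddCommGroup X] [NormedSpace ℝ X] {f : X → ℝ}
    {S A : Set X} (hS : IsOpen S) (hf : ContDiffOn ℝ ∞ f S) (hA : IsCompact A) (hAS : A ⊆ S) :
    ∃ C : ℝ, 0 ≤ C ∧ (∀ q ∈ A, |f q| ≤ C ∧ ‖fderiv ℝ f q‖ ≤ C) ∧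
      ∀ q q', segment ℝ q q' ⊆ A → |f q' - f q - fderiv ℝ f q (q' - q)| ≤ C * ‖q' - q‖ ^ 2 := by
  have hD : ContDiffOn ℝ ∞ (fderiv ℝ f) S := hf.fderiv_of_isOpen hS (by simp)
  have hD2 : ContDiffOn ℝ ∞ (fderiv ℝ (fderiv ℝ f)) S := hD.fderiv_of_isOpen hS (by simp)
  obtain ⟨C0, h0⟩ := hA.exists_bound_of_continuousOn (hf.continuousOn.mono hAS)
  obtain ⟨C1, h1⟩ := hA.exists_bound_of_continuousOn (hD.continuousOn.mono hAS)
  have hc2 : ContinuousOn (fderiv ℝ (fderiv ℝ f)) A := hD2.continuousOn.mono hAS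
  obtain ⟨C2, h2⟩ := IsCompact.exists_bound_of_continuousOn (E := X →L[ℝ] X →L[ℝ] ℝ) hA hc2
  have p0 := abs_nonneg C0
  have p1 := abs_nonneg C1
  have p2 := abs_nonneg C2
  refine ⟨|C0| + |C1| + |C2|, by positivity, fun q hq => ⟨?_, ?_⟩, fun q q' hq => ?_⟩
  · have := (h0 q hq).trans (le_abs_self _)
    rw [Real.norm_eq_abs] at this; linarith
  · have := (h1 q hq).trans (le_abs_self _)
    linarith
  · have hSc : Convex ℝ (segment ℝ q q') := convex_segment _ _
    have hl := left_mem_segment ℝ q q'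
    have hr := right_mem_segment ℝ q q'
    have m1 : ∀ y ∈ segment ℝ q q', ‖fderiv ℝ f y - fderiv ℝ f q‖ ≤ |C2| * ‖q' - q‖ := by
      intro y hy
      refine (hSc.norm_image_sub_le_of_norm_hasFDerivWithin_le (f' := fderiv ℝ (fderiv ℝ f))
        (fun y hy => ?_) (fun y hy => (h2 y (hq hy)).trans (le_abs_self _)) hl hy).trans ?_
      · exact ((hD.differentiableOn (by simp) y (hAS (hq hy))).differentiableAt
          (hS.mem_nhds (hAS (hq hy)))).hasFDerivAt.hasFDerivWithinAt
      · exact mul_le_mul_of_nonneg_left (norm_sub_le_of_mem_segment hy) (abs_nonneg _)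
    have m2 := hSc.norm_image_sub_le_of_norm_hasFDerivWithin_le' (f := f) (f' := fderiv ℝ f)
      (fun y hy => ((hf.differentiableOn (by simp) y (hAS (hq hy))).differentiableAt
          (hS.mem_nhds (hAS (hq hy)))).hasFDerivAt.hasFDerivWithinAt) m1 hl hr
    rw [Real.norm_eq_abs] at m2
    refine m2.trans ?_
    rw [mul_assoc, ← pow_two]
    gcongr
    linarith

theorem SHF.exists_bounds {Γ : P × E → ℝ} (h : SHF Γ) {Q : Set P} (hQ : IsCompact Q) :
    ∃ C : ℝ, 0 ≤ C ∧ ∀ p ∈ Q, ∀ z z' : E, ‖z‖ = 1 → ‖z'‖ = 1 → |Γ (p, z)| ≤ C ∧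
      |Γ (p, z') - fderiv ℝ Γ (p, z) (0, z')| ≤ C * ‖z' - z‖ ^ 2 := by
  set A : Set (P × E) := Q ×ˢ (Metric.closedBall 0 1 \ Metric.ball 0 (1 / 2)) with hA
  have hAc : IsCompact A := hQ.prod ((isCompact_closedBall 0 1).diff Metric.isOpen_ball)
  have hAS : A ⊆ {q | q.2 ≠ 0} := by
    rintro ⟨p, v⟩ ⟨-, -, hv⟩ h0
    exact hv (by simp [show v = 0 from h0])
  obtain ⟨C, hC, hb, htay⟩ := exists_taylor_bound isOpen_snd_ne h.smooth hAc hAS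
  have hmem : ∀ p ∈ Q, ∀ z : E, ‖z‖ ≤ 1 → 1 / 2 ≤ ‖z‖ → (p, z) ∈ A := fun p hp z h1 h2 =>
    ⟨hp, by simpa using h1, by simpa using h2⟩
  refine ⟨17 * C, by positivity, fun p hp z z' hz hz' => ?_⟩
  have hzA := hmem p hp z hz.le (by rw [hz]; norm_num)
  have hzA' := hmem p hp z' hz'.le (by rw [hz']; norm_num)
  have hz0 : z ≠ 0 := hAS hzA
  obtain ⟨b0, b1⟩ := hb _ hzA
  have b0' := (hb _ hzA').1
  refine ⟨b0.trans (by linarith), ?_⟩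
  have hrew : Γ (p, z') - fderiv ℝ Γ (p, z) (0, z') =
      Γ (p, z') - Γ (p, z) - fderiv ℝ Γ (p, z) ((p, z') - (p, z)) := by
    have : ((p, z') : P × E) - (p, z) = (0, z') - (0, z) := by simp
    rw [this, map_sub, h.euler hz0]; ring
  rw [hrew]
  have hsub : ‖((p, z') : P × E) - (p, z)‖ = ‖z' - z‖ := by simp [Prod.norm_def]
  rcases le_or_gt ‖z' - z‖ (1 / 2) with hclose | hfar
  · set S := segment ℝ ((p, z) : P × E) (p, z') with hS
    have hSA : S ⊆ A := by
      rintro q ⟨a, b, ha, hb, hab, rfl⟩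
      have e : a • ((p, z) : P × E) + b • (p, z') = (p, z + b • (z' - z)) := by
        obtain rfl : a = 1 - b := by linarith
        ext
        · simp [← add_smul]
        · simp only [Prod.snd_add, Prod.smul_snd]; module
      have e2 : z + b • (z' - z) = a • z + b • z' := by
        obtain rfl : a = 1 - b := by linarith
        module
      rw [e]
      refine hmem p hp _ ?_ ?_
      · rw [e2]
        refine (norm_add_le _ _).trans ?_
        rw [norm_smul, norm_smul, hz, hz', Real.norm_of_nonneg ha, Real.norm_of_nonneg hb]
        linarith
      · have h3 := norm_sub_norm_le z (-(b • (z' - z)))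
        rw [sub_neg_eq_add, norm_neg, norm_smul, hz, Real.norm_of_nonneg hb] at h3
        have : b * ‖z' - z‖ ≤ 1 * (1 / 2) := by gcongr; linarith
        linarith
    have := htay _ _ hSA
    rw [hsub] at this
    refine this.trans ?_
    gcongr
    linarith
  · have m3 : |fderiv ℝ Γ (p, z) ((p, z') - (p, z))| ≤ C * 2 := by
      refine ((fderiv ℝ Γ (p, z)).le_opNorm _).trans ?_
      rw [hsub]
      have := norm_sub_le z' z
      gcongr
      linarith
    have m4 : 1 ≤ 4 * ‖z' - z‖ ^ 2 := by nlinarith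
    have m5 : |Γ (p, z') - Γ (p, z) - fderiv ℝ Γ (p, z) ((p, z') - (p, z))| ≤
        4 * C := by
      rw [abs_le] at *
      constructor <;> linarith
    refine m5.trans ?_
    nlinarith

theorem SHF.exists_DCB {Γ : P × E → ℝ} (h : SHF Γ) {Q : Set P} (hQ : IsCompact Q) :
    ∃ R, ∀ p ∈ Q, DCB R fun v => Γ (p, v) := by
  obtain ⟨C, hC, hb⟩ := h.exists_bounds hQ
  have key : ∀ z z' : E, ‖z‖ = 1 → ‖z'‖ = 1 → ‖z' - z‖ ^ 2 = 2 - 2 * inner ℝ z z' := by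
    intro z z' hz hz'
    rw [norm_sub_sq_real, hz, hz', real_inner_comm]; ring
  have hbound : ∀ p ∈ Q, ∀ v, |Γ (p, v)| ≤ C * ‖v‖ := by
    intro p hp v
    by_cases hv : v = 0
    · have := h.hom p 0 0 le_rfl
      rw [zero_smul, zero_mul] at this
      simp [hv, this]
    · have hn : ‖‖v‖⁻¹ • v‖ = 1 := by
        rw [norm_smul, norm_inv, norm_norm, inv_mul_cancel₀ (norm_ne_zero_iff.2 hv)]
      have := (hb p hp _ _ hn hn).1
      rw [h.hom p v _ (by positivity), abs_mul, abs_inv, abs_norm,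
        inv_mul_le_iff₀ (norm_pos_iff.2 hv)] at this
      linarith
  refine ⟨2 * C, fun p hp => ⟨by positivity, fun v => (hbound p hp v).trans ?_, ?_, ?_⟩⟩
  · have := norm_nonneg v; nlinarith
  · refine IsSublinear.of_support (fun t v ht => ?_) fun z hz => ?_
    · rw [h.hom p v t ht, norm_smul, Real.norm_of_nonneg ht]; ring
    · have hz0 : z ≠ 0 := by rintro rfl; simp at hz
      refine ⟨((fderiv ℝ Γ (p, z)).comp (ContinuousLinearMap.inr ℝ P E) +
        (2 * C) • innerSL ℝ z : E →L[ℝ] ℝ), ?_, fun v hv => ?_⟩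
      · simp [h.euler hz0, hz]; ring
      · have := (hb p hp z v hz hv).2
        rw [key z v hz hv, abs_le] at this
        simp [hv]
        linarith
  · refine IsSublinear.of_support (fun t v ht => ?_) fun z hz => ?_
    · rw [h.hom p v t ht, norm_smul, Real.norm_of_nonneg ht]; ring
    · have hz0 : z ≠ 0 := by rintro rfl; simp at hz
      refine ⟨(-(fderiv ℝ Γ (p, z)).comp (ContinuousLinearMap.inr ℝ P E) +
        (2 * C) • innerSL ℝ z : E →L[ℝ] ℝ), ?_, fun v hv => ?_⟩
      · simp [h.euler hz0, hz]; ring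
      · have := (hb p hp z v hz hv).2
        rw [key z v hz hv, abs_le] at this
        simp [hv]
        linarith

end SmoothFamilies

section Derivative

open scoped ContDiff

theorem abs_taylor_le {a a' a'' : ℝ → ℝ} {M : ℝ} (h1 : ∀ s, HasDerivAt a (a' s) s)
    (h2 : ∀ s, HasDerivAt a' (a'' s) s) (hM : ∀ s ∈ Set.Icc (-1 : ℝ) 1, |a'' s| ≤ M) {t : ℝ}
    (ht : t ∈ Set.Icc (-1 : ℝ) 1) : |a t - a 0 - t * a' 0| ≤ M * t ^ 2 := by
  have hsub : Set.uIcc 0 t ⊆ Set.Icc (-1 : ℝ) 1 := by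
    rw [← Set.uIcc_of_le (by norm_num : (-1 : ℝ) ≤ 1)]
    refine Set.uIcc_subset_uIcc ?_ ?_ <;> rw [Set.uIcc_of_le (by norm_num : (-1 : ℝ) ≤ 1)]
    · constructor <;> norm_num
    · exact ht
  have hM0 : 0 ≤ M := (abs_nonneg _).trans (hM 0 (by constructor <;> norm_num))
  have b1 : ∀ s ∈ Set.uIcc 0 t, |a' s - a' 0| ≤ M * |t| := by
    intro s hs
    have := (convex_uIcc (0 : ℝ) t).norm_image_sub_le_of_norm_hasDerivWithin_le (f := a')
      (fun x _ => (h2 x).hasDerivWithinAt) (fun x hx => hM x (hsub hx)) Set.left_mem_uIcc hs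
    refine this.trans ?_
    gcongr
    rw [Real.norm_eq_abs]
    simpa using Set.abs_sub_left_of_mem_uIcc hs
  have := (convex_uIcc (0 : ℝ) t).norm_image_sub_le_of_norm_hasDerivWithin_le
    (f := fun s => a s - s * a' 0) (f' := fun s => a' s - a' 0)
    (fun x _ => ((h1 x).sub (by simpa using (hasDerivAt_id x).mul_const (a' 0))).hasDerivWithinAt)
    b1 Set.left_mem_uIcc Set.right_mem_uIcc
  simp only [zero_mul, sub_zero, Real.norm_eq_abs] at this
  rw [mul_assoc, ← pow_two, sq_abs] at this
  convert this using 2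
  ring

variable {P : Type*} [NormedAddCommGroup P] [NormedSpace ℝ P]
variable {E : Type*} [NormedAddCommGroup E] [InnerProductSpace ℝ E]

theorem SHF.map_zero {Γ : P × E → ℝ} (h : SHF Γ) (p : P) : Γ (p, 0) = 0 := by
  simpa using h.hom p 0 0 le_rfl

theorem SHF.add {Γ Γ' : P × E → ℝ} (h : SHF Γ) (h' : SHF Γ') : SHF (Γ + Γ') :=
  ⟨h.smooth.add h'.smooth, fun p v t ht => by
    simp only [Pi.add_apply, h.hom p v t ht, h'.hom p v t ht]; ring⟩

theorem SH.toSHF {f : E → ℝ} (h : SH f) : SHF fun q : P × E => f q.2 :=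
  ⟨h.smooth.comp contDiffOn_snd fun _ hq => hq, fun _ v t ht => h.hom v t ht⟩

theorem SHF.slice {Γ : P × E → ℝ} (h : SHF Γ) (p : P) : SH fun v => Γ (p, v) :=
  ⟨h.smooth.comp (contDiff_prodMk_right p).contDiffOn fun _ hq => hq, fun v t ht => h.hom p v t ht⟩

/-- The derivative of a one-parameter family with respect to the parameter. -/
def dt (Γ : ℝ × E → ℝ) (q : ℝ × E) : ℝ := deriv (fun s => Γ (s, q.2)) q.1

theorem SHF.hasDerivAt {Γ : ℝ × E → ℝ} (h : SHF Γ) (t : ℝ) (v : E) :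
    HasDerivAt (fun s => Γ (s, v)) (dt Γ (t, v)) t := by
  refine DifferentiableAt.hasDerivAt ?_
  by_cases hv : v = 0
  · subst hv
    simp only [h.map_zero]
    exact differentiableAt_const _
  · have : DifferentiableAt ℝ Γ (t, v) := h.differentiableAt hv
    exact DifferentiableAt.comp t (f := fun s => (s, v)) this (by fun_prop)

theorem SHF.dt {Γ : ℝ × E → ℝ} (h : SHF Γ) : SHF (dt Γ) := by
  refine ⟨?_, fun p v t ht => ?_⟩
  · have hD : ContDiffOn ℝ ∞ (fderiv ℝ Γ) {q | q.2 ≠ 0} :=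
      h.smooth.fderiv_of_isOpen isOpen_snd_ne (by simp)
    have : ContDiffOn ℝ ∞ (fun q => fderiv ℝ Γ q (1, 0)) {q : ℝ × E | q.2 ≠ 0} :=
      hD.clm_apply contDiffOn_const
    refine this.congr ?_
    rintro ⟨t, v⟩ hv
    have h1 := h.differentiableAt (q := (t, v)) hv
    have h2 : HasDerivAt (fun s : ℝ => ((s, v) : ℝ × E)) (1, 0) t :=
      (hasDerivAt_id t).prodMk (hasDerivAt_const _ _)
    exact (h1.hasFDerivAt.comp_hasDerivAt t h2).deriv
  · have h1 := (h.hasDerivAt p v).const_mul t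
    have : (fun s => Γ (s, t • v)) = fun s => t * Γ (s, v) := by
      funext s; exact h.hom s v t ht
    change deriv (fun s => Γ (s, t • v)) p = _
    rw [this]
    exact h1.deriv

variable [FiniteDimensional ℝ E]

theorem SH.exists_DCB {f : E → ℝ} (h : SH f) : ∃ R, DCB R f := by
  obtain ⟨R, hR⟩ := (h.toSHF (P := ℝ)).exists_DCB (isCompact_singleton (x := (0 : ℝ)))
  exact ⟨R, hR 0 rfl⟩

theorem SH.isDC {f : E → ℝ} (h : SH f) : IsDC f := by
  obtain ⟨R, hR⟩ := h.exists_DCB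
  exact hR.isDC

theorem SHF.taylor {Γ : ℝ × E → ℝ} (h : SHF Γ) :
    ∃ K, ∀ t ∈ Set.Icc (-1 : ℝ) 1,
      DCB (K * t ^ 2) fun v => Γ (t, v) - Γ (0, v) - t * _root_.dt Γ (0, v) := by
  obtain ⟨K, hK⟩ := h.dt.dt.exists_DCB (isCompact_Icc (a := (-1 : ℝ)) (b := 1))
  have hK0 := (hK 0 (by constructor <;> norm_num)).nonneg
  refine ⟨K, fun t ht => ?_⟩
  have hhom : ∀ (s : ℝ) v, 0 ≤ s → Γ (t, s • v) - Γ (0, s • v) - t * _root_.dt Γ (0, s • v) =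
      s * (Γ (t, v) - Γ (0, v) - t * _root_.dt Γ (0, v)) := by
    intro s v hs
    rw [h.hom _ _ _ hs, h.hom _ _ _ hs, h.dt.hom _ _ _ hs]; ring
  have hL : ∀ u v, |(Γ (t, u) + Γ (t, v) - Γ (t, u + v)) - (Γ (0, u) + Γ (0, v) - Γ (0, u + v))
      - t * (_root_.dt Γ (0, u) + _root_.dt Γ (0, v) - _root_.dt Γ (0, u + v))| ≤
      K * (‖u‖ + ‖v‖ - ‖u + v‖) * t ^ 2 := by
    intro u v
    refine abs_taylor_le (a := fun t => Γ (t, u) + Γ (t, v) - Γ (t, u + v))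
      (a' := fun t => _root_.dt Γ (t, u) + _root_.dt Γ (t, v) - _root_.dt Γ (t, u + v))
      (a'' := fun t => _root_.dt (_root_.dt Γ) (t, u) + _root_.dt (_root_.dt Γ) (t, v)
        - _root_.dt (_root_.dt Γ) (t, u + v))
      (fun s => ((h.hasDerivAt s u).add (h.hasDerivAt s v)).sub (h.hasDerivAt s _))
      (fun s => ((h.dt.hasDerivAt s u).add (h.dt.hasDerivAt s v)).sub (h.dt.hasDerivAt s _))
      (fun s hs => ?_) ht
    have h1 := (hK s hs).sub₁.add_le u v
    have h2 := (hK s hs).sub₂.add_le u v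
    rw [abs_le]
    constructor <;> linarith
  refine ⟨by positivity, fun v => ?_, ⟨fun u v => ?_, fun s v hs => ?_⟩,
    ⟨fun u v => ?_, fun s v hs => ?_⟩⟩
  · refine (abs_taylor_le (fun s => h.hasDerivAt s v) (fun s => h.dt.hasDerivAt s v)
      (fun s hs => (hK s hs).bound v) ht).trans (le_of_eq (by ring))
  · have := abs_le.1 (hL u v)
    linarith
  · rw [hhom s v hs, norm_smul, Real.norm_of_nonneg hs]; ring
  · have := abs_le.1 (hL u v)
    linarith
  · rw [hhom s v hs, norm_smul, Real.norm_of_nonneg hs]; ring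

variable {φ : ConvexBody E → ℝ}

theorem IsHom.bil_bounded_family (hφ : IsHom 2 φ) {Γ Γ' : P × E → ℝ} (h : SHF Γ) (h' : SHF Γ')
    {Q : Set P} (hQ : IsCompact Q) :
    ∃ C, ∀ p ∈ Q, |bil φ (fun v => Γ (p, v)) (fun v => Γ' (p, v))| ≤ C := by
  obtain ⟨C, hC, hb⟩ := hφ.bil_bounded
  obtain ⟨R, hR⟩ := h.exists_DCB hQ
  obtain ⟨R', hR'⟩ := h'.exists_DCB hQ
  exact ⟨_, fun p hp => hb (hR p hp) (hR' p hp)⟩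

/-- The bilinear extension is differentiable along smooth families. -/
theorem IsHom.hasDerivAt_bil (hφ : IsHom 2 φ) {Γ Γ' : ℝ × E → ℝ} (h : SHF Γ) (h' : SHF Γ') :
    HasDerivAt (fun t => bil φ (fun v => Γ (t, v)) (fun v => Γ' (t, v)))
      (bil φ (fun v => dt Γ (0, v)) (fun v => Γ' (0, v)) +
        bil φ (fun v => Γ (0, v)) (fun v => dt Γ' (0, v))) 0 := by
  obtain ⟨C, hC, hb⟩ := hφ.bil_bounded
  obtain ⟨K, hK⟩ := h.taylor
  obtain ⟨K', hK'⟩ := h'.taylor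
  have h1 : (1 : ℝ) ∈ Set.Icc (-1 : ℝ) 1 := by constructor <;> norm_num
  have hK0 : 0 ≤ K := by simpa using (hK 1 h1).nonneg
  have hK0' : 0 ≤ K' := by simpa using (hK' 1 h1).nonneg
  obtain ⟨R0, hR0⟩ := (h.slice 0).exists_DCB
  obtain ⟨R1, hR1⟩ := (h.dt.slice 0).exists_DCB
  obtain ⟨R0', hR0'⟩ := (h'.slice 0).exists_DCB
  obtain ⟨R1', hR1'⟩ := (h'.dt.slice 0).exists_DCB
  have n0 := hR0.nonneg
  have n1 := hR1.nonneg
  have n0' := hR0'.nonneg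
  have n1' := hR1'.nonneg
  set F := fun v => Γ (0, v)
  set F' := fun v => Γ' (0, v)
  set D := fun v => dt Γ (0, v)
  set D' := fun v => dt Γ' (0, v)
  have key : ∀ t ∈ Set.Icc (-1 : ℝ) 1,
      |bil φ (fun v => Γ (t, v)) (fun v => Γ' (t, v)) - bil φ F F' -
        t * (bil φ D F' + bil φ F D')| ≤
      (C * R1 * R1' + C * R0 * K' + C * R1 * K' + C * K * R0' + C * K * R1' + C * K * K') *
        t ^ 2 := by
    intro t ht
    set e := fun v => Γ (t, v) - Γ (0, v) - t * dt Γ (0, v) with he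
    set e' := fun v => Γ' (t, v) - Γ' (0, v) - t * dt Γ' (0, v) with he'
    have e1 : (fun v => Γ (t, v)) = F + t • D + e := by
      funext v; simp only [F, D, he, Pi.add_apply, Pi.smul_apply, smul_eq_mul]; ring
    have e2 : (fun v => Γ' (t, v)) = F' + t • D' + e' := by
      funext v; simp only [F', D', he', Pi.add_apply, Pi.smul_apply, smul_eq_mul]; ring
    have he := hK t ht
    have he' := hK' t ht
    have i1 := hR0.isDC
    have i2 := hR1.isDC
    have i3 := he.isDC
    have j1 := hR0'.isDC
    have j2 := hR1'.isDC
    have j3 := he'.isDC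
    rw [e1, e2, hφ.bil_add (i1.add (i2.smul t)) i3 ((j1.add (j2.smul t)).add j3),
      hφ.bil_add i1 (i2.smul t) ((j1.add (j2.smul t)).add j3),
      hφ.bil_smul i2 ((j1.add (j2.smul t)).add j3)]
    have ex : ∀ {G}, IsDC G → bil φ G (F' + t • D' + e') =
        bil φ G F' + t * bil φ G D' + bil φ G e' := fun hG => by
      rw [hφ.bil_add_right hG (j1.add (j2.smul t)) j3, hφ.bil_add_right hG j1 (j2.smul t),
        hφ.bil_smul_right hG j2]
    rw [ex i1, ex i2, ex i3]
    have a1 := hb hR1 hR1'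
    have a2 := hb hR0 he'
    have a3 := hb hR1 he'
    have a4 := hb he hR0'
    have a5 := hb he hR1'
    have a6 := hb he he'
    have ht1 : |t| ≤ 1 := abs_le.2 ht
    have ht2 : t ^ 2 ≤ 1 := by rw [← sq_abs]; exact pow_le_one₀ (abs_nonneg _) ht1
    have c1 : |t ^ 2 * bil φ D D'| ≤ C * R1 * R1' * t ^ 2 := by
      rw [abs_mul, abs_of_nonneg (sq_nonneg t)]; nlinarith [sq_nonneg t]
    have c3 : |t * bil φ D e'| ≤ C * R1 * K' * t ^ 2 := by
      rw [abs_mul]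
      calc _ ≤ 1 * |bil φ D e'| := by gcongr
        _ ≤ _ := by linarith
    have c5 : |t * bil φ e D'| ≤ C * K * R1' * t ^ 2 := by
      rw [abs_mul]
      calc _ ≤ 1 * |bil φ e D'| := by gcongr
        _ ≤ _ := by linarith
    have c6 : |bil φ e e'| ≤ C * K * K' * t ^ 2 := by
      refine a6.trans ?_
      calc _ = C * K * K' * t ^ 2 * t ^ 2 := by ring
        _ ≤ C * K * K' * t ^ 2 * 1 := by gcongr
        _ = _ := by ring
    rw [abs_le] at *
    constructor <;> nlinarith
  rw [hasDerivAt_iff_isLittleO]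
  set M := C * R1 * R1' + C * R0 * K' + C * R1 * K' + C * K * R0' + C * K * R1' + C * K * K'
  have hO : (fun t : ℝ => bil φ (fun v => Γ (t, v)) (fun v => Γ' (t, v)) - bil φ F F' -
        (t - 0) • (bil φ D F' + bil φ F D')) =O[nhds 0] fun t => t ^ 2 := by
    refine Asymptotics.IsBigO.of_bound M ?_
    filter_upwards [Icc_mem_nhds (show (-1 : ℝ) < 0 by norm_num) zero_lt_one] with t ht
    have := key t ht
    simpa using this
  refine hO.trans_isLittleO ?_
  simpa using Asymptotics.isLittleO_pow_id (𝕜 := ℝ) one_lt_two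

end Derivative

section Locality

open scoped ContDiff

/-- Positively homogeneous functions of degree zero which are smooth away from zero. -/
structure S0 {E : Type*} [NormedAddCommGroup E] [NormedSpace ℝ E] (χ : E → ℝ) : Prop where
  smooth : ContDiffOn ℝ ∞ χ {v | v ≠ 0}
  hom : ∀ v (t : ℝ), 0 < t → χ (t • v) = χ v

section Basic

variable {E : Type*} [NormedAddCommGroup E] [NormedSpace ℝ E]
variable {E' : Type*} [NormedAddCommGroup E'] [NormedSpace ℝ E']

theorem SH.map_zero {f : E → ℝ} (h : SH f) : f 0 = 0 := by simpa using h.hom 0 0 le_rfl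

theorem SH.mul {χ f : E → ℝ} (hf : SH f) (hχ : S0 χ) : SH (χ * f) := by
  refine ⟨hχ.smooth.mul hf.smooth, fun v t ht => ?_⟩
  rcases ht.eq_or_lt with rfl | ht
  · simp [hf.map_zero]
  · simp only [Pi.mul_apply, hχ.hom v t ht, hf.hom v t ht.le]; ring

theorem SH.add {f g : E → ℝ} (hf : SH f) (hg : SH g) : SH (f + g) :=
  ⟨hf.smooth.add hg.smooth, fun v t ht => by
    simp only [Pi.add_apply, hf.hom v t ht, hg.hom v t ht]; ring⟩

theorem SH.smul {f : E → ℝ} (hf : SH f) (c : ℝ) : SH (c • f) :=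
  ⟨hf.smooth.const_smul c, fun v t ht => by
    simp only [Pi.smul_apply, smul_eq_mul, hf.hom v t ht]; ring⟩

theorem SH.sub {f g : E → ℝ} (hf : SH f) (hg : SH g) : SH (f - g) := by
  have := hf.add (hg.smul (-1))
  rwa [neg_one_smul, ← sub_eq_add_neg] at this

theorem S0.mul {χ χ' : E → ℝ} (h : S0 χ) (h' : S0 χ') : S0 (χ * χ') :=
  ⟨h.smooth.mul h'.smooth, fun v t ht => by simp only [Pi.mul_apply, h.hom v t ht, h'.hom v t ht]⟩

theorem S0.one_sub {χ : E → ℝ} (h : S0 χ) : S0 (1 - χ) :=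
  ⟨contDiffOn_const.sub h.smooth, fun v t ht => by
    simp only [Pi.sub_apply, Pi.one_apply, h.hom v t ht]⟩

theorem SH.comp {f : E → ℝ} (hf : SH f) (e : E' ≃L[ℝ] E) : SH (f ∘ e) :=
  ⟨hf.smooth.comp e.contDiff.contDiffOn fun v hv => by simpa using hv, fun v t ht => by
    simp only [Function.comp_apply, map_smul, hf.hom _ _ ht]⟩

theorem S0.comp {f : E → ℝ} (hf : S0 f) (e : E' ≃L[ℝ] E) : S0 (f ∘ e) :=
  ⟨hf.smooth.comp e.contDiff.contDiffOn fun v hv => by simpa using hv, fun v t ht => by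
    simp only [Function.comp_apply, map_smul, hf.hom _ _ ht]⟩

theorem SHF.comp {P : Type*} [NormedAddCommGroup P] [NormedSpace ℝ P] {Γ : P × E → ℝ}
    (h : SHF Γ) (e : E' ≃L[ℝ] E) : SHF fun q : P × E' => Γ (q.1, e q.2) := by
  refine ⟨h.smooth.comp (t := {q : P × E | q.2 ≠ 0}) (f := fun q : P × E' => (q.1, e q.2)) ?_
    fun v hv => by simpa using hv, fun p v t ht => by
    simp only [map_smul, h.hom _ _ _ ht]⟩
  exact (contDiff_fst.prodMk (e.contDiff.comp contDiff_snd)).contDiffOn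

end Basic

variable {E : Type*} [NormedAddCommGroup E] [InnerProductSpace ℝ E]

theorem SH.norm : SH fun v : E => ‖v‖ :=
  ⟨fun v hv => (contDiffAt_norm ℝ hv).contDiffWithinAt, fun v t ht => by
    rw [norm_smul, Real.norm_of_nonneg ht]⟩

variable [FiniteDimensional ℝ E] {φ : ConvexBody E → ℝ}

theorem IsHom.bil_mul_eq_zero_of_nonneg (hφ : IsHom 2 φ) {A B : E → ℝ} (hA : SH A) (hB : SH B)
    (hA0 : ∀ v, 0 ≤ A v) (hB0 : ∀ v, 0 ≤ B v) (h : ∀ v, A v * B v = 0) : bil φ A B = 0 := by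
  obtain ⟨R, hR⟩ := hA.exists_DCB
  obtain ⟨R', hR'⟩ := hB.exists_DCB
  exact hφ.bil_eq_zero_of_mul_eq_zero (hR.mono (le_max_left R R')) (hR'.mono (le_max_right R R'))
    hA0 hB0 h

theorem IsHom.bil_local (hφ : IsHom 2 φ) {f g χ χ' : E → ℝ} (hf : SH f) (hg : SH g) (hχ : S0 χ)
    (hχ' : S0 χ') (h0 : ∀ v, 0 ≤ χ v) (h0' : ∀ v, 0 ≤ χ' v) (h : ∀ v ≠ 0, χ v * χ' v = 0) :
    bil φ (χ * f) (χ' * g) = 0 := by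
  have key : ∀ {f χ : E → ℝ}, SH f → S0 χ → (∀ v, 0 ≤ χ v) → ∃ A A' : E → ℝ, SH A ∧ SH A' ∧
      (∀ v, 0 ≤ A v) ∧ (∀ v, 0 ≤ A' v) ∧ χ * f = A - A' ∧ (∀ v, v = 0 ∨ χ v = 0 → A v = 0) ∧
      ∀ v, v = 0 ∨ χ v = 0 → A' v = 0 := by
    intro f χ hf hχ h0
    obtain ⟨R, hR⟩ := hf.exists_DCB
    have hn := (SH.norm (E := E)).smul R
    refine ⟨χ * (f + R • fun v => ‖v‖), χ * (R • fun v => ‖v‖), (hf.add hn).mul hχ, hn.mul hχ,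
      fun v => mul_nonneg (h0 v) ?_, fun v => mul_nonneg (h0 v) ?_, ?_, fun v hv => ?_,
      fun v hv => ?_⟩
    · have := (abs_le.1 (hR.bound v)).1
      simp only [Pi.add_apply, Pi.smul_apply, smul_eq_mul]; linarith
    · exact mul_nonneg hR.nonneg (norm_nonneg _)
    · rw [mul_add, add_sub_cancel_right]
    · rcases hv with rfl | hv
      · simp [hf.map_zero]
      · simp [hv]
    · rcases hv with rfl | hv
      · simp
      · simp [hv]
  obtain ⟨A, A', hA, hA', a0, a0', ea, az, az'⟩ := key hf hχ h0
  obtain ⟨B, B', hB, hB', b0, b0', eb, bz, bz'⟩ := key hg hχ' h0'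
  have hor : ∀ v : E, (v = 0 ∨ χ v = 0) ∨ (v = 0 ∨ χ' v = 0) := by
    intro v
    by_cases hv : v = 0
    · exact Or.inl (Or.inl hv)
    · rcases mul_eq_zero.1 (h v hv) with h | h
      · exact Or.inl (Or.inr h)
      · exact Or.inr (Or.inr h)
  have hz : ∀ {A B : E → ℝ}, (∀ v, v = 0 ∨ χ v = 0 → A v = 0) →
      (∀ v, v = 0 ∨ χ' v = 0 → B v = 0) → ∀ v, A v * B v = 0 := by
    intro A B ha hb v
    rcases hor v with h | h
    · rw [ha v h, zero_mul]
    · rw [hb v h, mul_zero]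
  rw [ea, eb, hφ.bil_sub hA.isDC hA'.isDC (hB.isDC.sub hB'.isDC),
    hφ.bil_sub_right hA.isDC hB.isDC hB'.isDC, hφ.bil_sub_right hA'.isDC hB.isDC hB'.isDC,
    hφ.bil_mul_eq_zero_of_nonneg hA hB a0 b0 (hz az bz),
    hφ.bil_mul_eq_zero_of_nonneg hA hB' a0 b0' (hz az bz'),
    hφ.bil_mul_eq_zero_of_nonneg hA' hB a0' b0 (hz az' bz),
    hφ.bil_mul_eq_zero_of_nonneg hA' hB' a0' b0' (hz az' bz')]
  ring

end Locality

section Chart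

open scoped ContDiff

local notation "X" => ℂ × ℂ

variable {P : Type*} [NormedAddCommGroup P] [NormedSpace ℝ P]

/-- Families of `1`-homogeneous functions on `ℂ × ℂ`, smooth where the first coordinate is nonzero,
which vanish in a conical neighbourhood of `0 × ℂ`. -/
structure CF (F : P × X → ℝ) : Prop where
  smooth : ContDiffOn ℝ ∞ F {q | q.2.1 ≠ 0}
  hom : ∀ p v (t : ℝ), 0 ≤ t → F (p, t • v) = t * F (p, v)
  van : ∃ κ > 0, ∀ p v, ‖v.1‖ ≤ κ * ‖v.2‖ → F (p, v) = 0

/-- The version of `CF` without parameters. -/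
structure CC (f : X → ℝ) : Prop where
  smooth : ContDiffOn ℝ ∞ f {v | v.1 ≠ 0}
  hom : ∀ v (t : ℝ), 0 ≤ t → f (t • v) = t * f v
  van : ∃ κ > 0, ∀ v, ‖v.1‖ ≤ κ * ‖v.2‖ → f v = 0

theorem contDiffOn_of_chart {F : P × X → ℝ} {κ c : ℝ} (hκ : 0 < κ)
    (h : ContDiffOn ℝ ∞ F {q | q.2.1 ≠ 0})
    (hc : ∀ q, q.2 ≠ 0 → ‖q.2.1‖ ≤ κ * ‖q.2.2‖ → F q = c) :
    ContDiffOn ℝ ∞ F {q | q.2 ≠ 0} := by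
  intro q hq
  by_cases h1 : q.2.1 = 0
  · have h2 : q.2.2 ≠ 0 := fun h2 => hq (Prod.ext h1 h2)
    have ho : IsOpen {q : P × X | ‖q.2.1‖ < κ * ‖q.2.2‖} :=
      isOpen_lt (by fun_prop) (by fun_prop)
    have hm : {q : P × X | ‖q.2.1‖ < κ * ‖q.2.2‖} ∈ nhds q := by
      refine ho.mem_nhds ?_
      simp only [Set.mem_ofPred_eq, h1, norm_zero]
      have := norm_pos_iff.2 h2
      positivity
    have he : F =ᶠ[nhds q] fun _ => c := by
      filter_upwards [hm] with y hy
      refine hc y (fun h0 => ?_) (le_of_lt hy)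
      have hy' : ‖y.2.1‖ < κ * ‖y.2.2‖ := hy
      simp [h0] at hy'
    exact (contDiffAt_const.congr_of_eventuallyEq he).contDiffWithinAt
  · have ho : IsOpen {q : P × X | q.2.1 ≠ 0} := isOpen_ne.preimage (by fun_prop)
    exact (h.contDiffAt (ho.mem_nhds h1)).contDiffWithinAt

theorem CF.toSHF {F : P × X → ℝ} (h : CF F) : SHF F := by
  obtain ⟨κ, hκ, hv⟩ := h.van
  exact ⟨contDiffOn_of_chart hκ h.smooth fun q _ hq => hv q.1 q.2 hq, h.hom⟩

theorem CC.toCF {f : X → ℝ} (h : CC f) : CF fun q : P × X => f q.2 := by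
  obtain ⟨κ, hκ, hv⟩ := h.van
  exact ⟨h.smooth.comp contDiff_snd.contDiffOn fun q hq => hq, fun p v t ht => h.hom v t ht,
    κ, hκ, fun p v h => hv v h⟩

theorem CF.slice {F : P × X → ℝ} (h : CF F) (p : P) : CC fun v => F (p, v) := by
  obtain ⟨κ, hκ, hv⟩ := h.van
  refine ⟨h.smooth.comp (f := fun v : X => (p, v)) (contDiff_const.prodMk contDiff_id).contDiffOn
    fun q hq => hq, h.hom p, κ, hκ, fun v h => hv p v h⟩

theorem CC.toSH {f : X → ℝ} (h : CC f) : SH f :=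
  ⟨(h.toCF (P := ℝ)).toSHF.smooth.comp (f := fun v : X => ((0 : ℝ), v))
    (contDiff_const.prodMk contDiff_id).contDiffOn fun _ hv => hv, h.hom⟩

theorem CC.add {f g : X → ℝ} (hf : CC f) (hg : CC g) : CC (f + g) := by
  obtain ⟨κ, hκ, hv⟩ := hf.van
  obtain ⟨κ', hκ', hv'⟩ := hg.van
  refine ⟨hf.smooth.add hg.smooth, fun v t ht => ?_, min κ κ', lt_min hκ hκ', fun v h => ?_⟩
  · simp only [Pi.add_apply, hf.hom v t ht, hg.hom v t ht]; ring
  · rw [Pi.add_apply, hv v (h.trans (by gcongr; exact min_le_left _ _)),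
      hv' v (h.trans (by gcongr; exact min_le_right _ _)), add_zero]

theorem CC.smul {f : X → ℝ} (hf : CC f) (c : ℝ) : CC (c • f) := by
  obtain ⟨κ, hκ, hv⟩ := hf.van
  refine ⟨hf.smooth.const_smul c, fun v t ht => ?_, κ, hκ, fun v h => ?_⟩
  · simp only [Pi.smul_apply, smul_eq_mul, hf.hom v t ht]; ring
  · simp [hv v h]

theorem CC.zero : CC (0 : X → ℝ) :=
  ⟨contDiffOn_const, fun v t _ => by simp, 1, one_pos, fun v _ => rfl⟩

theorem CC.sum {ι : Type*} (s : Finset ι) {f : ι → X → ℝ} (h : ∀ i ∈ s, CC (f i)) :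
    CC (∑ i ∈ s, f i) :=
  Finset.sum_induction f CC (fun _ _ => CC.add) CC.zero h

/-- The affine coordinate `η / ξ`. -/
def rho (v : X) : ℂ := v.2 / v.1

theorem rho_smul (v : X) {t : ℝ} (ht : 0 < t) : rho (t • v) = rho v := by
  simp only [rho, Prod.smul_fst, Prod.smul_snd, Complex.real_smul]
  have : (t : ℂ) ≠ 0 := by exact_mod_cast ht.ne'
  rw [mul_div_mul_left _ _ this]

theorem contDiffOn_rho : ContDiffOn ℝ ∞ rho {v : X | v.1 ≠ 0} := by
  have h : ContDiffOn ℝ ∞ (fun v : X => v.2 * v.1⁻¹) {v : X | v.1 ≠ 0} :=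
    contDiff_snd.contDiffOn.mul (contDiff_fst.contDiffOn.inv fun _ h => h)
  exact h.congr fun v _ => div_eq_mul_inv _ _

/-- Multiplication by a function of the affine coordinate. -/
def mulRho (u : ℂ → ℝ) (f : X → ℝ) (v : X) : ℝ := u (rho v) * f v

theorem CF.mulR {F : P × X → ℝ} (h : CF F) {u : ℂ → ℝ} (hu : ContDiff ℝ ∞ u) :
    CF fun q : P × X => mulRho u (fun v => F (q.1, v)) q.2 := by
  obtain ⟨κ, hκ, hv⟩ := h.van
  refine ⟨?_, fun p v t ht => ?_, κ, hκ, fun p v hh => ?_⟩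
  · refine ContDiffOn.mul (hu.comp_contDiffOn (contDiffOn_rho.comp contDiff_snd.contDiffOn
      fun q hq => hq)) h.smooth
  · rcases ht.eq_or_lt with rfl | ht
    · have := h.hom p 0 0 le_rfl
      simp only [zero_smul, zero_mul] at this
      simp [mulRho, this]
    · simp only [mulRho, rho_smul v ht, h.hom p v t ht.le]; ring
  · simp [mulRho, hv p v hh]

theorem CC.mulR {f : X → ℝ} (h : CC f) {u : ℂ → ℝ} (hu : ContDiff ℝ ∞ u) :
    CC (mulRho u f) := ((h.toCF (P := ℝ)).mulR hu).slice (0 : ℝ)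

/-- The linear change of coordinates `(ξ, η) ↦ (ξ, cξ + εη)`. -/
def shearT (c : ℂ) (ε : ℝ) (v : X) : X := (v.1, c * v.1 + ε * v.2)

theorem shearT_smul (c : ℂ) (ε t : ℝ) (v : X) : shearT c ε (t • v) = t • shearT c ε v := by
  ext <;> simp [shearT] ; ring

theorem rho_shearT (c : ℂ) (ε : ℝ) {v : X} (hv : v.1 ≠ 0) :
    rho (shearT c ε v) = c + ε * rho v := by
  simp only [rho, shearT]; field_simp

theorem CC.comp_shearT_mulRho {f : X → ℝ} (h : CC f) {u : ℂ → ℝ} (hu : ContDiff ℝ ∞ u) {r : ℝ}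
    (hr : 0 < r) (hur : ∀ z, r ≤ ‖z‖ → u z = 0) :
    CF fun q : (ℂ × ℝ) × X => mulRho u (f ∘ shearT q.1.1 q.1.2) q.2 := by
  have hf0 : ∀ v : X, v.1 = 0 → f v = 0 := by
    obtain ⟨κ, hκ, hv⟩ := h.van
    exact fun v h0 => hv v (by rw [h0, norm_zero]; positivity)
  refine ⟨?_, fun p v t ht => ?_, r⁻¹, inv_pos.2 hr, fun p v hh => ?_⟩
  · refine ContDiffOn.mul (hu.comp_contDiffOn (contDiffOn_rho.comp contDiff_snd.contDiffOn
      fun q hq => hq)) (h.smooth.comp (f := fun q : (ℂ × ℝ) × X => shearT q.1.1 q.1.2 q.2) ?_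
        fun q hq => hq)
    refine ContDiff.contDiffOn ?_
    unfold shearT
    have : ContDiff ℝ ∞ fun q : (ℂ × ℝ) × X => ((q.1.2 : ℝ) : ℂ) :=
      Complex.ofRealCLM.contDiff.comp (contDiff_snd.comp contDiff_fst)
    fun_prop
  · rcases ht.eq_or_lt with rfl | ht
    · simp [mulRho, hf0, shearT]
    · simp only [mulRho, rho_smul v ht, Function.comp_apply, shearT_smul, h.hom _ t ht.le]
      ring
  · simp only [mulRho, Function.comp_apply]
    by_cases h1 : v.1 = 0
    · rw [hf0 (shearT p.1 p.2 v) h1, mul_zero]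
    · rw [hur, zero_mul]
      rw [rho, norm_div, le_div_iff₀ (norm_pos_iff.2 h1)]
      calc r * ‖v.1‖ ≤ r * (r⁻¹ * ‖v.2‖) := by gcongr
        _ = ‖v.2‖ := by field_simp

theorem CC.comp_shearT {f : X → ℝ} (h : CC f) (c : ℂ) {ε : ℝ} (hε : 0 < ε) :
    CC (f ∘ shearT c ε) := by
  obtain ⟨κ, hκ, hv⟩ := h.van
  refine ⟨h.smooth.comp (ContDiff.contDiffOn (by unfold shearT; fun_prop)) fun q hq => hq,
    fun v t ht => ?_, κ * ε / (1 + κ * ‖c‖), by positivity, fun v hh => ?_⟩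
  · simp only [Function.comp_apply, shearT_smul, h.hom _ t ht]
  · refine hv _ ?_
    simp only [shearT]
    rw [div_mul_eq_mul_div, le_div_iff₀ (by positivity)] at hh
    have h1 : ‖(ε : ℂ) * v.2‖ ≤ ‖c * v.1 + ε * v.2‖ + ‖c * v.1‖ := by
      have := norm_sub_le (c * v.1 + ε * v.2) (c * v.1)
      rwa [add_sub_cancel_left] at this
    rw [norm_mul, norm_mul, Complex.norm_real, Real.norm_of_nonneg hε.le] at h1
    nlinarith

end Chart

section GoodForms

open scoped ContDiff

local notation "X" => ℂ × ℂ

theorem CC.eq_zero_of_fst {f : X → ℝ} (h : CC f) {v : X} (hv : v.1 = 0) : f v = 0 := by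
  obtain ⟨κ, hκ, h⟩ := h.van
  exact h v (by rw [hv, norm_zero]; positivity)

/-- The derivative of `f` in direction of the linear vector field `(0, a v)`. -/
def LD (a : X →L[ℝ] ℂ) (f : X → ℝ) (v : X) : ℝ := fderiv ℝ f v (0, a v)

theorem isOpen_fst_ne : IsOpen {v : X | v.1 ≠ 0} := isOpen_ne.preimage continuous_fst

theorem CC.LD_eq_zero {f : X → ℝ} {κ : ℝ} (hκ : 0 < κ)
    (hf : ∀ v : X, ‖v.1‖ ≤ κ * ‖v.2‖ → f v = 0) (a : X →L[ℝ] ℂ) {v : X}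
    (hv : ‖v.1‖ ≤ κ / 2 * ‖v.2‖) : LD a f v = 0 := by
  rw [LD]
  by_cases h0 : v = 0
  · have : ((0 : ℂ), a v) = 0 := by simp [h0]
    rw [this, map_zero]
  have h2 : 0 < ‖v.2‖ := by
    refine norm_pos_iff.2 fun h2 => h0 (Prod.ext ?_ h2)
    rw [h2, norm_zero, mul_zero] at hv
    exact norm_le_zero_iff.1 hv
  have ho : IsOpen {v : X | ‖v.1‖ < κ * ‖v.2‖} := isOpen_lt (by fun_prop) (by fun_prop)
  have hm : {v : X | ‖v.1‖ < κ * ‖v.2‖} ∈ nhds v := ho.mem_nhds (by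
    rw [Set.mem_ofPred_eq]; nlinarith)
  have he : f =ᶠ[nhds v] fun _ => 0 := by
    filter_upwards [hm] with y hy
    exact hf y (le_of_lt hy)
  rw [he.fderiv_eq]; simp

theorem CC.ld {f : X → ℝ} (h : CC f) (a : X →L[ℝ] ℂ) : CC (LD a f) := by
  obtain ⟨κ, hκ, hv⟩ := h.van
  refine ⟨?_, fun v t ht => ?_, κ / 2, by positivity, fun v hv' => CC.LD_eq_zero hκ hv a hv'⟩
  · have h1 : ContDiffOn ℝ ∞ (fderiv ℝ f) {v : X | v.1 ≠ 0} :=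
      h.smooth.fderiv_of_isOpen isOpen_fst_ne (by simp)
    exact h1.clm_apply (contDiff_const.prodMk a.contDiff).contDiffOn
  · rcases ht.eq_or_lt with rfl | ht
    · simp [LD, ← Prod.zero_eq_mk]
    · have hf : f = fun v => t⁻¹ * f (t • v) := by
        funext v; rw [h.hom v t ht.le]; field_simp
      have key : fderiv ℝ f (t • v) = fderiv ℝ f v := by
        have e : (fun v => f (t • v)) = fun v => t • f v := by
          funext w; rw [h.hom w t ht.le, smul_eq_mul]
        have h1 : fderiv ℝ (fun v => f (t • v)) v = t • fderiv ℝ f (t • v) := by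
          rw [fderiv_comp_smul]
        have h2 : fderiv ℝ (fun v => t • f v) v = t • fderiv ℝ f v :=
          congrFun (fderiv_const_smul_field (f := f) t) v
        rw [e, h2] at h1
        exact (smul_right_injective _ ht.ne' h1).symm
      rw [LD, LD, key, map_smul, ← smul_eq_mul, ← map_smul (fderiv ℝ f v), Prod.smul_mk, smul_zero]

theorem CC.hasDerivAt_line {f : X → ℝ} (h : CC f) {v : X} (hv : v.1 ≠ 0) (w : ℂ) :
    HasDerivAt (fun t : ℝ => f (v.1, v.2 + t * w)) (fderiv ℝ f v (0, w)) 0 := by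
  have h1 : DifferentiableAt ℝ f v :=
    (h.smooth.contDiffAt (isOpen_fst_ne.mem_nhds hv)).differentiableAt (by simp)
  have h2 : HasDerivAt (fun t : ℝ => ((v.1, v.2 + t * w) : X)) (0, w) 0 := by
    have h3 : HasDerivAt (fun t : ℝ => (t : ℂ) * w) (1 * w) 0 :=
      (Complex.ofRealCLM.hasDerivAt (x := (0 : ℝ))).mul_const w
    rw [one_mul] at h3
    exact (hasDerivAt_const _ _).prodMk (h3.const_add v.2)
  have h3 : HasFDerivAt f (fderiv ℝ f v) ((fun t : ℝ => ((v.1, v.2 + t * w) : X)) 0) := by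
    simpa using h1.hasFDerivAt
  exact h3.comp_hasDerivAt 0 h2

theorem CC.LD_mulRho {f : X → ℝ} (h : CC f) (a : X →L[ℝ] ℂ) (u : ℂ →L[ℝ] ℝ) (v : X) :
    LD a (mulRho u f) v = u (a v / v.1) * f v + mulRho u (LD a f) v := by
  have hm : CC (mulRho u f) := h.mulR u.contDiff
  by_cases hv : v.1 = 0
  · rw [(hm.ld a).eq_zero_of_fst hv, h.eq_zero_of_fst hv, mulRho,
      (h.ld a).eq_zero_of_fst hv]
    ring
  · have h1 := hm.hasDerivAt_line hv (a v)
    have h2 := h.hasDerivAt_line hv (a v)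
    have h3 : HasDerivAt (fun t : ℝ => u (rho v) + t * u (a v / v.1)) (u (a v / v.1)) 0 := by
      simpa using ((hasDerivAt_id (0 : ℝ)).mul_const (u (a v / v.1))).const_add (u (rho v))
    have h4 := h3.mul h2
    have e : (fun t : ℝ => mulRho u f (v.1, v.2 + t * a v)) =
        fun t : ℝ => (u (rho v) + t * u (a v / v.1)) * f (v.1, v.2 + t * a v) := by
      funext t
      rw [mulRho]
      congr 1
      rw [← smul_eq_mul t, ← map_smul, ← map_add]
      congr 1
      simp only [rho, Complex.real_smul]
      field_simp
    rw [e] at h1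
    have := h1.unique h4
    simpa [LD, mulRho] using this

/-- The linear vector field generating the shears. -/
def shearV (c : ℂ) : X →L[ℝ] ℂ := c • ContinuousLinearMap.fst ℝ ℂ ℂ

/-- The Euler vector field in the second coordinate. -/
def eulerV : X →L[ℝ] ℂ := ContinuousLinearMap.snd ℝ ℂ ℂ

theorem CC.LD_shearV_mulRho {f : X → ℝ} (h : CC f) (c : ℂ) (u : ℂ →L[ℝ] ℝ) :
    LD (shearV c) (mulRho u f) = u c • f + mulRho u (LD (shearV c) f) := by
  funext v
  rw [h.LD_mulRho, Pi.add_apply, Pi.smul_apply, smul_eq_mul]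
  by_cases hv : v.1 = 0
  · rw [h.eq_zero_of_fst hv]; ring
  · congr 3; simp [shearV, hv]

theorem CC.LD_eulerV_mulRho {f : X → ℝ} (h : CC f) (u : ℂ →L[ℝ] ℝ) :
    LD eulerV (mulRho u f) = mulRho u f + mulRho u (LD eulerV f) := by
  funext v
  rw [h.LD_mulRho]; rfl

theorem CC.LD_eulerV {f : X → ℝ} (h : CC f) :
    LD eulerV f = mulRho Complex.reCLM (LD (shearV 1) f) +
      mulRho Complex.imCLM (LD (shearV Complex.I) f) := by
  funext v
  by_cases hv : v.1 = 0
  · simp only [(h.ld eulerV).eq_zero_of_fst hv, Pi.add_apply, mulRho,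
      (h.ld (shearV _)).eq_zero_of_fst hv]; ring
  · simp only [LD, Pi.add_apply, mulRho, ← smul_eq_mul, ← map_smul, ← map_add]
    congr 1
    ext1
    · simp
    · simp only [eulerV, shearV, Prod.snd_add, Prod.smul_snd, Complex.real_smul,
        ContinuousLinearMap.coe_snd', smul_apply, ContinuousLinearMap.coe_fst',
        smul_eq_mul, Complex.reCLM_apply, Complex.imCLM_apply]
      rw [one_mul, ← mul_assoc, ← add_mul, Complex.re_add_im, rho]
      field_simp

/-- Bilinear forms of weight `s` on the chart class. -/
structure Good (s : ℝ) (B : (X → ℝ) → (X → ℝ) → ℝ) : Prop where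
  add_left : ∀ f f' g, CC f → CC f' → CC g → B (f + f') g = B f g + B f' g
  smul_left : ∀ (c : ℝ) f g, CC f → CC g → B (c • f) g = c * B f g
  add_right : ∀ f g g', CC f → CC g → CC g' → B f (g + g') = B f g + B f g'
  smul_right : ∀ (c : ℝ) f g, CC f → CC g → B f (c • g) = c * B f g
  scale : ∀ f g, CC f → CC g → ∀ (c : ℂ) (ε : ℝ), 0 < ε →
    B (f ∘ shearT c ε) (g ∘ shearT c ε) = ε ^ s * B f g
  shear : ∀ f g, CC f → CC g → ∀ c : ℂ, B (LD (shearV c) f) g + B f (LD (shearV c) g) = 0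
  euler : ∀ f g, CC f → CC g → B (LD eulerV f) g + B f (LD eulerV g) = s * B f g
  loc : ∀ f g, CC f → CC g → ∀ u u' : ℂ → ℝ, ContDiff ℝ ∞ u → ContDiff ℝ ∞ u' →
    (∀ z, 0 ≤ u z) → (∀ z, 0 ≤ u' z) → (∀ z, u z * u' z = 0) → B (mulRho u f) (mulRho u' g) = 0
  bdd : ∀ F G : (ℂ × ℝ) × X → ℝ, CF F → CF G → ∀ Q : Set (ℂ × ℝ), IsCompact Q →
    ∃ C, ∀ p ∈ Q, |B (fun v => F (p, v)) fun v => G (p, v)| ≤ C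

/-- The commutator of a bilinear form with multiplication by `u`. -/
def commR (u : ℂ →L[ℝ] ℝ) (B : (X → ℝ) → (X → ℝ) → ℝ) (f g : X → ℝ) : ℝ :=
  B (mulRho u f) g - B f (mulRho u g)

theorem mulRho_add (u : ℂ → ℝ) (f g : X → ℝ) : mulRho u (f + g) = mulRho u f + mulRho u g := by
  funext v; simp only [mulRho, Pi.add_apply]; ring

theorem mulRho_smul (u : ℂ → ℝ) (c : ℝ) (f : X → ℝ) : mulRho u (c • f) = c • mulRho u f := by
  funext v; simp only [mulRho, Pi.smul_apply, smul_eq_mul]; ring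

theorem mulRho_comm (u u' : ℂ → ℝ) (f : X → ℝ) :
    mulRho u (mulRho u' f) = mulRho u' (mulRho u f) := by
  funext v; simp only [mulRho]; ring

theorem CC.mulRho_comp_shearT {f : X → ℝ} (h : CC f) (u : ℂ →L[ℝ] ℝ) (c : ℂ) {ε : ℝ}
    (hε : 0 < ε) : mulRho u (f ∘ shearT c ε) =
      ε⁻¹ • ((mulRho u f) ∘ shearT c ε + (- u c) • (f ∘ shearT c ε)) := by
  funext v
  simp only [mulRho, Function.comp_apply, Pi.add_apply, Pi.smul_apply, smul_eq_mul]
  by_cases hv : v.1 = 0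
  · rw [h.eq_zero_of_fst (v := shearT c ε v) hv]; ring
  · rw [rho_shearT c ε hv, map_add, ← Complex.real_smul, map_smul, smul_eq_mul]
    field_simp
    ring

theorem Good.commR {s : ℝ} {B : (X → ℝ) → (X → ℝ) → ℝ} (h : Good s B) (u : ℂ →L[ℝ] ℝ) :
    Good (s - 1) (_root_.commR u B) := by
  have hm : ∀ {f}, CC f → CC (mulRho u f) := fun hf => hf.mulR u.contDiff
  refine ⟨?_, ?_, ?_, ?_, ?_, ?_, ?_, ?_, ?_⟩
  · intro f f' g hf hf' hg
    simp only [_root_.commR, mulRho_add]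
    rw [h.add_left _ _ _ (hm hf) (hm hf') hg, h.add_left _ _ _ hf hf' (hm hg)]; ring
  · intro c f g hf hg
    simp only [_root_.commR, mulRho_smul]
    rw [h.smul_left _ _ _ (hm hf) hg, h.smul_left _ _ _ hf (hm hg)]; ring
  · intro f g g' hf hg hg'
    simp only [_root_.commR, mulRho_add]
    rw [h.add_right _ _ _ (hm hf) hg hg', h.add_right _ _ _ hf (hm hg) (hm hg')]; ring
  · intro c f g hf hg
    simp only [_root_.commR, mulRho_smul]
    rw [h.smul_right _ _ _ (hm hf) hg, h.smul_right _ _ _ hf (hm hg)]; ring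
  · intro f g hf hg c ε hε
    have tf := hf.comp_shearT c hε
    have tg := hg.comp_shearT c hε
    have tf' := (hm hf).comp_shearT c hε
    have tg' := (hm hg).comp_shearT c hε
    simp only [_root_.commR]
    rw [hf.mulRho_comp_shearT u c hε, hg.mulRho_comp_shearT u c hε,
      h.smul_left _ _ _ (tf'.add (tf.smul _)) tg, h.smul_right _ _ _ tf (tg'.add (tg.smul _)),
      h.add_left _ _ _ tf' (tf.smul _) tg, h.add_right _ _ _ tf tg' (tg.smul _),
      h.smul_left _ _ _ tf tg, h.smul_right _ _ _ tf tg, h.scale _ _ (hm hf) hg c ε hε,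
      h.scale _ _ hf (hm hg) c ε hε, Real.rpow_sub_one hε.ne']
    field_simp
    ring
  · intro f g hf hg c
    have h1 := h.shear _ _ (hm hf) hg c
    have h2 := h.shear _ _ hf (hm hg) c
    rw [hf.LD_shearV_mulRho, h.add_left _ _ _ (hf.smul _) (hm (hf.ld _)) hg,
      h.smul_left _ _ _ hf hg] at h1
    rw [hg.LD_shearV_mulRho, h.add_right _ _ _ hf (hg.smul _) (hm (hg.ld _)),
      h.smul_right _ _ _ hf hg] at h2
    simp only [_root_.commR]
    linarith
  · intro f g hf hg
    have h1 := h.euler _ _ (hm hf) hg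
    have h2 := h.euler _ _ hf (hm hg)
    rw [hf.LD_eulerV_mulRho, h.add_left _ _ _ (hm hf) (hm (hf.ld _)) hg] at h1
    rw [hg.LD_eulerV_mulRho, h.add_right _ _ _ hf (hm hg) (hm (hg.ld _))] at h2
    simp only [_root_.commR]
    linarith
  · intro f g hf hg w w' hw hw' h0 h0' h00
    simp only [_root_.commR]
    rw [mulRho_comm u w, mulRho_comm u w', h.loc _ _ (hm hf) hg w w' hw hw' h0 h0' h00,
      h.loc _ _ hf (hm hg) w w' hw hw' h0 h0' h00, sub_zero]
  · intro F G hF hG Q hQ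
    obtain ⟨C, hC⟩ := h.bdd _ _ (hF.mulR u.contDiff) hG Q hQ
    obtain ⟨C', hC'⟩ := h.bdd _ _ hF (hG.mulR u.contDiff) Q hQ
    refine ⟨C + C', fun p hp => ?_⟩
    exact (abs_sub _ _).trans (add_le_add (hC p hp) (hC' p hp))

theorem Good.eq_zero_of_comm {s : ℝ} {B : (X → ℝ) → (X → ℝ) → ℝ} (h : Good s B) (hs : s + 2 ≠ 0)
    (h0 : ∀ u : ℂ →L[ℝ] ℝ, ∀ f g, CC f → CC g → _root_.commR u B f g = 0) {f g : X → ℝ}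
    (hf : CC f) (hg : CC g) : B f g = 0 := by
  have hm : ∀ (u : ℂ →L[ℝ] ℝ) {f}, CC f → CC (mulRho u f) := fun u _ hf => hf.mulR u.contDiff
  have key : ∀ (u : ℂ →L[ℝ] ℝ) (c : ℂ), B (mulRho u (LD (shearV c) f)) g =
      - u c * B f g - B f (mulRho u (LD (shearV c) g)) := by
    intro u c
    have h1 := h0 u _ _ (hf.ld (shearV c)) hg
    have h2 := h.shear _ _ hf (hm u hg) c
    rw [hg.LD_shearV_mulRho, h.add_right _ _ _ hf (hg.smul _) (hm u (hg.ld _)),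
      h.smul_right _ _ _ hf hg] at h2
    rw [_root_.commR] at h1
    linarith
  have h1 := h.euler _ _ hf hg
  rw [hf.LD_eulerV, hg.LD_eulerV, h.add_left _ _ _ (hm _ (hf.ld _)) (hm _ (hf.ld _)) hg,
    h.add_right _ _ _ hf (hm _ (hg.ld _)) (hm _ (hg.ld _)), key, key] at h1
  simp only [Complex.reCLM_apply, Complex.imCLM_apply, Complex.one_re, Complex.I_im] at h1
  have : (s + 2) * B f g = 0 := by linarith
  exact (mul_eq_zero.1 this).resolve_left hs

end GoodForms

section GoodVanish

open scoped ContDiff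
open Real (smoothTransition)

local notation "X" => ℂ × ℂ

/-- A smooth bump on the line which equals one on `[-b, b]`. The integer translates of `bump₁ 0`
sum to one. -/
def bump₁ (b x : ℝ) : ℝ := smoothTransition (x + b + 1) - smoothTransition (x - b)

section

variable {b : ℝ}

theorem bump₁_nonneg (hb : 0 ≤ b) (x : ℝ) : 0 ≤ bump₁ b x :=
  sub_nonneg.2 (Real.smoothTransition.monotone (by linarith))

theorem bump₁_le_one (x : ℝ) : bump₁ b x ≤ 1 :=
  (sub_le_self _ (Real.smoothTransition.nonneg _)).trans (Real.smoothTransition.le_one _)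

theorem bump₁_eq_zero (hb : 0 ≤ b) {x : ℝ} (h : b + 1 ≤ |x|) : bump₁ b x = 0 := by
  rcases le_abs.1 h with h | h
  · rw [bump₁, Real.smoothTransition.one_of_one_le (by linarith),
      Real.smoothTransition.one_of_one_le (by linarith), sub_self]
  · rw [bump₁, Real.smoothTransition.zero_of_nonpos (by linarith),
      Real.smoothTransition.zero_of_nonpos (by linarith), sub_self]

theorem bump₁_eq_one {x : ℝ} (h : |x| ≤ b) : bump₁ b x = 1 := by
  have := abs_le.1 h
  rw [bump₁, Real.smoothTransition.one_of_one_le (by linarith),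
    Real.smoothTransition.zero_of_nonpos (by linarith), sub_zero]

theorem contDiff_bump₁ : ContDiff ℝ ∞ (bump₁ b) :=
  (Real.smoothTransition.contDiff.comp (by fun_prop : ContDiff ℝ ∞ fun x : ℝ => x + b + 1)).sub
    (Real.smoothTransition.contDiff.comp (contDiff_id.sub contDiff_const))

theorem sum_bump₁ {N : ℕ} {y : ℝ} (hy : |y| ≤ N) :
    ∑ i ∈ Finset.range (2 * N + 1), bump₁ 0 (y - ((i : ℝ) - N)) = 1 := by
  have h := Finset.sum_range_sub' (fun i : ℕ => smoothTransition (y + N + 1 - i)) (2 * N + 1)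
  have h2 := abs_le.1 hy
  rw [Real.smoothTransition.one_of_one_le (by push_cast; linarith),
    Real.smoothTransition.zero_of_nonpos (by push_cast; linarith), sub_zero] at h
  rw [← h]
  refine Finset.sum_congr rfl fun i _ => ?_
  rw [bump₁]; congr 2 <;> push_cast <;> ring

/-- A smooth bump on `ℂ`. The translates of `bump₂ 0` under Gaussian integers sum to one. -/
def bump₂ (b : ℝ) (z : ℂ) : ℝ := bump₁ b z.re * bump₁ b z.im

theorem contDiff_bump₂ : ContDiff ℝ ∞ (bump₂ b) :=
  (contDiff_bump₁.comp Complex.reCLM.contDiff).mul (contDiff_bump₁.comp Complex.imCLM.contDiff)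

theorem bump₂_eq_zero (hb : 0 ≤ b) {z : ℂ} (h : 2 * (b + 1) ≤ ‖z‖) : bump₂ b z = 0 := by
  have h1 := Complex.norm_le_abs_re_add_abs_im z
  rcases le_total (b + 1) |z.re| with h2 | h2
  · rw [bump₂, bump₁_eq_zero hb h2, zero_mul]
  · rw [bump₂, bump₁_eq_zero hb (x := z.im) (by linarith), mul_zero]

theorem bump₂_mul_one_sub (z : ℂ) : bump₂ 0 z * (1 - bump₂ 1 z) = 0 := by
  rcases le_total 1 |z.re| with h | h
  · simp [bump₂, bump₁_eq_zero le_rfl (by simpa using h)]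
  rcases le_total 1 |z.im| with h' | h'
  · simp [bump₂, bump₁_eq_zero le_rfl (by simpa using h')]
  · simp [bump₂, bump₁_eq_one h, bump₁_eq_one h']

theorem bump₂_nonneg (hb : 0 ≤ b) (z : ℂ) : 0 ≤ bump₂ b z :=
  mul_nonneg (bump₁_nonneg hb _) (bump₁_nonneg hb _)

theorem bump₂_le_one (hb : 0 ≤ b) (z : ℂ) : bump₂ b z ≤ 1 :=
  mul_le_one₀ (bump₁_le_one _) (bump₁_nonneg hb _) (bump₁_le_one _)

end

/-- The grid point with index `p`, centred at `N`. -/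
def gridPt (N : ℕ) (p : ℕ × ℕ) : ℂ := ⟨(p.1 : ℝ) - N, (p.2 : ℝ) - N⟩

/-- The indices of a square grid. -/
def gridIdx (N : ℕ) : Finset (ℕ × ℕ) :=
  Finset.range (2 * N + 1) ×ˢ Finset.range (2 * N + 1)

theorem card_gridIdx (N : ℕ) : (gridIdx N).card = (2 * N + 1) ^ 2 := by
  simp [gridIdx, sq]

theorem norm_gridPt_le {N : ℕ} {p : ℕ × ℕ} (hp : p ∈ gridIdx N) : ‖gridPt N p‖ ≤ 2 * N := by
  simp only [gridIdx, Finset.mem_product, Finset.mem_range] at hp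
  have h1 : (p.1 : ℝ) ≤ 2 * N := by exact_mod_cast Nat.lt_succ_iff.1 hp.1
  have h2 : (p.2 : ℝ) ≤ 2 * N := by exact_mod_cast Nat.lt_succ_iff.1 hp.2
  have h3 := Complex.norm_le_abs_re_add_abs_im (gridPt N p)
  have h4 : |(gridPt N p).re| ≤ N := abs_le.2 ⟨by simp [gridPt], by simp [gridPt]; linarith⟩
  have h5 : |(gridPt N p).im| ≤ N := abs_le.2 ⟨by simp [gridPt], by simp [gridPt]; linarith⟩
  linarith

theorem sum_bump₂ {N : ℕ} {z : ℂ} (hz : ‖z‖ ≤ N) :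
    ∑ p ∈ gridIdx N, bump₂ 0 (z - gridPt N p) = 1 := by
  rw [gridIdx, Finset.sum_product]
  simp only [bump₂, gridPt, Complex.sub_re, Complex.sub_im]
  simp_rw [← Finset.mul_sum]
  rw [← Finset.sum_mul, sum_bump₁ ((Complex.abs_re_le_norm z).trans hz),
    sum_bump₁ ((Complex.abs_im_le_norm z).trans hz), one_mul]

theorem CC.norm_rho_le {f : X → ℝ} (hf : CC f) :
    ∃ r : ℝ, 0 ≤ r ∧ ∀ v, f v ≠ 0 → v.1 ≠ 0 ∧ ‖rho v‖ ≤ r := by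
  obtain ⟨κ, hκ, h⟩ := hf.van
  refine ⟨κ⁻¹, by positivity, fun v hv => ?_⟩
  have h1 : κ * ‖v.2‖ < ‖v.1‖ := not_le.1 fun hh => hv (h v hh)
  have h0 : 0 < ‖v.1‖ := lt_of_le_of_lt (by positivity) h1
  refine ⟨norm_pos_iff.1 h0, ?_⟩
  rw [rho, norm_div, div_le_iff₀ h0, inv_mul_eq_div, le_div_iff₀ hκ]
  linarith

theorem CC.eq_sum {f : X → ℝ} (h : CC f) : ∃ N₀ : ℕ, ∀ m : ℕ,
    f = ∑ p ∈ gridIdx (m * N₀), mulRho (fun z => bump₂ 0 (m * z - gridPt (m * N₀) p)) f := by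
  obtain ⟨r, -, hr⟩ := h.norm_rho_le
  obtain ⟨N₀, hN⟩ := exists_nat_ge r
  refine ⟨N₀, fun m => funext fun v => ?_⟩
  simp only [Finset.sum_apply, mulRho]
  rw [← Finset.sum_mul]
  by_cases hf : f v = 0
  · rw [hf, mul_zero]
  rw [sum_bump₂, one_mul]
  rw [norm_mul, Complex.norm_natCast]
  push_cast
  gcongr
  exact (hr v hf).2.trans hN

theorem Good.sum_left {s : ℝ} {B : (X → ℝ) → (X → ℝ) → ℝ} (h : Good s B) {ι : Type*}
    (S : Finset ι) {f : ι → X → ℝ} (hf : ∀ i ∈ S, CC (f i)) {g : X → ℝ} (hg : CC g) :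
    B (∑ i ∈ S, f i) g = ∑ i ∈ S, B (f i) g := by
  classical
  induction S using Finset.induction_on with
  | empty =>
    have := h.smul_left 0 0 g CC.zero hg
    simpa using this
  | insert i S hi ih =>
    rw [Finset.sum_insert hi, Finset.sum_insert hi, h.add_left _ _ _
      (hf i (Finset.mem_insert_self i S)) (CC.sum S fun j hj => hf j (Finset.mem_insert_of_mem hj))
      hg, ih fun j hj => hf j (Finset.mem_insert_of_mem hj)]

theorem CC.mulRho_affine_comp {f : X → ℝ} (h : CC f) (u : ℂ → ℝ) (c : ℂ) {m : ℝ} (hm : 0 < m) :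
    mulRho (fun z => u (m * z - c)) f ∘ shearT (c / m) m⁻¹ =
      mulRho u (f ∘ shearT (c / m) m⁻¹) := by
  funext v
  simp only [mulRho, Function.comp_apply]
  by_cases hv : v.1 = 0
  · rw [h.eq_zero_of_fst (v := shearT (c / m) m⁻¹ v) hv]; ring
  · rw [rho_shearT _ _ hv]
    have : (m : ℂ) ≠ 0 := by exact_mod_cast hm.ne'
    congr 2
    push_cast
    field_simp
    ring

theorem Good.eq_zero_of_lt {s : ℝ} {B : (X → ℝ) → (X → ℝ) → ℝ} (h : Good s B) (hs : s < -2)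
    {f g : X → ℝ} (hf : CC f) (hg : CC g) : B f g = 0 := by
  obtain ⟨N₀, hN₀⟩ := hf.eq_sum
  set Q : Set (ℂ × ℝ) := Metric.closedBall 0 (2 * N₀) ×ˢ Set.Icc 0 1
  have hQ : IsCompact Q := (isCompact_closedBall _ _).prod isCompact_Icc
  obtain ⟨C, hC⟩ := h.bdd _ _
    (hf.comp_shearT_mulRho contDiff_bump₂ (by norm_num) fun z => bump₂_eq_zero le_rfl)
    (hg.comp_shearT_mulRho contDiff_bump₂ (by norm_num) fun z => bump₂_eq_zero zero_le_one) Q hQ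
  have key : ∀ m : ℕ, 0 < m → |B f g| ≤ ((2 * N₀ + 1) ^ 2 * C) * (m : ℝ) ^ (s + 2) := by
    intro m hm
    have hm' : (0 : ℝ) < m := by exact_mod_cast hm
    have hm1 : (1 : ℝ) ≤ m := by exact_mod_cast hm
    have hcd : ∀ (b : ℝ) (c : ℂ), ContDiff ℝ ∞ fun z : ℂ => bump₂ b (m * z - c) :=
      fun b c => contDiff_bump₂.comp ((contDiff_const.mul contDiff_id).sub contDiff_const)
    have hpiece : ∀ p ∈ gridIdx (m * N₀),
        |B (mulRho (fun z => bump₂ 0 (m * z - gridPt (m * N₀) p)) f) g| ≤ (m : ℝ) ^ s * C := by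
      intro p hp
      set c := gridPt (m * N₀) p with hc
      set F := mulRho (fun z => bump₂ 0 (m * z - c)) f
      set G := mulRho (fun z => bump₂ 1 (m * z - c)) g
      have hF : CC F := hf.mulR (hcd 0 c)
      have hG : CC G := hg.mulR (hcd 1 c)
      have hcd' := contDiff_const (c := (1 : ℝ)).sub (hcd 1 c)
      have e1 : g = G + mulRho (fun z => 1 - bump₂ 1 (m * z - c)) g := by
        funext v; simp only [G, Pi.add_apply, mulRho]; ring
      have e2 : B F g = B F G := by
        conv_lhs => rw [e1]
        rw [h.add_right _ _ _ hF hG (hg.mulR hcd'), h.loc f g hf hg _ _ (hcd 0 c) hcd'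
          (fun z => bump₂_nonneg le_rfl _) (fun z => sub_nonneg.2 (bump₂_le_one zero_le_one _))
          (fun z => bump₂_mul_one_sub _), add_zero]
      have e3 := h.scale _ _ hF hG (c / (m : ℝ)) (m : ℝ)⁻¹ (inv_pos.2 hm')
      have a1 := hf.mulRho_affine_comp (bump₂ 0) c hm'
      have a2 := hg.mulRho_affine_comp (bump₂ 1) c hm'
      simp only [Complex.ofReal_natCast] at a1 a2 e3
      rw [a1, a2] at e3
      have hmem : ((c / (m : ℂ), (m : ℝ)⁻¹) : ℂ × ℝ) ∈ Q := by
        refine ⟨?_, by positivity, inv_le_one_of_one_le₀ hm1⟩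
        rw [mem_closedBall_zero_iff, norm_div, Complex.norm_natCast, div_le_iff₀ hm']
        have := norm_gridPt_le hp
        push_cast at this
        linarith
      have h5 := hC _ hmem
      simp only at h5
      rw [e3, abs_mul, Real.inv_rpow hm'.le, abs_of_pos (inv_pos.2 (Real.rpow_pos_of_pos hm' s)),
        inv_mul_le_iff₀ (Real.rpow_pos_of_pos hm' s), ← e2] at h5
      exact h5
    calc |B f g| = |∑ p ∈ gridIdx (m * N₀),
          B (mulRho (fun z => bump₂ 0 (m * z - gridPt (m * N₀) p)) f) g| := by
          rw [← h.sum_left _ (fun p _ => hf.mulR (hcd 0 _)) hg, ← hN₀ m]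
      _ ≤ ∑ p ∈ gridIdx (m * N₀), (m : ℝ) ^ s * C :=
          (Finset.abs_sum_le_sum_abs _ _).trans (Finset.sum_le_sum hpiece)
      _ = (2 * (m * N₀) + 1) ^ 2 * ((m : ℝ) ^ s * C) := by
          rw [Finset.sum_const, card_gridIdx, nsmul_eq_mul]; push_cast; ring
      _ ≤ ((2 * N₀ + 1) * m) ^ 2 * ((m : ℝ) ^ s * C) := by
          have : 0 ≤ C := (abs_nonneg _).trans (hC (0, 0) ⟨by simp, by simp⟩)
          gcongr
          nlinarith
      _ = ((2 * N₀ + 1) ^ 2 * C) * (m : ℝ) ^ (s + 2) := by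
          rw [Real.rpow_add hm', Real.rpow_two]; ring
  have ht := ((tendsto_rpow_neg_atTop (y := -(s + 2)) (by linarith)).comp
    (tendsto_natCast_atTop_atTop (R := ℝ))).const_mul ((2 * N₀ + 1) ^ 2 * C)
  rw [neg_neg, mul_zero] at ht
  exact abs_nonpos_iff.1 (ge_of_tendsto ht (Filter.eventually_atTop.2 ⟨1, key⟩))

theorem Good.eq_zero {s : ℝ} {B : (X → ℝ) → (X → ℝ) → ℝ} (h : Good s B)
    (hs : ∀ n : ℤ, s ≠ n) {f g : X → ℝ} (hf : CC f) (hg : CC g) : B f g = 0 := by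
  have key : ∀ (n : ℕ) (s : ℝ) (B : (X → ℝ) → (X → ℝ) → ℝ), Good s B → (∀ k : ℤ, s ≠ k) →
      s < -2 + n → ∀ f g, CC f → CC g → B f g = 0 := by
    intro n
    induction n with
    | zero => intro s B h _ hn f g hf hg; exact h.eq_zero_of_lt (by simpa using hn) hf hg
    | succ n ih =>
      intro s B h hs hn f g hf hg
      refine h.eq_zero_of_comm (fun h0 => hs (-2) (by push_cast; linarith)) (fun u => ?_) hf hg
      refine ih (s - 1) _ (h.commR u) (fun k hk => hs (k + 1) (by push_cast; linarith)) ?_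
      push_cast at hn; linarith
  obtain ⟨n, hn⟩ := exists_nat_gt (s + 2)
  exact key n s B h hs (by linarith) f g hf hg

end GoodVanish

section FormVanish

open scoped ContDiff
open Real (smoothTransition)

local notation "X" => ℂ × ℂ

/-- `ℂ × ℂ` with its Euclidean structure. -/
abbrev E2 := WithLp 2 (ℂ × ℂ)

/-- The identification of `E2` with `ℂ × ℂ`. -/
def eX : E2 ≃L[ℝ] ℂ × ℂ := WithLp.prodContinuousLinearEquiv 2 ℝ ℂ ℂ

/-- The function `u` of the affine coordinate, extended by zero to the line at infinity. -/
def chart (u : ℂ → ℝ) (v : X) : ℝ := if v.1 = 0 then 0 else u (rho v)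

theorem chart_of_ne (u : ℂ → ℝ) {v : X} (hv : v.1 ≠ 0) : chart u v = u (rho v) := if_neg hv

theorem chart_of_eq (u : ℂ → ℝ) {v : X} (hv : v.1 = 0) : chart u v = 0 := if_pos hv

theorem le_norm_rho {v : X} (hv : v.1 ≠ 0) {r : ℝ} (hr : 0 < r) (h : ‖v.1‖ ≤ r⁻¹ * ‖v.2‖) :
    r ≤ ‖rho v‖ := by
  rw [rho, norm_div, le_div_iff₀ (norm_pos_iff.2 hv)]
  calc r * ‖v.1‖ ≤ r * (r⁻¹ * ‖v.2‖) := by gcongr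
    _ = ‖v.2‖ := by field_simp

theorem chart_eq_zero {u : ℂ → ℝ} {r : ℝ} (hr : 0 < r) (h : ∀ z, r ≤ ‖z‖ → u z = 0) {v : X}
    (hv : ‖v.1‖ ≤ r⁻¹ * ‖v.2‖) : chart u v = 0 := by
  by_cases h1 : v.1 = 0
  · exact chart_of_eq u h1
  · rw [chart_of_ne u h1, h _ (le_norm_rho h1 hr hv)]

theorem S0_chart {u : ℂ → ℝ} (hu : ContDiff ℝ ∞ u) {r : ℝ} (hr : 0 < r)
    (h : ∀ z, r ≤ ‖z‖ → u z = 0) : S0 (chart u) := by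
  refine ⟨?_, fun v t ht => ?_⟩
  · have h1 : ContDiffOn ℝ ∞ (fun q : ℝ × X => chart u q.2) {q | q.2.1 ≠ 0} := by
      refine (hu.comp_contDiffOn (contDiffOn_rho.comp contDiff_snd.contDiffOn
        fun q (hq : q.2.1 ≠ 0) => hq)).congr fun q hq => ?_
      exact chart_of_ne u hq
    exact (contDiffOn_of_chart (c := 0) (inv_pos.2 hr) h1 fun q _ hq => chart_eq_zero hr h hq).comp
      (f := fun v : X => ((0 : ℝ), v)) (contDiff_const.prodMk contDiff_id).contDiffOn fun v hv => hv
  · by_cases h1 : v.1 = 0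
    · rw [chart_of_eq u h1, chart_of_eq u (by simp [h1])]
    · rw [chart_of_ne u h1, chart_of_ne u (by simp [h1, ht.ne']), rho_smul v ht]

theorem CC_chart_mul {u : ℂ → ℝ} (hu : ContDiff ℝ ∞ u) {r : ℝ} (hr : 0 < r)
    (h : ∀ z, r ≤ ‖z‖ → u z = 0) {f : X → ℝ} (hf : SH f) : CC (chart u * f) := by
  have h1 := hf.mul (S0_chart hu hr h)
  refine ⟨h1.smooth.mono fun v (hv : v.1 ≠ 0) h0 => hv (by rw [h0]; rfl), h1.hom, r⁻¹,
    inv_pos.2 hr, fun v hv => ?_⟩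
  rw [Pi.mul_apply, chart_eq_zero hr h hv, zero_mul]

/-- A smooth bump function on `ℂ`, equal to one for `‖z‖ ≤ r` and zero for `r + 1 ≤ ‖z‖`. -/
def disc (r : ℝ) (z : ℂ) : ℝ := smoothTransition ((r + 1) ^ 2 - ‖z‖ ^ 2)

theorem contDiff_disc (r : ℝ) : ContDiff ℝ ∞ (disc r) :=
  Real.smoothTransition.contDiff.comp (contDiff_const.sub (contDiff_norm_sq ℝ))

theorem disc_eq_one {r : ℝ} {z : ℂ} (hz : ‖z‖ ≤ r) : disc r z = 1 :=
  Real.smoothTransition.one_of_one_le (by nlinarith [norm_nonneg z])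

theorem disc_eq_zero {r : ℝ} (hr : 0 ≤ r) {z : ℂ} (hz : r + 1 ≤ ‖z‖) : disc r z = 0 :=
  Real.smoothTransition.zero_of_nonpos (by nlinarith [norm_nonneg z])

theorem disc_nonneg (r : ℝ) (z : ℂ) : 0 ≤ disc r z := Real.smoothTransition.nonneg _

theorem disc_le_one (r : ℝ) (z : ℂ) : disc r z ≤ 1 := Real.smoothTransition.le_one _

theorem S0_disc {r : ℝ} (hr : 0 ≤ r) : S0 (chart (disc r)) :=
  S0_chart (contDiff_disc r) (r := r + 1) (by positivity) fun _ => disc_eq_zero hr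

theorem chart_nonneg {u : ℂ → ℝ} (h : ∀ z, 0 ≤ u z) (v : X) : 0 ≤ chart u v := by
  rw [chart]; split_ifs; exacts [le_rfl, h _]

theorem CC.exists_disc_mul {f : X → ℝ} (hf : CC f) :
    ∃ r : ℝ, 0 ≤ r ∧ ∀ v, f v ≠ 0 → v.1 ≠ 0 ∧ disc r (rho v) = 1 := by
  obtain ⟨r, hr, h⟩ := hf.norm_rho_le
  exact ⟨r, hr, fun v hv => ⟨(h v hv).1, disc_eq_one (h v hv).2⟩⟩

theorem CC.mulRho_eq_chart {f : X → ℝ} (hf : CC f) {u : ℂ → ℝ} (hu : ContDiff ℝ ∞ u)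
    (h0 : ∀ z, 0 ≤ u z) : ∃ χ : X → ℝ, S0 χ ∧ (∀ v, 0 ≤ χ v) ∧ mulRho u f = χ * f ∧
      ∀ v, χ v ≠ 0 → u (rho v) ≠ 0 := by
  obtain ⟨r, hr, h⟩ := hf.exists_disc_mul
  refine ⟨chart (u * disc r), S0_chart (hu.mul (contDiff_disc r)) (r := r + 1) (by positivity)
    fun z hz => by rw [Pi.mul_apply, disc_eq_zero hr hz, mul_zero],
    chart_nonneg fun z => mul_nonneg (h0 z) (disc_nonneg r z), ?_, fun v hv => ?_⟩
  · funext v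
    rw [mulRho, Pi.mul_apply]
    by_cases hv : f v = 0
    · rw [hv, mul_zero, mul_zero]
    · rw [chart_of_ne _ (h v hv).1, Pi.mul_apply, (h v hv).2, mul_one]
  · by_cases h1 : v.1 = 0
    · exact absurd (chart_of_eq _ h1) hv
    · rw [chart_of_ne _ h1, Pi.mul_apply] at hv
      exact left_ne_zero_of_mul hv

theorem SH.flow {f : X → ℝ} (hf : SH f) {Ψ : ℝ × X → X} (hΨ : ContDiff ℝ ∞ Ψ)
    (h0 : ∀ p v, v ≠ 0 → Ψ (p, v) ≠ 0) (hs : ∀ p (t : ℝ) v, Ψ (p, t • v) = t • Ψ (p, v)) :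
    SHF fun q => f (Ψ q) :=
  ⟨hf.smooth.comp hΨ.contDiffOn fun q hq => h0 q.1 q.2 hq, fun p v t ht => by
    simp only [hs, hf.hom _ t ht]⟩

theorem CC.hasDerivAt_curve {f : X → ℝ} (h : CC f) (v : X) {y : ℝ → ℂ} {a : X →L[ℝ] ℂ}
    (hy0 : y 0 = v.2) (hy : HasDerivAt y (a v) 0) :
    HasDerivAt (fun t : ℝ => f (v.1, y t)) (LD a f v) 0 := by
  by_cases hv : v.1 = 0
  · rw [(h.ld a).eq_zero_of_fst hv]
    have : (fun t : ℝ => f (v.1, y t)) = fun _ => 0 := by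
      funext t; exact h.eq_zero_of_fst hv
    rw [this]; exact hasDerivAt_const _ _
  · have h1 : DifferentiableAt ℝ f v :=
      (h.smooth.contDiffAt (isOpen_fst_ne.mem_nhds hv)).differentiableAt (by simp)
    have h2 : HasDerivAt (fun t : ℝ => ((v.1, y t) : X)) (0, a v) 0 :=
      (hasDerivAt_const _ _).prodMk hy
    have h3 : HasFDerivAt f (fderiv ℝ f v) ((fun t : ℝ => ((v.1, y t) : X)) 0) := by
      simpa [hy0] using h1.hasFDerivAt
    exact h3.comp_hasDerivAt 0 h2

/-- `shearT` on `E2`. -/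
def shearE (c : ℂ) (ε : ℝ) : E2 →L[ℝ] E2 :=
  (eX.symm : X →L[ℝ] E2) ∘L ((ContinuousLinearMap.fst ℝ ℂ ℂ).prod
    (c • ContinuousLinearMap.fst ℝ ℂ ℂ + ε • ContinuousLinearMap.snd ℝ ℂ ℂ)) ∘L (eX : E2 →L[ℝ] X)

theorem eX_shearE (c : ℂ) (ε : ℝ) (v : E2) : eX (shearE c ε v) = shearT c ε (eX v) := by
  simp [shearE, shearT]

section Transform

variable {E : Type*} [NormedAddCommGroup E] [InnerProductSpace ℝ E] [FiniteDimensional ℝ E]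

theorem supp_mapCLM_adjoint (A : E →L[ℝ] E) (K : ConvexBody E) :
    supp (K.mapCLM (ContinuousLinearMap.adjoint A)) = supp K ∘ A := by
  funext v
  rw [supp, hSupp_mapCLM, Function.comp_apply, supp]
  congr 1
  funext x
  simp [ContinuousLinearMap.adjoint_inner_right]

theorem IsHom.bil_comp {φ : ConvexBody E → ℝ} (hφ : IsHom 2 φ) {A : E →L[ℝ] E} {c : ℝ}
    (h : ∀ K : ConvexBody E, φ (K.mapCLM (ContinuousLinearMap.adjoint A)) = c * φ K) {F G : E → ℝ}
    (hF : IsDC F) (hG : IsDC G) : bil φ (F ∘ A) (G ∘ A) = c * bil φ F G := by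
  obtain ⟨K, L, rfl⟩ := hF
  obtain ⟨K', L', rfl⟩ := hG
  set T := fun K : ConvexBody E => K.mapCLM (ContinuousLinearMap.adjoint A)
  have e : ∀ K L : ConvexBody E, (supp K - supp L) ∘ A = supp (T K) - supp (T L) := by
    intro K L; rw [supp_mapCLM_adjoint, supp_mapCLM_adjoint]; rfl
  have hp : ∀ K L : ConvexBody E, polar φ (T K) (T L) = c * polar φ K L := by
    intro K L
    rw [polar, polar, ← ConvexBody.mapCLM_add, h, h, h]; ring
  rw [e, e, hφ.bil_eq, hφ.bil_eq, hp, hp, hp, hp]; ring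

end Transform

variable {φ : ConvexBody E2 → ℝ}

/-- The bilinear form of `φ` in the coordinates `ℂ × ℂ`. -/
def bilX (φ : ConvexBody E2 → ℝ) (f g : X → ℝ) : ℝ := bil φ (f ∘ eX) (g ∘ eX)

theorem SH.isDC_comp {f : X → ℝ} (hf : SH f) : IsDC (f ∘ eX) := (hf.comp eX).isDC

theorem CC.isDC {f : X → ℝ} (hf : CC f) : IsDC (f ∘ eX) := hf.toSH.isDC_comp

/-- Weight `s` behaviour with respect to the maps adjoint to the shears. -/
def HasWeight (s : ℝ) (φ : ConvexBody E2 → ℝ) : Prop :=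
  ∀ (c : ℂ) (ε : ℝ), 0 < ε → ∀ K : ConvexBody E2,
    φ (K.mapCLM (ContinuousLinearMap.adjoint (shearE c ε))) = ε ^ s * φ K

theorem IsHom.bilX_scale (hφ : IsHom 2 φ) {s : ℝ} (hw : HasWeight s φ) {f g : X → ℝ} (hf : SH f)
    (hg : SH g) (c : ℂ) {ε : ℝ} (hε : 0 < ε) :
    bilX φ (f ∘ shearT c ε) (g ∘ shearT c ε) = ε ^ s * bilX φ f g := by
  have h := hφ.bil_comp (A := shearE c ε) (hw c ε hε) hf.isDC_comp hg.isDC_comp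
  have e : ∀ f : X → ℝ, (f ∘ shearT c ε) ∘ eX = (f ∘ eX) ∘ shearE c ε := by
    intro f; funext v; simp only [Function.comp_apply, eX_shearE]
  rw [bilX, e, e, h, bilX]

theorem IsHom.hasDerivAt_bilX (hφ : IsHom 2 φ) {Γ Γ' : ℝ × X → ℝ} (h : SHF Γ) (h' : SHF Γ') :
    HasDerivAt (fun t => bilX φ (fun v => Γ (t, v)) (fun v => Γ' (t, v)))
      (bilX φ (fun v => dt Γ (0, v)) (fun v => Γ' (0, v)) +
        bilX φ (fun v => Γ (0, v)) (fun v => dt Γ' (0, v))) 0 :=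
  hφ.hasDerivAt_bil (h.comp eX) (h'.comp eX)

theorem IsHom.bilX_flow (hφ : IsHom 2 φ) {s : ℝ} (hw : HasWeight s φ) {a : ℝ → ℂ} {b : ℝ → ℝ}
    (ha : ContDiff ℝ ∞ a) (hb : ContDiff ℝ ∞ b) (hb0 : ∀ t, 0 < b t) (a0 : a 0 = 0) (b0 : b 0 = 1)
    {V : X →L[ℝ] ℂ} (hV : ∀ v : X, HasDerivAt (fun t => a t * v.1 + (b t : ℂ) * v.2) (V v) 0)
    {f g : X → ℝ} (hf : CC f) (hg : CC g) :
    HasDerivAt (fun t => b t ^ s * bilX φ f g) (bilX φ (LD V f) g + bilX φ f (LD V g)) 0 := by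
  have hΨ : ∀ {f}, CC f → SHF fun q : ℝ × X => f (shearT (a q.1) (b q.1) q.2) := by
    intro f hf
    refine hf.toSH.flow (Ψ := fun q : ℝ × X => shearT (a q.1) (b q.1) q.2) ?_ ?_ ?_
    · have : ContDiff ℝ ∞ fun q : ℝ × X => (b q.1 : ℂ) :=
        Complex.ofRealCLM.contDiff.comp (hb.comp contDiff_fst)
      unfold shearT; fun_prop
    · intro p v hv h0
      simp only [shearT, Prod.mk_eq_zero] at h0
      refine hv (Prod.ext h0.1 ?_)
      simpa [h0.1, (hb0 p).ne'] using h0.2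
    · intro p t v; exact shearT_smul _ _ _ _
  have hd : ∀ {f} (hf : CC f), (fun v => dt (fun q : ℝ × X => f (shearT (a q.1) (b q.1) q.2))
      (0, v)) = LD V f := fun hf => funext fun v =>
    (hf.hasDerivAt_curve v (by simp [a0, b0]) (hV v)).deriv
  have h := hφ.hasDerivAt_bilX (hΨ hf) (hΨ hg)
  have e0 : ∀ f : X → ℝ, (fun v => f (shearT (a 0) (b 0) v)) = f := by
    intro f; funext v; simp [shearT, a0, b0]
  rw [hd hf, hd hg] at h
  simp only [e0] at h
  exact h.congr_of_eventuallyEq (.of_forall fun t =>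
    (hφ.bilX_scale hw hf.toSH hg.toSH (a t) (hb0 t)).symm)

theorem IsHom.good (hφ : IsHom 2 φ) {s : ℝ} (hw : HasWeight s φ) : Good s (bilX φ) := by
  refine ⟨?_, ?_, ?_, ?_, ?_, ?_, ?_, ?_, ?_⟩
  · exact fun f f' g hf hf' hg => hφ.bil_add hf.isDC hf'.isDC hg.isDC
  · exact fun c f g hf hg => hφ.bil_smul hf.isDC hg.isDC c
  · exact fun f g g' hf hg hg' => hφ.bil_add_right hf.isDC hg.isDC hg'.isDC
  · exact fun c f g hf hg => hφ.bil_smul_right hf.isDC hg.isDC c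
  · exact fun f g hf hg c ε hε => hφ.bilX_scale hw hf.toSH hg.toSH c hε
  · intro f g hf hg c
    have h := hφ.bilX_flow hw (a := fun t => t * c) (b := fun _ => 1) (V := shearV c)
      (Complex.ofRealCLM.contDiff.mul contDiff_const) contDiff_const (fun _ => one_pos) (by simp)
      rfl (fun v => by
        simpa [mul_assoc, shearV] using ((Complex.ofRealCLM.hasDerivAt (x := (0 : ℝ))).mul_const
          (c * v.1)).add_const v.2) hf hg
    exact h.unique (by simpa using hasDerivAt_const (0 : ℝ) (bilX φ f g))
  · intro f g hf hg
    have h := hφ.bilX_flow hw (a := fun _ => 0) (b := Real.exp) (V := eulerV) contDiff_const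
      Real.contDiff_exp Real.exp_pos rfl Real.exp_zero (fun v => by
        simpa [eulerV] using (Real.hasDerivAt_exp 0).ofReal_comp.mul_const v.2) hf hg
    simp only [← Real.exp_mul] at h
    exact h.unique (by
      simpa using (((hasDerivAt_id (0 : ℝ)).mul_const s).exp).mul_const (bilX φ f g))
  · intro f g hf hg u u' hu hu' h0 h0' h
    obtain ⟨χ, s1, s2, s3, s4⟩ := hf.mulRho_eq_chart hu h0
    obtain ⟨χ', s1', s2', s3', s4'⟩ := hg.mulRho_eq_chart hu' h0'
    rw [s3, s3']
    refine hφ.bil_local (hf.toSH.comp eX) (hg.toSH.comp eX) (s1.comp eX) (s1'.comp eX)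
      (fun v => s2 _) (fun v => s2' _) fun v _ => ?_
    by_contra hne
    exact mul_ne_zero (s4 _ (left_ne_zero_of_mul hne)) (s4' _ (right_ne_zero_of_mul hne)) (h _)
  · intro F G hF hG Q hQ
    exact hφ.bil_bounded_family (hF.toSHF.comp eX) (hG.toSHF.comp eX) hQ

theorem IsHom.bilX_eq_zero (hφ : IsHom 2 φ) {s : ℝ} (hw : HasWeight s φ) (hs : ∀ n : ℤ, s ≠ n)
    {f G : X → ℝ} (hf : CC f) (hG : SH G) : bilX φ f G = 0 := by
  obtain ⟨r, hr, h⟩ := hf.exists_disc_mul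
  have hr1 : 0 ≤ r + 1 := by positivity
  have hχ := S0_disc hr
  have hχ' := S0_disc hr1
  set ψ := chart (disc (r + 1)) with hψ
  have e : G = ψ * G + (1 - ψ) * G := by ring
  have c1 : CC (ψ * G) := CC_chart_mul (contDiff_disc _) (r := r + 1 + 1)
    (by positivity) (fun z => disc_eq_zero hr1) hG
  have c2 : SH ((1 - ψ) * G) := hG.mul hχ'.one_sub
  have ef : f = chart (disc r) * f := by
    funext v
    rw [Pi.mul_apply]
    by_cases hv : f v = 0
    · rw [hv, mul_zero]
    · rw [chart_of_ne _ (h v hv).1, (h v hv).2, one_mul]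
  have h1 : bilX φ f ((1 - ψ) * G) = 0 := by
    rw [ef]
    refine hφ.bil_local (hf.toSH.comp eX) (hG.comp eX) (hχ.comp eX) (hχ'.one_sub.comp eX)
      (fun v => chart_nonneg (disc_nonneg r) _) (fun v => ?_) fun v _ => ?_
    · simp only [hψ, Pi.sub_apply, Pi.one_apply, chart]
      split_ifs
      · simp
      · exact sub_nonneg.2 (disc_le_one _ _)
    · simp only [hψ, Pi.sub_apply, Pi.one_apply]
      by_cases h1 : (eX v).1 = 0
      · rw [chart_of_eq _ h1, zero_mul]
      · rw [chart_of_ne _ h1, chart_of_ne _ h1]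
        rcases le_total ‖rho (eX v)‖ (r + 1) with h2 | h2
        · rw [disc_eq_one h2, sub_self, mul_zero]
        · rw [disc_eq_zero hr h2, zero_mul]
  rw [e, show bilX φ f (ψ * G + (1 - ψ) * G) = bilX φ f (ψ * G) + bilX φ f ((1 - ψ) * G) from
    hφ.bil_add_right hf.isDC c1.isDC c2.isDC_comp, h1, (hφ.good hw).eq_zero hs hf c1, add_zero]

end FormVanish

section SmoothVanish

open scoped ContDiff

local notation "X" => ℂ × ℂ

variable {φ : ConvexBody E2 → ℝ}

theorem disc_one_of_snd {v : X} (h : ‖v.2‖ < ‖v.1‖) : chart (disc 1) v = 1 := by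
  have h0 : 0 < ‖v.1‖ := (norm_nonneg _).trans_lt h
  rw [chart_of_ne _ (norm_pos_iff.1 h0), disc_eq_one]
  rw [rho, norm_div, div_le_one h0]; exact h.le

theorem SH.squeeze {h : X → ℝ} (hh : SH h) :
    SHF fun q : ℝ × X => h ((q.1 : ℂ) * q.2.1, q.2.2) * (1 - chart (disc 1) q.2) := by
  have hS := S0_disc (r := 1) zero_le_one
  refine ⟨fun q (hq : q.2 ≠ 0) => ?_, fun p v t ht => ?_⟩
  · by_cases h2 : q.2.2 = 0
    · have h1 : q.2.1 ≠ 0 := fun h1 => hq (Prod.ext h1 h2)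
      have hU : {q : ℝ × X | ‖q.2.2‖ < ‖q.2.1‖} ∈ nhds q := by
        refine IsOpen.mem_nhds (isOpen_lt (by fun_prop) (by fun_prop)) ?_
        simpa [Set.mem_ofPred_eq, h2] using h1
      refine (ContDiffAt.congr_of_eventuallyEq (contDiffAt_const (c := (0 : ℝ)))
        ?_).contDiffWithinAt
      filter_upwards [hU] with p hp
      rw [disc_one_of_snd hp, sub_self, mul_zero]
    · have h3 : ContDiff ℝ ∞ fun q : ℝ × X => (((q.1 : ℂ) * q.2.1, q.2.2) : X) := by
        have : ContDiff ℝ ∞ fun q : ℝ × X => (q.1 : ℂ) :=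
          Complex.ofRealCLM.contDiff.comp contDiff_fst
        fun_prop
      have h4 : ContDiffAt ℝ ∞ h ((q.1 : ℂ) * q.2.1, q.2.2) :=
        hh.smooth.contDiffAt (isOpen_ne.mem_nhds fun h0 => h2 (Prod.mk_eq_zero.1 h0).2)
      have h5 : ContDiffAt ℝ ∞ (chart (disc 1)) q.2 :=
        hS.smooth.contDiffAt (isOpen_ne.mem_nhds hq)
      exact ((h4.comp (f := fun q : ℝ × X => (((q.1 : ℂ) * q.2.1, q.2.2) : X)) q
        h3.contDiffAt).mul (contDiffAt_const.sub
          (h5.comp q contDiff_snd.contDiffAt))).contDiffWithinAt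
  · rcases ht.eq_or_lt with rfl | ht
    · simp only [zero_smul, zero_mul, Prod.snd_zero, Prod.fst_zero, mul_zero]
      rw [show ((0 : ℂ), (0 : ℂ)) = (0 : X) from rfl, hh.map_zero, zero_mul]
    · have e : (((p : ℂ) * (t • v).1, (t • v).2) : X) = t • ((p : ℂ) * v.1, v.2) := by
        ext <;> simp; ring
      simp only
      rw [e, hh.hom _ _ ht.le, hS.hom _ _ ht]; ring

theorem IsHom.bilX_self_of_cut (hφ : IsHom 2 φ) {s : ℝ} (hw : HasWeight s φ)
    (hs : ∀ n : ℤ, s ≠ n) {h : X → ℝ} (hh : SH h) :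
    bilX φ ((1 - chart (disc 1)) * h) ((1 - chart (disc 1)) * h) = bilX φ h h := by
  have hS := S0_disc (r := 1) zero_le_one
  have c1 : CC (chart (disc 1) * h) := CC_chart_mul (contDiff_disc _) (r := 1 + 1)
    (by positivity) (fun z => disc_eq_zero zero_le_one) hh
  have c2 : SH ((1 - chart (disc 1)) * h) := hh.mul hS.one_sub
  have e : h = chart (disc 1) * h + (1 - chart (disc 1)) * h := by ring
  have h1 : ∀ G, SH G → bilX φ h G = bilX φ ((1 - chart (disc 1)) * h) G := by
    intro G hG
    have : bilX φ (chart (disc 1) * h + (1 - chart (disc 1)) * h) G =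
      bilX φ (chart (disc 1) * h) G + bilX φ ((1 - chart (disc 1)) * h) G :=
      hφ.bil_add c1.isDC c2.isDC_comp hG.isDC_comp
    rw [← e, hφ.bilX_eq_zero hw hs c1 hG, zero_add] at this
    exact this
  rw [h1 h hh, show bilX φ ((1 - chart (disc 1)) * h) h = bilX φ h ((1 - chart (disc 1)) * h) from
    hφ.bil_comm c2.isDC_comp hh.isDC_comp, h1 _ c2]

theorem IsHom.eq_zero_of_smooth (hφ : IsHom 2 φ) {s : ℝ} (hw : HasWeight s φ)
    (hs : ∀ n : ℤ, s ≠ n) (h1s : 1 < s) (hs2 : s < 2) {K : ConvexBody E2} (hK : SH (supp K)) :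
    φ K = 0 := by
  set h : X → ℝ := supp K ∘ eX.symm with hh'
  have hh : SH h := hK.comp eX.symm
  have hd := hφ.hasDerivAt_bilX hh.squeeze hh.squeeze
  set b : ℝ → ℝ := fun t => bilX φ
    (fun v => h ((t : ℂ) * v.1, v.2) * (1 - chart (disc 1) v))
    (fun v => h ((t : ℂ) * v.1, v.2) * (1 - chart (disc 1) v)) with hb
  have hbt : ∀ t : ℝ, 0 < t → b t = t ^ (2 - s) * φ K := by
    intro t ht
    set Kt := t • K.mapCLM (ContinuousLinearMap.adjoint (shearE 0 t⁻¹))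
    have e1 : φ Kt = t ^ (2 - s) * φ K := by
      rw [hφ.smul _ _ ht.le, hw _ _ (inv_pos.2 ht), Real.rpow_sub ht, Real.inv_rpow ht.le]
      have := (Real.rpow_pos_of_pos ht s).ne'
      rw [Real.rpow_two]; field_simp
    have e2 : supp Kt ∘ eX.symm = fun v : X => h ((t : ℂ) * v.1, v.2) := by
      funext v
      have e3 : ∀ v, supp Kt v = t * supp K (shearE 0 t⁻¹ v) := by
        intro v
        have := congrFun (supp_mapCLM_adjoint (shearE 0 t⁻¹) K) v
        rw [Function.comp_apply] at this
        rw [← this]; exact congrFun (supp_smul _ ht.le) v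
      rw [Function.comp_apply, e3, hh', Function.comp_apply, ← hK.hom _ _ ht.le]
      congr 1
      apply eX.injective
      rw [map_smul, eX_shearE]
      simp only [ContinuousLinearEquiv.apply_symm_apply, shearT]
      have : (t : ℂ) ≠ 0 := by exact_mod_cast ht.ne'
      ext <;> simp [this]
    have e4 : SH (fun v : X => h ((t : ℂ) * v.1, v.2)) := by
      rw [← e2]
      refine SH.comp ?_ eX.symm
      have : supp Kt = (supp Kt ∘ eX.symm) ∘ eX := by funext v; simp
      rw [this, e2]
      refine SH.comp (E' := E2) (E := X) ⟨?_, ?_⟩ eX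
      · refine hh.smooth.comp (s := {v | v ≠ 0}) (g := h)
          (f := fun v : X => (((t : ℂ) * v.1, v.2) : X))
          (by fun_prop) ?_
        intro v hv h0
        have h0 := Prod.mk_eq_zero.1 h0
        refine hv (Prod.ext ?_ h0.2)
        exact (mul_eq_zero.1 h0.1).resolve_left (by exact_mod_cast ht.ne')
      · intro v r hr
        rw [← hh.hom _ _ hr]
        congr 1
        ext <;> simp; ring
    rw [← e1, ← hφ.bil_supp_self Kt, hb]
    have := hφ.bilX_self_of_cut hw hs e4
    have e5 : ((1 - chart (disc 1)) * fun v : X => h ((t : ℂ) * v.1, v.2)) =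
        fun v => h ((t : ℂ) * v.1, v.2) * (1 - chart (disc 1) v) := by
      funext v; simp [mul_comm]
    rw [e5] at this
    simp only
    rw [this, ← e2, bilX]
    congr 1
  have hb0 : b 0 = 0 := by
    have hc := hd.continuousAt.tendsto.mono_left (nhdsWithin_le_nhds (s := Set.Ioi 0))
    have h2 : Filter.Tendsto b (nhdsWithin 0 (Set.Ioi 0)) (nhds (0 * φ K)) := by
      have h3 : Filter.Tendsto (fun t : ℝ => t ^ (2 - s) * φ K) (nhdsWithin 0 (Set.Ioi 0))
          (nhds (0 * φ K)) := by
        have := (Real.continuousAt_rpow_const 0 (2 - s) (Or.inr (by linarith))).tendsto.mono_left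
          (nhdsWithin_le_nhds (s := Set.Ioi 0))
        rw [Real.zero_rpow (by linarith)] at this
        exact this.mul_const _
      refine h3.congr' ?_
      filter_upwards [self_mem_nhdsWithin] with t ht
      exact (hbt t ht).symm
    rw [zero_mul] at h2
    exact tendsto_nhds_unique hc h2
  obtain ⟨D, hd'⟩ : ∃ D, HasDerivAt b D 0 := ⟨_, hd⟩
  have hsl := (hasDerivAt_iff_tendsto_slope.1 hd').mono_left
    (nhdsWithin_mono 0 (fun t (ht : (0 : ℝ) < t) => ht.ne') : nhdsWithin (0 : ℝ) (Set.Ioi 0) ≤ _)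
  have h6 : Filter.Tendsto (fun t : ℝ => t ^ (s - 1) * slope b 0 t) (nhdsWithin 0 (Set.Ioi 0))
      (nhds (0 * D)) := by
    have := (Real.continuousAt_rpow_const 0 (s - 1) (Or.inr (by linarith))).tendsto.mono_left
          (nhdsWithin_le_nhds (s := Set.Ioi 0))
    rw [Real.zero_rpow (by linarith)] at this
    exact this.mul hsl
  rw [zero_mul] at h6
  refine tendsto_nhds_unique (tendsto_const_nhds.congr' ?_) h6
  filter_upwards [self_mem_nhdsWithin] with t (ht : 0 < t)
  rw [slope_def_field, hb0, hbt t ht, sub_zero, sub_zero, mul_div_assoc', ← mul_assoc,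
    ← Real.rpow_add ht]
  rw [show s - 1 + (2 - s) = 1 by ring, Real.rpow_one]
  field_simp

end SmoothVanish

section HullDensity

open ConvexBody

variable {V : Type*} [NormedAddCommGroup V] [NormedSpace ℝ V]

/-- The convex hull of a nonempty finite set. -/
def hullBody (T : Finset V) (hT : T.Nonempty) : ConvexBody V :=
  ⟨convexHull ℝ (T : Set V), convex_convexHull ℝ _, T.finite_toSet.isCompact_convexHull ℝ,
    convexHull_nonempty_iff.2 (by exact_mod_cast hT)⟩

theorem mem_hullBody_of_mem {T : Finset V} (hT : T.Nonempty) {x : V} (hx : x ∈ T) :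
    x ∈ hullBody T hT := subset_convexHull ℝ (T : Set V) (Finset.mem_coe.2 hx)

theorem hullBody_subset {T : Finset V} (hT : T.Nonempty) {K : ConvexBody V} (h : ∀ x ∈ T, x ∈ K) :
    (hullBody T hT : Set V) ⊆ K := convexHull_min (fun x hx => h x hx) K.convex

theorem exists_hullBody_dist_le (K : ConvexBody V) {ε : ℝ} (hε : 0 < ε) :
    ∃ (T : Finset V) (hT : T.Nonempty), (hullBody T hT : Set V) ⊆ K ∧
      dist K (hullBody T hT) ≤ ε := by
  classical
  obtain ⟨t, htK, htf, hc⟩ := K.isCompact.finite_cover_balls hε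
  replace hc : ∀ x ∈ K, ∃ y ∈ t, dist x y < ε := fun x hx => by simpa using hc hx
  have hne : t.Nonempty := let ⟨_, hx⟩ := K.nonempty; let ⟨y, hy, _⟩ := hc _ hx; ⟨y, hy⟩
  have hT : htf.toFinset.Nonempty := htf.toFinset_nonempty.2 hne
  have hsub := hullBody_subset hT (K := K) fun x hx => htK (htf.mem_toFinset.1 hx)
  refine ⟨htf.toFinset, hT, hsub, ?_⟩
  refine dist_le_of_forall hε.le (fun x hx => ?_) fun y hy => ⟨y, hsub hy, by simp [hε.le]⟩
  obtain ⟨y, hy, hxy⟩ := hc x hx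
  exact ⟨y, mem_hullBody_of_mem hT (htf.mem_toFinset.2 hy), hxy.le⟩

theorem eq_of_eq_on_hullBody {α : Type*} [TopologicalSpace α] [T2Space α] {φ ψ : ConvexBody V → α}
    (hφ : Continuous φ) (hψ : Continuous ψ)
    (h : ∀ T hT, φ (hullBody T hT) = ψ (hullBody T hT)) (K : ConvexBody V) : φ K = ψ K := by
  refine congrFun (Continuous.ext_on (s := {K | φ K = ψ K}) (fun K => ?_) hφ hψ fun _ h => h) K
  refine Metric.mem_closure_iff.2 fun ε hε => ?_
  obtain ⟨T, hT, -, hd⟩ := exists_hullBody_dist_le K (half_pos hε)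
  exact ⟨_, h T hT, by linarith⟩

end HullDensity

section SuppDist

open ConvexBody

variable {V : Type*} [NormedAddCommGroup V] [NormedSpace ℝ V] [FiniteDimensional ℝ V]

/-- The closed unit ball as a convex body. -/
def unitBall (V : Type*) [NormedAddCommGroup V] [NormedSpace ℝ V] [FiniteDimensional ℝ V] :
    ConvexBody V :=
  ⟨Metric.closedBall 0 1, convex_closedBall _ _,
    have := FiniteDimensional.proper ℝ V
    isCompact_closedBall _ _, Metric.nonempty_closedBall.2 zero_le_one⟩

theorem mem_unitBall {x : V} : x ∈ unitBall V ↔ ‖x‖ ≤ 1 := mem_closedBall_zero_iff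

theorem norm_le_hSupp_unitBall (g : V →L[ℝ] ℝ) : ‖g‖ ≤ hSupp (unitBall V) g := by
  have h0 : 0 ≤ hSupp (unitBall V) g := by
    simpa using le_hSupp (K := unitBall V) g (x := 0) (mem_unitBall.2 (by simp))
  have key : ∀ x, g x ≤ hSupp (unitBall V) g * ‖x‖ := by
    intro x
    rcases eq_or_ne x 0 with rfl | hx
    · simp
    have hx' := norm_pos_iff.2 hx
    have := le_hSupp (K := unitBall V) g (x := ‖x‖⁻¹ • x) (mem_unitBall.2 (by
      simp [norm_smul, hx'.ne']))
    rwa [map_smul, smul_eq_mul, inv_mul_le_iff₀' hx'] at this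
  exact g.opNorm_le_bound h0 fun x => abs_le'.2 ⟨key x, by simpa using key (-x)⟩

theorem dist_le_of_hSupp {K L : ConvexBody V} {ε : ℝ} (hε : 0 ≤ ε)
    (h : ∀ g : V →L[ℝ] ℝ, |hSupp K g - hSupp L g| ≤ ε * ‖g‖) : dist K L ≤ ε := by
  have key : ∀ K L : ConvexBody V, (∀ g : V →L[ℝ] ℝ, |hSupp K g - hSupp L g| ≤ ε * ‖g‖) →
      ∀ x ∈ K, ∃ y ∈ L, dist x y ≤ ε := by
    intro K L h x hx
    have hs : (K : Set V) ⊆ (L + ε • unitBall V : ConvexBody V) := subset_of_hSupp_le fun g => by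
      rw [hSupp_add, hSupp_smul _ hε]
      have := (abs_le.1 (h g)).2
      have := mul_le_mul_of_nonneg_left (norm_le_hSupp_unitBall g) hε
      linarith
    obtain ⟨y, hy, z, hz, rfl⟩ := mem_add.1 (hs hx)
    obtain ⟨w, hw, rfl⟩ := mem_smul.1 hz
    refine ⟨y, hy, ?_⟩
    rw [dist_eq_norm, add_sub_cancel_left, norm_smul, Real.norm_of_nonneg hε]
    exact mul_le_of_le_one_right hε (mem_unitBall.1 hw)
  refine dist_le_of_forall hε (key K L h) fun y hy => ?_
  obtain ⟨x, hx, hd⟩ := key L K (fun g => by rw [abs_sub_comm]; exact h g) y hy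
  exact ⟨x, hx, by rwa [dist_comm]⟩

end SuppDist

section SmoothDensity

open ConvexBody
open scoped ContDiff

variable {E : Type*} [NormedAddCommGroup E] [InnerProductSpace ℝ E] [FiniteDimensional ℝ E]

theorem dist_le_of_supp {K L : ConvexBody E} {ε : ℝ} (hε : 0 ≤ ε)
    (h : ∀ v, |supp K v - supp L v| ≤ ε * ‖v‖) : dist K L ≤ ε := by
  refine dist_le_of_hSupp hε fun g => ?_
  have := h ((InnerProductSpace.toDual ℝ E).symm g)
  rw [LinearIsometryEquiv.norm_map] at this
  convert this using 3 <;> (rw [supp]; congr 1; funext x; simp)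

theorem supp_hullBody_le {T : Finset E} (hT : T.Nonempty) {v : E} {c : ℝ}
    (h : ∀ x ∈ T, inner ℝ v x ≤ c) : supp (hullBody T hT) v ≤ c :=
  supp_le fun _ hx => convexHull_min (t := {x | inner ℝ v x ≤ c}) (fun x hx => h x hx)
    (convex_halfSpace_le (innerSL ℝ v).isLinear c) hx

/-- The `ℓᵖ` smoothing of the support function of `hullBody T + R • B`. -/
def lpSupp (T : Finset E) (R p : ℝ) (v : E) : ℝ :=
  (∑ x ∈ T, (inner ℝ v x + R * ‖v‖) ^ p) ^ (1 / p)

theorem lp_base_pos {R : ℝ} {x v : E} (hR : ‖x‖ < R) (hv : v ≠ 0) : 0 < inner ℝ v x + R * ‖v‖ := by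
  have h1 := abs_le.1 (abs_real_inner_le_norm v x)
  have h2 := norm_pos_iff.2 hv
  nlinarith [h1.1, mul_lt_mul_of_pos_right hR h2]

theorem lp_base_nonneg {R : ℝ} {x : E} (hR : ‖x‖ < R) (v : E) : 0 ≤ inner ℝ v x + R * ‖v‖ := by
  rcases eq_or_ne v 0 with rfl | hv
  · simp
  · exact (lp_base_pos hR hv).le

theorem isSublinear_lpSupp {T : Finset E} {R p : ℝ} (hR : ∀ x ∈ T, ‖x‖ < R) (hp : 1 ≤ p) :
    IsSublinear (lpSupp T R p) := by
  have hp0 : 0 < p := by linarith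
  refine ⟨fun u v => ?_, fun t v ht => ?_⟩
  · have h0 : 0 ≤ R ∨ T = ∅ := by
      rcases T.eq_empty_or_nonempty with h | ⟨x, hx⟩
      · exact Or.inr h
      · exact Or.inl ((norm_nonneg x).trans (hR x hx).le)
    refine le_trans ?_ (Real.Lp_add_le_of_nonneg (s := T) hp
      (fun x hx => lp_base_nonneg (hR x hx) u) fun x hx => lp_base_nonneg (hR x hx) v)
    refine Real.rpow_le_rpow (Finset.sum_nonneg fun x hx =>
      Real.rpow_nonneg (lp_base_nonneg (hR x hx) _) _) (Finset.sum_le_sum fun x hx => ?_)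
      (by positivity)
    refine Real.rpow_le_rpow (lp_base_nonneg (hR x hx) _) ?_ hp0.le
    rw [inner_add_left]
    have := mul_le_mul_of_nonneg_left (norm_add_le u v) ((norm_nonneg x).trans (hR x hx).le)
    linarith
  · rw [lpSupp, lpSupp]
    have e : ∀ x ∈ T, (inner ℝ (t • v) x + R * ‖t • v‖) ^ p =
        t ^ p * (inner ℝ v x + R * ‖v‖) ^ p := by
      intro x hx
      rw [← Real.mul_rpow ht (lp_base_nonneg (hR x hx) v), real_inner_smul_left, norm_smul,
        Real.norm_of_nonneg ht]
      ring_nf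
    rw [Finset.sum_congr rfl e, ← Finset.mul_sum, Real.mul_rpow (Real.rpow_nonneg ht _)
      (Finset.sum_nonneg fun x hx => Real.rpow_nonneg (lp_base_nonneg (hR x hx) _) _),
      ← Real.rpow_mul ht, mul_one_div_cancel hp0.ne', Real.rpow_one]

theorem SH_lpSupp {T : Finset E} (hT : T.Nonempty) {R p : ℝ} (hR : ∀ x ∈ T, ‖x‖ < R)
    (hp : 1 ≤ p) : SH (lpSupp T R p) := by
  refine ⟨fun v hv => ?_, fun v t ht =>
    (isSublinear_lpSupp hR hp).smul t v ht⟩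
  have h1 : ∀ x ∈ T, ContDiffAt ℝ ∞ (fun v : E => (inner ℝ v x + R * ‖v‖) ^ p) v := by
    intro x hx
    refine ContDiffAt.rpow_const_of_ne ?_ (lp_base_pos (hR x hx) hv).ne'
    exact (contDiffAt_id.inner ℝ contDiffAt_const).add
      (contDiffAt_const.mul (contDiffAt_norm ℝ hv))
  refine (ContDiffAt.rpow_const_of_ne (ContDiffAt.sum h1) ?_).contDiffWithinAt
  exact (Finset.sum_pos (fun x hx => Real.rpow_pos_of_pos (lp_base_pos (hR x hx) hv) _) hT).ne'

theorem supp_hull_add_ball {T : Finset E} (hT : T.Nonempty) {R : ℝ} (hR0 : 0 ≤ R) (v : E) :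
    supp (hullBody T hT + ballBody R hR0) v = supp (hullBody T hT) v + R * ‖v‖ := by
  rw [supp_add, supp_ballBody]; rfl

theorem lpSupp_bounds {T : Finset E} (hT : T.Nonempty) {R p : ℝ} (hR : ∀ x ∈ T, ‖x‖ < R)
    (hR0 : 0 ≤ R) (hp : 1 ≤ p) (v : E) :
    supp (hullBody T hT + ballBody R hR0) v ≤ lpSupp T R p v ∧
      lpSupp T R p v ≤ (T.card : ℝ) ^ (1 / p) * supp (hullBody T hT + ballBody R hR0) v := by
  have hp0 : 0 < p := by linarith
  have hp1 : 0 ≤ 1 / p := by positivity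
  rw [supp_hull_add_ball hT hR0]
  have hb : ∀ x ∈ T, inner ℝ v x + R * ‖v‖ ≤ supp (hullBody T hT) v + R * ‖v‖ := fun x hx =>
    add_le_add_left (inner_le_supp (mem_hullBody_of_mem hT hx) v) _
  constructor
  · rw [← le_sub_iff_add_le]
    refine supp_hullBody_le hT fun x hx => ?_
    rw [le_sub_iff_add_le]
    have h0 := lp_base_nonneg (hR x hx) v
    have h1 : ((inner ℝ v x + R * ‖v‖) ^ p) ^ (1 / p) ≤ lpSupp T R p v :=
      Real.rpow_le_rpow (Real.rpow_nonneg h0 _) (Finset.single_le_sum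
        (f := fun x => (inner ℝ v x + R * ‖v‖) ^ p)
        (fun y hy => Real.rpow_nonneg (lp_base_nonneg (hR y hy) v) _) hx) hp1
    rwa [← Real.rpow_mul h0, mul_one_div_cancel hp0.ne', Real.rpow_one] at h1
  · obtain ⟨x₀, hx₀⟩ := hT
    have hM : 0 ≤ supp (hullBody T ⟨x₀, hx₀⟩) v + R * ‖v‖ :=
      (lp_base_nonneg (hR x₀ hx₀) v).trans (hb x₀ hx₀)
    have h1 : ∑ x ∈ T, (inner ℝ v x + R * ‖v‖) ^ p ≤
        T.card * (supp (hullBody T ⟨x₀, hx₀⟩) v + R * ‖v‖) ^ p := by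
      rw [← nsmul_eq_mul]
      exact Finset.sum_le_card_nsmul _ _ _ fun x hx =>
        Real.rpow_le_rpow (lp_base_nonneg (hR x hx) v) (hb x hx) hp0.le
    refine (Real.rpow_le_rpow (Finset.sum_nonneg fun x hx =>
      Real.rpow_nonneg (lp_base_nonneg (hR x hx) _) _) h1 hp1).trans ?_
    rw [Real.mul_rpow (by positivity) (Real.rpow_nonneg hM _), ← Real.rpow_mul hM,
      mul_one_div_cancel hp0.ne', Real.rpow_one]

theorem IsHom.eq_zero_of_eq_zero_smooth {φ : ConvexBody E → ℝ} (hφ : IsHom 2 φ)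
    (h : ∀ K, SH (supp K) → φ K = 0) (K : ConvexBody E) : φ K = 0 := by
  refine eq_of_eq_on_hullBody (ψ := fun _ => 0) hφ.cont continuous_const (fun T hT => ?_) K
  obtain ⟨R₀, hR₀, hTR⟩ : ∃ R₀, 0 ≤ R₀ ∧ ∀ x ∈ T, ‖x‖ < R₀ := by
    obtain ⟨r, hr⟩ := (T.finite_toSet.image norm).bddAbove
    exact ⟨|r| + 1, by positivity, fun x hx =>
      ((hr ⟨x, hx, rfl⟩).trans (le_abs_self r)).trans_lt (by linarith)⟩
  set P := hullBody T hT
  have key : ∀ R (hR : R₀ ≤ R), φ (P + ballBody R (hR₀.trans hR)) = 0 := by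
    intro R hR
    have hR0 := hR₀.trans hR
    have hTR' : ∀ x ∈ T, ‖x‖ < R := fun x hx => (hTR x hx).trans_le hR
    have hn1 : ∀ n : ℕ, (1 : ℝ) ≤ n + 1 := fun n => by linarith [n.cast_nonneg (α := ℝ)]
    choose L hL using fun n : ℕ => (isSublinear_lpSupp hTR' (hn1 n)).exists_body
    have hL0 : ∀ n, φ (L n) = 0 := fun n => h _ (by rw [hL]; exact SH_lpSupp hT hTR' (hn1 n))
    have hd : ∀ n : ℕ, dist (L n) (P + ballBody R hR0) ≤
        ((T.card : ℝ) ^ (1 / ((n : ℝ) + 1)) - 1) * (2 * R) := by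
      intro n
      have hc1 : (1 : ℝ) ≤ (T.card : ℝ) ^ (1 / ((n : ℝ) + 1)) :=
        Real.one_le_rpow (by exact_mod_cast hT.card_pos) (by positivity)
      refine dist_le_of_supp (mul_nonneg (by linarith) (by positivity)) fun v => ?_
      obtain ⟨h1, h2⟩ := lpSupp_bounds hT hTR' hR0 (hn1 n) v
      rw [hL, abs_of_nonneg (by linarith)]
      have h3 : supp (P + ballBody R hR0) v ≤ 2 * R * ‖v‖ := by
        rw [supp_hull_add_ball]
        have : supp P v ≤ R * ‖v‖ := supp_hullBody_le hT fun x hx => by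
          have h4 := (abs_le.1 (abs_real_inner_le_norm v x)).2
          have := mul_le_mul_of_nonneg_left (hTR' x hx).le (norm_nonneg v)
          linarith
        linarith
      have := mul_le_mul_of_nonneg_left h3 (sub_nonneg.2 hc1)
      linarith
    have ht : Filter.Tendsto L Filter.atTop (nhds (P + ballBody R hR0)) := by
      rw [tendsto_iff_dist_tendsto_zero]
      refine squeeze_zero (fun _ => dist_nonneg) hd ?_
      have h5 : Filter.Tendsto (fun n : ℕ => (T.card : ℝ) ^ (1 / ((n : ℝ) + 1))) Filter.atTop
          (nhds ((T.card : ℝ) ^ (0 : ℝ))) :=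
        (Real.continuousAt_const_rpow (by simpa using hT.ne_empty)).tendsto.comp
          tendsto_one_div_add_atTop_nhds_zero_nat
      rw [Real.rpow_zero] at h5
      simpa using (h5.sub_const 1).mul_const (2 * R)
    exact tendsto_nhds_unique ((hφ.cont.tendsto _).comp ht)
      (tendsto_const_nhds.congr fun n => (hL0 n).symm)
  have hq : ∀ R, R₀ ≤ R → φ P + 2 * R * polar φ P (ballBody 1 zero_le_one) +
      R ^ 2 * φ (ballBody 1 zero_le_one) = 0 := by
    intro R hR
    have hR0 := hR₀.trans hR
    have e : ballBody (E := E) R hR0 = R • ballBody 1 zero_le_one :=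
      eq_of_supp_eq (by
        rw [supp_smul _ hR0, supp_ballBody, supp_ballBody]; funext v; simp)
    have h1 := key R hR
    have h2 : polar φ P (R • ballBody 1 zero_le_one) = R * polar φ P (ballBody 1 zero_le_one) :=
      hφ.polar_smul_right _ _ hR0
    rw [polar, ← e, h1, e, hφ.smul _ _ hR0] at h2
    linarith
  have h0 := hq R₀ le_rfl
  have h1 := hq (R₀ + 1) (by linarith)
  have h2 := hq (R₀ + 2) (by linarith)
  linear_combination (R₀ + 1) * (R₀ + 2) / 2 * h0 - R₀ * (R₀ + 2) * h1 + R₀ * (R₀ + 1) / 2 * h2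

end SmoothDensity

section WeightVanish

open ConvexBody

theorem IsHom.eq_zero_of_hasWeight {φ : ConvexBody E2 → ℝ} (hφ : IsHom 2 φ) {s : ℝ}
    (hw : HasWeight s φ) (h1s : 1 < s) (hs2 : s < 2) (K : ConvexBody E2) : φ K = 0 := by
  refine hφ.eq_zero_of_eq_zero_smooth (fun K hK => hφ.eq_zero_of_smooth hw (fun n hn => ?_)
    h1s hs2 hK) K
  rw [hn] at h1s hs2
  norm_cast at h1s hs2
  omega

end WeightVanish

section Weights

open ConvexBody

local notation "X" => ℂ × ℂ

/-- The complex shear `(x, y) ↦ (x + c y, y)`. -/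
def shU (c : ℂ) : X →L[ℝ] X :=
  (ContinuousLinearMap.fst ℝ ℂ ℂ + c • ContinuousLinearMap.snd ℝ ℂ ℂ).prod
    (ContinuousLinearMap.snd ℝ ℂ ℂ)

theorem shU_apply (c : ℂ) (v : X) : shU c v = (v.1 + c * v.2, v.2) := by simp [shU]

/-- The dilation `(x, y) ↦ (a x, b y)`. -/
def dil (a b : ℝ) : X →L[ℝ] X :=
  (a • ContinuousLinearMap.fst ℝ ℂ ℂ).prod (b • ContinuousLinearMap.snd ℝ ℂ ℂ)

theorem dil_apply (a b : ℝ) (v : X) : dil a b v = (a • v.1, b • v.2) := by simp [dil]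

/-- Continuous translation invariant valuations with the symmetries of the coefficient functions of
a contravariant Minkowski valuation. -/
structure Adm (φ : ConvexBody X → ℝ) : Prop extends IsCTV φ where
  shear : ∀ c K, φ (K.mapCLM (shU c)) = φ K
  dil : ∀ (t : ℝ) K, 0 < t → φ (K.mapCLM (dil t t⁻¹)) = t⁻¹ * φ K

/-- Homogeneous components of admissible valuations. -/
structure Wt (i : ℕ) (φ : ConvexBody X → ℝ) : Prop extends IsHom i φ where
  shear : ∀ c K, φ (K.mapCLM (shU c)) = φ K
  dil : ∀ (a b : ℝ) K, 0 < a → 0 < b →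
    φ (K.mapCLM (_root_.dil a b)) = a ^ (((i : ℝ) - 1) / 2) * b ^ (((i : ℝ) + 1) / 2) * φ K

theorem finrank_X : finrank ℝ X = 4 := by
  rw [Module.finrank_prod, Complex.finrank_real_complex]

theorem mcm_mapCLM {φ : ConvexBody X → ℝ} {A : X →L[ℝ] X} {c : ℝ}
    (h : ∀ K, φ (K.mapCLM A) = c * φ K) (i : ℕ) (K : ConvexBody X) :
    mcm 4 φ i (K.mapCLM A) = c * mcm 4 φ i K := by
  rw [mcm, mcm, Finset.mul_sum]
  refine Finset.sum_congr rfl fun j _ => ?_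
  rw [← mapCLM_smul, h]; ring

variable {φ : ConvexBody X → ℝ}

theorem Adm.wt_mcm (h : Adm φ) {i : ℕ} (hi : i ≤ 4) : Wt i (mcm 4 φ i) := by
  have h1 := h.toIsCTV.mcm_isHom finrank_X.le hi
  refine ⟨h1, fun c K => ?_, fun a b K ha hb => ?_⟩
  · rw [mcm_mapCLM (c := 1) (fun K => by rw [h.shear, one_mul]), one_mul]
  · set r := Real.sqrt (a * b) with hr
    set t := Real.sqrt (a / b) with ht
    have hr0 : 0 < r := Real.sqrt_pos.2 (by positivity)
    have ht0 : 0 < t := Real.sqrt_pos.2 (by positivity)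
    have e1 : r * t = a := by
      rw [hr, ht, ← Real.sqrt_mul (by positivity), show a * b * (a / b) = a ^ 2 by field_simp,
        Real.sqrt_sq ha.le]
    have e2 : r * t⁻¹ = b := by
      rw [hr, ht, ← Real.sqrt_inv, ← Real.sqrt_mul (by positivity),
        show a * b * (a / b)⁻¹ = b ^ 2 by field_simp, Real.sqrt_sq hb.le]
    have e : K.mapCLM (_root_.dil a b) = r • K.mapCLM (_root_.dil t t⁻¹) := by
      rw [smul_eq_mapCLM, mapCLM_mapCLM]
      congr 1
      ext v <;> simp [dil_apply, ← mul_assoc, ← Complex.ofReal_mul, e1]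
      · simp [← e2]
    rw [e, h1.smul _ _ hr0.le, mcm_mapCLM (fun K => h.dil t K ht0), ← mul_assoc]
    congr 1
    rw [← e1, ← e2, Real.mul_rpow hr0.le ht0.le, Real.mul_rpow hr0.le (inv_pos.2 ht0).le,
      Real.inv_rpow ht0.le]
    have : r ^ (((i : ℝ) - 1) / 2) * t ^ (((i : ℝ) - 1) / 2) *
      (r ^ (((i : ℝ) + 1) / 2) * (t ^ (((i : ℝ) + 1) / 2))⁻¹) =
      (r ^ (((i : ℝ) - 1) / 2) * r ^ (((i : ℝ) + 1) / 2)) *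
        (t ^ (((i : ℝ) - 1) / 2) * (t ^ (((i : ℝ) + 1) / 2))⁻¹) := by ring
    rw [this, ← Real.rpow_add hr0, ← Real.rpow_neg ht0.le, ← Real.rpow_add ht0]
    rw [show ((i : ℝ) - 1) / 2 + ((i : ℝ) + 1) / 2 = i by ring,
      show ((i : ℝ) - 1) / 2 + -(((i : ℝ) + 1) / 2) = -1 by ring, Real.rpow_natCast,
      Real.rpow_neg_one]

theorem continuous_mapCLM_dil (K : ConvexBody X) (b : ℝ) :
    Continuous fun a : ℝ => K.mapCLM (dil a b) := by
  have h1 : Continuous fun a : ℝ => dil a b := by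
    have e : (fun a : ℝ => dil a b) = fun a : ℝ =>
        a • (ContinuousLinearMap.fst ℝ ℂ ℂ).prod (0 : X →L[ℝ] ℂ) + dil 0 b := by
      funext a; ext v <;> simp [dil]
    rw [e]; fun_prop
  exact continuous_mapCLM_prod.comp (h1.prodMk continuous_const)

theorem continuous_mapCLM_dil' (K : ConvexBody X) (a : ℝ) :
    Continuous fun b : ℝ => K.mapCLM (dil a b) := by
  have h1 : Continuous fun b : ℝ => dil a b := by
    have e : (fun b : ℝ => dil a b) = fun b : ℝ =>
        b • (0 : X →L[ℝ] ℂ).prod (ContinuousLinearMap.snd ℝ ℂ ℂ) + dil a 0 := by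
      funext a; ext v <;> simp [dil]
    rw [e]; fun_prop
  exact continuous_mapCLM_prod.comp (h1.prodMk continuous_const)

theorem Wt.zero_eq_zero (h : Wt 0 φ) (K : ConvexBody X) : φ K = 0 := by
  have hc : ∀ K, φ K = φ 0 := by
    intro K
    have := h.smul K 0 le_rfl
    rw [zero_smul'] at this
    simpa using this.symm
  have h1 := h.dil 1 4 0 one_pos (by norm_num)
  rw [hc] at h1
  have h2 : (4 : ℝ) ^ (((0 : ℕ) + 1 : ℝ) / 2) = 2 := by
    rw [show (4 : ℝ) = 2 ^ (2 : ℝ) by norm_num, ← Real.rpow_mul (by norm_num)]; norm_num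
  rw [h2, Real.one_rpow] at h1
  rw [hc]; linarith

theorem Wt.one_eq (h : Wt 1 φ) (K : ConvexBody X) : φ K = φ (K.mapCLM (_root_.dil 0 1)) := by
  have h1 : Filter.Tendsto (fun a : ℝ => φ (K.mapCLM (_root_.dil a 1))) (nhdsWithin 0 (Set.Ioi 0))
      (nhds (φ (K.mapCLM (_root_.dil 0 1)))) :=
    ((h.cont.comp (continuous_mapCLM_dil K 1)).tendsto 0).mono_left nhdsWithin_le_nhds
  refine tendsto_nhds_unique (tendsto_const_nhds.congr' ?_) h1
  filter_upwards [self_mem_nhdsWithin] with a ha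
  rw [h.dil a 1 K ha one_pos]; simp

theorem Wt.horizontal {i : ℕ} (h : Wt i φ) (K : ConvexBody X) : φ (K.mapCLM (_root_.dil 1 0)) = 0 := by
  have h1 : Filter.Tendsto (fun b : ℝ => φ (K.mapCLM (_root_.dil 1 b))) (nhdsWithin 0 (Set.Ioi 0))
      (nhds (φ (K.mapCLM (_root_.dil 1 0)))) :=
    ((h.cont.comp (continuous_mapCLM_dil' K 1)).tendsto 0).mono_left nhdsWithin_le_nhds
  have h2 : Filter.Tendsto (fun b : ℝ => b ^ (((i : ℝ) + 1) / 2) * φ K)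
      (nhdsWithin 0 (Set.Ioi 0)) (nhds 0) := by
    have := ((Real.continuousAt_rpow_const 0 (((i : ℝ) + 1) / 2) (Or.inr (by positivity))).tendsto.mono_left
      (nhdsWithin_le_nhds (s := Set.Ioi 0))).mul_const (φ K)
    rwa [Real.zero_rpow (by positivity), zero_mul] at this
  refine tendsto_nhds_unique h1 (h2.congr' ?_)
  filter_upwards [self_mem_nhdsWithin] with b hb
  rw [h.dil 1 b K one_pos hb]; simp

theorem eX_adjoint_shearE (c : ℂ) {ε : ℝ} (hε : ε ≠ 0) :
    (eX : E2 →L[ℝ] X) ∘L ContinuousLinearMap.adjoint (shearE c ε) =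
      shU (starRingEnd ℂ c / ε) ∘L dil 1 ε ∘L (eX : E2 →L[ℝ] X) := by
  have : (eX.symm : X →L[ℝ] E2) ∘L shU (starRingEnd ℂ c / ε) ∘L dil 1 ε ∘L (eX : E2 →L[ℝ] X) =
      ContinuousLinearMap.adjoint (shearE c ε) := by
    rw [ContinuousLinearMap.eq_adjoint_iff]
    intro v w
    have hε' : (ε : ℂ) ≠ 0 := by exact_mod_cast hε
    have e1 : ((eX.symm : X →L[ℝ] E2) ∘L shU (starRingEnd ℂ c / ε) ∘L dil 1 ε ∘L
        (eX : E2 →L[ℝ] X)) v = eX.symm (v.fst + starRingEnd ℂ c * v.snd, ε * v.snd) := by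
      simp only [ContinuousLinearMap.comp_apply, shU_apply, dil_apply]
      refine congrArg eX.symm ?_
      ext1
      · simp only [one_smul, Complex.real_smul]
        rw [div_mul_eq_mul_div, mul_left_comm, mul_div_cancel_left₀ _ hε']; rfl
      · simp only [Complex.real_smul]; rfl
    have e2 : shearE c ε w = eX.symm (w.fst, c * w.fst + ε * w.snd) := by
      apply eX.injective
      rw [eX_shearE, ContinuousLinearEquiv.apply_symm_apply]; rfl
    rw [e1, e2, WithLp.prod_inner_apply, WithLp.prod_inner_apply]
    simp only [Complex.inner]
    change (w.fst * (starRingEnd ℂ) (v.fst + starRingEnd ℂ c * v.snd)).re +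
      (w.snd * (starRingEnd ℂ) (ε * v.snd)).re = (w.fst * (starRingEnd ℂ) v.fst).re +
      ((c * w.fst + ε * w.snd) * (starRingEnd ℂ) v.snd).re
    rw [← Complex.add_re, ← Complex.add_re]
    congr 1
    simp only [map_add, map_mul, Complex.conj_conj, Complex.conj_ofReal]
    ring
  rw [← this]
  exact ContinuousLinearMap.ext fun v => by simp

theorem Wt.two_eq_zero (h : Wt 2 φ) (K : ConvexBody X) : φ K = 0 := by
  have h1 : IsHom 2 fun L : ConvexBody E2 => φ (L.mapCLM (eX : E2 →L[ℝ] X)) :=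
    ⟨h.toIsCTV.comp_mapCLM _, fun L t ht => by rw [mapCLM_smul, h.smul _ _ ht]⟩
  have h2 : HasWeight (3 / 2) fun L : ConvexBody E2 => φ (L.mapCLM (eX : E2 →L[ℝ] X)) := by
    intro c ε hε L
    simp only
    rw [mapCLM_mapCLM, eX_adjoint_shearE c hε.ne', ← mapCLM_mapCLM, h.shear, ← mapCLM_mapCLM,
      h.dil _ _ _ one_pos hε]
    norm_num
  have h3 := h1.eq_zero_of_hasWeight h2 (by norm_num) (by norm_num)
    (K.mapCLM (eX.symm : X →L[ℝ] E2))
  simp only [mapCLM_mapCLM] at h3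
  rw [← h3]
  congr 1
  rw [show (eX : E2 →L[ℝ] X) ∘L (eX.symm : X →L[ℝ] E2) = ContinuousLinearMap.id ℝ X by
    exact ContinuousLinearMap.ext fun v => by simp, mapCLM_id]

end Weights

section Slabs

open ConvexBody

variable {V : Type*} [NormedAddCommGroup V] [NormedSpace ℝ V]

/-- The slab `a ≤ g ≤ b`. -/
def slab (g : V →L[ℝ] ℝ) (a b : ℝ) : Set V := {x | a ≤ g x ∧ g x ≤ b}

theorem convex_slab (g : V →L[ℝ] ℝ) (a b : ℝ) : Convex ℝ (slab g a b) :=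
  (convex_halfSpace_ge g.toLinearMap.isLinear a).inter
    (convex_halfSpace_le g.toLinearMap.isLinear b)

theorem isClosed_slab (g : V →L[ℝ] ℝ) (a b : ℝ) : IsClosed (slab g a b) :=
  (isClosed_le continuous_const g.continuous).inter (isClosed_le g.continuous continuous_const)

/-- A set function vanishing on the subsets of `S` contained in a level set of `g`. -/
def LevelZero (g : V →L[ℝ] ℝ) (φ : ConvexBody V → ℝ) (S : Set V) : Prop :=
  ∀ K : ConvexBody V, (K : Set V) ⊆ S → (∀ x ∈ K, ∀ y ∈ K, g x = g y) → φ K = 0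

variable {φ : ConvexBody V → ℝ} {g f : V →L[ℝ] ℝ} {S T : Set V}

theorem LevelZero.hat (h : LevelZero g φ S) (hT : T ⊆ S) (hg : ∀ x ∈ T, ∀ y ∈ T, g x = g y) :
    hat φ T = 0 := by
  unfold _root_.hat
  split_ifs with h1
  · exact h _ hT hg
  · rfl

theorem hat_slab_add (hφ : IsValuation φ) (h0 : LevelZero g φ S) (h₁ : Convex ℝ S)
    (h₂ : IsCompact S) {a b c : ℝ} (hab : a ≤ b) (hbc : b ≤ c) :
    hat φ (S ∩ slab g a c) = hat φ (S ∩ slab g a b) + hat φ (S ∩ slab g b c) := by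
  have h := hat_cut hφ (h₁.inter (convex_slab g a c)) (h₂.inter_right (isClosed_slab g a c)) g b
  rw [h0.hat (T := S ∩ slab g a c ∩ {x | g x = b}) (fun x hx => hx.1.1)
    (fun x hx y hy => Eq.trans hx.2 (Eq.symm hy.2)), add_zero] at h
  rw [h]
  congr 2
  · ext x
    simp only [slab, Set.mem_inter_iff, Set.mem_ofPred_eq]
    exact ⟨fun h => ⟨h.1.1, h.1.2.1, h.2⟩, fun h => ⟨⟨h.1, h.2.1, h.2.2.trans hbc⟩, h.2.2⟩⟩
  · ext x
    simp only [slab, Set.mem_inter_iff, Set.mem_ofPred_eq]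
    exact ⟨fun h => ⟨h.1.1, h.2, h.1.2.2⟩, fun h => ⟨⟨h.1, hab.trans h.2.1, h.2.2⟩, h.2.1⟩⟩

theorem hat_slab_sum (hφ : IsValuation φ) (h0 : LevelZero g φ S) (h₁ : Convex ℝ S)
    (h₂ : IsCompact S) (a : ℝ) {h : ℝ} (hh : 0 ≤ h) (n : ℕ) :
    hat φ (S ∩ slab g a (a + n * h)) =
      ∑ k ∈ Finset.range n, hat φ (S ∩ slab g (a + k * h) (a + k * h + h)) := by
  induction n with
  | zero =>
    rw [Finset.sum_range_zero]
    refine h0.hat Set.inter_subset_left fun x hx y hy => ?_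
    have h1 := hx.2
    have h2 := hy.2
    simp only [slab, Set.mem_ofPred_eq] at h1 h2
    norm_num at h1 h2
    linarith [h1.1, h1.2, h2.1, h2.2]
  | succ n ih =>
    rw [Finset.sum_range_succ, ← ih, show a + ((n + 1 : ℕ) : ℝ) * h = a + n * h + h by push_cast; ring]
    have : 0 ≤ (n : ℝ) * h := by positivity
    exact hat_slab_add hφ h0 h₁ h₂ (by linarith) (by linarith)

theorem hat_slab_sum_of_bound (hφ : IsValuation φ) (h0 : LevelZero g φ S) (h₁ : Convex ℝ S)
    (h₂ : IsCompact S) {m : ℕ} (hm : ∀ x ∈ S, |g x| ≤ m) {n : ℕ} (hn : 0 < n) :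
    hat φ S = ∑ k ∈ Finset.range (2 * m * n),
      hat φ (S ∩ slab g (-m + k * (n : ℝ)⁻¹) (-m + k * (n : ℝ)⁻¹ + (n : ℝ)⁻¹)) := by
  rw [← hat_slab_sum hφ h0 h₁ h₂ _ (by positivity)]
  congr 1
  rw [eq_comm, Set.inter_eq_left]
  intro x hx
  have hn' : (n : ℝ) ≠ 0 := by positivity
  have := abs_le.1 (hm x hx)
  refine ⟨this.1, ?_⟩
  have e : -(m : ℝ) + ((2 * m * n : ℕ) : ℝ) * (n : ℝ)⁻¹ = m := by
    push_cast; field_simp; ring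
  rw [e]; exact this.2

theorem hat_grid_sum (hφ : IsValuation φ) (hg : LevelZero g φ S) (hf : LevelZero f φ S)
    (h₁ : Convex ℝ S) (h₂ : IsCompact S) {m : ℕ} (hm : ∀ x ∈ S, |g x| ≤ m)
    (hm' : ∀ x ∈ S, |f x| ≤ m) {n : ℕ} (hn : 0 < n) :
    hat φ S = ∑ k ∈ Finset.range (2 * m * n), ∑ l ∈ Finset.range (2 * m * n),
      hat φ (S ∩ slab g (-m + k * (n : ℝ)⁻¹) (-m + k * (n : ℝ)⁻¹ + (n : ℝ)⁻¹) ∩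
        slab f (-m + l * (n : ℝ)⁻¹) (-m + l * (n : ℝ)⁻¹ + (n : ℝ)⁻¹)) := by
  rw [hat_slab_sum_of_bound hφ hg h₁ h₂ hm hn]
  refine Finset.sum_congr rfl fun k _ => ?_
  exact hat_slab_sum_of_bound hφ (fun L hL => hf L (hL.trans Set.inter_subset_left)) (h₁.inter (convex_slab _ _ _))
    (h₂.inter_right (isClosed_slab _ _ _)) (fun x hx => hm' x hx.1) hn

theorem abs_hat_le {C : ℝ} (hC : 0 ≤ C) (h : ∀ K : ConvexBody V, (K : Set V) ⊆ S → |φ K| ≤ C) :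
    |hat φ S| ≤ C := by
  unfold hat
  split_ifs with h1
  · exact h _ subset_rfl
  · simpa using hC

theorem eq_zero_of_abs_le_rpow {a B s : ℝ} (hs : 0 < s)
    (h : ∀ n : ℕ, 0 < n → |a| ≤ B * (n : ℝ) ^ (-s)) : a = 0 := by
  have h1 : Filter.Tendsto (fun n : ℕ => B * (n : ℝ) ^ (-s)) Filter.atTop (nhds (B * 0)) :=
    ((tendsto_rpow_neg_atTop hs).comp tendsto_natCast_atTop_atTop).const_mul B
  rw [mul_zero] at h1
  have h2 := ge_of_tendsto h1 (Filter.eventually_atTop.2 ⟨1, fun n hn => h n hn⟩)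
  exact abs_nonpos_iff.1 h2

end Slabs

section WeightsVanish

open ConvexBody

local notation "X" => ℂ × ℂ

variable {φ : ConvexBody X → ℝ} {i : ℕ}

theorem Wt.stretch (h : Wt i φ) (L : ConvexBody X) (q : ℂ) {n : ℝ} (hn : 0 < n) :
    φ ((L.translate (0, -q)).mapCLM (_root_.dil 1 n)) = n ^ (((i : ℝ) + 1) / 2) * φ L := by
  rw [h.dil 1 n _ one_pos hn, h.trans]; simp

theorem mem_stretch {L : ConvexBody X} {q : ℂ} {n : ℝ} {p : X} :
    p ∈ (L.translate (0, -q)).mapCLM (dil 1 n) ↔ ∃ v ∈ L, p = (v.1, n • (v.2 - q)) := by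
  simp only [mem_mapCLM, mem_translate]
  constructor
  · rintro ⟨_, ⟨z, hz, rfl⟩, rfl⟩
    exact ⟨z, hz, by simp [dil_apply]; ring⟩
  · rintro ⟨v, hv, rfl⟩
    exact ⟨_, ⟨v, hv, rfl⟩, by simp [dil_apply]; ring⟩

theorem Wt.exists_abs_le (h : Wt i φ) (hi : i ≠ 0) (R : ℝ) : ∃ C, 0 ≤ C ∧ ∀ (n : ℝ) (_ : 0 < n)
    (L : ConvexBody X), (∀ p ∈ L, ‖p.1‖ ≤ R) →
    (∀ p ∈ L, ∀ q ∈ L, ‖p.2 - q.2‖ ≤ 2 / n) → |φ L| ≤ C * n ^ (-(((i : ℝ) + 1) / 2)) := by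
  obtain ⟨C, hC, hb⟩ := h.toIsHom.bounded hi (max R 2)
  refine ⟨C, hC, fun n hn L hR hL => ?_⟩
  obtain ⟨q, hq⟩ := L.nonempty
  have h1 := hb ((L.translate (0, -q.2)).mapCLM (_root_.dil 1 n)) (by
    intro p hp
    obtain ⟨v, hv, rfl⟩ := mem_stretch.1 hp
    refine max_le_max (hR v hv) ?_
    simp only [norm_smul, Real.norm_eq_abs, abs_of_pos hn]
    have := hL v hv q hq
    rw [le_div_iff₀ hn] at this
    linarith)
  rw [h.stretch L q.2 hn, abs_mul, abs_of_pos (Real.rpow_pos_of_pos hn _)] at h1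
  rw [Real.rpow_neg hn.le, ← div_eq_mul_inv, le_div_iff₀ (Real.rpow_pos_of_pos hn _)]
  linarith

theorem Wt.eq_zero_of_const (h : Wt i φ) (K : ConvexBody X)
    (hK : ∀ p ∈ K, ∀ q ∈ K, p.2 = q.2) : φ K = 0 := by
  obtain ⟨q, hq⟩ := K.nonempty
  rw [← h.trans K (0, -q.2), ← h.horizontal (K.translate (0, -q.2))]
  congr 1
  ext p
  constructor
  · rintro ⟨z, hz, rfl⟩
    exact ⟨_, ⟨z, hz, rfl⟩, Prod.ext (by simp [dil_apply]) (by simp [dil_apply, hK z hz q hq])⟩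
  · rintro ⟨_, ⟨z, hz, rfl⟩, rfl⟩
    exact ⟨z, hz, Prod.ext (by simp [dil_apply]) (by simp [dil_apply, hK z hz q hq])⟩

theorem exists_nat_bound (K : ConvexBody X) : ∃ m : ℕ, 0 < m ∧ ∀ p ∈ K, ‖p‖ ≤ m := by
  obtain ⟨R, hR, h⟩ := K.exists_norm_le
  obtain ⟨m, hm⟩ := exists_nat_gt R
  exact ⟨m, by exact_mod_cast hR.trans hm, fun p hp => (h p hp).trans hm.le⟩

/-- The real and imaginary parts of the second coordinate. -/
def reY : X →L[ℝ] ℝ := Complex.reCLM ∘L ContinuousLinearMap.snd ℝ ℂ ℂ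

/-- The imaginary part of the second coordinate. -/
def imY : X →L[ℝ] ℝ := Complex.imCLM ∘L ContinuousLinearMap.snd ℝ ℂ ℂ

@[simp] theorem reY_apply (p : X) : reY p = p.2.re := rfl
@[simp] theorem imY_apply (p : X) : imY p = p.2.im := rfl

theorem Wt.levelZero_aux (h : Wt i φ) (hi : 2 ≤ i) {f g : X →L[ℝ] ℝ}
    (hfg : ∀ p q : X, ‖p.2 - q.2‖ ≤ |f p - f q| + |g p - g q|) (hf : ∀ p : X, |f p| ≤ ‖p‖)
    (K : Set X) :
    LevelZero g φ K := by
  intro L hLK hL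
  have h0 : LevelZero f φ L := fun L' hL' hf' => h.eq_zero_of_const L' fun p hp q hq => by
    have := hfg p q
    rw [hf' p hp q hq, hL p (hL' hp) q (hL' hq), sub_self, sub_self, abs_zero, add_zero] at this
    exact sub_eq_zero.1 (norm_le_zero_iff.1 this)
  obtain ⟨m, hm, hmL⟩ := exists_nat_bound L
  obtain ⟨C, hC, hb⟩ := h.exists_abs_le (by omega) m
  have hs : 0 < ((i : ℝ) + 1) / 2 - 1 := by
    have : (2 : ℝ) ≤ i := by exact_mod_cast hi
    linarith
  refine eq_zero_of_abs_le_rpow (B := 2 * m * C) hs fun n hn => ?_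
  have hn' : (0 : ℝ) < n := by exact_mod_cast hn
  rw [← hat_coe φ L, hat_slab_sum_of_bound h.val h0 L.convex L.isCompact
    (fun x hx => (hf x).trans (hmL x hx)) hn]
  refine (Finset.abs_sum_le_sum_abs _ _).trans ((Finset.sum_le_sum fun k _ =>
    abs_hat_le (by positivity) fun K' hK' => hb n hn' K'
      (fun p hp => (norm_fst_le p).trans (hmL p (hK' hp).1)) fun p hp q hq => ?_).trans_eq ?_)
  · obtain ⟨h1, h2, h3⟩ := hK' hp
    obtain ⟨h4, h5, h6⟩ := hK' hq
    have : |f p - f q| ≤ (n : ℝ)⁻¹ := abs_le.2 ⟨by linarith, by linarith⟩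
    refine (hfg p q).trans ?_
    rw [hL p h1 q h4, sub_self, abs_zero, add_zero, div_eq_mul_inv]
    linarith
  · simp only [Finset.sum_const, Finset.card_range, nsmul_eq_mul]
    rw [neg_sub, sub_eq_add_neg, Real.rpow_add hn', Real.rpow_one]
    push_cast; ring

theorem norm_le_re_im (p q : X) :
    ‖p.2 - q.2‖ ≤ |reY p - reY q| + |imY p - imY q| := by
  simpa using Complex.norm_le_abs_re_add_abs_im (p.2 - q.2)

theorem abs_reY_le (p : X) : |reY p| ≤ ‖p‖ := (Complex.abs_re_le_norm _).trans (norm_snd_le p)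

theorem abs_imY_le (p : X) : |imY p| ≤ ‖p‖ := (Complex.abs_im_le_norm _).trans (norm_snd_le p)

theorem Wt.levelZero_reY (h : Wt i φ) (hi : 2 ≤ i) (K : Set X) : LevelZero reY φ K :=
  h.levelZero_aux (f := imY) hi
    (fun p q => (norm_le_re_im p q).trans_eq (add_comm _ _)) abs_imY_le K

theorem Wt.levelZero_imY (h : Wt i φ) (hi : 2 ≤ i) (K : Set X) : LevelZero imY φ K :=
  h.levelZero_aux (f := reY) hi norm_le_re_im abs_reY_le K

/-- The part of a body lying over the square with lower left corner `a + b I` and side `n⁻¹`. -/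
def cell (S : Set X) (a b n : ℝ) : Set X :=
  S ∩ slab reY a (a + n⁻¹) ∩ slab imY b (b + n⁻¹)

theorem Wt.abs_hat_cell_le (h : Wt i φ) (hi : i ≠ 0) (R : ℝ) : ∃ C, 0 ≤ C ∧
    ∀ (n : ℝ) (_ : 0 < n) (S : Set X) (a b : ℝ), (∀ p ∈ S, ‖p.1‖ ≤ R) →
    |hat φ (cell S a b n)| ≤ C * n ^ (-(((i : ℝ) + 1) / 2)) := by
  obtain ⟨C, hC, hb⟩ := h.exists_abs_le hi R
  refine ⟨C, hC, fun n hn S a b hS => ?_⟩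
  refine abs_hat_le (by positivity) fun L hL => hb n hn L (fun p hp => hS p (hL hp).1.1)
    fun p hp q hq => (norm_le_re_im p q).trans ?_
  obtain ⟨⟨-, h1, h2⟩, h3, h4⟩ := hL hp
  obtain ⟨⟨-, h5, h6⟩, h7, h8⟩ := hL hq
  have e1 : |reY p - reY q| ≤ n⁻¹ := abs_le.2 ⟨by linarith, by linarith⟩
  have e2 : |imY p - imY q| ≤ n⁻¹ := abs_le.2 ⟨by linarith, by linarith⟩
  rw [div_eq_mul_inv]; linarith

theorem Wt.eq_sum_cell (h : Wt i φ) (hi : 2 ≤ i) (K : ConvexBody X) {m : ℕ}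
    (hm : ∀ p ∈ K, ‖p‖ ≤ m) {n : ℕ} (hn : 0 < n) :
    φ K = ∑ k ∈ Finset.range (2 * m * n), ∑ l ∈ Finset.range (2 * m * n),
      hat φ (cell K (-m + k * (n : ℝ)⁻¹) (-m + l * (n : ℝ)⁻¹) n) := by
  rw [← hat_coe φ K]
  exact hat_grid_sum h.val (h.levelZero_reY hi _) (h.levelZero_imY hi _) K.convex K.isCompact
    (fun p hp => (abs_reY_le p).trans (hm p hp)) (fun p hp => (abs_imY_le p).trans (hm p hp)) hn

theorem Wt.four_eq_zero (h : Wt 4 φ) (K : ConvexBody X) : φ K = 0 := by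
  obtain ⟨m, hm, hmK⟩ := exists_nat_bound K
  obtain ⟨C, hC, hb⟩ := h.abs_hat_cell_le (by norm_num) m
  refine eq_zero_of_abs_le_rpow (B := (2 * m) ^ 2 * C) (s := 1 / 2) (by norm_num) fun n hn => ?_
  have hn' : (0 : ℝ) < n := by exact_mod_cast hn
  rw [h.eq_sum_cell (by norm_num) K hmK hn]
  refine (Finset.abs_sum_le_sum_abs _ _).trans ((Finset.sum_le_sum fun k _ =>
    (Finset.abs_sum_le_sum_abs _ _).trans (Finset.sum_le_sum fun l _ =>
    hb n hn' _ _ _ fun p hp => (norm_fst_le p).trans (hmK p hp))).trans_eq ?_)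
  simp only [Finset.sum_const, Finset.card_range, nsmul_eq_mul]
  have : (n : ℝ) ^ (-((((4 : ℕ) : ℝ) + 1) / 2)) * (n : ℝ) ^ 2 = (n : ℝ) ^ (-(1 / 2 : ℝ)) := by
    rw [← Real.rpow_natCast (n : ℝ) 2, ← Real.rpow_add hn']; norm_num
  rw [← this]
  push_cast; ring

end WeightsVanish

section Fiber

open ConvexBody

local notation "X" => ℂ × ℂ

/-- The closed unit square in the complex plane. -/
def unitSq : ConvexBody ℂ :=
  ⟨Set.Icc 0 1 ×ℂ Set.Icc 0 1, fun x hx y hy a b ha hb hab => by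
    rw [Complex.mem_reProdIm] at *
    exact ⟨convex_Icc 0 1 hx.1 hy.1 ha hb hab |> fun h => by simpa using h,
      convex_Icc 0 1 hx.2 hy.2 ha hb hab |> fun h => by simpa using h⟩,
    isCompact_Icc.reProdIm isCompact_Icc, ⟨0, by simp [Complex.mem_reProdIm]⟩⟩

theorem mem_unitSq {z : ℂ} : z ∈ unitSq ↔ (0 ≤ z.re ∧ z.re ≤ 1) ∧ 0 ≤ z.im ∧ z.im ≤ 1 := Iff.rfl

/-- The product of two planar convex bodies. -/
def prodBody (A B : ConvexBody ℂ) : ConvexBody X :=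
  A.mapCLM (ContinuousLinearMap.inl ℝ ℂ ℂ) + B.mapCLM (ContinuousLinearMap.inr ℝ ℂ ℂ)

theorem mem_prodBody {A B : ConvexBody ℂ} {p : X} : p ∈ prodBody A B ↔ p.1 ∈ A ∧ p.2 ∈ B := by
  rw [prodBody, mem_add]
  constructor
  · rintro ⟨_, ⟨x, hx, rfl⟩, _, ⟨y, hy, rfl⟩, rfl⟩
    simpa using ⟨hx, hy⟩
  · rintro ⟨h1, h2⟩
    exact ⟨_, ⟨p.1, h1, rfl⟩, _, ⟨p.2, h2, rfl⟩, by simp⟩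

/-- The horizontal section of a set at height `y`. -/
def fiber (S : Set X) (y : ℂ) : Set ℂ := {x | (x, y) ∈ S}

variable {φ : ConvexBody X → ℝ}

/-- The planar functional `A ↦ φ (A × □)`. -/
def sqVal (φ : ConvexBody X → ℝ) (A : ConvexBody ℂ) : ℝ := φ (prodBody A unitSq)

theorem IsCTV.sqVal (h : IsCTV φ) : IsCTV (sqVal φ) :=
  (h.comp_add _).comp_mapCLM (ContinuousLinearMap.inl ℝ ℂ ℂ)

theorem convex_fiber (K : ConvexBody X) (y : ℂ) : Convex ℝ (fiber K y) := by
  intro x hx x' hx' a b ha hb hab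
  have := K.convex hx hx' ha hb hab
  have e : a • (x, y) + b • (x', y) = (a • x + b • x', y) := by
    rw [Prod.smul_mk, Prod.smul_mk, Prod.mk_add_mk, ← add_smul, hab, one_smul]
  rwa [e] at this

theorem isCompact_fiber (K : ConvexBody X) (y : ℂ) : IsCompact (fiber (K : Set X) y) := by
  have h1 : IsClosed (fiber (K : Set X) y) :=
    K.isClosed.preimage (by fun_prop : Continuous fun x : ℂ => (x, y))
  exact (K.isCompact.image continuous_fst).of_isClosed_subset h1 fun x hx => ⟨_, hx, rfl⟩

/-- The part of `K` over a square with corner `a + b I` and side `n⁻¹`, stretched vertically so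
that the square becomes the unit square. -/
def stretched (K : ConvexBody X) (a b n : ℝ) : Set X :=
  {p | p.2 ∈ unitSq ∧ (p.1, (⟨a, b⟩ : ℂ) + n⁻¹ • p.2) ∈ K}

theorem stretched_eq_image (K : ConvexBody X) (a b : ℝ) {n : ℝ} (hn : 0 < n) :
    stretched K a b n = (fun p : X => (p.1, n • (p.2 - ⟨a, b⟩))) '' cell K a b n := by
  have hn' := inv_pos.2 hn
  rw [Set.image_eq_preimage_of_inverse (g := fun p : X => (p.1, (⟨a, b⟩ : ℂ) + n⁻¹ • p.2))
    (fun p => by simp [hn.ne']) (fun p => by simp [hn.ne'])]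
  ext p
  simp only [stretched, cell, slab, Set.mem_ofPred_eq, Set.mem_preimage, Set.mem_inter_iff,
    mem_unitSq, reY_apply, imY_apply, Complex.add_re, Complex.add_im, Complex.smul_re,
    Complex.smul_im, smul_eq_mul, le_add_iff_nonneg_right, add_le_add_iff_left,
    mul_nonneg_iff_of_pos_left hn', mul_le_iff_le_one_right hn']
  tauto

theorem convex_cell (K : ConvexBody X) (a b n : ℝ) : Convex ℝ (cell K a b n) :=
  (K.convex.inter (convex_slab _ _ _)).inter (convex_slab _ _ _)

theorem isCompact_cell (K : ConvexBody X) (a b n : ℝ) : IsCompact (cell K a b n) :=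
  (K.isCompact.inter_right (isClosed_slab _ _ _)).inter_right (isClosed_slab _ _ _)

theorem Wt.hat_stretched (h : Wt 3 φ) (K : ConvexBody X) (a b : ℝ) {n : ℝ} (hn : 0 < n) :
    hat φ (stretched K a b n) = n ^ 2 * hat φ (cell K a b n) := by
  by_cases h0 : (cell K a b n).Nonempty
  · rw [hat_of_convex φ (convex_cell K a b n) (isCompact_cell K a b n) h0]
    set L : ConvexBody X := ⟨cell K a b n, convex_cell K a b n, isCompact_cell K a b n, h0⟩
    have e : stretched K a b n = ((L.translate (0, -⟨a, b⟩)).mapCLM (_root_.dil 1 n) : Set X) := by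
      rw [stretched_eq_image K a b hn]
      ext p
      refine Iff.trans ?_ mem_stretch.symm
      exact exists_congr fun v => and_congr Iff.rfl eq_comm
    rw [e, hat_coe, h.stretch L ⟨a, b⟩ hn]
    congr 1
    rw [← Real.rpow_natCast]; norm_num
  · rw [Set.not_nonempty_iff_eq_empty] at h0
    rw [stretched_eq_image K a b hn, h0, Set.image_empty, hat_empty, mul_zero]

theorem fiber_lipschitz (K : ConvexBody X) {y₀ : ℂ}
    (hy : y₀ ∈ interior (Prod.snd '' (K : Set X))) : ∃ r C : ℝ, 0 < r ∧ 0 ≤ C ∧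
      ∀ y₁ y₂, ‖y₁ - y₀‖ ≤ r → ‖y₂ - y₀‖ ≤ r → ∀ x₁, (x₁, y₁) ∈ K →
        ∃ x₂, (x₂, y₂) ∈ K ∧ ‖x₁ - x₂‖ ≤ C * ‖y₁ - y₂‖ := by
  obtain ⟨R, hR, hKR⟩ := K.exists_norm_le
  rw [mem_interior_iff_mem_nhds, Metric.nhds_basis_closedBall.mem_iff] at hy
  obtain ⟨ρ, hρ, hball⟩ := hy
  refine ⟨ρ / 4, 2 / ρ * (2 * R), by positivity, by positivity, fun y₁ y₂ h1 h2 x₁ hx₁ => ?_⟩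
  rcases eq_or_ne y₁ y₂ with rfl | hd
  · exact ⟨x₁, hx₁, by simp⟩
  have hd0 : 0 < ‖y₁ - y₂‖ := norm_pos_iff.2 (sub_ne_zero.2 hd)
  set d := ‖y₁ - y₂‖ with hd'
  have hdle : d ≤ ρ / 2 := by
    have : y₁ - y₂ = (y₁ - y₀) - (y₂ - y₀) := by ring
    rw [hd', this]
    exact (norm_sub_le _ _).trans (by linarith)
  set l := 2 * d / ρ with hl
  have hl0 : 0 < l := by positivity
  have hl1 : l ≤ 1 := by rw [hl, div_le_one hρ]; linarith
  set y₃ := y₂ + ((1 - l) / l) • (y₂ - y₁) with hy₃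
  have hy3 : y₃ ∈ Metric.closedBall y₀ ρ := by
    rw [mem_closedBall_iff_norm]
    have e : y₃ - y₀ = (y₂ - y₀) + ((1 - l) / l) • (y₂ - y₁) := by rw [hy₃]; ring
    have h3 : ‖((1 - l) / l) • (y₂ - y₁)‖ ≤ ρ / 2 := by
      rw [norm_smul, Real.norm_eq_abs, abs_of_nonneg (div_nonneg (by linarith) hl0.le),
        norm_sub_rev, ← hd', div_mul_eq_mul_div, div_le_iff₀ hl0]
      have : ρ / 2 * l = d := by rw [hl]; field_simp
      rw [this]
      nlinarith
    rw [e]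
    exact (norm_add_le _ _).trans (by linarith)
  obtain ⟨⟨x₃, y⟩, hx₃, hyy⟩ := hball hy3
  obtain rfl : y = y₃ := hyy
  refine ⟨(1 - l) • x₁ + l • x₃, ?_, ?_⟩
  · have := K.convex hx₁ hx₃ (sub_nonneg.2 hl1) hl0.le (by ring)
    have e : (1 - l) • (x₁, y₁) + l • (x₃, y₃) = ((1 - l) • x₁ + l • x₃, y₂) := by
      ext1
      · rfl
      · change (1 - l) • y₁ + l • y₃ = y₂
        rw [hy₃, smul_add, smul_smul, mul_div_cancel₀ _ hl0.ne', smul_sub]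
        module
    rwa [e] at this
  · have e : x₁ - ((1 - l) • x₁ + l • x₃) = l • (x₁ - x₃) := by module
    rw [e, norm_smul, Real.norm_eq_abs, abs_of_pos hl0]
    have h4 : ‖x₁ - x₃‖ ≤ 2 * R := (norm_sub_le _ _).trans (by
      have := (norm_fst_le (x₁, y₁)).trans (hKR _ hx₁)
      have := (norm_fst_le (x₃, y₃)).trans (hKR _ hx₃)
      simp only at *
      linarith)
    calc l * ‖x₁ - x₃‖ ≤ l * (2 * R) := by gcongr
      _ = 2 / ρ * (2 * R) * d := by rw [hl]; ring

/-- Convergence of the stretched cells at an interior point of the projection. -/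
theorem tendsto_hat_stretched (h : IsCTV φ) (K : ConvexBody X) {y₀ : ℂ}
    (hy : y₀ ∈ interior (Prod.snd '' (K : Set X))) {a b : ℕ → ℝ}
    (ha : ∀ n : ℕ, a n ≤ y₀.re ∧ y₀.re ≤ a n + ((n : ℝ) + 1)⁻¹)
    (hb : ∀ n : ℕ, b n ≤ y₀.im ∧ y₀.im ≤ b n + ((n : ℝ) + 1)⁻¹) :
    Filter.Tendsto (fun n : ℕ => hat φ (stretched K (a n) (b n) ((n : ℝ) + 1))) Filter.atTop
      (nhds (hat (sqVal φ) (fiber K y₀))) := by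
  obtain ⟨r, C, hr, hC, hlip⟩ := fiber_lipschitz K hy
  obtain ⟨⟨x₀, y⟩, hx₀, rfl : y = y₀⟩ := interior_subset hy
  have hne : (fiber (K : Set X) y).Nonempty := ⟨x₀, hx₀⟩
  rw [hat_of_convex _ (convex_fiber K y) (isCompact_fiber K y) hne]
  set F : ConvexBody ℂ := ⟨fiber K y, convex_fiber K y, isCompact_fiber K y, hne⟩
  set ε : ℕ → ℝ := fun n => 2 * ((n : ℝ) + 1)⁻¹ with hε
  have hεlim : Filter.Tendsto ε Filter.atTop (nhds 0) := by
    simpa [hε] using (tendsto_one_div_add_atTop_nhds_zero_nat (𝕜 := ℝ)).const_mul 2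
  have hclose : ∀ n (u : ℂ), u ∈ unitSq →
      ‖((⟨a n, b n⟩ : ℂ) + ((n : ℝ) + 1)⁻¹ • u) - y‖ ≤ ε n := by
    intro n u hu
    obtain ⟨⟨h1, h2⟩, h3, h4⟩ := mem_unitSq.1 hu
    have hn : (0 : ℝ) ≤ ((n : ℝ) + 1)⁻¹ := by positivity
    refine (Complex.norm_le_abs_re_add_abs_im _).trans ?_
    have e1 := mul_le_of_le_one_right hn h2
    have e2 := mul_le_of_le_one_right hn h4
    have e3 := mul_nonneg hn h1
    have e4 := mul_nonneg hn h3
    refine le_of_le_of_eq ?_ (two_mul _).symm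
    simp only [Complex.sub_re, Complex.add_re, Complex.smul_re, Complex.sub_im, Complex.add_im,
      Complex.smul_im, smul_eq_mul]
    exact add_le_add (abs_le.2 ⟨by linarith [(ha n).2], by linarith [(ha n).1]⟩)
      (abs_le.2 ⟨by linarith [(hb n).2], by linarith [(hb n).1]⟩)
  have hev : ∀ᶠ n in Filter.atTop, ε n ≤ r := hεlim.eventually_le_const hr
  have hT : ∀ n, ε n ≤ r → ∃ T : ConvexBody X, (T : Set X) = stretched K (a n) (b n) ((n : ℝ) + 1) ∧
      dist T (prodBody F unitSq) ≤ C * ε n := by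
    intro n hn
    have hn0 : (0 : ℝ) < (n : ℝ) + 1 := by positivity
    have hεn : 0 ≤ ε n := by rw [hε]; positivity
    have hy0 : ‖y - y‖ ≤ r := by simpa using hr.le
    have hfwd : ∀ p ∈ stretched K (a n) (b n) ((n : ℝ) + 1),
        ∃ q ∈ prodBody F unitSq, dist p q ≤ C * ε n := by
      rintro ⟨x, u⟩ ⟨hu, hx⟩
      obtain ⟨x₂, hx₂, hd⟩ := hlip _ y ((hclose n u hu).trans hn) hy0 _ hx
      refine ⟨(x₂, u), mem_prodBody.2 ⟨hx₂, hu⟩, ?_⟩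
      rw [Prod.dist_eq]
      simp only [dist_self, dist_eq_norm]
      exact max_le (hd.trans (mul_le_mul_of_nonneg_left (hclose n u hu) hC)) (by positivity)
    have hbwd : ∀ q ∈ prodBody F unitSq, ∃ p ∈ stretched K (a n) (b n) ((n : ℝ) + 1),
        dist p q ≤ C * ε n := by
      rintro ⟨x, u⟩ hq
      obtain ⟨hx, hu⟩ := mem_prodBody.1 hq
      obtain ⟨x₂, hx₂, hd⟩ := hlip y _ hy0 ((hclose n u hu).trans hn) x hx
      refine ⟨(x₂, u), ⟨hu, hx₂⟩, ?_⟩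
      rw [Prod.dist_eq]
      simp only [dist_self, dist_eq_norm]
      rw [norm_sub_rev, norm_sub_rev y] at hd
      exact max_le (hd.trans (mul_le_mul_of_nonneg_left (hclose n u hu) hC)) (by positivity)
    have hconv : Convex ℝ (stretched K (a n) (b n) ((n : ℝ) + 1)) := by
      intro p hp q hq s t hs ht hst
      refine ⟨unitSq.convex hp.1 hq.1 hs ht hst, ?_⟩
      have := K.convex hp.2 hq.2 hs ht hst
      refine (congrArg (· ∈ (K : Set X)) ?_).mpr this
      ext1
      · rfl
      · simp only [Prod.snd_add, Prod.smul_snd]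
        obtain rfl := eq_sub_of_add_eq hst
        module
    have hcpt : IsCompact (stretched K (a n) (b n) ((n : ℝ) + 1)) := by
      rw [stretched_eq_image K _ _ hn0]
      exact (isCompact_cell K _ _ _).image (by fun_prop)
    obtain ⟨p, hp, -⟩ := hbwd (x₀, 0) (mem_prodBody.2 ⟨hx₀, mem_unitSq.2 (by simp)⟩)
    exact ⟨⟨_, hconv, hcpt, ⟨p, hp⟩⟩, rfl, dist_le_of_forall (by positivity) hfwd hbwd⟩
  choose! T hT1 hT2 using hT
  have hlim : Filter.Tendsto T Filter.atTop (nhds (prodBody F unitSq)) := by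
    rw [tendsto_iff_dist_tendsto_zero]
    have h1 : Filter.Tendsto (fun n => C * ε n) Filter.atTop (nhds 0) := by
      simpa using hεlim.const_mul C
    refine squeeze_zero' (Filter.Eventually.of_forall fun _ => dist_nonneg) ?_ h1
    filter_upwards [hev] with n hn using hT2 n hn
  refine Filter.Tendsto.congr' ?_ ((h.cont.tendsto _).comp hlim)
  filter_upwards [hev] with n hn
  rw [← hT1 n hn, hat_coe]
  rfl

end Fiber

section FiberIntegral

open ConvexBody

local notation "X" => ℂ × ℂ

variable {φ : ConvexBody X → ℝ}

/-- Half open squares in the plane. -/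
def halfSq (a b r : ℝ) : Set ℂ := Set.Ico a (a + r) ×ℂ Set.Ico b (b + r)

theorem mem_halfSq {a b r : ℝ} {y : ℂ} :
    y ∈ halfSq a b r ↔ (a ≤ y.re ∧ y.re < a + r) ∧ b ≤ y.im ∧ y.im < b + r := Iff.rfl

theorem halfSq_eq_preimage (a b r : ℝ) : halfSq a b r =
    Complex.measurableEquivRealProd ⁻¹' (Set.Ico a (a + r) ×ˢ Set.Ico b (b + r)) := rfl

theorem measurableSet_halfSq (a b r : ℝ) : MeasurableSet (halfSq a b r) :=
  Complex.measurableEquivRealProd.measurable (measurableSet_Ico.prod measurableSet_Ico)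

theorem volume_halfSq (a b : ℝ) {r : ℝ} (hr : 0 ≤ r) :
    volume (halfSq a b r) = ENNReal.ofReal (r ^ 2) := by
  rw [halfSq_eq_preimage, Complex.volume_preserving_equiv_real_prod.measure_preimage
    (measurableSet_Ico.prod measurableSet_Ico).nullMeasurableSet, Measure.volume_eq_prod,
    Measure.prod_prod, Real.volume_Ico, Real.volume_Ico, add_sub_cancel_left, add_sub_cancel_left,
    ← ENNReal.ofReal_mul hr, sq]

/-- The step function approximating the fibre functional. -/
def stepFn (φ : ConvexBody X → ℝ) (K : ConvexBody X) (m n : ℕ) (y : ℂ) : ℝ :=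
  ∑ k ∈ Finset.range (2 * m * n), ∑ l ∈ Finset.range (2 * m * n),
    (halfSq (-m + k * (n : ℝ)⁻¹) (-m + l * (n : ℝ)⁻¹) (n : ℝ)⁻¹).indicator
      (fun _ => (n : ℝ) ^ 2 *
        hat φ (cell K (-m + k * (n : ℝ)⁻¹) (-m + l * (n : ℝ)⁻¹) n)) y

theorem grid_unique {m n : ℕ} (hn : 0 < n) {k k' : ℕ} {x : ℝ}
    (h1 : -m + k * (n : ℝ)⁻¹ ≤ x) (h2 : x < -m + k * (n : ℝ)⁻¹ + (n : ℝ)⁻¹)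
    (h3 : -m + k' * (n : ℝ)⁻¹ ≤ x) (h4 : x < -m + k' * (n : ℝ)⁻¹ + (n : ℝ)⁻¹) : k = k' := by
  have hn' : (0 : ℝ) < (n : ℝ)⁻¹ := by positivity
  have e1 : (k : ℝ) < k' + 1 := lt_of_mul_lt_mul_right (by linarith) hn'.le
  have e2 : (k' : ℝ) < k + 1 := lt_of_mul_lt_mul_right (by linarith) hn'.le
  norm_cast at e1 e2
  omega

theorem exists_grid {m n : ℕ} (hn : 0 < n) {x : ℝ} (h1 : -m ≤ x) (h2 : x < m) :
    ∃ k ∈ Finset.range (2 * m * n), -m + k * (n : ℝ)⁻¹ ≤ x ∧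
      x < -m + k * (n : ℝ)⁻¹ + (n : ℝ)⁻¹ := by
  have hn' : (0 : ℝ) < n := by exact_mod_cast hn
  have h0 : 0 ≤ n * (x + m) := mul_nonneg hn'.le (by linarith)
  have h3 := Nat.floor_le h0
  have h4 := Nat.lt_floor_add_one (n * (x + m))
  refine ⟨⌊n * (x + m)⌋₊, ?_, ?_, ?_⟩
  · rw [Finset.mem_range, Nat.floor_lt h0]
    push_cast
    nlinarith
  · have := mul_le_mul_of_nonneg_left h3 (inv_pos.2 hn').le
    rw [inv_mul_cancel_left₀ hn'.ne'] at this
    linarith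
  · have := mul_lt_mul_of_pos_left h4 (inv_pos.2 hn')
    rw [inv_mul_cancel_left₀ hn'.ne'] at this
    linarith

theorem stepFn_eq {K : ConvexBody X} {m n : ℕ} (hn : 0 < n) {k l : ℕ}
    (hk : k ∈ Finset.range (2 * m * n)) (hl : l ∈ Finset.range (2 * m * n)) {y : ℂ}
    (hy : y ∈ halfSq (-m + k * (n : ℝ)⁻¹) (-m + l * (n : ℝ)⁻¹) (n : ℝ)⁻¹) :
    stepFn φ K m n y = (n : ℝ) ^ 2 *
        hat φ (cell K (-m + k * (n : ℝ)⁻¹) (-m + l * (n : ℝ)⁻¹) n) := by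
  obtain ⟨⟨h1, h2⟩, h3, h4⟩ := mem_halfSq.1 hy
  rw [stepFn, Finset.sum_eq_single_of_mem k hk, Finset.sum_eq_single_of_mem l hl,
    Set.indicator_of_mem hy]
  · intro l' _ hne
    refine Set.indicator_of_notMem (fun h => hne ?_) _
    obtain ⟨-, h5, h6⟩ := mem_halfSq.1 h
    exact grid_unique hn h5 h6 h3 h4
  · intro k' _ hne
    refine Finset.sum_eq_zero fun l' _ => Set.indicator_of_notMem (fun h => hne ?_) _
    obtain ⟨⟨h5, h6⟩, -⟩ := mem_halfSq.1 h
    exact grid_unique hn h5 h6 h1 h2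

theorem stepFn_cases (K : ConvexBody X) {m n : ℕ} (hn : 0 < n) (y : ℂ) :
    stepFn φ K m n y = 0 ∨ ∃ k ∈ Finset.range (2 * m * n), ∃ l ∈ Finset.range (2 * m * n),
      y ∈ halfSq (-m + k * (n : ℝ)⁻¹) (-m + l * (n : ℝ)⁻¹) (n : ℝ)⁻¹ ∧
      stepFn φ K m n y = (n : ℝ) ^ 2 *
        hat φ (cell K (-m + k * (n : ℝ)⁻¹) (-m + l * (n : ℝ)⁻¹) n) := by
  by_cases h : ∃ k ∈ Finset.range (2 * m * n), ∃ l ∈ Finset.range (2 * m * n),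
      y ∈ halfSq (-m + k * (n : ℝ)⁻¹) (-m + l * (n : ℝ)⁻¹) (n : ℝ)⁻¹
  · obtain ⟨k, hk, l, hl, hy⟩ := h
    exact Or.inr ⟨k, hk, l, hl, hy, stepFn_eq hn hk hl hy⟩
  · push Not at h
    refine Or.inl (Finset.sum_eq_zero fun k hk => Finset.sum_eq_zero fun l hl => ?_)
    exact Set.indicator_of_notMem (h k hk l hl) _

theorem measurable_stepFn (K : ConvexBody X) (m n : ℕ) : Measurable (stepFn φ K m n) := by
  refine Finset.measurable_fun_sum _ fun k _ => Finset.measurable_fun_sum _ fun l _ => ?_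
  exact measurable_const.indicator (measurableSet_halfSq _ _ _)

theorem Wt.integral_stepFn (h : Wt 3 φ) (K : ConvexBody X) {m n : ℕ} (hn : 0 < n)
    (hm : ∀ p ∈ K, ‖p‖ ≤ m) : ∫ y, stepFn φ K m n y = φ K := by
  have hint : ∀ a b c : ℝ, Integrable ((halfSq a b (n : ℝ)⁻¹).indicator fun _ => c) := by
    intro a b c
    refine (integrable_indicator_iff (measurableSet_halfSq _ _ _)).2 ?_
    refine integrableOn_const (by rw [volume_halfSq _ _ (by positivity)]; exact ENNReal.ofReal_ne_top)
  unfold stepFn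
  rw [integral_finsetSum _ fun k _ => integrable_finsetSum _ fun l _ => hint _ _ _,
    h.eq_sum_cell (by norm_num) K hm hn]
  refine Finset.sum_congr rfl fun k _ => ?_
  rw [integral_finsetSum _ fun l _ => hint _ _ _]
  refine Finset.sum_congr rfl fun l _ => ?_
  rw [integral_indicator_const _ (measurableSet_halfSq _ _ _), measureReal_def,
    volume_halfSq _ _ (by positivity), ENNReal.toReal_ofReal (by positivity), smul_eq_mul,
    ← mul_assoc, ← mul_pow, inv_mul_cancel₀ (by positivity), one_pow, one_mul]

theorem Wt.integral_fiber (h : Wt 3 φ) (K : ConvexBody X) :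
    (Integrable fun y => hat (sqVal φ) (fiber K y)) ∧
      φ K = ∫ y, hat (sqVal φ) (fiber K y) := by
  obtain ⟨m₀, hm₀, hmK'⟩ := exists_nat_bound K
  set m := m₀ + 1 with hm
  have hmlt : ∀ p ∈ K, ‖p‖ < m := fun p hp => (hmK' p hp).trans_lt (by rw [hm]; push_cast; linarith)
  have hmK : ∀ p ∈ K, ‖p‖ ≤ m := fun p hp => (hmlt p hp).le
  obtain ⟨C, hC, hb⟩ := h.abs_hat_cell_le (by norm_num) m
  have hbound : ∀ n : ℕ, ∀ y, ‖stepFn φ K m (n + 1) y‖ ≤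
      (Metric.closedBall (0 : ℂ) (2 * m)).indicator (fun _ => C) y := by
    intro n y
    have hn : (0 : ℝ) < ((n + 1 : ℕ) : ℝ) := by positivity
    rcases stepFn_cases (φ := φ) K (m := m) (Nat.succ_pos n) y with h0 | ⟨k, hk, l, hl, hy, he⟩
    · rw [h0, norm_zero]; exact Set.indicator_nonneg (fun _ _ => hC) _
    · have hin : y ∈ Metric.closedBall (0 : ℂ) (2 * m) := by
        have hgrid : ∀ j ∈ Finset.range (2 * m * (n + 1)), -(m : ℝ) ≤ -m + j * ((n + 1 : ℕ) : ℝ)⁻¹ ∧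
            -m + j * ((n + 1 : ℕ) : ℝ)⁻¹ + ((n + 1 : ℕ) : ℝ)⁻¹ ≤ m := by
          intro j hj
          have h1 : (0 : ℝ) ≤ j * ((n + 1 : ℕ) : ℝ)⁻¹ := by positivity
          refine ⟨by linarith, ?_⟩
          have h2 : ((j + 1 : ℕ) : ℝ) ≤ ((2 * m * (n + 1) : ℕ) : ℝ) :=
            Nat.cast_le.2 (Finset.mem_range.1 hj)
          have h3 := mul_le_mul_of_nonneg_right h2 (inv_pos.2 hn).le
          push_cast at h3 hn ⊢
          have h4 : 2 * (m : ℝ) * (n + 1) * ((n : ℝ) + 1)⁻¹ = 2 * m := by field_simp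
          rw [h4] at h3
          linarith
        obtain ⟨⟨h1, h2⟩, h3, h4⟩ := mem_halfSq.1 hy
        rw [mem_closedBall_zero_iff]
        refine (Complex.norm_le_abs_re_add_abs_im y).trans ?_
        have e1 : |y.re| ≤ m := abs_le.2 ⟨by linarith [(hgrid k hk).1], by linarith [(hgrid k hk).2]⟩
        have e2 : |y.im| ≤ m := abs_le.2 ⟨by linarith [(hgrid l hl).1], by linarith [(hgrid l hl).2]⟩
        linarith
      rw [Set.indicator_of_mem hin, he, norm_mul, Real.norm_eq_abs, Real.norm_eq_abs,
        abs_of_nonneg (by positivity)]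
      have h1 := hb _ hn K (-m + k * ((n + 1 : ℕ) : ℝ)⁻¹) (-m + l * ((n + 1 : ℕ) : ℝ)⁻¹)
        fun p hp => (norm_fst_le p).trans (hmK p hp)
      have h2 : ((n + 1 : ℕ) : ℝ) ^ (-((((3 : ℕ) : ℝ) + 1) / 2)) = (((n + 1 : ℕ) : ℝ) ^ 2)⁻¹ := by
        rw [← Real.rpow_natCast _ 2, ← Real.rpow_neg hn.le]; norm_num
      rw [h2] at h1
      refine (mul_le_mul_of_nonneg_left h1 (sq_nonneg _)).trans_eq ?_
      field_simp
  have hlim : ∀ᵐ y, Filter.Tendsto (fun n : ℕ => stepFn φ K m (n + 1) y) Filter.atTop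
      (nhds (hat (sqVal φ) (fiber K y))) := by
    have hπc : Convex ℝ (Prod.snd '' (K : Set X)) :=
      K.convex.linear_image (LinearMap.snd ℝ ℂ ℂ)
    have hπk : IsCompact (Prod.snd '' (K : Set X)) := K.isCompact.image continuous_snd
    have h0 : ∀ᵐ y : ℂ, y ∉ frontier (Prod.snd '' (K : Set X)) :=
      measure_eq_zero_iff_ae_notMem.1 (hπc.addHaar_frontier volume)
    filter_upwards [h0] with y hy
    by_cases hyK : y ∈ Prod.snd '' (K : Set X)
    · have hyi : y ∈ interior (Prod.snd '' (K : Set X)) := by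
        by_contra hcon
        exact hy ⟨subset_closure hyK, hcon⟩
      have hyn : ‖y‖ < m := by
        obtain ⟨p, hp, rfl⟩ := hyK
        exact (norm_snd_le p).trans_lt (hmlt p hp)
      have hre := abs_lt.1 ((Complex.abs_re_le_norm y).trans_lt hyn)
      have him := abs_lt.1 ((Complex.abs_im_le_norm y).trans_lt hyn)
      choose k hk hk1 hk2 using fun n : ℕ => exists_grid (m := m) (Nat.succ_pos n) hre.1.le hre.2
      choose l hl hl1 hl2 using fun n : ℕ => exists_grid (m := m) (Nat.succ_pos n) him.1.le him.2
      have ht := tendsto_hat_stretched h.toIsCTV K hyi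
        (a := fun n => -m + k n * ((n + 1 : ℕ) : ℝ)⁻¹) (b := fun n => -m + l n * ((n + 1 : ℕ) : ℝ)⁻¹)
        (fun n => ⟨hk1 n, by have := (hk2 n).le; push_cast at this ⊢; exact this⟩)
        (fun n => ⟨hl1 n, by have := (hl2 n).le; push_cast at this ⊢; exact this⟩)
      refine ht.congr fun n => ?_
      rw [stepFn_eq (Nat.succ_pos n) (hk n) (hl n) (mem_halfSq.2 ⟨⟨hk1 n, hk2 n⟩, hl1 n, hl2 n⟩),
        h.hat_stretched _ _ _ (by positivity)]
      push_cast
      rfl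
    · have hf : fiber (K : Set X) y = ∅ :=
        Set.eq_empty_iff_forall_notMem.2 fun x hx => hyK ⟨_, hx, rfl⟩
      rw [hf, hat_empty]
      have hopen : (Prod.snd '' (K : Set X))ᶜ ∈ nhds y := hπk.isClosed.isOpen_compl.mem_nhds hyK
      obtain ⟨ε, hε, hball⟩ := Metric.mem_nhds_iff.1 hopen
      have hev : ∀ᶠ n : ℕ in Filter.atTop, 2 * ((n : ℝ) + 1)⁻¹ < ε := by
        have := (tendsto_one_div_add_atTop_nhds_zero_nat (𝕜 := ℝ)).const_mul 2
        rw [mul_zero] at this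
        simpa using this.eventually_lt_const hε
      refine tendsto_const_nhds.congr' ?_
      filter_upwards [hev] with n hn
      rcases stepFn_cases (φ := φ) K (m := m) (Nat.succ_pos n) y with h0 | ⟨k, hk, l, hl, hy, he⟩
      · exact h0.symm
      · rw [he]
        have : cell K (-m + k * ((n + 1 : ℕ) : ℝ)⁻¹) (-m + l * ((n + 1 : ℕ) : ℝ)⁻¹)
            ((n + 1 : ℕ) : ℝ) = ∅ := by
          refine Set.eq_empty_iff_forall_notMem.2 ?_
          rintro p ⟨⟨hp, h1, h2⟩, h3, h4⟩
          refine hball ?_ ⟨p, hp, rfl⟩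
          rw [mem_ball_iff_norm]
          obtain ⟨⟨h5, h6⟩, h7, h8⟩ := mem_halfSq.1 hy
          simp only [reY_apply, imY_apply] at h1 h2 h3 h4
          push_cast at *
          refine (Complex.norm_le_abs_re_add_abs_im _).trans_lt (lt_of_le_of_lt ?_ hn)
          rw [Complex.sub_re, Complex.sub_im, two_mul]
          exact add_le_add (abs_le.2 ⟨by linarith, by linarith⟩) (abs_le.2 ⟨by linarith, by linarith⟩)
        rw [this, hat_empty, mul_zero]
  have hint : Integrable ((Metric.closedBall (0 : ℂ) (2 * m)).indicator (fun _ => C)) :=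
    (integrable_indicator_iff Metric.isClosed_closedBall.measurableSet).2
      (integrableOn_const (isCompact_closedBall _ _).measure_lt_top.ne)
  have hmeas : ∀ n : ℕ, AEStronglyMeasurable (stepFn φ K m (n + 1)) volume :=
    fun n => (measurable_stepFn K m (n + 1)).aestronglyMeasurable
  refine ⟨hint.mono' (aestronglyMeasurable_of_tendsto_ae Filter.atTop hmeas hlim) ?_, ?_⟩
  · filter_upwards [hlim] with y hy
    exact le_of_tendsto hy.norm (Filter.Eventually.of_forall fun n => hbound n y)
  have hconv := tendsto_integral_of_dominated_convergence
    (F := fun n => stepFn φ K m (n + 1)) (f := fun y => hat (sqVal φ) (fiber K y)) _ hmeas hint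
    (fun n => Filter.Eventually.of_forall (hbound n)) hlim
  simp only [h.integral_stepFn K (Nat.succ_pos _) hmK] at hconv
  exact tendsto_nhds_unique tendsto_const_nhds hconv

end FiberIntegral

section Decomposition

open ConvexBody

local notation "X" => ℂ × ℂ

variable {φ : ConvexBody X → ℝ}

/-- The body `0 × L`. -/
def vert (L : ConvexBody ℂ) : ConvexBody X := L.mapCLM (ContinuousLinearMap.inr ℝ ℂ ℂ)

theorem mem_vert {L : ConvexBody ℂ} {p : X} : p ∈ vert L ↔ p.1 = 0 ∧ p.2 ∈ L := by
  rw [vert, mem_mapCLM]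
  constructor
  · rintro ⟨x, hx, rfl⟩; simpa using hx
  · rintro ⟨h1, h2⟩; exact ⟨p.2, h2, Prod.ext (by simp [h1]) rfl⟩

theorem prodBody_zero (B : ConvexBody ℂ) : prodBody 0 B = vert B := by
  ext p
  refine mem_prodBody.trans (Iff.trans ?_ mem_vert.symm)
  rw [show p.1 ∈ (0 : ConvexBody ℂ) ↔ p.1 = 0 from Iff.rfl]

/-- The projection of a body to the second coordinate. -/
def projY (K : ConvexBody X) : ConvexBody ℂ := K.mapCLM (ContinuousLinearMap.snd ℝ ℂ ℂ)

theorem vert_projY (K : ConvexBody X) : vert (projY K) = K.mapCLM (dil 0 1) := by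
  rw [vert, projY, mapCLM_mapCLM]
  congr 1
  exact ContinuousLinearMap.ext fun v => by simp [dil_apply]

theorem projY_prodBody (A B : ConvexBody ℂ) : projY (prodBody A B) = B := by
  ext y
  constructor
  · rintro ⟨p, hp, rfl⟩; exact (mem_prodBody.1 hp).2
  · intro hy
    obtain ⟨a, ha⟩ := A.nonempty
    exact ⟨(a, y), mem_prodBody.2 ⟨ha, hy⟩, rfl⟩

theorem Wt.three_vert (h : Wt 3 φ) (L : ConvexBody ℂ) : φ (vert L) = 0 := by
  have h1 := h.dil 2 1 (vert L) two_pos one_pos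
  have h2 : (vert L).mapCLM (_root_.dil 2 1) = vert L := by
    rw [vert, mapCLM_mapCLM]
    congr 1
    exact ContinuousLinearMap.ext fun v => by simp [dil_apply]
  rw [h2] at h1
  norm_num at h1
  linarith

theorem Wt.three_sqVal (h : Wt 3 φ) : IsHom 1 (sqVal φ) := by
  refine ⟨h.toIsCTV.sqVal, fun A t ht => ?_⟩
  rcases ht.eq_or_lt with rfl | ht
  · rw [zero_smul', sqVal, prodBody_zero, h.three_vert]; simp
  · have h1 := h.dil t 1 (prodBody A unitSq) ht one_pos
    have h2 : (prodBody A unitSq).mapCLM (_root_.dil t 1) = prodBody (t • A) unitSq := by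
      rw [prodBody, prodBody, mapCLM_add, mapCLM_mapCLM, mapCLM_mapCLM, smul_eq_mapCLM,
        mapCLM_mapCLM]
      congr 2 <;> exact ContinuousLinearMap.ext fun v => by simp [dil_apply]
    rw [h2] at h1
    norm_num at h1
    rw [sqVal, sqVal, h1, pow_one]

theorem Wt.one_eq_vert (h : Wt 1 φ) (K : ConvexBody X) : φ K = φ (vert (projY K)) := by
  rw [vert_projY]; exact h.one_eq K

theorem Adm.eq_scaled (h : Adm φ) (K : ConvexBody X) {t : ℝ} (ht : 0 ≤ t) :
    φ (t • K) = t * mcm 4 φ 1 K + t ^ 3 * mcm 4 φ 3 K := by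
  rw [h.toIsCTV.mcm_sum finrank_X.le K ht]
  simp only [Finset.sum_range_succ, Finset.sum_range_zero]
  rw [(h.wt_mcm (i := 0) (by norm_num)).zero_eq_zero, (h.wt_mcm (i := 2) (by norm_num)).two_eq_zero,
    (h.wt_mcm (i := 4) (by norm_num)).four_eq_zero]
  ring

theorem Adm.eq_add (h : Adm φ) (K : ConvexBody X) :
    φ K = mcm 4 φ 1 K + mcm 4 φ 3 K := by
  have := h.eq_scaled K (t := 1) zero_le_one
  have e : (1 : ℝ) • K = K := one_smul ℝ K
  rw [e, one_pow, one_mul, one_mul] at this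
  exact this

theorem Adm.vert_eq (h : Adm φ) (L : ConvexBody ℂ) : mcm 4 φ 1 (vert L) = φ (vert L) := by
  rw [h.eq_add, (h.wt_mcm (i := 3) (by norm_num)).three_vert, add_zero]

theorem Adm.isHom_vert (h : Adm φ) : IsHom 1 fun L => φ (vert L) := by
  refine ⟨h.toIsCTV.comp_mapCLM _, fun L t ht => ?_⟩
  have : vert (t • L) = t • vert L := by rw [vert, mapCLM_smul]; rfl
  rw [this, h.eq_scaled _ ht, (h.wt_mcm (i := 3) (by norm_num)).three_vert, h.vert_eq]
  ring

theorem Adm.one_eq (h : Adm φ) (K : ConvexBody X) : mcm 4 φ 1 K = φ (vert (projY K)) := by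
  rw [(h.wt_mcm (i := 1) (by norm_num)).one_eq_vert, h.vert_eq]

theorem Adm.sqVal_three (h : Adm φ) (A : ConvexBody ℂ) :
    sqVal (mcm 4 φ 3) A = φ (prodBody A unitSq) - φ (prodBody 0 unitSq) := by
  rw [h.eq_add (prodBody A unitSq), h.one_eq (prodBody A unitSq), prodBody_zero, projY_prodBody,
    sqVal]
  ring

/-- An admissible valuation is determined by its values on the bodies `0 × L` and `A × □`. -/
theorem Adm.eq_zero (h : Adm φ) (h1 : ∀ L, φ (vert L) = 0)
    (h2 : ∀ A, φ (prodBody A unitSq) = 0) (K : ConvexBody X) : φ K = 0 := by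
  have h3 : ∀ S : Set ℂ, hat (sqVal (mcm 4 φ 3)) S = 0 := by
    intro S
    unfold hat
    split_ifs with hS
    · rw [h.sqVal_three, h2, h2, sub_zero]
    · rfl
  rw [h.eq_add, h.one_eq, h1, ((h.wt_mcm (i := 3) (by norm_num)).integral_fiber K).2]
  simp [h3]

end Decomposition

section Volume

open ConvexBody Filter Topology Measure

variable {V : Type*} [NormedAddCommGroup V] [NormedSpace ℝ V] [FiniteDimensional ℝ V]

theorem mem_of_closedBall_subset {K L : ConvexBody V} {x : V} {r : ℝ} (hr : 0 ≤ r)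
    (h : Metric.closedBall x r ⊆ K) (hd : dist K L < r) : x ∈ L := by
  by_contra hx
  obtain ⟨g, u, h1, h2⟩ := geometric_hahn_banach_closed_point L.convex L.isClosed hx
  have h3 : hSupp L g ≤ u := hSupp_le fun a ha => (h1 a ha).le
  have h4 : ((point x + r • unitBall V : ConvexBody V) : Set V) ⊆ K := by
    rintro _ ⟨_, rfl, _, ⟨z, hz, rfl⟩, rfl⟩
    refine h ?_
    have : ‖r • z‖ ≤ r * 1 := by
      rw [norm_smul, Real.norm_of_nonneg hr]
      exact mul_le_mul_of_nonneg_left (mem_unitBall.1 hz) hr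
    simpa using this
  have h5 := hSupp_mono h4 g
  rw [hSupp_add, hSupp_point, hSupp_smul _ hr] at h5
  have h6 := mul_le_mul_of_nonneg_left (norm_le_hSupp_unitBall g) hr
  have h7 := (abs_le.1 (abs_hSupp_sub_le K L g)).2
  have h8 : ‖g‖ * dist K L ≤ ‖g‖ * r := mul_le_mul_of_nonneg_left hd.le (norm_nonneg g)
  linarith [mul_comm r ‖g‖]

variable [MeasurableSpace V] [BorelSpace V] (μ : Measure V) [μ.IsAddHaarMeasure]

/-- The volume of a convex body. -/
def vol (K : ConvexBody V) : ℝ := (μ (K : Set V)).toReal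

theorem vol_mono {K L : ConvexBody V} (h : (K : Set V) ⊆ L) : vol μ K ≤ vol μ L :=
  ENNReal.toReal_mono L.isCompact.measure_ne_top (measure_mono h)

theorem continuous_vol : Continuous (vol μ) := by
  refine continuous_iff_continuousAt.2 fun K => ?_
  obtain ⟨R, hR, hK⟩ := K.exists_norm_le
  have hc : IsCompact (Metric.closedBall (0 : V) (R + 1)) := isCompact_closedBall _ _
  have key := tendsto_measure_of_ae_tendsto_indicator (μ := μ) (𝓝 K) (A := (K : Set V))
    (As := fun L : ConvexBody V => (L : Set V)) (B := Metric.closedBall 0 (R + 1))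
    K.isClosed.measurableSet (fun L => L.isClosed.measurableSet) hc.measurableSet
    hc.measure_ne_top ?_ ?_
  · exact (ENNReal.tendsto_toReal K.isCompact.measure_ne_top).comp key
  · filter_upwards [Metric.ball_mem_nhds K one_pos] with L hL x hx
    obtain ⟨y, hy, hxy⟩ := exists_dist_le (K := L) (L := K) hx
    rw [mem_closedBall_zero_iff]
    rw [dist_eq_norm] at hxy
    have := norm_add_le (x - y) y
    rw [sub_add_cancel] at this
    linarith [hK y hy, Metric.mem_ball.1 hL]
  · have h0 : μ (frontier (K : Set V)) = 0 := K.convex.addHaar_frontier μ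
    filter_upwards [measure_eq_zero_iff_ae_notMem.1 h0] with x hx
    by_cases hxK : x ∈ (K : Set V)
    · have hi : x ∈ interior (K : Set V) := by
        by_contra hi
        exact hx ⟨subset_closure hxK, hi⟩
      obtain ⟨r, hr, hb⟩ := Metric.nhds_basis_closedBall.mem_iff.1 (mem_interior_iff_mem_nhds.1 hi)
      filter_upwards [Metric.ball_mem_nhds K hr] with L hL
      exact iff_of_true (mem_of_closedBall_subset hr.le hb
        (by rw [dist_comm]; exact Metric.mem_ball.1 hL)) hxK
    · obtain ⟨r, hr, hb⟩ := Metric.nhds_basis_ball.mem_iff.1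
        (K.isClosed.isOpen_compl.mem_nhds hxK)
      filter_upwards [Metric.ball_mem_nhds K hr] with L hL
      refine iff_of_false (fun hxL => ?_) hxK
      obtain ⟨y, hy, hxy⟩ := exists_dist_le (K := L) (L := K) hxL
      refine hb (Metric.mem_ball.2 ?_) hy
      rw [dist_comm]
      exact hxy.trans_lt (Metric.mem_ball.1 hL)

theorem vol_translate (K : ConvexBody V) (x : V) : vol μ (K.translate x) = vol μ K := by
  rw [vol, vol, coe_translate]
  rw [Set.image_add_left, measure_preimage_add]

theorem vol_mapCLM (f : V →L[ℝ] V) (K : ConvexBody V) :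
    vol μ (K.mapCLM f) = |LinearMap.det (f : V →ₗ[ℝ] V)| * vol μ K := by
  rw [vol, vol, coe_mapCLM, addHaar_image_continuousLinearMap, ENNReal.toReal_mul,
    ENNReal.toReal_ofReal (abs_nonneg _)]

theorem isCTV_vol : IsCTV (vol μ) := by
  refine ⟨continuous_vol μ, fun K L hU hI => ?_, fun K x => vol_translate μ K x⟩
  have := measure_union_add_inter (μ := μ) (K : Set V) (t := (L : Set V)) L.isClosed.measurableSet
  have h := congrArg ENNReal.toReal this
  rwa [ENNReal.toReal_add (K.isCompact.union L.isCompact).measure_ne_top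
    (K.isCompact.inter L.isCompact).measure_ne_top, ENNReal.toReal_add K.isCompact.measure_ne_top
    L.isCompact.measure_ne_top] at h

theorem isHom_vol : IsHom (finrank ℝ V) (vol μ) := by
  refine ⟨isCTV_vol μ, fun K t ht => ?_⟩
  rw [smul_eq_mapCLM, vol_mapCLM]
  simp [abs_of_nonneg ht, LinearMap.det_smul]

end Volume

section Triangles

open ConvexBody Complex

theorem IsValuation.cut {V : Type*} [NormedAddCommGroup V] [NormedSpace ℝ V]
    {φ : ConvexBody V → ℝ} (h : IsValuation φ) {K A B C : ConvexBody V} (g : V →L[ℝ] ℝ)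
    (c : ℝ) (hC : ∀ x, x ∈ C ↔ x ∈ K ∧ g x = c) (hA : ∀ x, x ∈ A ↔ x ∈ K ∧ g x ≤ c)
    (hB : ∀ x, x ∈ B ↔ x ∈ K ∧ c ≤ g x) : φ K + φ C = φ A + φ B := by
  have := hat_cut h K.convex K.isCompact g c
  rwa [← show (C : Set V) = (K : Set V) ∩ {x | g x = c} from Set.ext hC,
    ← show (A : Set V) = (K : Set V) ∩ {x | g x ≤ c} from Set.ext hA,
    ← show (B : Set V) = (K : Set V) ∩ {x | c ≤ g x} from Set.ext hB, hat_coe, hat_coe, hat_coe,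
    hat_coe] at this

theorem mem_translate_iff {V : Type*} [NormedAddCommGroup V] [NormedSpace ℝ V]
    {K : ConvexBody V} {x y : V} : y ∈ K.translate x ↔ y - x ∈ K := by
  refine Iff.trans mem_translate ⟨?_, fun h => ⟨_, h, by abel⟩⟩
  rintro ⟨z, hz, rfl⟩
  simpa using hz

/-- The linear map of the plane sending `1` to `u` and `i` to `v`. -/
def lin (u v : ℂ) : ℂ →L[ℝ] ℂ := reCLM.smulRight u + imCLM.smulRight v

theorem lin_apply (u v z : ℂ) : lin u v z = (z.re : ℂ) * u + (z.im : ℂ) * v := by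
  simp [lin]

theorem lin_one_I : lin 1 I = ContinuousLinearMap.id ℝ ℂ :=
  ContinuousLinearMap.ext fun z => by simp [lin_apply, re_add_im]

/-- The standard triangle. -/
def stdTri : ConvexBody ℂ :=
  ⟨(unitSq : Set ℂ) ∩ {z | z.re + z.im ≤ 1},
    unitSq.convex.inter (convex_halfSpace_le (reCLM + imCLM).isLinear 1),
    unitSq.isCompact.inter_right (isClosed_le (continuous_re.add continuous_im) continuous_const),
    ⟨0, by simp [mem_unitSq]⟩⟩

theorem mem_stdTri {z : ℂ} : z ∈ stdTri ↔ 0 ≤ z.re ∧ 0 ≤ z.im ∧ z.re + z.im ≤ 1 := by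
  refine Iff.trans (b := z ∈ unitSq ∧ z.re + z.im ≤ 1) Iff.rfl ?_
  rw [mem_unitSq]
  constructor
  · rintro ⟨⟨⟨h1, -⟩, h2, -⟩, h3⟩; exact ⟨h1, h2, h3⟩
  · rintro ⟨h1, h2, h3⟩; exact ⟨⟨⟨h1, by linarith⟩, h2, by linarith⟩, h3⟩

/-- The triangle with vertices `0`, `u`, `v`. -/
def tri (u v : ℂ) : ConvexBody ℂ := stdTri.mapCLM (lin u v)

theorem mem_tri {u v x : ℂ} :
    x ∈ tri u v ↔ ∃ s t : ℝ, 0 ≤ s ∧ 0 ≤ t ∧ s + t ≤ 1 ∧ x = s * u + t * v := by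
  constructor
  · rintro ⟨z, hz, rfl⟩
    obtain ⟨h1, h2, h3⟩ := mem_stdTri.1 hz
    exact ⟨z.re, z.im, h1, h2, h3, lin_apply _ _ _⟩
  · rintro ⟨s, t, hs, ht, hst, rfl⟩
    exact ⟨⟨s, t⟩, mem_stdTri.2 ⟨hs, ht, hst⟩, lin_apply _ _ _⟩

theorem mem_seg {u x : ℂ} : x ∈ tri u 0 ↔ ∃ s : ℝ, 0 ≤ s ∧ s ≤ 1 ∧ x = s * u := by
  rw [mem_tri]
  constructor
  · rintro ⟨s, t, hs, ht, hst, rfl⟩; exact ⟨s, hs, by linarith, by ring⟩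
  · rintro ⟨s, hs, hs1, rfl⟩; exact ⟨s, 0, hs, le_rfl, by linarith, by simp⟩

theorem tri_comm (u v : ℂ) : tri u v = tri v u := by
  ext x
  refine mem_tri.trans (Iff.trans ?_ mem_tri.symm)
  constructor <;> rintro ⟨s, t, hs, ht, hst, rfl⟩ <;>
    exact ⟨t, s, ht, hs, by linarith, by ring⟩

theorem tri_translate (u v : ℂ) : (tri u v).translate (-u) = tri (-u) (v - u) := by
  ext x
  refine Iff.trans mem_translate_iff (mem_tri.trans (Iff.trans ?_ mem_tri.symm))
  constructor
  · rintro ⟨s, t, hs, ht, hst, h⟩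
    refine ⟨1 - s - t, t, by linarith, ht, by linarith, ?_⟩
    push_cast
    linear_combination h
  · rintro ⟨s, t, hs, ht, hst, rfl⟩
    refine ⟨1 - s - t, t, by linarith, ht, by linarith, ?_⟩
    push_cast
    ring

theorem tri_mapCLM (u v : ℂ) (f : ℂ →L[ℝ] ℂ) : (tri u v).mapCLM f = tri (f u) (f v) := by
  rw [tri, tri, mapCLM_mapCLM]
  congr 1
  refine ContinuousLinearMap.ext fun z => ?_
  simp only [ContinuousLinearMap.comp_apply, lin_apply, map_add, ← real_smul, map_smul]

theorem smul_tri (u v : ℂ) (t : ℝ) : t • tri u v = tri (t * u) (t * v) := by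
  rw [smul_eq_mapCLM, tri_mapCLM]; simp

theorem unitSq_mapCLM_lin (u v : ℂ) : unitSq.mapCLM (lin u v) = tri u 0 + tri v 0 := by
  ext x
  refine Iff.trans mem_mapCLM (Iff.trans ?_ mem_add.symm)
  constructor
  · rintro ⟨z, hz, rfl⟩
    obtain ⟨⟨h1, h2⟩, h3, h4⟩ := mem_unitSq.1 hz
    exact ⟨_, mem_seg.2 ⟨z.re, h1, h2, rfl⟩, _, mem_seg.2 ⟨z.im, h3, h4, rfl⟩,
      (lin_apply _ _ _).symm⟩
  · rintro ⟨_, h1, _, h2, rfl⟩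
    obtain ⟨s, hs, hs1, rfl⟩ := mem_seg.1 h1
    obtain ⟨t, ht, ht1, rfl⟩ := mem_seg.1 h2
    exact ⟨⟨s, t⟩, mem_unitSq.2 ⟨⟨hs, hs1⟩, ht, ht1⟩, lin_apply _ _ _⟩

variable {φ : ConvexBody ℂ → ℝ}

theorem IsCTV.tri_rotate (h : IsCTV φ) (u v : ℂ) : φ (tri u v) = φ (tri (v - u) (-u)) := by
  rw [← h.trans (tri u v) (-u), tri_translate, tri_comm]

theorem IsCTV.seg_neg (h : IsCTV φ) (u : ℂ) : φ (tri (-u) 0) = φ (tri u 0) := by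
  rw [h.tri_rotate u 0, zero_sub]
  congr 1
  ext x
  refine mem_seg.trans (Iff.trans ?_ mem_tri.symm)
  constructor
  · rintro ⟨s, h1, h2, rfl⟩; exact ⟨s, 0, h1, le_rfl, by linarith, by simp⟩
  · rintro ⟨s, t, h1, h2, h3, rfl⟩
    exact ⟨s + t, by linarith, h3, by push_cast; ring⟩

theorem IsCTV.tri_cut (h : IsCTV φ) (u v : ℂ) {t : ℝ} (h0 : 0 ≤ t) (h1 : t ≤ 1) :
    φ (tri u v) + φ (tri ((1 - t : ℝ) * u + t * v) 0) =
      φ (tri u ((1 - t : ℝ) * u + t * v)) + φ (tri ((1 - t : ℝ) * u + t * v) v) := by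
  set w : ℂ := ⟨1 - t, t⟩ with hw
  have hl : ∀ a b : ℂ, (tri a b).mapCLM (lin u v) = tri (lin u v a) (lin u v b) := fun a b =>
    tri_mapCLM a b _
  have key := (h.comp_mapCLM (lin u v)).val.cut (K := tri 1 I) (A := tri 1 w) (B := tri w I)
    (C := tri w 0) ((1 - t) • imCLM - t • reCLM) 0 ?_ ?_ ?_
  · simp only [hl] at key
    simpa [lin_apply, hw] using key
  all_goals
    intro x
    have hK : x ∈ tri 1 I ↔ 0 ≤ x.re ∧ 0 ≤ x.im ∧ x.re + x.im ≤ 1 := by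
      rw [tri, lin_one_I, mapCLM_id]; exact mem_stdTri
    rw [hK]
    simp only [sub_apply, smul_apply, imCLM_apply, reCLM_apply, smul_eq_mul]
  · rw [mem_seg]
    constructor
    · rintro ⟨s, hs, hs1, rfl⟩
      simp only [re_ofReal_mul, im_ofReal_mul, hw]
      exact ⟨⟨by nlinarith, by nlinarith, by nlinarith⟩, by ring⟩
    · rintro ⟨⟨h2, h3, h4⟩, h5⟩
      refine ⟨x.re + x.im, by linarith, h4, Complex.ext ?_ ?_⟩ <;>
        simp only [re_ofReal_mul, im_ofReal_mul, hw] <;> linarith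
  · rw [mem_tri]
    constructor
    · rintro ⟨s, r, hs, hr, hsr, rfl⟩
      simp only [add_re, add_im, re_ofReal_mul, im_ofReal_mul, hw, one_re, one_im]
      refine ⟨⟨by nlinarith, by nlinarith, by nlinarith⟩, ?_⟩
      have := mul_nonneg h0 hs
      linarith
    · rintro ⟨⟨h2, h3, h4⟩, h5⟩
      rcases h0.eq_or_lt with h0 | h0
      · subst h0
        refine ⟨x.re, 0, h2, le_rfl, by linarith, Complex.ext (by simp) ?_⟩
        simp; linarith
      · refine ⟨x.re - (1 - t) * (x.im / t), x.im / t, ?_, by positivity, ?_,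
          Complex.ext ?_ ?_⟩
        · have : (1 - t) * (x.im / t) = (1 - t) * x.im / t := by ring
          rw [this, sub_nonneg, div_le_iff₀ h0]; linarith
        · have : x.re - (1 - t) * (x.im / t) + x.im / t = x.re + x.im := by field_simp; ring
          rw [this]; exact h4
        · simp only [add_re, re_ofReal_mul, hw, one_re]; ring
        · simp only [add_im, im_ofReal_mul, hw, one_im]; field_simp; ring
  · rw [mem_tri]
    constructor
    · rintro ⟨s, r, hs, hr, hsr, rfl⟩
      simp only [add_re, add_im, re_ofReal_mul, im_ofReal_mul, hw, I_re, I_im]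
      refine ⟨⟨by nlinarith, by nlinarith, by nlinarith⟩, ?_⟩
      have := mul_nonneg (sub_nonneg.2 h1) hr
      linarith
    · rintro ⟨⟨h2, h3, h4⟩, h5⟩
      rcases h1.eq_or_lt with h1 | h1
      · subst h1
        refine ⟨0, x.im, le_rfl, h3, by linarith, Complex.ext ?_ (by simp)⟩
        simp; linarith
      · have h1 : 0 < 1 - t := by linarith
        refine ⟨x.re / (1 - t), x.im - t * (x.re / (1 - t)), by positivity, ?_, ?_,
          Complex.ext ?_ ?_⟩
        · have : t * (x.re / (1 - t)) = t * x.re / (1 - t) := by ring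
          rw [this, sub_nonneg, div_le_iff₀ h1]; linarith
        · have : x.re / (1 - t) + (x.im - t * (x.re / (1 - t))) = x.re + x.im := by
            field_simp; ring
          rw [this]; exact h4
        · simp only [add_re, re_ofReal_mul, hw, I_re]; field_simp; ring
        · simp only [add_im, im_ofReal_mul, hw, I_im]; ring

/-- A parallelogram is cut into two triangles by a diagonal. -/
theorem IsCTV.parallelogram (h : IsCTV φ) (u v : ℂ) :
    φ (tri u 0 + tri v 0) + φ (tri (v - u) 0) = φ (tri u v) + φ (tri (-u) (-v)) := by
  have key := (h.comp_mapCLM (lin u v)).val.cut (K := unitSq) (A := tri 1 I)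
    (B := (tri (-1) (-I)).translate (1 + I)) (C := (tri (I - 1) 0).translate 1)
    (reCLM + imCLM) 1 ?_ ?_ ?_
  · simp only [unitSq_mapCLM_lin, mapCLM_translate, tri_mapCLM, h.trans _ _] at key
    simpa [lin_apply, sub_eq_neg_add, h.trans _ _] using key
  all_goals
    intro x
    rw [mem_unitSq]
    simp only [add_apply, imCLM_apply, reCLM_apply]
  · rw [mem_translate_iff, mem_seg]
    constructor
    · rintro ⟨s, hs, hs1, hx⟩
      have h1 := congrArg re hx
      have h2 := congrArg im hx
      simp at h1 h2
      exact ⟨⟨⟨by linarith, by linarith⟩, by linarith, by linarith⟩, by linarith⟩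
    · rintro ⟨⟨⟨h1, h2⟩, h3, h4⟩, h5⟩
      exact ⟨x.im, h3, h4, Complex.ext (by simp; linarith) (by simp)⟩
  · rw [tri, lin_one_I, mapCLM_id]; exact Iff.rfl
  · rw [mem_translate_iff, mem_tri]
    constructor
    · rintro ⟨s, r, hs, hr, hsr, hx⟩
      have h1 := congrArg re hx
      have h2 := congrArg im hx
      simp at h1 h2
      exact ⟨⟨⟨by linarith, by linarith⟩, by linarith, by linarith⟩, by linarith⟩
    · rintro ⟨⟨⟨h1, h2⟩, h3, h4⟩, h5⟩
      exact ⟨1 - x.re, 1 - x.im, by linarith, by linarith, by linarith,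
        Complex.ext (by simp) (by simp)⟩

end Triangles

section PlanarArea

open ConvexBody Complex Filter Topology

theorem polar_mono {V : Type*} [NormedAddCommGroup V] [NormedSpace ℝ V] [FiniteDimensional ℝ V]
    {φ : ConvexBody V → ℝ} (h : IsHom 2 φ)
    (hm : ∀ {K L : ConvexBody V}, (K : Set V) ⊆ L → φ K ≤ φ L) {K K' : ConvexBody V}
    (hK : (K : Set V) ⊆ K') (L : ConvexBody V) : polar φ K L ≤ polar φ K' L := by
  have key : ∀ t : ℝ, 0 < t → 2 * (polar φ K L - polar φ K' L) ≤ t * (φ K' - φ K) := by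
    intro t ht
    have h1 : φ (t • K + L) ≤ φ (t • K' + L) := by
      refine hm ?_
      rintro _ ⟨_, ⟨x, hx, rfl⟩, y, hy, rfl⟩
      exact ⟨_, ⟨x, hK hx, rfl⟩, y, hy, rfl⟩
    have h2 := h.polar_smul K L ht.le
    have h3 := h.polar_smul K' L ht.le
    simp only [polar, h.smul _ t ht.le] at h2 h3
    have h4 : t * (2 * (polar φ K L - polar φ K' L)) ≤ t * (t * (φ K' - φ K)) := by
      simp only [polar]; nlinarith
    exact le_of_mul_le_mul_left h4 ht
  have hlim : Tendsto (fun t : ℝ => t * (φ K' - φ K)) (𝓝[>] 0) (𝓝 (0 * (φ K' - φ K))) :=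
    (tendsto_id.mul_const _).mono_left nhdsWithin_le_nhds
  have := ge_of_tendsto hlim (eventually_nhdsWithin_of_forall fun t ht => key t ht)
  linarith

/-- The area of a planar body. -/
def area : ConvexBody ℂ → ℝ := vol volume

theorem isHom_area : IsHom 2 area := by
  have := isHom_vol (V := ℂ) volume
  rwa [finrank_real_complex] at this

/-- Twice the mixed area. -/
def mv (K L : ConvexBody ℂ) : ℝ := 2 * polar area K L

theorem mv_eq (K L : ConvexBody ℂ) : mv K L = area (K + L) - area K - area L := by
  simp only [mv, polar]; ring

theorem mv_comm (K L : ConvexBody ℂ) : mv K L = mv L K := by rw [mv, polar_comm, mv]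

theorem isHom_mv (L : ConvexBody ℂ) : IsHom 1 fun K => mv K L :=
  ⟨(isHom_area.polar_isHom L).toIsCTV.const_mul 2, fun K t ht => by
    simp only [mv, (isHom_area.polar_isHom L).smul K t ht]; ring⟩

theorem isHom_mv_right (K : ConvexBody ℂ) : IsHom 1 fun L => mv K L := by
  simpa only [mv_comm] using isHom_mv K

theorem mv_translate_right (K L : ConvexBody ℂ) (x : ℂ) : mv K (L.translate x) = mv K L :=
  (isHom_mv_right K).trans L x

theorem mv_smul_right (K L : ConvexBody ℂ) {t : ℝ} (ht : 0 ≤ t) : mv K (t • L) = t * mv K L := by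
  simpa using (isHom_mv_right K).smul L t ht

theorem mv_mono {K K' L L' : ConvexBody ℂ} (h : (K : Set ℂ) ⊆ K') (h' : (L : Set ℂ) ⊆ L') :
    mv K L ≤ mv K' L' := by
  have hm : ∀ {K L : ConvexBody ℂ}, (K : Set ℂ) ⊆ L → area K ≤ area L := vol_mono _
  refine (mul_le_mul_of_nonneg_left (polar_mono isHom_area hm h L) zero_le_two).trans ?_
  rw [polar_comm, mv, polar_comm area K' L']
  exact mul_le_mul_of_nonneg_left (polar_mono isHom_area hm h' K') zero_le_two

theorem det_lin (u v : ℂ) : LinearMap.det (lin u v : ℂ →ₗ[ℝ] ℂ) = u.re * v.im - u.im * v.re := by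
  rw [← LinearMap.det_toMatrix basisOneI, Matrix.det_fin_two]
  simp [LinearMap.toMatrix_apply, lin_apply]
  ring

theorem area_mapCLM (f : ℂ →L[ℝ] ℂ) (K : ConvexBody ℂ) :
    area (K.mapCLM f) = |LinearMap.det (f : ℂ →ₗ[ℝ] ℂ)| * area K := vol_mapCLM _ f K

theorem area_unitSq : area unitSq = 1 := by
  have h : (unitSq : Set ℂ) = Set.Icc 0 1 ×ℂ Set.Icc 0 1 := by
    ext x
    refine Iff.trans mem_unitSq ?_
    simp [mem_reProdIm]
  rw [area, vol, h, ← volume_preserving_equiv_real_prod.symm.measure_preimage_equiv]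
  have : measurableEquivRealProd.symm ⁻¹' (Set.Icc (0:ℝ) 1 ×ℂ Set.Icc (0:ℝ) 1) =
      Set.Icc (0:ℝ) 1 ×ˢ Set.Icc (0:ℝ) 1 := by
    ext x
    simp only [Set.mem_preimage, mem_reProdIm, measurableEquivRealProd_symm_apply, Set.mem_prod]
  rw [this, Measure.volume_eq_prod, Measure.prod_prod]
  simp

theorem area_parallelogram (u v : ℂ) :
    area (tri u 0 + tri v 0) = |u.re * v.im - u.im * v.re| := by
  rw [← unitSq_mapCLM_lin, area_mapCLM, det_lin, area_unitSq, mul_one]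

theorem area_tri_aux (u v : ℂ) : area (tri u v) = |u.re * v.im - u.im * v.re| * area stdTri := by
  rw [tri, area_mapCLM, det_lin]

theorem area_seg (u : ℂ) : area (tri u 0) = 0 := by simp [area_tri_aux]

theorem area_tri (u v : ℂ) : area (tri u v) = |u.re * v.im - u.im * v.re| / 2 := by
  have h := isHom_area.toIsCTV.parallelogram 1 I
  rw [area_parallelogram, area_seg] at h
  simp only [area_tri_aux] at h ⊢
  simp at h
  rw [show area stdTri = 1 / 2 by linarith]
  ring

theorem mv_seg_seg (e f : ℂ) : mv (tri e 0) (tri f 0) = |e.re * f.im - e.im * f.re| := by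
  rw [mv_eq, area_parallelogram, area_seg, area_seg]; ring

theorem mv_self (K : ConvexBody ℂ) : mv K K = 2 * area K := by
  rw [mv, isHom_area.polar_self]

theorem inner_eq (u v : ℂ) : inner ℝ u v = u.re * v.re + u.im * v.im := by
  rw [Complex.inner]; simp; ring

theorem mv_tri_le (N : ConvexBody ℂ) {u v : ℂ} (hD : 0 < u.re * v.im - u.im * v.re) :
    mv (tri u v) N ≤ supp N (-I * u) + supp N (-I * (v - u)) + supp N (I * v) := by
  set D := u.re * v.im - u.im * v.re with hDdef
  set a := supp N (-I * u)
  set b := supp N (-I * (v - u))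
  set c := supp N (I * v)
  have hs := isSublinear_supp N
  have h0 : 0 ≤ a + b + c := by
    have h1 := hs.add_le (-I * u) (-I * (v - u))
    have h2 := hs.add_le (-I * u + -I * (v - u)) (I * v)
    rw [show -I * u + -I * (v - u) + I * v = 0 by ring, hs.map_zero] at h2
    linarith
  have hsub : (N : Set ℂ) ⊆ (((a + b + c) / D) • tri u v : ConvexBody ℂ).translate
      (-((c / D : ℝ) * u + (a / D : ℝ) * v)) := by
    intro x hx
    have h1 : inner ℝ (-I * u) x ≤ a := inner_le_supp hx _
    have h2 : inner ℝ (-I * (v - u)) x ≤ b := inner_le_supp hx _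
    have h3 : inner ℝ (I * v) x ≤ c := inner_le_supp hx _
    simp only [inner_eq] at h1 h2 h3
    simp at h1 h2 h3
    refine mem_translate_iff.2 ?_
    rcases h0.eq_or_lt with h0 | h0
    · rw [← h0, zero_div, ConvexBody.zero_smul', zero_eq_point, mem_point, sub_neg_eq_add]
      have e1 : x.re * v.im - x.im * v.re = -c := by nlinarith
      have e2 : u.re * x.im - u.im * x.re = -a := by nlinarith
      rw [show c = -(x.re * v.im - x.im * v.re) by linarith,
        show a = -(u.re * x.im - u.im * x.re) by linarith]
      refine Complex.ext ?_ ?_ <;> simp <;> field_simp <;> rw [hDdef] <;> ring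
    · rw [smul_tri, mem_tri]
      refine ⟨(x.re * v.im - x.im * v.re + c) / (a + b + c),
        (u.re * x.im - u.im * x.re + a) / (a + b + c), ?_, ?_, ?_, ?_⟩
      · refine div_nonneg ?_ h0.le; linarith
      · refine div_nonneg ?_ h0.le; linarith
      · rw [← add_div, div_le_one h0]; linarith
      · refine Complex.ext ?_ ?_ <;>
          simp only [sub_re, neg_re, add_re, re_ofReal_mul, sub_im, neg_im, add_im, im_ofReal_mul,
            ← mul_assoc, ← ofReal_mul] <;> field_simp <;> rw [hDdef] <;> ring
  refine (mv_mono (subset_refl _) hsub).trans_eq ?_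
  rw [mv_translate_right, mv_smul_right _ _ (by positivity), mv_self, area_tri,
    abs_of_pos hD]
  field_simp

theorem le_mv_seg (N : ConvexBody ℂ) (e : ℂ) :
    supp N (I * e) + supp N (-I * e) ≤ mv (tri e 0) N := by
  obtain ⟨p, hp, h1⟩ := exists_supp_eq N (I * e)
  obtain ⟨q, hq, h2⟩ := exists_supp_eq N (-I * e)
  have hsub : ((tri (p - q) 0).translate q : Set ℂ) ⊆ N := by
    intro x hx
    obtain ⟨s, hs, hs1, h⟩ := mem_seg.1 (mem_translate_iff.1 hx)
    have := N.convex hp hq hs (sub_nonneg.2 hs1) (by ring)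
    rwa [show s • p + (1 - s) • q = x by
      simp only [real_smul, ofReal_sub, ofReal_one]; linear_combination -h] at this
  refine le_trans ?_ (mv_mono (subset_refl _) hsub)
  rw [mv_translate_right, mv_seg_seg, ← h1, ← h2]
  refine le_trans (le_of_eq ?_) (le_abs_self _)
  simp only [inner_eq]
  simp
  ring

theorem mv_tri_and_seg (N : ConvexBody ℂ) {u v : ℂ} (hD : 0 < u.re * v.im - u.im * v.re) :
    mv (tri u v) N = supp N (-I * u) + supp N (-I * (v - u)) + supp N (I * v) ∧
      mv (tri u 0) N = supp N (I * u) + supp N (-I * u) := by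
  have h1 := (isHom_mv N).toIsCTV.parallelogram u v
  simp only [(isHom_mv N).additive] at h1
  have h2 := mv_tri_le N hD
  have h3 := mv_tri_le N (u := -u) (v := -v) (by simpa using hD)
  have h4 := le_mv_seg N u
  have h5 := le_mv_seg N v
  have h6 := le_mv_seg N (v - u)
  rw [show -I * -u = I * u by ring, show -I * (-v - -u) = I * (v - u) by ring,
    show I * -v = -I * v by ring] at h3
  constructor <;> linarith

theorem mv_tri (N : ConvexBody ℂ) {u v : ℂ} (hD : 0 < u.re * v.im - u.im * v.re) :
    mv (tri u v) N = supp N (-I * u) + supp N (-I * (v - u)) + supp N (I * v) :=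
  (mv_tri_and_seg N hD).1

theorem mv_seg (N : ConvexBody ℂ) (e : ℂ) :
    mv (tri e 0) N = supp N (I * e) + supp N (-I * e) := by
  rcases eq_or_ne e 0 with rfl | he
  · have h := (isHom_mv N).smul (tri 0 0) 0 le_rfl
    rw [smul_tri] at h
    simp only [mul_zero, (isSublinear_supp N).map_zero] at h ⊢
    simpa using h
  · refine (mv_tri_and_seg N (v := I * e) ?_).2
    have : 0 < normSq e := normSq_pos.2 he
    rw [normSq_apply] at this
    simpa using this

end PlanarArea

section TriangleDetermination

open ConvexBody Complex Filter Topology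

theorem exists_tri_of_pyramid {L : ConvexBody ℂ} (h0 : 0 ∈ L) {ℓ : ℂ →L[ℝ] ℝ}
    (h1 : ∀ x ∈ L, ℓ x ≤ 1) (h2 : ∀ x ∈ L, ∀ t : ℝ, 0 ≤ t → t * ℓ x ≤ 1 → t • x ∈ L) :
    ∃ u v, L = tri u v := by
  have hpos : ∀ x ∈ L, x ≠ 0 → 0 < ℓ x := by
    intro x hx hx0
    by_contra! hneg
    exact hx0 (eq_zero_of_forall_smul_mem fun t ht => h2 x hx t ht
      ((mul_nonpos_of_nonneg_of_nonpos ht hneg).trans zero_le_one))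
  by_cases hne : ∃ x ∈ L, x ≠ 0
  · obtain ⟨x₀, hx₀, hne⟩ := hne
    have hc : IsCompact ((L : Set ℂ) ∩ {x | ℓ x = 1}) :=
      L.isCompact.inter_right (isClosed_eq ℓ.continuous continuous_const)
    have hn : ((L : Set ℂ) ∩ {x | ℓ x = 1}).Nonempty := by
      have := hpos x₀ hx₀ hne
      refine ⟨(ℓ x₀)⁻¹ • x₀, h2 _ hx₀ _ (by positivity) ?_, ?_⟩
      · exact (inv_mul_cancel₀ this.ne').le
      · exact (map_smul ℓ _ _).trans (inv_mul_cancel₀ this.ne')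
    set g : ℂ → ℝ := fun x => ℓ 1 * x.im - ℓ I * x.re with hg
    have hgc : Continuous g := by fun_prop
    have hℓ : ∀ x : ℂ, ℓ x = x.re * ℓ 1 + x.im * ℓ I := by
      intro x
      conv_lhs => rw [show x = x.re • (1 : ℂ) + x.im • I by simp [re_add_im]]
      rw [map_add, map_smul, map_smul, smul_eq_mul, smul_eq_mul]
    obtain ⟨p, ⟨hpL, hp⟩, hpm⟩ := hc.exists_isMinOn hn hgc.continuousOn
    obtain ⟨q, ⟨hqL, hq⟩, hqm⟩ := hc.exists_isMaxOn hn hgc.continuousOn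
    replace hp : ℓ p = 1 := hp
    replace hq : ℓ q = 1 := hq
    refine ⟨p, q, ?_⟩
    ext x
    refine Iff.trans ?_ mem_tri.symm
    constructor
    · intro hx
      by_cases hx0 : x = 0
      · exact ⟨0, 0, le_rfl, le_rfl, by simp, by simp [hx0]⟩
      have hlx := hpos x hx hx0
      have hlx1 := h1 x hx
      have hyL : (ℓ x)⁻¹ • x ∈ (L : Set ℂ) ∩ {x | ℓ x = 1} :=
        ⟨h2 _ hx _ (by positivity) (inv_mul_cancel₀ hlx.ne').le,
          (map_smul ℓ _ _).trans (inv_mul_cancel₀ hlx.ne')⟩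
      have hy1 : g p ≤ g ((ℓ x)⁻¹ • x) := hpm hyL
      have hy2 : g ((ℓ x)⁻¹ • x) ≤ g q := hqm hyL
      have hseg : (ℓ x)⁻¹ • x ∈ segment ℝ p q := by
        set y := (ℓ x)⁻¹ • x with hy
        have hly : ℓ y = 1 := hyL.2
        have hinj : ∀ z w : ℂ, ℓ z = ℓ w → g z = g w → z = w := by
          intro z w e1 e2
          rw [hℓ z, hℓ w] at e1
          simp only [hg] at e2
          have hn : 0 < ℓ 1 ^ 2 + ℓ I ^ 2 := by
            by_contra! hcon
            have e3 : ℓ 1 = 0 := by nlinarith [sq_nonneg (ℓ 1), sq_nonneg (ℓ I)]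
            have e4 : ℓ I = 0 := by nlinarith [sq_nonneg (ℓ 1), sq_nonneg (ℓ I)]
            rw [hℓ, e3, e4] at hp
            simp at hp
          refine Complex.ext (mul_left_cancel₀ hn.ne' ?_) (mul_left_cancel₀ hn.ne' ?_)
          · linear_combination ℓ 1 * e1 - ℓ I * e2
          · linear_combination ℓ I * e1 + ℓ 1 * e2
        have hmem : g y ∈ segment ℝ (g p) (g q) := by
          rw [segment_eq_Icc (hy1.trans hy2)]; exact ⟨hy1, hy2⟩
        obtain ⟨a, b, ha, hb, hab, he⟩ := hmem
        refine ⟨a, b, ha, hb, hab, hinj _ _ ?_ ?_⟩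
        · rw [map_add, map_smul, map_smul, hp, hq, hly, smul_eq_mul, smul_eq_mul, mul_one, mul_one, hab]
        · rw [← he]; simp [hg]; ring
      obtain ⟨a, b, ha, hb, hab, he⟩ := hseg
      refine ⟨ℓ x * a, ℓ x * b, by positivity, by positivity, by rw [← mul_add, hab]; simpa, ?_⟩
      have : x = ℓ x • (a • p + b • q) := by rw [he, smul_smul, mul_inv_cancel₀ hlx.ne', one_smul]
      conv_lhs => rw [this]
      simp only [real_smul]; push_cast; ring
    · rintro ⟨s, t, hs, ht, hst, rfl⟩
      have := L.convex.sum_mem (t := (Finset.univ : Finset (Fin 3))) (w := ![1 - s - t, s, t])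
        (z := ![0, p, q]) (by intro i _; fin_cases i <;> simp <;> linarith)
        (by simp [Fin.sum_univ_three]; ring) (by intro i _; fin_cases i <;> assumption)
      simpa [Fin.sum_univ_three] using this
  · push Not at hne
    refine ⟨0, 0, ?_⟩
    ext x
    refine Iff.trans ?_ mem_seg.symm
    constructor
    · intro hx; exact ⟨0, le_rfl, zero_le_one, by simp [hne x hx]⟩
    · rintro ⟨s, -, -, rfl⟩; simpa using h0

theorem IsCTV.eq_zero_of_tri {Φ : ConvexBody ℂ → ℝ} (h : IsCTV Φ) (h0 : ∀ u v, Φ (tri u v) = 0)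
    (K : ConvexBody ℂ) : Φ K = 0 := by
  refine eq_of_eq_on_isPolyhedral (ψ := fun _ => 0) h.cont continuous_const (fun L hL => ?_) K
  have key : ∀ (d : ℕ) (L : ConvexBody ℂ), IsPolyhedral L → DimLE d L → Φ L = 0 := by
    intro d
    induction d using Nat.strong_induction_on with
    | _ d ih =>
      intro L hP hd
      refine poly_induction h.val h.trans (fun L hP d' hd' hL => ih d' hd' L hP hL)
        (fun L _ _ h1 ℓ h2 h3 => ?_) L hP hd
      obtain ⟨u, v, rfl⟩ := exists_tri_of_pyramid h1 h2 h3
      exact h0 u v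
  exact key _ L hL (dimLE_finrank L)

theorem IsCTV.eq_zero_of_tri_pos {Φ : ConvexBody ℂ → ℝ} (h : IsCTV Φ)
    (h0 : ∀ u v : ℂ, 0 < u.re * v.im - u.im * v.re → Φ (tri u v) = 0) (K : ConvexBody ℂ) :
    Φ K = 0 := by
  refine h.eq_zero_of_tri (fun u v => ?_) K
  have hlim : ∀ a b u v : ℂ, (∀ t : ℝ, 0 < t →
      0 < (u + t * a).re * (v + t * b).im - (u + t * a).im * (v + t * b).re) →
      Φ (tri u v) = 0 := by
    intro a b u v hab
    have hc : Continuous fun t : ℝ => Φ (tri (u + t * a) (v + t * b)) := by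
      refine h.cont.comp (continuous_mapCLM_prod.comp (Continuous.prodMk ?_ continuous_const))
      refine Continuous.add ?_ ?_
      · exact (ContinuousLinearMap.smulRightL ℝ ℂ ℂ reCLM).continuous.comp (by fun_prop)
      · exact (ContinuousLinearMap.smulRightL ℝ ℂ ℂ imCLM).continuous.comp (by fun_prop)
    have h1 := (hc.tendsto 0).mono_left (nhdsWithin_le_nhds (s := Set.Ioi 0))
    simp only [ofReal_zero, zero_mul, add_zero] at h1
    refine tendsto_nhds_unique h1 (tendsto_const_nhds.congr' ?_)
    exact eventually_nhdsWithin_of_forall fun t ht => (h0 _ _ (hab t ht)).symm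
  rcases lt_trichotomy (u.re * v.im - u.im * v.re) 0 with hD | hD | hD
  · rw [tri_comm]; exact h0 _ _ (by linarith)
  · by_cases hz : 0 < normSq u + normSq v
    · refine hlim (-I * v) (I * u) u v fun t ht => ?_
      rw [normSq_apply, normSq_apply] at hz
      simp
      nlinarith [mul_pos ht hz, sq_nonneg t]
    · have hu := normSq_nonneg u
      have hv := normSq_nonneg v
      have hu0 : u = 0 := normSq_eq_zero.1 (by linarith)
      have hv0 : v = 0 := normSq_eq_zero.1 (by linarith)
      subst hu0 hv0
      refine hlim 1 I 0 0 fun t ht => ?_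
      simp; positivity
  · exact h0 _ _ hD

end TriangleDetermination

section PlanarCharacterization

open ConvexBody Complex

variable {ν : ConvexBody ℂ → ℝ}

/-- The generating function of a planar Minkowski additive functional. -/
def genFun (ν : ConvexBody ℂ → ℝ) (e : ℂ) : ℝ :=
  (if 0 ≤ e.re * e.im then ν (tri (e.re : ℂ) (-(e.im * I))) else ν (tri (-(e.re : ℂ)) (e.im * I)))
    - max (-e.re) 0 * ν (tri 1 0) - max (-e.im) 0 * ν (tri I 0)

theorem IsHom.seg_mul (h : IsHom 1 ν) (t : ℝ) (u : ℂ) : ν (tri (t * u) 0) = |t| * ν (tri u 0) := by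
  have key : ∀ {s : ℝ}, 0 ≤ s → ν (tri (s * u) 0) = s * ν (tri u 0) := fun {s} hs => by
    have := h.smul (tri u 0) s hs
    rwa [smul_tri, mul_zero, pow_one] at this
  rcases le_total 0 t with ht | ht
  · rw [key ht, abs_of_nonneg ht]
  · rw [← h.seg_neg, ← neg_mul, ← ofReal_neg, key (neg_nonneg.2 ht), abs_of_nonpos ht]

theorem IsHom.seg_zero (h : IsHom 1 ν) : ν (tri 0 0) = 0 := by
  simpa using h.seg_mul 0 0

theorem IsHom.genFun_mul (h : IsHom 1 ν) {t : ℝ} (ht : 0 ≤ t) (e : ℂ) :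
    genFun ν (t * e) = t * genFun ν e := by
  rcases ht.eq_or_lt with rfl | ht
  · simp [genFun, h.seg_zero]
  have h1 : (0 ≤ t * e.re * (t * e.im)) ↔ 0 ≤ e.re * e.im := by
    rw [show t * e.re * (t * e.im) = t ^ 2 * (e.re * e.im) by ring,
      mul_nonneg_iff_of_pos_left (by positivity)]
  have h2 : ∀ u v : ℂ, ν (tri (t * u) (t * v)) = t * ν (tri u v) := fun u v => by
    rw [← smul_tri, h.smul _ _ ht.le, pow_one]
  have h3 : ∀ s : ℝ, max (-(t * s)) 0 = t * max (-s) 0 := fun s => by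
    rw [mul_max_of_nonneg _ _ ht.le, mul_zero, mul_neg]
  simp only [genFun, re_ofReal_mul, im_ofReal_mul, h1, h3]
  have h4 : ν (tri ((t * e.re : ℝ) : ℂ) (-((t * e.im : ℝ) * I))) =
      t * ν (tri (e.re : ℂ) (-(e.im * I))) := by
    rw [← h2]; congr 2 <;> push_cast <;> ring
  have h5 : ν (tri (-((t * e.re : ℝ) : ℂ)) ((t * e.im : ℝ) * I)) =
      t * ν (tri (-(e.re : ℂ)) (e.im * I)) := by
    rw [← h2]; congr 2 <;> push_cast <;> ring
  rw [h4, h5]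
  split_ifs <;> ring

theorem IsHom.genFun_ofReal (h : IsHom 1 ν) (a : ℝ) : genFun ν a = max a 0 * ν (tri 1 0) := by
  have := h.seg_mul a 1
  rw [mul_one] at this
  simp [genFun, this]
  rcases le_total 0 a with ha | ha <;> simp [ha, abs_of_nonneg, abs_of_nonpos]

theorem IsHom.genFun_mul_I (h : IsHom 1 ν) (b : ℝ) :
    genFun ν (b * I) = max b 0 * ν (tri I 0) := by
  have := h.seg_mul b I
  simp [genFun, tri_comm 0, h.seg_neg, this]
  rcases le_total 0 b with hb | hb <;> simp [hb, abs_of_nonneg, abs_of_nonpos]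

theorem IsHom.genFun_add_neg (h : IsHom 1 ν) (e : ℂ) :
    genFun ν e + genFun ν (-e) = ν (tri e 0) := by
  have hp := h.parallelogram (e.re : ℂ) (-(e.im * I))
  have h1 := h.seg_mul e.re 1
  have h2 := h.seg_mul e.im I
  rw [mul_one] at h1
  rw [h.additive, h.seg_neg, h1, h2, neg_neg, show -((e.im : ℂ) * I) - e.re = -e by
    conv_rhs => rw [← re_add_im e]
    ring, h.seg_neg] at hp
  have h3 : ∀ s : ℝ, max (-s) 0 + max s 0 = |s| := fun s => by
    rw [add_comm, max_zero_add_max_neg_zero_eq_abs_self]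
  simp only [genFun, neg_re, neg_im, neg_neg, ofReal_neg, neg_mul]
  rw [← h3, ← h3] at hp
  split_ifs <;> linarith

/-- The defect of the edge formula on a triangle. -/
def triDefect (ν : ConvexBody ℂ → ℝ) (u v : ℂ) : ℝ :=
  ν (tri u v) - genFun ν u - genFun ν (v - u) - genFun ν (-v)

theorem IsHom.triDefect_rotate (h : IsHom 1 ν) (u v : ℂ) :
    triDefect ν u v = triDefect ν (v - u) (-u) := by
  rw [triDefect, triDefect, h.tri_rotate, show -u - (v - u) = -v by ring, neg_neg]
  ring

theorem IsHom.triDefect_rotate' (h : IsHom 1 ν) (u v : ℂ) :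
    triDefect ν u v = triDefect ν (-v) (u - v) := by
  rw [h.triDefect_rotate, h.triDefect_rotate]
  congr 1 <;> ring

theorem IsHom.triDefect_cut (h : IsHom 1 ν) {u v w : ℂ} {t : ℝ} (h0 : 0 ≤ t) (h1 : t ≤ 1)
    (hw : w = (1 - t : ℝ) * u + t * v) :
    triDefect ν u v = triDefect ν u w + triDefect ν w v := by
  have h2 := h.tri_cut u v h0 h1
  rw [← hw] at h2
  have h3 := h.genFun_add_neg w
  have h4 : genFun ν (w - u) = t * genFun ν (v - u) := by
    rw [← h.genFun_mul h0, hw]; congr 1; push_cast; ring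
  have h5 : genFun ν (v - w) = (1 - t) * genFun ν (v - u) := by
    rw [← h.genFun_mul (sub_nonneg.2 h1), hw]; congr 1; push_cast; ring
  simp only [triDefect, h4, h5]
  linarith

theorem IsHom.triDefect_re_im (h : IsHom 1 ν) {a b : ℝ} (hab : 0 ≤ a * b) :
    triDefect ν a (b * I) = 0 := by
  rw [triDefect, h.genFun_ofReal, ← neg_mul, ← ofReal_neg, h.genFun_mul_I]
  rcases hab.eq_or_lt with h0 | h0
  · have ha := h.seg_mul a 1
    have hb := h.seg_mul b I
    rw [mul_one] at ha
    rcases mul_eq_zero.1 h0.symm with rfl | rfl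
    · simp [h.genFun_mul_I, tri_comm 0, hb]
      rcases le_total 0 b with hb | hb <;> simp [hb, abs_of_nonneg, abs_of_nonpos]
    · have := h.genFun_ofReal (-a)
      rw [ofReal_neg] at this
      simp [ha, this]
      rcases le_total 0 a with hb | hb <;> simp [hb, abs_of_nonneg, abs_of_nonpos]
  · simp [genFun, h0.not_ge]

theorem IsHom.triDefect_im_re (h : IsHom 1 ν) {a b : ℝ} (hab : a * b ≤ 0) :
    triDefect ν (b * I) a = 0 := by
  have h1 : triDefect ν (b * I) a = ν (tri (b * I) a) - max b 0 * ν (tri I 0)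
      - genFun ν (a - b * I) - max (-a) 0 * ν (tri 1 0) := by
    rw [triDefect, ← ofReal_neg, h.genFun_ofReal, h.genFun_mul_I]
  rw [h1, tri_comm]
  simp [genFun, hab]

theorem IsHom.triDefect_foot (h : IsHom 1 ν) {x y : ℝ} (hxy : 0 ≤ x * y) :
    triDefect ν x (x + y * I) = 0 := by
  rw [h.triDefect_rotate, add_sub_cancel_left, ← ofReal_neg]
  exact h.triDefect_im_re (by linarith)

theorem IsHom.triDefect_foot' (h : IsHom 1 ν) {x y : ℝ} (hxy : x * y ≤ 0) :
    triDefect ν (x + y * I) x = 0 := by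
  rw [h.triDefect_rotate', add_sub_cancel_left, ← ofReal_neg]
  exact h.triDefect_re_im (by linarith)

theorem IsHom.triDefect_vertical (h : IsHom 1 ν) {u v : ℂ} (hx : u.re ≠ 0) (huv : v.re = u.re)
    (hle : u.re * u.im ≤ u.re * v.im) : triDefect ν u v = 0 := by
  obtain ⟨x, y⟩ := u
  obtain ⟨x', y'⟩ := v
  obtain rfl : x' = x := huv
  simp only at hx hle
  have hcut : ∀ p q r : ℝ, x' * p ≤ x' * q → x' * q ≤ x' * r →
      triDefect ν ⟨x', p⟩ ⟨x', r⟩ = triDefect ν ⟨x', p⟩ ⟨x', q⟩ + triDefect ν ⟨x', q⟩ ⟨x', r⟩ := by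
    intro p q r h1 h2
    have : ∃ t : ℝ, 0 ≤ t ∧ t ≤ 1 ∧ q = (1 - t) * p + t * r := by
      rcases (h1.trans h2).eq_or_lt with h3 | h3
      · exact ⟨0, le_rfl, zero_le_one, by simpa using mul_left_cancel₀ hx (by linarith)⟩
      · have h4 : 0 < x' * r - x' * p := by linarith
        refine ⟨(x' * q - x' * p) / (x' * r - x' * p), div_nonneg (by linarith) h4.le,
          (div_le_one h4).2 (by linarith), ?_⟩
        have : r - p ≠ 0 := fun h => by
          rw [sub_eq_zero.1 h] at h3; exact lt_irrefl _ h3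
        rw [← mul_sub, ← mul_sub, mul_div_mul_left _ _ hx]
        field_simp
        ring
    obtain ⟨t, h3, h4, rfl⟩ := this
    exact h.triDefect_cut h3 h4 (Complex.ext (by simp; ring) (by simp))
  have e : ∀ p : ℝ, (⟨x', p⟩ : ℂ) = x' + p * I := fun p => mk_eq_add_mul_I _ _
  have e0 : (⟨x', 0⟩ : ℂ) = x' := rfl
  rcases le_total 0 (x' * y) with h1 | h1
  · have h2 := hcut 0 y y' (by simpa using h1) hle
    rw [e0, e y, e y', h.triDefect_foot h1, h.triDefect_foot (h1.trans hle)] at h2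
    rw [e, e]; linarith
  · rcases le_total 0 (x' * y') with h3 | h3
    · rw [hcut y 0 y' (by simpa using h1) (by simpa using h3), e0, e y, e y',
        h.triDefect_foot h3, h.triDefect_foot' h1, add_zero]
    · have h2 := hcut y y' 0 hle (by simpa using h3)
      rw [e0, e y, e y', h.triDefect_foot' h1, h.triDefect_foot' h3] at h2
      rw [e, e]; linarith

theorem IsHom.triDefect_of_re (h : IsHom 1 ν) {u v : ℂ} (hD : 0 < u.re * v.im - u.im * v.re)
    (huv : u.re * v.re ≤ 0) : triDefect ν u v = 0 := by
  by_cases hu : u.re = 0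
  · have hv : v.re ≠ 0 := fun hv => by simp [hu, hv] at hD
    rw [h.triDefect_rotate']
    refine h.triDefect_vertical (by simpa using hv) (by simp [hu]) ?_
    rw [hu] at hD
    simp
    linarith
  by_cases hv : v.re = 0
  · rw [h.triDefect_rotate]
    refine h.triDefect_vertical (by simpa [hv] using hu) (by simp [hv]) ?_
    rw [hv] at hD
    simp [hv]
    linarith
  have hlt : 0 < u.re * (u.re - v.re) := by
    have : 0 < u.re ^ 2 := by positivity
    nlinarith
  have hne : u.re - v.re ≠ 0 := fun h0 => by simp [h0] at hlt
  set t : ℝ := u.re / (u.re - v.re) with ht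
  have ht' : t = u.re * u.re / (u.re * (u.re - v.re)) := by rw [mul_div_mul_left _ _ hu]
  have ht0 : 0 ≤ t := by rw [ht']; exact div_nonneg (mul_self_nonneg _) hlt.le
  have ht1 : t ≤ 1 := by rw [ht', div_le_one hlt]; linarith
  set w : ℂ := (1 - t : ℝ) * u + t * v with hw
  have hwre : w.re = 0 := by
    rw [hw, add_re, re_ofReal_mul, re_ofReal_mul, ht]; field_simp; ring
  have hwim : w.im = (1 - t) * u.im + t * v.im := by
    rw [hw, add_im, im_ofReal_mul, im_ofReal_mul]
  have hwre' : (1 - t) * u.re + t * v.re = 0 := by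
    rw [← hwre, hw, add_re, re_ofReal_mul, re_ofReal_mul]
  rw [h.triDefect_cut ht0 ht1 hw, h.triDefect_rotate u w, h.triDefect_rotate' w v,
    h.triDefect_vertical, h.triDefect_vertical, add_zero]
  · simpa using hv
  · simp [hwre]
  · simp
    have : 0 ≤ (1 - t) * (u.re * v.im - u.im * v.re) := mul_nonneg (sub_nonneg.2 ht1) hD.le
    have e : v.re * w.im = -((1 - t) * (u.re * v.im - u.im * v.re)) := by
      rw [hwim]; linear_combination v.im * hwre'
    nlinarith
  · simpa [hwre] using hu
  · simp [hwre]
  · simp [hwre]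
    have : 0 ≤ t * (u.re * v.im - u.im * v.re) := mul_nonneg ht0 hD.le
    have e : u.re * w.im = t * (u.re * v.im - u.im * v.re) := by
      rw [hwim]; linear_combination u.im * hwre'
    nlinarith

theorem IsHom.triDefect_eq_zero (h : IsHom 1 ν) {u v : ℂ}
    (hD : 0 < u.re * v.im - u.im * v.re) : triDefect ν u v = 0 := by
  by_cases h1 : u.re * v.re ≤ 0
  · exact h.triDefect_of_re hD h1
  by_cases h2 : (v - u).re * (-u).re ≤ 0
  · rw [h.triDefect_rotate]
    refine h.triDefect_of_re ?_ h2
    simp; linarith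
  · rw [h.triDefect_rotate']
    refine h.triDefect_of_re ?_ ?_
    · simp; linarith
    · simp at h1 h2 ⊢
      nlinarith

theorem IsHom.isSublinear_genFun (h : IsHom 1 ν)
    (hT : ∀ u v, ν (tri u v) ≤ ν (tri u 0) + ν (tri v 0)) : IsSublinear (genFun ν) := by
  have hpos : ∀ u, 0 ≤ ν (tri u 0) := fun u => by
    have h1 := hT u u
    rw [h.tri_rotate, sub_self, tri_comm, h.seg_neg] at h1
    linarith
  have hmain : ∀ u v : ℂ, 0 < u.re * v.im - u.im * v.re →
      genFun ν (u + v) ≤ genFun ν u + genFun ν v := by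
    intro u v hD
    have h1 := h.triDefect_eq_zero (u := u) (v := u + v) (by simp; linarith)
    have h2 := h.genFun_add_neg (u + v)
    have h3 := h.parallelogram u (-v)
    have h4 := hT u (-v)
    rw [h.additive, ← neg_add', h.seg_neg, h.seg_neg, neg_neg, add_comm v u] at h3
    rw [h.seg_neg] at h4
    rw [triDefect, h.tri_rotate, add_sub_cancel_left, tri_comm] at h1
    linarith
  refine ⟨fun u v => ?_, fun t v ht => ?_⟩
  · rcases lt_trichotomy (u.re * v.im - u.im * v.re) 0 with hD | hD | hD
    · rw [add_comm u, add_comm (genFun ν u)]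
      exact hmain v u (by linarith)
    · by_cases hu : u = 0
      · have : genFun ν 0 = 0 := by simpa using h.genFun_mul le_rfl 0
        simp [hu, this]
      obtain ⟨c, rfl⟩ : ∃ c : ℝ, v = c * u := by
        have h0 : (v / u : ℂ) = (v / u).re := Complex.ext rfl (by
          rw [div_im, ← sub_div, div_eq_zero_iff.2 (Or.inl (by linarith)), ofReal_im])
        exact ⟨_, by rw [← h0, div_mul_cancel₀ _ hu]⟩
      have hs := h.genFun_add_neg u
      have hσ := hpos u
      rcases le_total 0 c with hc | hc
      · rw [h.genFun_mul hc, show u + c * u = ((1 + c : ℝ) : ℂ) * u by push_cast; ring,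
          h.genFun_mul (by linarith)]
        linarith
      · have h1 : genFun ν (c * u) = -c * genFun ν (-u) := by
          rw [← h.genFun_mul (neg_nonneg.2 hc)]; congr 1; push_cast; ring
        rw [h1]
        rcases le_total 0 (1 + c) with hc' | hc'
        · rw [show u + c * u = ((1 + c : ℝ) : ℂ) * u by push_cast; ring, h.genFun_mul hc']
          nlinarith
        · rw [show u + c * u = ((-(1 + c) : ℝ) : ℂ) * -u by push_cast; ring,
            h.genFun_mul (neg_nonneg.2 hc')]
          nlinarith
    · exact hmain u v hD
  · rw [real_smul]; exact h.genFun_mul ht v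

/-- A Minkowski additive planar functional whose values on triangles satisfy the triangle
inequality is a mixed area. -/
theorem IsHom.exists_mv (h : IsHom 1 ν)
    (hT : ∀ u v, ν (tri u v) ≤ ν (tri u 0) + ν (tri v 0)) : ∃ N, ∀ K, ν K = mv K N := by
  have hs := h.isSublinear_genFun hT
  obtain ⟨N, hN⟩ := IsSublinear.exists_body (F := fun ζ : ℂ => genFun ν (I * ζ))
    ⟨fun u v => by simpa [mul_add] using hs.add_le (I * u) (I * v), fun t v ht => by
      simpa [mul_left_comm] using hs.smul t (I * v) ht⟩
  refine ⟨N, fun K => ?_⟩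
  have h1 := (h.toIsCTV.sub (isHom_mv N).toIsCTV).eq_zero_of_tri_pos (fun u v hD => ?_) K
  · linarith
  · have h2 := h.triDefect_eq_zero hD
    rw [mv_tri N hD, hN]
    simp only [triDefect] at h2
    have e : ∀ z : ℂ, I * (-I * z) = z := fun z => by rw [← mul_assoc]; simp
    have e' : I * (I * v) = -v := by rw [← mul_assoc]; simp
    simp only [e, e']
    linarith

end PlanarCharacterization

section FirstTriangle

open ConvexBody

local notation "X" => ℂ × ℂ

variable {φ : ConvexBody X → ℝ}

/-- The lower complex shear `(x, y) ↦ (x, y + c x)`. -/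
def shL (c : ℂ) : X →L[ℝ] X :=
  (ContinuousLinearMap.fst ℝ ℂ ℂ).prod
    (ContinuousLinearMap.snd ℝ ℂ ℂ + c • ContinuousLinearMap.fst ℝ ℂ ℂ)

theorem shL_apply (c : ℂ) (v : X) : shL c v = (v.1, v.2 + c * v.1) := by simp [shL]

/-- The map `(x, y) ↦ (y, -x)`. -/
def rotX : X →L[ℝ] X :=
  (ContinuousLinearMap.snd ℝ ℂ ℂ).prod (-ContinuousLinearMap.fst ℝ ℂ ℂ)

theorem rotX_apply (v : X) : rotX v = (v.2, -v.1) := by simp [rotX]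

theorem nonneg_of_forall_cubic {p q : ℝ} (h : ∀ r : ℝ, 0 < r → 0 ≤ r * p + r ^ 3 * q) :
    0 ≤ p ∧ 0 ≤ q := by
  have h' : ∀ s : ℝ, 0 < s → 0 ≤ p + s * q := by
    intro s hs
    have h1 := h (Real.sqrt s) (Real.sqrt_pos.2 hs)
    have h2 : Real.sqrt s * p + Real.sqrt s ^ 3 * q = Real.sqrt s * (p + s * q) := by
      rw [pow_succ, Real.sq_sqrt hs.le]; ring
    rw [h2] at h1
    exact nonneg_of_mul_nonneg_right h1 (Real.sqrt_pos.2 hs)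
  constructor
  · by_contra! hp
    have h1 := h' (-p / (2 * (|q| + 1))) (div_pos (by linarith) (by positivity))
    have h2 : -p / (2 * (|q| + 1)) * q ≤ -p / (2 * (|q| + 1)) * (|q| + 1) :=
      mul_le_mul_of_nonneg_left (by linarith [le_abs_self q])
        (div_nonneg (by linarith) (by positivity))
    have h3 : -p / (2 * (|q| + 1)) * (|q| + 1) = -p / 2 := by field_simp
    linarith
  · by_contra! hq
    have h1 := h' ((|p| + 1) / (-q)) (div_pos (by positivity) (by linarith))
    have h2 : (|p| + 1) / (-q) * q = -(|p| + 1) := by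
      have : q ≠ 0 := hq.ne
      field_simp
    linarith [le_abs_self p]

theorem Adm.mcm_le (h : Adm φ) {a b c : ℝ} {A B C : X →L[ℝ] X}
    (hle : ∀ K : ConvexBody X, a * φ (K.mapCLM A) ≤ b * φ (K.mapCLM B) + c * φ (K.mapCLM C))
    (K : ConvexBody X) :
    a * mcm 4 φ 1 (K.mapCLM A) ≤ b * mcm 4 φ 1 (K.mapCLM B) + c * mcm 4 φ 1 (K.mapCLM C) ∧
    a * mcm 4 φ 3 (K.mapCLM A) ≤ b * mcm 4 φ 3 (K.mapCLM B) + c * mcm 4 φ 3 (K.mapCLM C) := by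
  have := nonneg_of_forall_cubic
    (p := b * mcm 4 φ 1 (K.mapCLM B) + c * mcm 4 φ 1 (K.mapCLM C) - a * mcm 4 φ 1 (K.mapCLM A))
    (q := b * mcm 4 φ 3 (K.mapCLM B) + c * mcm 4 φ 3 (K.mapCLM C) - a * mcm 4 φ 3 (K.mapCLM A)) ?_
  · exact ⟨by linarith [this.1], by linarith [this.2]⟩
  · intro r hr
    have h1 := hle (r • K)
    simp only [mapCLM_smul, h.eq_scaled _ hr.le] at h1
    linarith

theorem mapCLM_hullBody {V V' : Type*} [NormedAddCommGroup V] [NormedSpace ℝ V]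
    [NormedAddCommGroup V'] [NormedSpace ℝ V'] {T : Finset V} (hT : T.Nonempty) (f : V →L[ℝ] V')
    {L : ConvexBody V'} (h : (L : Set V') = convexHull ℝ (f '' (T : Set V))) :
    (hullBody T hT).mapCLM f = L := by
  apply SetLike.coe_injective
  rw [h]
  exact (f : V →ₗ[ℝ] V').image_convexHull _

theorem seg_eq_convexHull (u : ℂ) : (tri u 0 : Set ℂ) = convexHull ℝ {0, u} := by
  rw [convexHull_pair]
  ext x
  refine Iff.trans mem_seg ?_
  rw [segment_eq_image]
  constructor
  · rintro ⟨s, h0, h1, rfl⟩; exact ⟨s, ⟨h0, h1⟩, by simp⟩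
  · rintro ⟨s, ⟨h0, h1⟩, rfl⟩; exact ⟨s, h0, h1, by simp⟩

theorem tri_eq_convexHull (u v : ℂ) {S : Set ℂ} (h0 : (0 : ℂ) ∈ S) (hu : u ∈ S) (hv : v ∈ S)
    (hS : S ⊆ tri u v) : (tri u v : Set ℂ) = convexHull ℝ S := by
  refine Set.Subset.antisymm (fun x hx => ?_) (convexHull_min hS (tri u v).convex)
  obtain ⟨s, t, hs, ht, hst, rfl⟩ := mem_tri.1 hx
  have := (convex_convexHull ℝ S).sum_mem (t := (Finset.univ : Finset (Fin 3)))
    (w := ![1 - s - t, s, t]) (z := ![0, u, v])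
    (by intro i _; fin_cases i <;> simp <;> linarith)
    (by simp [Fin.sum_univ_three]; ring)
    (by intro i _; fin_cases i <;> exact subset_convexHull ℝ S (by assumption))
  simpa [Fin.sum_univ_three] using this

theorem Adm.vert_tri_le (h : Adm φ)
    (hle : ∀ K : ConvexBody X, 2 * φ K ≤ φ (K.mapCLM (shL (-1))) + φ (K.mapCLM (shL 1)))
    (u v : ℂ) : φ (vert (tri u v)) ≤ φ (vert (tri u 0)) + φ (vert (tri v 0)) := by
  classical
  set T : Finset X := {(0, 0), (0, u), (0, v), ((1 / 2 : ℝ) * (u + v), (1 / 2 : ℝ) * (u + v))}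
    with hT
  have hTn : T.Nonempty := ⟨(0, 0), by simp [hT]⟩
  have hmid : ((1 / 2 : ℝ) : ℂ) * (u + v) ∈ tri u v :=
    mem_tri.2 ⟨1 / 2, 1 / 2, by norm_num, by norm_num, by norm_num, by push_cast; ring⟩
  have h0T : (0 : ℂ) ∈ tri u v := mem_tri.2 ⟨0, 0, by simp⟩
  have huT : u ∈ tri u v := mem_tri.2 ⟨1, 0, by simp⟩
  have hvT : v ∈ tri u v := mem_tri.2 ⟨0, 1, by simp⟩
  have key := (h.mcm_le (a := 2) (b := 1) (c := 1) (A := .id ℝ X) (B := shL (-1)) (C := shL 1)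
    (fun K => by simpa [mapCLM_id] using hle K) (hullBody T hTn)).1
  rw [mapCLM_id, h.one_eq, h.one_eq, h.one_eq, projY, projY, projY, mapCLM_mapCLM,
    mapCLM_mapCLM] at key
  have e1 : (hullBody T hTn).mapCLM (ContinuousLinearMap.snd ℝ ℂ ℂ) = tri u v := by
    refine mapCLM_hullBody hTn _ (tri_eq_convexHull u v ?_ ?_ ?_ ?_)
    · exact ⟨(0, 0), by simp [hT], rfl⟩
    · exact ⟨(0, u), by simp [hT], rfl⟩
    · exact ⟨(0, v), by simp [hT], rfl⟩
    · rintro _ ⟨p, hp, rfl⟩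
      simp only [hT, Finset.coe_insert, Finset.coe_singleton, Set.mem_insert_iff,
        Set.mem_singleton_iff] at hp
      rcases hp with rfl | rfl | rfl | rfl <;> assumption
  have e2 : (hullBody T hTn).mapCLM ((ContinuousLinearMap.snd ℝ ℂ ℂ).comp (shL (-1))) =
      tri u v := by
    refine mapCLM_hullBody hTn _ (tri_eq_convexHull u v ?_ ?_ ?_ ?_)
    · exact ⟨(0, 0), by simp [hT], by simp [shL_apply]⟩
    · exact ⟨(0, u), by simp [hT], by simp [shL_apply]⟩
    · exact ⟨(0, v), by simp [hT], by simp [shL_apply]⟩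
    · rintro _ ⟨p, hp, rfl⟩
      simp only [hT, Finset.coe_insert, Finset.coe_singleton, Set.mem_insert_iff,
        Set.mem_singleton_iff] at hp
      rcases hp with rfl | rfl | rfl | rfl <;> simp [shL_apply] <;> assumption
  have e3 : (hullBody T hTn).mapCLM ((ContinuousLinearMap.snd ℝ ℂ ℂ).comp (shL 1)) =
      tri u 0 + tri v 0 := by
    refine mapCLM_hullBody hTn _ ?_
    rw [ConvexBody.coe_add, seg_eq_convexHull, seg_eq_convexHull, ← convexHull_add]
    congr 1
    have hhalf' : (2 : ℂ)⁻¹ * (u + v) + 2⁻¹ * (u + v) = u + v := by ring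
    simp [hT, Set.image_insert_eq, shL_apply, hhalf']
    ext x
    simp only [Set.mem_add, Set.mem_insert_iff, Set.mem_singleton_iff, exists_eq_or_imp,
      exists_eq_left, zero_add, add_zero]
    grind
  rw [e1, e2, e3, h.isHom_vert.additive] at key
  linarith

end FirstTriangle

section SecondTriangle

open ConvexBody Complex

local notation "X" => ℂ × ℂ

/-- The rectangle `[0, a] × [0, b]`. -/
def rect (a b : ℝ) : ConvexBody ℂ := tri a 0 + tri (b * I) 0

theorem mem_rect {a b : ℝ} (ha : 0 ≤ a) (hb : 0 ≤ b) {z : ℂ} :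
    z ∈ rect a b ↔ (0 ≤ z.re ∧ z.re ≤ a) ∧ 0 ≤ z.im ∧ z.im ≤ b := by
  have aux : ∀ {x c : ℝ}, 0 ≤ x → x ≤ c → ∃ s : ℝ, 0 ≤ s ∧ s ≤ 1 ∧ x = s * c := by
    intro x c h0 h1
    rcases (h0.trans h1).eq_or_lt with h | h
    · exact ⟨0, le_rfl, zero_le_one, by rw [zero_mul]; linarith⟩
    · exact ⟨x / c, div_nonneg h0 h.le, (div_le_one h).2 h1, by field_simp⟩
  rw [rect, mem_add]
  constructor
  · rintro ⟨_, h1, _, h2, rfl⟩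
    obtain ⟨s, hs0, hs1, rfl⟩ := mem_seg.1 h1
    obtain ⟨t, ht0, ht1, rfl⟩ := mem_seg.1 h2
    simpa using ⟨⟨mul_nonneg hs0 ha, mul_le_of_le_one_left ha hs1⟩, mul_nonneg ht0 hb,
      mul_le_of_le_one_left hb ht1⟩
  · rintro ⟨⟨h1, h2⟩, h3, h4⟩
    obtain ⟨s, hs0, hs1, hs⟩ := aux h1 h2
    obtain ⟨t, ht0, ht1, ht⟩ := aux h3 h4
    exact ⟨_, mem_seg.2 ⟨s, hs0, hs1, rfl⟩, _, mem_seg.2 ⟨t, ht0, ht1, rfl⟩,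
      Complex.ext (by simp [hs]) (by simp [ht])⟩

theorem IsHom.rect {ν : ConvexBody ℂ → ℝ} (h : IsHom 1 ν) {a b : ℝ} (ha : 0 ≤ a) (hb : 0 ≤ b) :
    ν (rect a b) = a * ν (tri 1 0) + b * ν (tri I 0) := by
  rw [_root_.rect, h.additive, h.seg_mul, ← mul_one (a : ℂ), h.seg_mul, abs_of_nonneg ha,
    abs_of_nonneg hb]

theorem volume_reProdIm_Icc {a b c d : ℝ} (hab : a ≤ b) :
    volume (Set.Icc a b ×ℂ Set.Icc c d) = ENNReal.ofReal ((b - a) * (d - c)) := by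
  rw [show Set.Icc a b ×ℂ Set.Icc c d =
    Complex.measurableEquivRealProd ⁻¹' (Set.Icc a b ×ˢ Set.Icc c d) from rfl,
    Complex.volume_preserving_equiv_real_prod.measure_preimage
    (measurableSet_Icc.prod measurableSet_Icc).nullMeasurableSet, Measure.volume_eq_prod,
    Measure.prod_prod, Real.volume_Icc, Real.volume_Icc, ← ENNReal.ofReal_mul (by linarith)]

theorem integral_reProdIm_Icc {a b c d : ℝ} (hab : a ≤ b) (hcd : c ≤ d) (e : ℝ) :
    Integrable ((Set.Icc a b ×ℂ Set.Icc c d).indicator fun _ => e) ∧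
    ∫ z, (Set.Icc a b ×ℂ Set.Icc c d).indicator (fun _ => e) z = (b - a) * (d - c) * e := by
  have hm := (isCompact_Icc (a := a) (b := b)).reProdIm (isCompact_Icc (a := c) (b := d))
  refine ⟨(integrable_indicator_iff hm.measurableSet).2
    (integrableOn_const hm.measure_lt_top.ne), ?_⟩
  rw [integral_indicator_const _ hm.measurableSet, Measure.real, volume_reProdIm_Icc hab,
    ENNReal.toReal_ofReal (mul_nonneg (by linarith) (by linarith)), smul_eq_mul]

/-- The test body comparing a triangle with its sides. -/
def wedgeBody (R : ℝ) (hR : 0 ≤ R) : ConvexBody X :=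
  ⟨(prodBody (rect 1 R) (rect R 1) : Set X) ∩ {p | p.1.re + p.2.im ≤ 1},
    (prodBody (rect 1 R) (rect R 1)).convex.inter
    (convex_halfSpace_le (reCLM.comp (ContinuousLinearMap.fst ℝ ℂ ℂ) +
      imCLM.comp (ContinuousLinearMap.snd ℝ ℂ ℂ)).isLinear 1),
    (prodBody (rect 1 R) (rect R 1)).isCompact.inter_right
      (isClosed_le (by fun_prop) continuous_const), 0, mem_prodBody.2
      ⟨(mem_rect zero_le_one hR).2 (by simp [hR]), (mem_rect hR zero_le_one).2 (by simp [hR])⟩,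
      by simp⟩

theorem mem_wedgeBody {R : ℝ} (hR : 0 ≤ R) {p : X} : p ∈ wedgeBody R hR ↔
    (((0 ≤ p.1.re ∧ p.1.re ≤ 1) ∧ 0 ≤ p.1.im ∧ p.1.im ≤ R) ∧
      (0 ≤ p.2.re ∧ p.2.re ≤ R) ∧ 0 ≤ p.2.im ∧ p.2.im ≤ 1) ∧ p.1.re + p.2.im ≤ 1 := by
  rw [← mem_rect zero_le_one hR, ← mem_rect hR zero_le_one, ← mem_prodBody]
  rfl

variable {ν : ConvexBody ℂ → ℝ}

theorem hat_fiber_wedge_le (h : IsHom 1 ν) {R : ℝ} (hR : 1 ≤ R) (q : ℂ) :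
    hat ν (fiber (wedgeBody R (by linarith)) q) ≤ (Set.Icc 0 R ×ℂ Set.Icc 0 1).indicator
      (fun _ => |ν (tri 1 0)| + R * ν (tri I 0)) q := by
  have hR0 : 0 ≤ R := by linarith
  by_cases hq : q ∈ Set.Icc 0 R ×ℂ Set.Icc (0 : ℝ) 1
  · obtain ⟨⟨h1, h2⟩, h3, h4⟩ := id hq
    have e : fiber (wedgeBody R hR0 : Set X) q = rect (1 - q.im) R := by
      ext x
      refine (mem_wedgeBody hR0).trans (Iff.trans ?_ (mem_rect (by linarith) hR0).symm)
      constructor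
      · rintro ⟨⟨⟨⟨h5, h6⟩, h7⟩, -⟩, h8⟩; exact ⟨⟨h5, by linarith⟩, h7⟩
      · rintro ⟨⟨h5, h6⟩, h7⟩; exact ⟨⟨⟨⟨h5, by linarith⟩, h7⟩, ⟨h1, h2⟩, h3, h4⟩, by linarith⟩
    rw [e, hat_coe, h.rect (by linarith) hR0, Set.indicator_of_mem hq]
    nlinarith [le_abs_self (ν (tri 1 0)), abs_nonneg (ν (tri 1 0))]
  · have e : fiber (wedgeBody R hR0 : Set X) q = ∅ :=
      Set.eq_empty_iff_forall_notMem.2 fun x hx => hq ((mem_wedgeBody hR0).1 hx).1.2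
    rw [e, hat_empty, Set.indicator_of_notMem hq]

theorem hat_fiber_rot_wedge_le (h : IsHom 1 ν) {R : ℝ} (hR : 1 ≤ R) (q : ℂ) :
    hat ν (fiber ((wedgeBody R (by linarith)).mapCLM rotX) q) ≤
      (Set.Icc (-1) 0 ×ℂ Set.Icc (-R) 0).indicator
      (fun _ => R * ν (tri 1 0) + |ν (tri I 0)|) q := by
  have hR0 : 0 ≤ R := by linarith
  have hm : ∀ x, x ∈ fiber ((wedgeBody R hR0).mapCLM rotX : Set X) q ↔
      (-q, x) ∈ wedgeBody R hR0 := by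
    intro x
    refine mem_mapCLM.trans ?_
    constructor
    · rintro ⟨p, hp, hpe⟩
      rw [rotX_apply, Prod.mk.injEq] at hpe
      rwa [← hpe.1, ← hpe.2, neg_neg]
    · intro hx; exact ⟨_, hx, by simp [rotX_apply]⟩
  by_cases hq : q ∈ Set.Icc (-1 : ℝ) 0 ×ℂ Set.Icc (-R) 0
  · obtain ⟨⟨h1, h2⟩, h3, h4⟩ := id hq
    have e : fiber ((wedgeBody R hR0).mapCLM rotX : Set X) q = rect R (1 + q.re) := by
      ext x
      refine (hm x).trans ((mem_wedgeBody hR0).trans (Iff.trans ?_ (mem_rect hR0 (by linarith)).symm))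
      simp only [neg_re, neg_im]
      constructor
      · rintro ⟨⟨-, h7, h5, h6⟩, h8⟩; exact ⟨h7, h5, by linarith⟩
      · rintro ⟨h7, h5, h6⟩
        exact ⟨⟨⟨⟨by linarith, by linarith⟩, by linarith, by linarith⟩, h7, h5, by linarith⟩,
          by linarith⟩
    rw [e, hat_coe, h.rect hR0 (by linarith), Set.indicator_of_mem hq]
    nlinarith [le_abs_self (ν (tri I 0)), abs_nonneg (ν (tri I 0))]
  · have e : fiber ((wedgeBody R hR0).mapCLM rotX : Set X) q = ∅ := by
      rw [Set.eq_empty_iff_forall_notMem]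
      intro x hx
      have := ((mem_wedgeBody hR0).1 ((hm x).1 hx)).1.1
      simp only [neg_re, neg_im] at this
      exact hq ⟨⟨by linarith [this.1.2], by linarith [this.1.1]⟩, by linarith [this.2.2],
        by linarith [this.2.1]⟩
    rw [e, hat_empty, Set.indicator_of_notMem hq]

theorem le_hat_fiber_shear_wedge (h : IsHom 1 ν) {C : ℝ} (hC0 : 0 ≤ C)
    (hC : ∀ K : ConvexBody ℂ, (∀ x ∈ K, ‖x‖ ≤ 2) → |ν K| ≤ C) {R : ℝ} (hR : 1 ≤ R) (q : ℂ) :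
    (Set.Icc 0 (R - 1) ×ℂ Set.Icc (1 - R) 0).indicator (fun _ => ν stdTri + C) q -
      (Set.Icc (-1) R ×ℂ Set.Icc (-R) 1).indicator (fun _ => C) q ≤
    hat ν (fiber ((wedgeBody R (by linarith)).mapCLM (shL (-1))) q) := by
  have hR0 : 0 ≤ R := by linarith
  have hm : ∀ x, x ∈ fiber ((wedgeBody R hR0).mapCLM (shL (-1)) : Set X) q ↔
      (x, q + x) ∈ wedgeBody R hR0 := by
    intro x
    refine mem_mapCLM.trans ?_
    constructor
    · rintro ⟨p, hp, hpe⟩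
      rw [shL_apply, Prod.mk.injEq] at hpe
      rwa [← hpe.1, ← hpe.2, show p.2 + -1 * p.1 + p.1 = p.2 by ring]
    · intro hx; exact ⟨_, hx, by simp [shL_apply]⟩
  set S := fiber ((wedgeBody R hR0).mapCLM (shL (-1)) : Set X) q with hS
  by_cases hin : q ∈ Set.Icc 0 (R - 1) ×ℂ Set.Icc (1 - R) 0
  · obtain ⟨⟨h1, h2⟩, h3, h4⟩ := id hin
    have hout : q ∈ Set.Icc (-1) R ×ℂ Set.Icc (-R) 1 :=
      ⟨⟨by linarith, by linarith⟩, by linarith, by linarith⟩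
    have e : S = stdTri.translate (-(q.im : ℂ) * I) := by
      ext x
      refine (hm x).trans ((mem_wedgeBody hR0).trans (Iff.trans ?_
        (mem_translate_iff.trans mem_stdTri).symm))
      simp only [add_re, add_im, sub_re, sub_im, mul_re, mul_im, neg_re, neg_im, ofReal_re,
        ofReal_im, I_re, I_im]
      constructor
      · rintro ⟨⟨⟨h5, h6⟩, h7, h8⟩, h9⟩
        exact ⟨by linarith, by linarith, by linarith⟩
      · rintro ⟨h5, h6, h7⟩
        exact ⟨⟨⟨⟨by linarith, by linarith⟩, by linarith, by linarith⟩,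
          ⟨by linarith, by linarith⟩, by linarith, by linarith⟩, by linarith⟩
    rw [e, hat_coe, h.trans, Set.indicator_of_mem hin, Set.indicator_of_mem hout]
    linarith
  · rw [Set.indicator_of_notMem hin, zero_sub]
    by_cases hne : S.Nonempty
    · rw [hat_of_convex ν (convex_fiber _ _) (isCompact_fiber _ _) hne]
      set L : ConvexBody ℂ := ⟨S, _, _, hne⟩ with hL
      have hmem : ∀ x ∈ L, (x, q + x) ∈ wedgeBody R hR0 := fun x hx => (hm x).1 hx
      have hout : q ∈ Set.Icc (-1) R ×ℂ Set.Icc (-R) 1 := by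
        obtain ⟨x, hx⟩ := hne
        obtain ⟨⟨⟨⟨h5, h6⟩, h7, h8⟩, ⟨h9, h10⟩, h11, h12⟩, h13⟩ :=
          (mem_wedgeBody hR0).1 (hmem x hx)
        simp only [add_re, add_im] at *
        exact ⟨⟨by linarith, by linarith⟩, by linarith, by linarith⟩
      rw [Set.indicator_of_mem hout, ← h.trans L ((q.im : ℂ) * I)]
      refine (abs_le.1 (hC _ fun x hx => ?_)).1
      obtain ⟨⟨⟨⟨h5, h6⟩, h7, h8⟩, ⟨h9, h10⟩, h11, h12⟩, h13⟩ :=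
        (mem_wedgeBody hR0).1 (hmem _ (mem_translate_iff.1 hx))
      simp only [add_re, add_im, sub_re, sub_im, mul_re, mul_im, ofReal_re,
        ofReal_im, I_re, I_im] at *
      refine (Complex.norm_le_abs_re_add_abs_im x).trans ?_
      linarith [abs_le.2 (⟨by linarith, by linarith⟩ : -1 ≤ x.re ∧ x.re ≤ 1),
        abs_le.2 (⟨by linarith, by linarith⟩ : -1 ≤ x.im ∧ x.im ≤ 1)]
    · rw [Set.not_nonempty_iff_eq_empty.1 hne, hat_empty]
      have := Set.indicator_nonneg (s := Set.Icc (-1) R ×ℂ Set.Icc (-R) 1)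
        (f := fun _ : ℂ => C) (fun _ _ => hC0) q
      linarith

theorem IsHom.stdTri_le (h : IsHom 1 ν)
    (hint : ∀ K : ConvexBody X, Integrable fun q => hat ν (fiber K q))
    (hle : ∀ K : ConvexBody X, ∫ q, hat ν (fiber (K.mapCLM (shL (-1))) q) ≤
      (∫ q, hat ν (fiber K q)) + ∫ q, hat ν (fiber (K.mapCLM rotX) q)) :
    ν stdTri ≤ ν (tri 1 0) + ν (tri I 0) := by
  obtain ⟨C, hC0, hC⟩ := h.bounded one_ne_zero 2
  set σ₁ := ν (tri 1 0)
  set σ₂ := ν (tri I 0)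
  set τ := ν stdTri
  have key : ∀ R : ℝ, 1 ≤ R →
      (R - 1) ^ 2 * (τ + C) - (R + 1) ^ 2 * C ≤ R * (|σ₁| + R * σ₂) + R * (R * σ₁ + |σ₂|) := by
    intro R hR
    have hR0 : 0 ≤ R := by linarith
    have a1 := integral_reProdIm_Icc (a := 0) (b := R - 1) (c := 1 - R) (d := 0)
      (by linarith) (by linarith) (τ + C)
    have a2 := integral_reProdIm_Icc (a := -1) (b := R) (c := -R) (d := 1)
      (by linarith) (by linarith) C
    have a3 := integral_reProdIm_Icc (a := 0) (b := R) (c := 0) (d := 1)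
      (by linarith) (by linarith) (|σ₁| + R * σ₂)
    have a4 := integral_reProdIm_Icc (a := -1) (b := 0) (c := -R) (d := 0)
      (by linarith) (by linarith) (R * σ₁ + |σ₂|)
    have b1 := integral_mono (a1.1.sub a2.1) (hint ((wedgeBody R hR0).mapCLM (shL (-1))))
      (le_hat_fiber_shear_wedge h hC0 hC hR)
    have b2 := integral_mono (hint (wedgeBody R hR0)) a3.1 (hat_fiber_wedge_le h hR)
    have b3 := integral_mono (hint ((wedgeBody R hR0).mapCLM rotX)) a4.1
      (hat_fiber_rot_wedge_le h hR)
    rw [integral_sub' a1.1 a2.1, a1.2, a2.2] at b1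
    rw [a3.2] at b2
    rw [a4.2] at b3
    have := hle (wedgeBody R hR0)
    linarith
  by_contra! hcon
  set δ := τ - σ₁ - σ₂ with hδ
  have hδ0 : 0 < δ := by rw [hδ]; linarith
  set D := 4 * C + |σ₁| + |σ₂| + 2 * |τ| with hD
  have hD0 : 0 ≤ D := by rw [hD]; positivity
  have h1 : 1 ≤ (D + |τ|) / δ + 1 := le_add_of_nonneg_left (by positivity)
  set R := (D + |τ|) / δ + 1 with hR
  have h4 : R * δ = D + |τ| + δ := by rw [hR]; field_simp
  have h5 : R * (R * δ) ≤ R * (D + |τ|) := by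
    have := key R h1
    have := mul_le_mul_of_nonneg_left (le_abs_self τ) (zero_le_one.trans h1)
    have := le_mul_of_one_le_left (abs_nonneg τ) h1
    rw [hδ, hD]; nlinarith [neg_abs_le τ]
  nlinarith

end SecondTriangle

section TriangleInequality

open ConvexBody Complex

local notation "X" => ℂ × ℂ

variable {φ : ConvexBody X → ℝ}

theorem fiber_mapCLM_prodMap {f : ℂ →L[ℝ] ℂ} (hf : Function.Injective f) (K : ConvexBody X)
    (q : ℂ) : fiber (K.mapCLM (f.prodMap f) : Set X) (f q) = f '' fiber (K : Set X) q := by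
  ext x
  constructor
  · rintro ⟨p, hp, hpe⟩
    obtain ⟨h1, h2⟩ := Prod.mk.inj hpe
    refine ⟨p.1, ?_, h1⟩
    rw [← hf h2]
    exact hp
  · rintro ⟨y, hy, rfl⟩
    exact ⟨(y, q), hy, rfl⟩

theorem hat_image {V V' : Type*} [NormedAddCommGroup V] [NormedSpace ℝ V]
    [NormedAddCommGroup V'] [NormedSpace ℝ V'] (ν : ConvexBody V' → ℝ) (f : V →L[ℝ] V') {S : Set V}
    (h₁ : Convex ℝ S) (h₂ : IsCompact S) :
    hat ν (f '' S) = hat (fun A => ν (A.mapCLM f)) S := by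
  by_cases h : S.Nonempty
  · rw [hat_of_convex _ h₁ h₂ h]
    exact hat_coe ν (mapCLM f ⟨S, h₁, h₂, h⟩)
  · rw [Set.not_nonempty_iff_eq_empty.1 h, Set.image_empty, hat_empty, hat_empty]

theorem Wt.integral_fiber_map {ψ : ConvexBody X → ℝ} (h : Wt 3 ψ) {f : ℂ →L[ℝ] ℂ}
    (hf : LinearMap.det (f : ℂ →ₗ[ℝ] ℂ) ≠ 0) (K : ConvexBody X) :
    (Integrable fun q => hat (fun A => sqVal ψ (A.mapCLM f)) (fiber K q)) ∧
    ψ (K.mapCLM (f.prodMap f)) = |LinearMap.det (f : ℂ →ₗ[ℝ] ℂ)| *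
      ∫ q, hat (fun A => sqVal ψ (A.mapCLM f)) (fiber K q) := by
  obtain ⟨h1, h2⟩ := h.integral_fiber (K.mapCLM (f.prodMap f))
  set g := fun y => hat (sqVal ψ) (fiber (K.mapCLM (f.prodMap f)) y) with hg
  have hinj : Function.Injective f :=
    (LinearMap.equivOfDetNeZero (f : ℂ →ₗ[ℝ] ℂ) hf).injective
  have he : MeasurableEmbedding f :=
    (LinearMap.equivOfDetNeZero (f : ℂ →ₗ[ℝ] ℂ) hf).toContinuousLinearEquiv.toHomeomorph
      |>.measurableEmbedding
  have hcomp : ∀ q, g (f q) = hat (fun A => sqVal ψ (A.mapCLM f)) (fiber K q) := fun q => by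
    simp only [hg]
    rw [fiber_mapCLM_prodMap hinj, hat_image _ _ (convex_fiber K q) (isCompact_fiber K q)]
  have hmap := Measure.map_linearMap_addHaar_eq_smul_addHaar (volume : Measure ℂ) hf
  rw [ContinuousLinearMap.coe_coe] at hmap
  constructor
  · have h3 : Integrable g (Measure.map f volume) := by
      rw [hmap]; exact h1.smul_measure ENNReal.ofReal_ne_top
    simpa only [Function.comp_def, hcomp] using he.integrable_map_iff.1 h3
  · have h4 := he.integral_map (μ := volume) g
    rw [hmap, integral_smul_measure, ENNReal.toReal_ofReal (abs_nonneg _), ← h2, smul_eq_mul,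
      abs_inv] at h4
    simp only [hcomp] at h4
    rw [← h4, mul_inv_cancel_left₀ (abs_ne_zero.2 hf)]

theorem Adm.sqVal_tri_le_of_det (h : Adm φ)
    (hle : ∀ K : ConvexBody X, φ (K.mapCLM (shL (-1))) ≤ φ K + φ (K.mapCLM rotX))
    {u v : ℂ} (hD : u.re * v.im - u.im * v.re ≠ 0) :
    sqVal (mcm 4 φ 3) (tri u v) ≤
      sqVal (mcm 4 φ 3) (tri u 0) + sqVal (mcm 4 φ 3) (tri v 0) := by
  set ψ := mcm 4 φ 3 with hψ
  have hw : Wt 3 ψ := h.wt_mcm (by norm_num)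
  set f := lin u v with hf
  have hdet : LinearMap.det (f : ℂ →ₗ[ℝ] ℂ) ≠ 0 := by rw [hf, det_lin]; exact hD
  set ν : ConvexBody ℂ → ℝ := fun A => sqVal ψ (A.mapCLM f) with hν
  have hνH : IsHom 1 ν :=
    ⟨hw.three_sqVal.toIsCTV.comp_mapCLM f, fun A t ht => by
      simp only [hν]; rw [mapCLM_smul, hw.three_sqVal.smul _ _ ht]⟩
  have hle3 : ∀ K : ConvexBody X, ψ (K.mapCLM (shL (-1))) ≤ ψ K + ψ (K.mapCLM rotX) := by
    intro K
    have := (h.mcm_le (a := 1) (b := 1) (c := 1) (A := shL (-1)) (B := .id ℝ X) (C := rotX)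
      (fun K => by simpa [mapCLM_id] using hle K) K).2
    simpa [mapCLM_id] using this
  have key := hνH.stdTri_le (fun K => (hw.integral_fiber_map hdet K).1) fun K => by
    have h1 := hle3 (K.mapCLM (f.prodMap f))
    have c1 : (shL (-1)).comp (f.prodMap f) = (f.prodMap f).comp (shL (-1)) :=
      ContinuousLinearMap.ext fun p => by simp [shL_apply]
    have c2 : rotX.comp (f.prodMap f) = (f.prodMap f).comp rotX :=
      ContinuousLinearMap.ext fun p => by simp [rotX_apply]
    rw [mapCLM_mapCLM, mapCLM_mapCLM, c1, c2, ← mapCLM_mapCLM, ← mapCLM_mapCLM,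
      (hw.integral_fiber_map hdet _).2, (hw.integral_fiber_map hdet _).2,
      (hw.integral_fiber_map hdet _).2, ← mul_add] at h1
    exact le_of_mul_le_mul_left h1 (abs_pos.2 hdet)
  simp only [hν, tri_mapCLM] at key
  have e1 : f 1 = u := by simp [hf, lin_apply]
  have e2 : f I = v := by simp [hf, lin_apply]
  rw [e1, e2, map_zero] at key
  exact key

theorem continuous_tri : Continuous fun p : ℂ × ℂ => tri p.1 p.2 := by
  have h1 : Continuous fun p : ℂ × ℂ => lin p.1 p.2 := by
    unfold lin
    exact ((ContinuousLinearMap.smulRightL ℝ ℂ ℂ reCLM).continuous.comp continuous_fst).add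
      ((ContinuousLinearMap.smulRightL ℝ ℂ ℂ imCLM).continuous.comp continuous_snd)
  exact continuous_mapCLM_prod.comp (h1.prodMk continuous_const)

theorem Adm.sqVal_tri_le (h : Adm φ)
    (hle : ∀ K : ConvexBody X, φ (K.mapCLM (shL (-1))) ≤ φ K + φ (K.mapCLM rotX)) (u v : ℂ) :
    sqVal (mcm 4 φ 3) (tri u v) ≤
      sqVal (mcm 4 φ 3) (tri u 0) + sqVal (mcm 4 φ 3) (tri v 0) := by
  by_cases hD : u.re * v.im - u.im * v.re ≠ 0
  · exact h.sqVal_tri_le_of_det hle hD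
  push Not at hD
  set ν := sqVal (mcm 4 φ 3)
  have hc : Continuous ν := (h.wt_mcm (i := 3) (by norm_num)).three_sqVal.cont
  have h1 : Continuous fun ε : ℝ => ν (tri (u + ε) (v + ε * I)) :=
    hc.comp (continuous_tri.comp (f := fun ε : ℝ => (u + (ε : ℂ), v + ε * I)) (by fun_prop))
  have h2 : Continuous fun ε : ℝ => ν (tri (u + ε) 0) + ν (tri (v + ε * I) 0) :=
    (hc.comp (continuous_tri.comp (f := fun ε : ℝ => (u + (ε : ℂ), (0 : ℂ))) (by fun_prop))).add
      (hc.comp (continuous_tri.comp (f := fun ε : ℝ => (v + (ε : ℂ) * I, (0 : ℂ))) (by fun_prop)))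
  have h3 := (h1.tendsto 0).mono_left (nhdsWithin_le_nhds (s := Set.Ioi 0))
  have h4 := (h2.tendsto 0).mono_left (nhdsWithin_le_nhds (s := Set.Ioi 0))
  have h5 : ∀ᶠ ε : ℝ in nhdsWithin 0 (Set.Ioi 0), ε + (u.re + v.im) ≠ 0 := by
    rcases eq_or_ne (u.re + v.im) 0 with h0 | h0
    · filter_upwards [self_mem_nhdsWithin] with ε hε
      rw [h0, add_zero]; exact (Set.mem_Ioi.1 hε).ne'
    · refine nhdsWithin_le_nhds ?_
      have : Continuous fun ε : ℝ => ε + (u.re + v.im) := by fun_prop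
      exact this.continuousAt.eventually_ne (by simpa using h0)
  have h6 := le_of_tendsto_of_tendsto h3 h4 (by
    filter_upwards [self_mem_nhdsWithin, h5] with ε hε hne
    refine h.sqVal_tri_le_of_det hle ?_
    have hε : (0 : ℝ) < ε := hε
    have e : (u + (ε : ℂ)).re * (v + ε * I).im - (u + (ε : ℂ)).im * (v + ε * I).re =
        ε * (ε + (u.re + v.im)) + (u.re * v.im - u.im * v.re) := by
      simp; ring
    rw [e, hD, add_zero]
    exact mul_ne_zero hε.ne' hne)
  simpa using h6

/-- An admissible valuation satisfying two instances of subadditivity is given by two planar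
bodies on the test bodies `0 × L` and `A × □`. -/
theorem Adm.exists_bodies (h : Adm φ)
    (hle₁ : ∀ K : ConvexBody X, 2 * φ K ≤ φ (K.mapCLM (shL (-1))) + φ (K.mapCLM (shL 1)))
    (hle₂ : ∀ K : ConvexBody X, φ (K.mapCLM (shL (-1))) ≤ φ K + φ (K.mapCLM rotX)) :
    ∃ M N : ConvexBody ℂ, (∀ L, φ (vert L) = mv L M) ∧
      ∀ A, φ (prodBody A unitSq) = mv unitSq M + mv A N := by
  obtain ⟨M, hM⟩ := h.isHom_vert.exists_mv (h.vert_tri_le hle₁)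
  obtain ⟨N, hN⟩ := (h.wt_mcm (i := 3) (by norm_num)).three_sqVal.exists_mv (h.sqVal_tri_le hle₂)
  refine ⟨M, N, hM, fun A => ?_⟩
  have := hN A
  rw [h.sqVal_three, prodBody_zero, hM] at this
  linarith

end TriangleInequality

section SurfaceArea

open ConvexBody Complex
open scoped CompactlySupported

theorem two_mul_mixedVol (M L : ConvexBody ℂ) : 2 * mixedVol volume ![M, L] = mv M L := by
  have h : (Finset.univ : Finset (Finset (Fin 2))) = {∅, {0}, {1}, {0, 1}} := by decide
  have h0 : (volume (0 : Set ℂ)).toReal = 0 := by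
    rw [← Set.singleton_zero]; simp
  have e : area (M + L) = (volume ((M : Set ℂ) + (L : Set ℂ))).toReal := by rw [area, vol, coe_add]
  rw [mixedVol, h, mv_eq, e]
  rw [Finset.sum_insert (by decide), Finset.sum_insert (by decide), Finset.sum_insert (by decide),
    Finset.sum_singleton]
  simp [h0, area, vol, Nat.factorial]
  ring

theorem hSupp_mul_conj (L : ConvexBody ℂ) (α : ℂ) :
    hSupp L (fun c => (c * (starRingEnd ℂ) α).re) = supp L α := by
  rw [supp]
  congr 1

/-- The support function of a planar body, restricted to the unit circle. -/
def circleSupp (K : ConvexBody ℂ) : C_c(Metric.sphere (0 : ℂ) 1, ℝ) :=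
  ⟨⟨fun v => supp K v, (isSublinear_supp K).continuous.comp continuous_subtype_val⟩,
    HasCompactSupport.of_compactSpace _⟩

theorem supp_le_of_sphere {K L : ConvexBody ℂ}
    (h : ∀ v : Metric.sphere (0 : ℂ) 1, supp K v ≤ supp L v) (v : ℂ) : supp K v ≤ supp L v := by
  rcases eq_or_ne v 0 with rfl | hv
  · rw [(isSublinear_supp K).map_zero, (isSublinear_supp L).map_zero]
  · have hv' : v = ‖v‖ • (‖v‖⁻¹ • v) := by rw [smul_inv_smul₀ (norm_ne_zero_iff.2 hv)]
    rw [hv', (isSublinear_supp K).smul _ _ (norm_nonneg v),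
      (isSublinear_supp L).smul _ _ (norm_nonneg v)]
    refine mul_le_mul_of_nonneg_left (h ⟨‖v‖⁻¹ • v, ?_⟩) (norm_nonneg v)
    simp [hv]

theorem subset_of_supp_le {K L : ConvexBody ℂ} (h : ∀ v, supp K v ≤ supp L v) :
    (K : Set ℂ) ⊆ L := subset_of_hSupp_le fun g => by
  have := h ((InnerProductSpace.toDual ℝ ℂ).symm g)
  simpa [supp, innerSL_apply_apply] using this

/-- Surface area measures of planar convex bodies exist. -/
theorem exists_isSurfaceAreaMeasure (M : ConvexBody ℂ) : ∃ σ, IsSurfaceAreaMeasure M σ := by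
  set D := Finsupp.linearCombination ℝ circleSupp with hD
  set V := Finsupp.linearCombination ℝ (mv M) with hV
  have hadd : ∀ P Q, circleSupp (P + Q) = circleSupp P + circleSupp Q := fun P Q => by
    ext v; exact congr_fun (supp_add P Q) v
  have hmv := isHom_mv_right M
  have hrep : ∀ x, ∃ P Q, D x = circleSupp P - circleSupp Q ∧ V x = mv M P - mv M Q := by
    intro x
    induction x using Finsupp.induction_linear with
    | zero => exact ⟨0, 0, by simp, by simp⟩
    | add x y hx hy =>
      obtain ⟨P, Q, h1, h2⟩ := hx
      obtain ⟨P', Q', h3, h4⟩ := hy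
      refine ⟨P + P', Q + Q', ?_, ?_⟩
      · rw [map_add, h1, h3, hadd, hadd]; abel
      · rw [map_add, h2, h4, hmv.additive, hmv.additive]; ring
    | single K a =>
      have hs : ∀ {t : ℝ}, 0 ≤ t → circleSupp (t • K) = t • circleSupp K := fun ht => by
        ext v; exact congr_fun (supp_smul K ht) v
      have h0 : circleSupp 0 = 0 := by ext v; exact congr_fun supp_zero _
      have hm0 : mv M 0 = 0 := by simpa [zero_smul'] using mv_smul_right M 0 le_rfl
      rcases le_total 0 a with ha | ha
      · exact ⟨a • K, 0, by simp [hD, hs ha, h0], by simp [hV, mv_smul_right _ _ ha, hm0]⟩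
      · have ha' : 0 ≤ -a := neg_nonneg.2 ha
        exact ⟨0, (-a) • K, by
          rw [hs ha', h0, zero_sub]
          ext v
          simp [hD],
          by rw [mv_smul_right _ _ ha', hm0]; simp [hV]⟩
  have hpos : ∀ x, 0 ≤ D x → 0 ≤ V x := by
    intro x hx
    obtain ⟨P, Q, h1, h2⟩ := hrep x
    rw [h2, sub_nonneg]
    refine mv_mono subset_rfl (subset_of_supp_le (supp_le_of_sphere fun v => ?_))
    have := hx v
    rw [h1] at this
    exact sub_nonneg.1 this
  have hker : LinearMap.ker D ≤ LinearMap.ker V := fun x hx => by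
    rw [LinearMap.mem_ker] at hx ⊢
    refine le_antisymm ?_ (hpos x hx.ge)
    have := hpos (-x) (by rw [map_neg, hx, neg_zero])
    rwa [map_neg, neg_nonneg] at this
  have : PosSMulMono ℝ C_c(Metric.sphere (0 : ℂ) 1, ℝ) :=
    ⟨fun a ha f f' hf v => mul_le_mul_of_nonneg_left (hf v) ha⟩
  set T := (LinearMap.ker D).liftQ V hker ∘ₗ D.quotKerEquivRange.symm.toLinearMap
  have hT : ∀ x, T ⟨D x, LinearMap.mem_range_self D x⟩ = V x := fun x => by
    change (LinearMap.ker D).liftQ V hker (D.quotKerEquivRange.symm ⟨D x, _⟩) = V x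
    rw [LinearMap.quotKerEquivRange_symm_apply_image, Submodule.mkQ_apply, Submodule.liftQ_apply]
  obtain ⟨g, hg1, hg2⟩ := riesz_extension (PointedCone.positive ℝ C_c(Metric.sphere (0 : ℂ) 1, ℝ))
    ⟨LinearMap.range D, T⟩
    (by
      rintro ⟨_, x, rfl⟩ hx
      exact (hpos x hx).trans_eq (hT x).symm)
    (by
      intro y
      obtain ⟨R, hR⟩ := isCompact_univ.exists_bound_of_continuousOn y.continuous.continuousOn
      have h0 : (1 : ℂ) ∈ Metric.sphere (0 : ℂ) 1 := by simp
      have hR0 : 0 ≤ R := (norm_nonneg _).trans (hR ⟨1, h0⟩ trivial)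
      refine ⟨⟨circleSupp (R • unitBall ℂ), Finsupp.single (R • unitBall ℂ) 1, by simp [hD]⟩, fun v => ?_⟩
      have h1 : ‖innerSL ℝ (v : ℂ)‖ ≤ supp (unitBall ℂ) v := norm_le_hSupp_unitBall _
      rw [innerSL_apply_norm, norm_eq_of_mem_sphere] at h1
      have h2 : circleSupp (R • unitBall ℂ) v = R * supp (unitBall ℂ) v :=
        congr_fun (supp_smul _ hR0) _
      have h3 : -R ≤ y v := neg_le_of_abs_le (hR v trivial)
      have h4 := mul_le_mul_of_nonneg_left h1 hR0
      change 0 ≤ circleSupp (R • unitBall ℂ) v + y v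
      rw [h2]
      linarith)
  set ν := RealRMK.rieszMeasure (PositiveLinearMap.mk₀ g hg2)
  have hS : MeasurableSet (Metric.sphere (0 : ℂ) 1)ᶜ := Metric.isClosed_sphere.measurableSet.compl
  refine ⟨ν.map Subtype.val, inferInstance, ?_, fun L => ?_⟩
  · rw [Measure.map_apply measurable_subtype_coe hS]
    simp
  · simp only [hSupp_mul_conj]
    rw [integral_map measurable_subtype_coe.aemeasurable
      (isSublinear_supp L).continuous.aestronglyMeasurable, two_mul_mixedVol]
    have h1 := RealRMK.integral_rieszMeasure (PositiveLinearMap.mk₀ g hg2) (circleSupp L)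
    have h2 := hg1 ⟨_, Finsupp.single L 1, rfl⟩
    refine h1.trans (Eq.trans (congr_arg g ?_) (h2.trans ((hT _).trans ?_)))
    · simp [hD]
    · simp [hV]

end SurfaceArea

section MixedVolume

open ConvexBody

variable {V : Type*} [NormedAddCommGroup V] [NormedSpace ℝ V] [FiniteDimensional ℝ V]
  [MeasurableSpace V] [BorelSpace V] (μ : Measure V)

/-- The mixed volume `V(K, K, K, L)`. -/
def mixedVol₃₁ (K L : ConvexBody V) : ℝ := mixedVol μ ![K, K, K, L]

theorem mixedVol₃₁_eq (K L : ConvexBody V) :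
    mixedVol₃₁ μ K L = 24⁻¹ * ((vol μ ((3 : ℝ) • K + L) - vol μ ((3 : ℝ) • K))
      - 3 * (vol μ ((2 : ℝ) • K + L) - vol μ ((2 : ℝ) • K))
      + 3 * (vol μ ((1 : ℝ) • K + L) - vol μ ((1 : ℝ) • K))
      - (vol μ ((0 : ℝ) • K + L) - vol μ ((0 : ℝ) • K))) := by
  have h1 : (1 : ℝ) • K = K := one_smul ℝ K
  have h2 : (2 : ℝ) • K = K + K := by
    rw [show (2 : ℝ) = 1 + 1 by norm_num, smul_convex_add K zero_le_one zero_le_one, h1]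
  have h3 : (3 : ℝ) • K = K + (K + K) := by
    rw [show (3 : ℝ) = 1 + 2 by norm_num, smul_convex_add K zero_le_one zero_le_two, h1, h2]
  have hc : ∀ S : Finset (Fin 4), (∑ i ∈ S, (![K, K, K, L] i : Set V)) =
      ((∑ i ∈ S, ![K, K, K, L] i : ConvexBody V) : Set V) := fun S => by
    induction S using Finset.induction_on with
    | empty => simp
    | insert i S hi h => rw [Finset.sum_insert hi, Finset.sum_insert hi, h, coe_add]
  have hu : (Finset.univ : Finset (Finset (Fin 4))) = {∅, {0}, {1}, {2}, {3}, {0, 1}, {0, 2}, {0, 3},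
    {1, 2}, {1, 3}, {2, 3}, {0, 1, 2}, {0, 1, 3}, {0, 2, 3}, {1, 2, 3}, {0, 1, 2, 3}} := by decide
  simp only [mixedVol₃₁, mixedVol, hc, hu]
  repeat rw [Finset.sum_insert (by decide)]
  simp [Nat.factorial]
  rw [h2, h3, zero_smul']
  simp only [zero_add, add_assoc, vol, coe_add, coe_zero]
  ring

end MixedVolume

section MixedVolumeHom

open ConvexBody Filter Topology

variable {V : Type*} [NormedAddCommGroup V] [NormedSpace ℝ V] [FiniteDimensional ℝ V]
  [MeasurableSpace V] [BorelSpace V] (μ : Measure V) [μ.IsAddHaarMeasure]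

theorem isCTV_mixedVol₃₁ (L : ConvexBody V) : IsCTV fun K => mixedVol₃₁ μ K L := by
  have h := fun s : ℝ => (((isCTV_vol μ).comp_add L).comp_smul s).sub ((isCTV_vol μ).comp_smul s)
  simp only [mixedVol₃₁_eq]
  exact ((((h 3).sub ((h 2).const_mul 3)).add ((h 1).const_mul 3)).sub (h 0)).const_mul _

theorem mixedVol₃₁_smul (hV : finrank ℝ V = 4) (K L : ConvexBody V) {t : ℝ} (ht : 0 ≤ t) :
    mixedVol₃₁ μ K (t • L) = t * mixedVol₃₁ μ K L := by
  have hvol := isHom_vol (V := V) μ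
  rw [hV] at hvol
  obtain ⟨f, hf⟩ : ∃ f : ℝ → ℝ, ∀ t, f t = mixedVol₃₁ μ K (t • L) := ⟨_, fun _ => rfl⟩
  have h0 : f 0 = 0 := by simp [hf, mixedVol₃₁_eq, zero_smul']
  obtain ⟨a, c, hac⟩ : ∃ a c : ℝ, ∀ t, 0 < t → f t = t * a + c := by
    set m := fun i => mcm 4 (fun K => vol μ (K + L)) i K
    refine ⟨m 3 / 4, 3 / 2 * (m 4 - vol μ K), fun t ht => ?_⟩
    have key : ∀ s : ℝ, 0 ≤ s → vol μ (s • K + t • L) - vol μ (s • K) =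
        t ^ 4 * (m 0 + (t⁻¹ * s) * m 1 + (t⁻¹ * s) ^ 2 * m 2 + (t⁻¹ * s) ^ 3 * m 3
          + (t⁻¹ * s) ^ 4 * m 4) - s ^ 4 * vol μ K := fun s hs => by
      have h1 : s • K + t • L = t • ((t⁻¹ * s) • K + L) := by
        rw [smul_add, smul_smul, mul_inv_cancel_left₀ ht.ne']
      have h2 := ((isCTV_vol μ).comp_add L).mcm_sum hV.le K (t := t⁻¹ * s) (by positivity)
      rw [h1, hvol.smul _ _ ht.le, h2, hvol.smul _ _ hs]
      simp [Finset.sum_range_succ, m]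
    simp only [hf, mixedVol₃₁_eq]
    rw [key 3 (by norm_num), key 2 (by norm_num), key 1 (by norm_num), key 0 le_rfl]
    field_simp
    ring
  have hcont : Continuous f := by
    simp only [funext hf, mixedVol₃₁_eq]
    have h := continuous_vol μ
    fun_prop
  have hc : c = 0 := by
    have h1 : Tendsto (fun t : ℝ => t * a + c) (𝓝[>] 0) (𝓝 (0 * a + c)) :=
      ((tendsto_id.mul_const a).add_const c).mono_left nhdsWithin_le_nhds
    have h2 : Tendsto f (𝓝[>] 0) (𝓝 (f 0)) := hcont.continuousAt.mono_left nhdsWithin_le_nhds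
    have h3 := tendsto_nhds_unique (h1.congr' ?_) h2
    · simpa [h0] using h3
    · exact eventually_nhdsWithin_of_forall fun t ht => (hac t ht).symm
  have h1 : f 1 = a := by rw [hac 1 one_pos, hc]; ring
  have e : (1 : ℝ) • L = L := one_smul ℝ L
  rw [← hf, show mixedVol₃₁ μ K L = a by rw [← h1, hf, e]]
  rcases ht.eq_or_lt with rfl | ht
  · rw [h0, zero_mul]
  · rw [hac t ht, hc, add_zero]

theorem mixedVol₃₁_mapCLM (f : V →L[ℝ] V) (K L : ConvexBody V) :
    mixedVol₃₁ μ (K.mapCLM f) (L.mapCLM f) =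
      |LinearMap.det (f : V →ₗ[ℝ] V)| * mixedVol₃₁ μ K L := by
  simp only [mixedVol₃₁_eq, ← mapCLM_smul, ← mapCLM_add, vol_mapCLM]
  ring

end MixedVolumeHom

section Equivariant

open ConvexBody

local notation "X" => ℂ × ℂ

variable {W : Type*} [NormedAddCommGroup W] [NormedSpace ℂ W] [FiniteDimensional ℂ W]

/-- A positively homogeneous and `SL(W, ℂ)`-equivariant family of continuous translation invariant
valuations indexed by `W`. -/
structure IsEquivariant (G : W → ConvexBody W → ℝ) : Prop where
  isCTV : ∀ w, IsCTV (G w)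
  smul : ∀ (t : ℝ) w K, 0 ≤ t → G (t • w) K = t * G w K
  map : ∀ f : W →ₗ[ℂ] W, LinearMap.det f = 1 → ∀ w K, G (f w) (K.mapCLM (cReal f)) = G w K

theorem IsEquivariant.sub {G G' : W → ConvexBody W → ℝ} (h : IsEquivariant G)
    (h' : IsEquivariant G') : IsEquivariant fun w K => G w K - G' w K :=
  ⟨fun w => (h.isCTV w).sub (h'.isCTV w), fun t w K ht => by rw [h.smul t w K ht,
    h'.smul t w K ht, mul_sub], fun f hf w K => by rw [h.map f hf, h'.map f hf]⟩

variable (b : Basis (Fin 2) ℂ W)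

/-- The coordinate isomorphism `(x, y) ↦ x • b 0 + y • b 1`. -/
def coordMap : X →L[ℝ] W :=
  LinearMap.toContinuousLinearMap (((LinearMap.toSpanSingleton ℂ W (b 0)).coprod
    (LinearMap.toSpanSingleton ℂ W (b 1))).restrictScalars ℝ)

theorem coordMap_apply (p : X) : coordMap b p = p.1 • b 0 + p.2 • b 1 := by simp [coordMap]

/-- The inverse of `coordMap b`. -/
def coordInv : W →L[ℝ] X :=
  LinearMap.toContinuousLinearMap (((b.coord 0).prod (b.coord 1)).restrictScalars ℝ)

theorem coordInv_apply (w : W) : coordInv b w = (b.coord 0 w, b.coord 1 w) := by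
  simp [coordInv]

theorem coordInv_coordMap (p : X) : coordInv b (coordMap b p) = p := by
  simp [coordInv_apply, coordMap_apply]

theorem coordMap_coordInv (w : W) : coordMap b (coordInv b w) = w := by
  have := b.sum_repr w
  rw [Fin.sum_univ_two] at this
  simpa [coordInv_apply, coordMap_apply] using this

theorem mapCLM_coordInv_coordMap (K : ConvexBody W) :
    (K.mapCLM (coordInv b)).mapCLM (coordMap b) = K := by
  rw [mapCLM_mapCLM, mapCLM_congr (g := ContinuousLinearMap.id ℝ W)
    (fun x _ => coordMap_coordInv b x), mapCLM_id]

theorem toLin_coordMap (A : Matrix (Fin 2) (Fin 2) ℂ) (p : X) : Matrix.toLin b b A (coordMap b p) =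
    coordMap b (A 0 0 * p.1 + A 0 1 * p.2, A 1 0 * p.1 + A 1 1 * p.2) := by
  simp only [coordMap_apply, map_add, map_smul, Matrix.toLin_self, Fin.sum_univ_two]
  module

variable {b} {G : W → ConvexBody W → ℝ}

theorem IsEquivariant.map_coord (h : IsEquivariant G) (A : Matrix (Fin 2) (Fin 2) ℂ)
    (hA : A.det = 1) {g : X →L[ℝ] X}
    (hg : ∀ p, g p = (A 0 0 * p.1 + A 0 1 * p.2, A 1 0 * p.1 + A 1 1 * p.2)) (p : X)
    (K : ConvexBody X) :
    G (coordMap b (g p)) ((K.mapCLM g).mapCLM (coordMap b)) =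
      G (coordMap b p) (K.mapCLM (coordMap b)) := by
  have h1 := h.map (Matrix.toLin b b A) (by rw [LinearMap.det_toLin, hA]) (coordMap b p)
    (K.mapCLM (coordMap b))
  have h2 : ∀ q, coordMap b (g q) = Matrix.toLin b b A (coordMap b q) := fun q => by
    rw [hg, toLin_coordMap]
  rw [mapCLM_mapCLM] at h1 ⊢
  rw [← h1, h2, mapCLM_congr fun q _ => ?_]
  exact h2 q

theorem coordMap_one : coordMap b (1, 0) = b 0 := by simp [coordMap_apply]

theorem IsEquivariant.adm (h : IsEquivariant G) :
    Adm fun K => G (b 0) (K.mapCLM (coordMap b)) := by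
  refine ⟨(h.isCTV _).comp_mapCLM _, fun c K => ?_, fun t K ht => ?_⟩
  · have := h.map_coord (b := b) !![1, c; 0, 1] (by simp) (g := shU c)
      (fun p => by simp [shU_apply]) (1, 0) K
    simpa [shU_apply, coordMap_one] using this
  · have ht' : (t : ℂ) ≠ 0 := by exact_mod_cast ht.ne'
    have := h.map_coord (b := b) !![(t : ℂ), 0; 0, (t : ℂ)⁻¹] (by simp [ht']) (g := dil t t⁻¹)
      (fun p => by simp [dil_apply]) (1, 0) K
    have e : dil t t⁻¹ (1, 0) = t • ((1, 0) : X) := by simp [dil_apply]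
    rw [e, map_smul, coordMap_one, h.smul _ _ _ ht.le] at this
    rw [← this, inv_mul_cancel_left₀ ht.ne']

theorem IsEquivariant.exists_bodies (h : IsEquivariant G)
    (hG : ∀ u v K, G (u + v) K ≤ G u K + G v K) : ∃ M N : ConvexBody ℂ,
      (∀ L, G (b 0) ((vert L).mapCLM (coordMap b)) = mv L M) ∧
      ∀ A, G (b 0) ((prodBody A unitSq).mapCLM (coordMap b)) = mv unitSq M + mv A N := by
  have h1 : ∀ (c : ℂ) (K : ConvexBody X), G (b 0) ((K.mapCLM (shL (-c))).mapCLM (coordMap b)) =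
      G (coordMap b (1, c)) (K.mapCLM (coordMap b)) := fun c K => by
    have := h.map_coord (b := b) !![1, 0; -c, 1] (by simp) (g := shL (-c))
      (fun p => by simp [shL_apply, add_comm]) (1, c) K
    simpa [shL_apply, coordMap_one] using this
  have h2 : ∀ K : ConvexBody X, G (b 0) ((K.mapCLM rotX).mapCLM (coordMap b)) =
      G (coordMap b (0, 1)) (K.mapCLM (coordMap b)) := fun K => by
    have := h.map_coord (b := b) !![0, 1; -1, 0] (by simp) (g := rotX)
      (fun p => by simp [rotX_apply]) (0, 1) K
    simpa [rotX_apply, coordMap_one] using this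
  refine h.adm.exists_bodies (fun K => ?_) fun K => ?_
  · have h3 := h1 (-1) K
    rw [neg_neg] at h3
    rw [h1 1, h3, ← h.smul _ _ _ zero_le_two]
    refine le_trans (le_of_eq ?_) (hG _ _ _)
    rw [← map_add, ← coordMap_one (b := b), ← map_smul]
    congr 2
    norm_num
  · rw [h1 1, h2, ← coordMap_one (b := b)]
    refine le_trans (le_of_eq ?_) (hG _ _ _)
    rw [← map_add]
    congr 2
    norm_num

theorem IsEquivariant.eq_zero (h : IsEquivariant G)
    (h1 : ∀ L, G (b 0) ((vert L).mapCLM (coordMap b)) = 0)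
    (h2 : ∀ A, G (b 0) ((prodBody A unitSq).mapCLM (coordMap b)) = 0) (w : W) (K : ConvexBody W) :
    G w K = 0 := by
  have h0 : ∀ K : ConvexBody X, G (coordMap b (1, 0)) (K.mapCLM (coordMap b)) = 0 := fun K => by
    rw [coordMap_one]
    exact h.adm.eq_zero h1 h2 K
  have key : ∀ (p : X) (K : ConvexBody X), G (coordMap b p) (K.mapCLM (coordMap b)) = 0 := by
    rintro ⟨x, y⟩ K
    by_cases hx : x = 0
    · by_cases hy : y = 0
      · subst hx hy
        have := h.smul 0 0 (K.mapCLM (coordMap b)) le_rfl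
        rw [smul_zero, zero_mul] at this
        exact (congr_arg (fun w => G w _) (map_zero (coordMap b))).trans this
      · subst hx
        rw [← h.map_coord (b := b) !![0, y⁻¹; -y, 0] (by simp [hy])
          (g := (y⁻¹ • ContinuousLinearMap.snd ℝ ℂ ℂ).prod (-y • ContinuousLinearMap.fst ℝ ℂ ℂ))
          (fun p => by simp) (0, y) K]
        simpa [hy] using h0 _
    · rw [← h.map_coord (b := b) !![x⁻¹, 0; -y, x] (by simp [hx])
        (g := (x⁻¹ • ContinuousLinearMap.fst ℝ ℂ ℂ).prod
          (-y • ContinuousLinearMap.fst ℝ ℂ ℂ + x • ContinuousLinearMap.snd ℝ ℂ ℂ))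
        (fun p => by simp) (x, y) K]
      simpa [hx, mul_comm y x] using h0 _
  have := key (coordInv b w) (K.mapCLM (coordInv b))
  rwa [mapCLM_coordInv_coordMap, coordMap_coordInv] at this

end Equivariant

section Formula

open ConvexBody Complex

local notation "X" => ℂ × ℂ

variable {W : Type*} [NormedAddCommGroup W] [NormedSpace ℂ W] [FiniteDimensional ℂ W]
variable (b : Basis (Fin 2) ℂ W)

theorem cdetCLM_apply (u w : W) : cdetCLM b w u = cdet b u w := by
  simp [cdetCLM, cdet, mul_comm]

theorem cdet_map (f : W →ₗ[ℂ] W) (u v : W) : cdet b (f u) (f v) = LinearMap.det f * cdet b u v := by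
  have h : ∀ u v : W, cdet b u v = b.det ![u, v] := fun u v => by
    rw [Basis.det_apply, Matrix.det_fin_two]
    simp [cdet, Basis.toMatrix_apply, mul_comm]
  rw [h, h, ← Basis.det_comp]
  congr 1
  ext i
  fin_cases i <;> rfl

/-- `w ↦ det(·, w)` as a linear map. -/
def cdetLin : W →ₗ[ℝ] W →L[ℝ] ℂ where
  toFun := cdetCLM b
  map_add' u v := ContinuousLinearMap.ext fun x => by simp [cdetCLM_apply, cdet]; ring
  map_smul' t u := ContinuousLinearMap.ext fun x => by simp [cdetCLM_apply, cdet]; ring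

/-- `w ↦ (c ↦ c • w)` as a linear map. -/
def dotLin : W →ₗ[ℝ] ℂ →L[ℝ] W where
  toFun w := LinearMap.toContinuousLinearMap ((LinearMap.toSpanSingleton ℂ W w).restrictScalars ℝ)
  map_add' u v := ContinuousLinearMap.ext fun x => by simp
  map_smul' t u := ContinuousLinearMap.ext fun x => smul_comm x t u

theorem dotBody_eq (N : ConvexBody ℂ) (w : W) : dotBody N w = N.mapCLM (dotLin w) := rfl

theorem dotLin_apply (w : W) (c : ℂ) : dotLin w c = c • w := by simp [dotLin]

theorem detBody_eq (K : ConvexBody W) (w : W) : detBody b K w = K.mapCLM (cdetLin b w) := rfl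

theorem mapCLM_smul_left {V V' : Type*} [NormedAddCommGroup V] [NormedSpace ℝ V]
    [NormedAddCommGroup V'] [NormedSpace ℝ V'] (t : ℝ) (f : V →L[ℝ] V') (K : ConvexBody V) :
    K.mapCLM (t • f) = t • K.mapCLM f := by
  rw [← mapCLM_smul, smul_eq_mapCLM, mapCLM_mapCLM]
  exact mapCLM_congr fun x _ => by simp

variable [MeasurableSpace W] [BorelSpace W] (μ : Measure W) [μ.IsAddHaarMeasure]

/-- The support function at `w` of the sum of the two model valuations. -/
def formula (M N : ConvexBody ℂ) (w : W) (K : ConvexBody W) : ℝ :=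
  mv M (detBody b K w) + mixedVol₃₁ μ K (dotBody N w)

theorem isEquivariant_formula (M N : ConvexBody ℂ) : IsEquivariant (formula b μ M N) where
  isCTV w := ((isHom_mv_right M).toIsCTV.comp_mapCLM _).add (isCTV_mixedVol₃₁ μ _)
  smul t w K ht := by
    have h4 : finrank ℝ W = 4 := by
      rw [finrank_real_of_complex, finrank_eq_card_basis b]; rfl
    rw [formula, detBody_eq, dotBody_eq, map_smul, map_smul, mapCLM_smul_left, mapCLM_smul_left,
      mv_smul_right _ _ ht, mixedVol₃₁_smul _ h4 _ _ ht, ← mul_add]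
    rfl
  map f hf w K := by
    have h1 : detBody b (K.mapCLM (cReal f)) (f w) = detBody b K w := by
      rw [detBody, detBody, mapCLM_mapCLM]
      refine mapCLM_congr fun x _ => ?_
      have := cdet_map b f x w
      rw [hf, one_mul] at this
      simpa [cdetCLM_apply, cReal] using this
    have h2 : dotBody N (f w) = (dotBody N w).mapCLM (cReal f) := by
      rw [dotBody_eq, dotBody_eq, mapCLM_mapCLM]
      exact mapCLM_congr fun x _ => by simp [dotLin_apply, cReal]
    have h3 : LinearMap.det (cReal f : W →ₗ[ℝ] W) = 1 := by
      rw [show (cReal f : W →ₗ[ℝ] W) = f.restrictScalars ℝ from rfl,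
        LinearMap.det_restrictScalars, hf, map_one]
    rw [formula, formula, h1, h2, mixedVol₃₁_mapCLM, h3, abs_one, one_mul]

theorem continuous_formula (M N : ConvexBody ℂ) :
    Continuous fun p : W × ConvexBody W => formula b μ M N p.1 p.2 := by
  have h1 : Continuous fun p : W × ConvexBody W => mv M (detBody b p.2 p.1) :=
    (isHom_mv_right M).cont.comp (continuous_mapCLM_prod.comp
      (((cdetLin b).continuous_of_finiteDimensional.comp continuous_fst).prodMk continuous_snd))
  have h2 : Continuous fun p : W × ConvexBody W => N.mapCLM (dotLin p.1) :=
    continuous_mapCLM_prod.comp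
      (((dotLin (W := W)).continuous_of_finiteDimensional.comp continuous_fst).prodMk continuous_const)
  refine h1.add ?_
  simp only [mixedVol₃₁_eq, dotBody_eq]
  have h := continuous_vol μ
  have h' := fun s : ℝ => continuous_smul_const (V := W) s
  fun_prop

theorem exists_vol_prodBody : ∃ c : ℝ, 0 < c ∧ ∀ A B : ConvexBody ℂ,
    vol μ ((prodBody A B).mapCLM (coordMap b)) = c * (area A * area B) := by
  let e : W ≃L[ℝ] X := ContinuousLinearEquiv.equivOfInverse (coordInv b) (coordMap b)
    (coordMap_coordInv b) (coordInv_coordMap b)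
  have : (μ.map e).IsAddHaarMeasure := e.isAddHaarMeasure_map μ
  have : (volume : Measure X).IsAddHaarMeasure :=
    inferInstanceAs ((volume : Measure ℂ).prod (volume : Measure ℂ)).IsAddHaarMeasure
  obtain ⟨c, hc, hpos⟩ : ∃ c : NNReal, μ.map e = c • (volume : Measure X) ∧ 0 < c :=
    ⟨_, Measure.isAddLeftInvariant_eq_smul _ _,
      Measure.addHaarScalarFactor_pos_of_isAddHaarMeasure _ _⟩
  refine ⟨c, hpos, fun A B => ?_⟩
  have h1 : μ (coordMap b '' (prodBody A B : Set X)) = μ.map e (prodBody A B : Set X) := by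
    rw [Measure.map_apply e.continuous.measurable (prodBody A B).isCompact.measurableSet]
    congr 1
    exact e.symm.image_eq_preimage_symm _
  have h2 : (prodBody A B : Set X) = (A : Set ℂ) ×ˢ (B : Set ℂ) :=
    Set.ext fun p => mem_prodBody
  rw [vol, coe_mapCLM, h1, hc, h2, Measure.smul_apply, Measure.volume_eq_prod, Measure.prod_prod]
  rw [ENNReal.smul_def, smul_eq_mul, ENNReal.toReal_mul, ENNReal.toReal_mul]
  rfl

theorem exists_mixedVol₃₁_prodBody : ∃ c : ℝ, 0 < c ∧ ∀ A B N : ConvexBody ℂ,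
    mixedVol₃₁ μ ((prodBody A B).mapCLM (coordMap b)) (dotBody N (b 0)) =
      c * (area B * mv A N) := by
  obtain ⟨c, hc, h⟩ := exists_vol_prodBody b μ
  refine ⟨c / 4, by positivity, fun A B N => ?_⟩
  have h1 : ∀ t : ℝ, t • (prodBody A B).mapCLM (coordMap b) + dotBody N (b 0) =
      (prodBody (t • A + N) (t • B)).mapCLM (coordMap b) := fun t => by
    have h3 : dotBody N (b 0) =
        (N.mapCLM (ContinuousLinearMap.inl ℝ ℂ ℂ)).mapCLM (coordMap b) := by
      rw [dotBody_eq, mapCLM_mapCLM]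
      exact mapCLM_congr fun x _ => by simp [dotLin_apply, coordMap_apply]
    rw [h3, ← mapCLM_smul, ← mapCLM_add, prodBody, prodBody, smul_add, mapCLM_add _ (t • A),
      mapCLM_smul, mapCLM_smul, add_right_comm]
  have h2 : ∀ t : ℝ, t • (prodBody A B).mapCLM (coordMap b) =
      (prodBody (t • A) (t • B)).mapCLM (coordMap b) := fun t => by
    rw [← mapCLM_smul, prodBody, prodBody, smul_add, mapCLM_smul, mapCLM_smul]
  have h4 : ∀ (t : ℝ) (A : ConvexBody ℂ), 0 ≤ t → area (t • A) = t ^ 2 * area A := fun t A ht =>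
    isHom_area.smul A t ht
  have h5 : ∀ t : ℝ, 0 ≤ t → area (t • A + N) = t ^ 2 * area A + t * mv A N + area N :=
    fun t ht => by
    have := mv_eq (t • A) N
    rw [mv_comm, mv_smul_right _ _ ht, mv_comm, h4 t A ht] at this
    linarith
  rw [mixedVol₃₁_eq]
  simp only [h1]
  simp only [h2, h]
  rw [h5 3 (by norm_num), h5 2 (by norm_num), h5 1 (by norm_num), h5 0 le_rfl,
    h4 3 A (by norm_num), h4 2 A (by norm_num), h4 1 A (by norm_num), h4 0 A le_rfl,
    h4 3 B (by norm_num), h4 2 B (by norm_num), h4 1 B (by norm_num), h4 0 B le_rfl]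
  ring

theorem detBody_prodBody (A B : ConvexBody ℂ) :
    detBody b ((prodBody A B).mapCLM (coordMap b)) (b 0) = B.neg := by
  have h := projY_prodBody A B
  rw [projY] at h
  rw [detBody, mapCLM_mapCLM]
  conv_rhs => rw [← h]
  rw [ConvexBody.neg, mapCLM_mapCLM]
  exact mapCLM_congr fun p _ => by simp [cdetCLM_apply, cdet, coordMap_apply]

theorem neg_neg' (K : ConvexBody ℂ) : K.neg.neg = K := by
  rw [ConvexBody.neg, ConvexBody.neg, mapCLM_mapCLM,
    mapCLM_congr (g := ContinuousLinearMap.id ℝ ℂ) fun x _ => by simp, mapCLM_id]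

theorem mv_neg (M L : ConvexBody ℂ) : mv M L.neg = mv M.neg L := by
  have h : ∀ K : ConvexBody ℂ, area K.neg = area K := fun K => by
    rw [ConvexBody.neg, area_mapCLM, ContinuousLinearMap.toLinearMap_neg, ← neg_one_smul ℝ,
      LinearMap.det_smul]
    simp
  have h1 : (M.neg + L).neg = M + L.neg :=
    (mapCLM_add _ _ _).trans (congr_arg (· + L.neg) (neg_neg' M))
  rw [mv_eq, mv_eq, h, h, ← h (_ + L), h1]

theorem zero_mv (K : ConvexBody ℂ) : mv 0 K = 0 := by
  have h := mv_smul_right K K le_rfl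
  rwa [zero_smul', zero_mul, mv_comm] at h

theorem exists_formula_prodBody : ∃ c : ℝ, 0 < c ∧ ∀ M N A B : ConvexBody ℂ,
    formula b μ M N (b 0) ((prodBody A B).mapCLM (coordMap b)) =
      mv M B.neg + c * (area B * mv A N) := by
  obtain ⟨c, hc, h⟩ := exists_mixedVol₃₁_prodBody b μ
  exact ⟨c, hc, fun M N A B => by rw [formula, detBody_prodBody, h]⟩

end Formula

section Main

open ConvexBody Complex

variable {W : Type*} [NormedAddCommGroup W] [NormedSpace ℂ W] [FiniteDimensional ℂ W]

/-- The real functional `ξ ↦ Re ⟨ξ, w⟩` on the complex dual. -/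
def reEval (w : W) : (W →L[ℂ] ℂ) →L[ℝ] ℝ :=
  reCLM.comp ((ContinuousLinearMap.apply ℂ ℂ w).restrictScalars ℝ)

/-- Every real functional on the complex dual is of the form `reEval w`. -/
theorem exists_reEval (b : Basis (Fin 2) ℂ W) :
    ∃ T : ((W →L[ℂ] ℂ) →L[ℝ] ℝ) →ₗ[ℝ] W, ∀ g, g = reEval (T g) := by
  set β : Fin 2 → W →L[ℂ] ℂ := fun i => LinearMap.toContinuousLinearMap (b.coord i) with hβ
  refine ⟨{ toFun := fun g => ∑ i, ((g (β i) : ℂ) - g (I • β i) * I) • b i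
            map_add' := fun g g' => by
              rw [← Finset.sum_add_distrib]
              refine Finset.sum_congr rfl fun i _ => ?_
              simp only [add_apply, ofReal_add]
              module
            map_smul' := fun t g => by
              rw [Finset.smul_sum]
              refine Finset.sum_congr rfl fun i _ => ?_
              rw [← Complex.coe_smul]
              simp only [smul_apply, smul_eq_mul, ofReal_mul, RingHom.id_apply, smul_smul]
              congr 1
              ring }, fun g => ContinuousLinearMap.ext fun ξ => ?_⟩
  have h1 : ξ = ∑ i, ((ξ (b i)).re • β i + (ξ (b i)).im • (I • β i)) := by
    ext w
    conv_lhs => rw [← b.sum_repr w, map_sum]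
    simp only [sum_apply, add_apply, smul_apply, hβ, map_smul]
    refine Finset.sum_congr rfl fun i _ => ?_
    conv_lhs => rw [← re_add_im (ξ (b i))]
    simp [mul_comm]
    ring
  conv_lhs => rw [h1]
  simp [reEval, mul_comm]

variable {G : W → ConvexBody W → ℝ} {Z : ConvexBody W → ConvexBody (W →L[ℂ] ℂ)}

theorem continuous_of_hSupp {D : Type*} [NormedAddCommGroup D] [NormedSpace ℝ D]
    [FiniteDimensional ℝ D] {Z : ConvexBody W → ConvexBody D} (hG : IsEquivariant G)
    (hc : Continuous fun p : W × ConvexBody W => G p.1 p.2) (T : (D →L[ℝ] ℝ) →ₗ[ℝ] W)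
    (hZ : ∀ K (g : D →L[ℝ] ℝ), hSupp (Z K) g = G (T g) K) : Continuous Z := by
  have hTc := T.continuous_of_finiteDimensional
  have : ProperSpace (D →L[ℝ] ℝ) := FiniteDimensional.proper_real _
  refine continuous_iff_continuousAt.2 fun K => Metric.tendsto_nhds.2 fun ε hε => ?_
  have h1 : ∀ᶠ L in nhds K, ∀ g ∈ Metric.closedBall (0 : D →L[ℝ] ℝ) 1,
      |G (T g) L - G (T g) K| < ε / 2 := by
    refine (isCompact_closedBall _ _).eventually_forall_of_forall_eventually fun g _ => ?_
    have h2 : Continuous fun p : ConvexBody W × (D →L[ℝ] ℝ) => |G (T p.2) p.1 - G (T p.2) K| :=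
      ((hc.comp ((hTc.comp continuous_snd).prodMk continuous_fst)).sub
        (hc.comp ((hTc.comp continuous_snd).prodMk continuous_const))).abs
    refine h2.continuousAt.eventually_lt continuousAt_const ?_
    simpa using half_pos hε
  filter_upwards [h1] with L hL
  refine lt_of_le_of_lt (dist_le_of_hSupp (half_pos hε).le fun g => ?_) (half_lt_self hε)
  rw [hZ, hZ]
  rcases eq_or_ne g 0 with rfl | hg
  · have h0 : ∀ K, G 0 K = 0 := fun K => by simpa using hG.smul 0 0 K le_rfl
    simp [h0]
  · have hg' : ‖g‖ ≠ 0 := norm_ne_zero_iff.2 hg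
    have e : g = ‖g‖ • (‖g‖⁻¹ • g) := by rw [smul_inv_smul₀ hg']
    rw [congr_arg T e, map_smul, hG.smul _ _ _ (norm_nonneg g), hG.smul _ _ _ (norm_nonneg g),
      ← mul_sub, abs_mul, abs_norm, mul_comm]
    refine mul_le_mul_of_nonneg_right (hL _ ?_).le (norm_nonneg g)
    rw [mem_closedBall_zero_iff, norm_smul, norm_inv, norm_norm, inv_mul_cancel₀ hg']

theorem contravariant_of_hSupp (b : Basis (Fin 2) ℂ W) (hG : IsEquivariant G)
    (hc : Continuous fun p : W × ConvexBody W => G p.1 p.2)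
    (hZ : ∀ K w, hSupp (Z K) (reEval w) = G w K) :
    Continuous Z ∧ IsTranslationInvariant Z ∧ IsMinkowskiValuation Z ∧ IsSLContravariant Z := by
  obtain ⟨T, hT⟩ := exists_reEval b
  have hext : ∀ P Q : ConvexBody (W →L[ℂ] ℂ),
      (∀ w, hSupp P (reEval w) = hSupp Q (reEval w)) → P = Q := fun P Q h =>
    eq_of_hSupp_eq fun g => by
      rw [hT g, h]
  refine ⟨continuous_of_hSupp hG hc T fun K g => (by rw [hT g, hZ, ← hT g]),
    fun K x => hext _ _ fun w => ?_,
    fun K L hU hI => hext _ _ fun w => ?_, fun g hg K => hext _ _ fun w => ?_⟩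
  · rw [hZ, hZ, (hG.isCTV w).trans]
  · rw [hSupp_add, hSupp_add, hZ, hZ, hZ, hZ, (hG.isCTV w).val]
  · have h1 := hG.map (g : W →ₗ[ℂ] W) hg (g.symm w) K
    rw [hZ, hSupp_mapCLM, show (fun ξ => reEval w (precompDual (g.symm : W →L[ℂ] W) ξ)) =
      reEval (g.symm w) from rfl, hZ, ← h1]
    congr 1
    exact (g.apply_symm_apply w).symm

theorem isEquivariant_hSupp (hc : Continuous Z) (ht : IsTranslationInvariant Z)
    (hv : IsMinkowskiValuation Z) (hs : IsSLContravariant Z) :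
    IsEquivariant fun w K => hSupp (Z K) (reEval w) where
  isCTV w := ⟨(continuous_hSupp _).comp hc,
    fun K L hU hI => by rw [← hSupp_add, hv K L hU hI, hSupp_add], fun K x => by rw [ht]⟩
  smul t w K h := by
    rw [← hSupp_smul _ h, smul_eq_mapCLM, hSupp_mapCLM]
    congr 1
    ext ξ
    simp [reEval]
  map f hf w K := by
    have hf' : IsUnit (LinearMap.det f) := by rw [hf]; exact isUnit_one
    set g := (LinearEquiv.ofIsUnitDet (f := f) (v := Module.finBasis ℂ W)
      (v' := Module.finBasis ℂ W) (by rwa [LinearMap.det_toMatrix])).toContinuousLinearEquiv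
    have h1 := hs g hf K
    have h2 : cReal ((g : W →L[ℂ] W) : W →ₗ[ℂ] W) = cReal f := rfl
    have h3 : f w = g w := rfl
    change hSupp (Z (K.mapCLM (cReal ((g : W →L[ℂ] W) : W →ₗ[ℂ] W)))) _ = _
    refine (congr_arg (fun P => hSupp P _) h1).trans ?_
    rw [hSupp_mapCLM, h3]
    congr 1
    ext ξ
    simp [reEval, precompDual]

theorem hSupp_reEval_add_le (K : ConvexBody (W →L[ℂ] ℂ)) (u v : W) :
    hSupp K (reEval (u + v)) ≤ hSupp K (reEval u) + hSupp K (reEval v) := hSupp_le fun ξ hξ => by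
  have h : reEval (u + v) ξ = reEval u ξ + reEval v ξ := by simp [reEval]
  rw [h]
  exact add_le_add (le_hSupp _ hξ) (le_hSupp _ hξ)

/-- A planar body is determined up to translation by its mixed areas. -/
theorem exists_translate_of_mv_eq {K L : ConvexBody ℂ} (h : ∀ A, mv A K = mv A L) :
    ∃ x, L = K.translate x := by
  set g : ℂ → ℝ := fun v => supp L v - supp K v with hg
  have hpos : ∀ (t : ℝ) v, 0 ≤ t → g (t • v) = t * g v := fun t v ht => by
    simp only [hg, (isSublinear_supp _).smul _ _ ht]
    ring
  have hodd : ∀ v, g (-v) = -g v := fun v => by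
    have h1 := h (tri (-I * v) 0)
    have e1 : I * (-I * v) = v := by simp [← mul_assoc]
    have e2 : -I * (-I * v) = -v := by simp [← mul_assoc]
    rw [mv_seg, mv_seg, e1, e2] at h1
    simp only [hg]
    linarith
  have hlin : ∀ (t : ℝ) v, g (t • v) = t * g v := fun t v => by
    rcases le_total 0 t with ht | ht
    · exact hpos t v ht
    · rw [← neg_neg t, neg_smul, hodd, hpos _ _ (neg_nonneg.2 ht)]
      ring
  have hadd : ∀ a c : ℂ, 0 < a.re * c.im - a.im * c.re → g (a + c) = g a + g c := fun a c hD => by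
    have h1 := h (tri (I * a) (I * (a + c)))
    have hD' : 0 < (I * a).re * (I * (a + c)).im - (I * a).im * (I * (a + c)).re := by
      simp
      linarith
    have e1 : -I * (I * a) = a := by simp [← mul_assoc]
    have e2 : -I * (I * (a + c) - I * a) = c := by rw [← mul_sub, ← mul_assoc]; simp
    have e3 : I * (I * (a + c)) = -(a + c) := by rw [← mul_assoc]; simp
    rw [mv_tri _ hD', mv_tri _ hD', e1, e2, e3] at h1
    have h2 := hodd (a + c)
    simp only [hg] at h2 ⊢
    linarith
  refine ⟨⟨g 1, g I⟩, eq_of_supp_eq (funext fun v => ?_)⟩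
  have key : g v = v.re * g 1 + v.im * g I := by
    have e : v = v.re • (1 : ℂ) + v.im • I := by
      rw [real_smul, real_smul, mul_one, re_add_im]
    rcases lt_trichotomy 0 (v.re * v.im) with h0 | h0 | h0
    · conv_lhs => rw [e, hadd _ _ (by simpa using h0), hlin, hlin]
    · rcases mul_eq_zero.1 h0.symm with h0 | h0
      all_goals
        conv_lhs => rw [e, h0]
        simp only [zero_smul, zero_add, add_zero, hlin]
        rw [h0, zero_mul]
        simp
    · conv_lhs => rw [e, add_comm, hadd _ _ (by simp; linarith), hlin, hlin]
      ring
  rw [translate_eq_add, supp_add, Pi.add_apply, supp_point, inner_eq, ← key]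
  simp [hg]

variable [MeasurableSpace W] [BorelSpace W] (μ : Measure W) [μ.IsAddHaarMeasure]

theorem unique_of_formula_eq (b : Basis (Fin 2) ℂ W) {M N M' N' : ConvexBody ℂ}
    (h : ∀ w K, formula b μ M N w K = formula b μ M' N' w K) :
    (∃ x, M' = M.translate x) ∧ ∃ x, N' = N.translate x := by
  obtain ⟨c, hc, hf⟩ := exists_formula_prodBody b μ
  have h1 : ∀ A B : ConvexBody ℂ, mv M B.neg + c * (area B * mv A N) = mv M' B.neg + c * (area B * mv A N') :=
    fun A B => by rw [← hf, ← hf, h]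
  have h2 : ∀ B : ConvexBody ℂ, mv M B.neg = mv M' B.neg := fun B => by simpa [zero_mv] using h1 0 B
  refine ⟨exists_translate_of_mv_eq fun A => ?_, exists_translate_of_mv_eq fun A => ?_⟩
  · rw [mv_comm, mv_comm A, ← neg_neg' A, h2]
  · have h3 := h1 A unitSq
    rw [h2, area_unitSq] at h3
    simpa [hc.ne'] using h3

theorem exists_formula_of_contravariant (b : Basis (Fin 2) ℂ W) (hc : Continuous Z)
    (ht : IsTranslationInvariant Z) (hv : IsMinkowskiValuation Z) (hs : IsSLContravariant Z) :
    ∃ M N, ∀ K w, hSupp (Z K) (reEval w) = formula b μ M N w K := by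
  have hG := isEquivariant_hSupp hc ht hv hs
  obtain ⟨M, N, h1, h2⟩ := hG.exists_bodies (b := b) fun u v K => hSupp_reEval_add_le _ u v
  obtain ⟨c, hc, hf⟩ := exists_formula_prodBody b μ
  refine ⟨M.neg, c⁻¹ • N, fun K w => sub_eq_zero.1 ?_⟩
  have hf' : ∀ A B, formula b μ M.neg (c⁻¹ • N) (b 0) ((prodBody A B).mapCLM (coordMap b)) =
      mv M B + area B * mv A N := fun A B => by
    rw [hf, ← mv_neg, neg_neg', mv_smul_right _ _ (inv_nonneg.2 hc.le)]
    field_simp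
  refine (hG.sub (isEquivariant_formula b μ M.neg (c⁻¹ • N))).eq_zero (b := b) (fun L => ?_)
    (fun A => ?_) w K
  · rw [h1, ← prodBody_zero, hf', zero_mv, mv_comm]
    ring
  · rw [h2, hf', area_unitSq, mv_comm M]
    ring

end Main

/-- Theorem 3 of the paper. Let `W` be a 2-dimensional complex vector
space (with a fixed basis `b`, used for the determinant identification, and a fixed
Lebesgue measure `μ`, used for mixed volumes). A map `Z : 𝒦(W) → 𝒦(W*)` is a continuous,
translation invariant and `SL(W,ℂ)`-contravariant Minkowski valuation if and only if
there are convex bodies `M, N ⊆ ℂ` such that `Z K = D̃_M K + Π_N K` for all `K`, i.e.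
`h(Z K, w) = ∫_{S¹} h(det(K,w), α) dS(M, α) + V(K, K, K, N·w)` for all `K ∈ 𝒦(W)`,
`w ∈ W`.  Moreover, `M` and `N` are unique up to translations. -/
theorem contravariant_classification_dim_two
    {W : Type*} [NormedAddCommGroup W] [NormedSpace ℂ W] [FiniteDimensional ℂ W]
    (hW : Module.finrank ℂ W = 2) (b : Basis (Fin 2) ℂ W)
    [MeasurableSpace W] [BorelSpace W] (μ : Measure W) [μ.IsAddHaarMeasure]
    (Z : ConvexBody W → ConvexBody (W →L[ℂ] ℂ)) :
    ((Continuous Z ∧ IsTranslationInvariant Z ∧ IsMinkowskiValuation Z ∧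
        IsSLContravariant Z) ↔
      (∃ (M N : ConvexBody ℂ) (σ : Measure ℂ), IsSurfaceAreaMeasure M σ ∧
        ∀ (K : ConvexBody W) (w : W),
          hSupp (Z K) (fun ξ => (ξ w).re) =
            (∫ α, hSupp (detBody b K w) (fun c => (c * (starRingEnd ℂ) α).re) ∂σ)
              + mixedVol μ ![K, K, K, dotBody N w])) ∧
    (∀ (M₁ N₁ M₂ N₂ : ConvexBody ℂ) (σ₁ σ₂ : Measure ℂ),
      (IsSurfaceAreaMeasure M₁ σ₁ ∧ ∀ (K : ConvexBody W) (w : W),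
          hSupp (Z K) (fun ξ => (ξ w).re) =
            (∫ α, hSupp (detBody b K w) (fun c => (c * (starRingEnd ℂ) α).re) ∂σ₁)
              + mixedVol μ ![K, K, K, dotBody N₁ w]) →
      (IsSurfaceAreaMeasure M₂ σ₂ ∧ ∀ (K : ConvexBody W) (w : W),
          hSupp (Z K) (fun ξ => (ξ w).re) =
            (∫ α, hSupp (detBody b K w) (fun c => (c * (starRingEnd ℂ) α).re) ∂σ₂)
              + mixedVol μ ![K, K, K, dotBody N₂ w]) →
      (∃ x : ℂ, M₂ = M₁.translate x) ∧ (∃ x : ℂ, N₂ = N₁.translate x)) := by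
  have key : ∀ {M N : ConvexBody ℂ} {σ : Measure ℂ}, IsSurfaceAreaMeasure M σ → ∀ K w,
      (∫ α, hSupp (detBody b K w) (fun c => (c * (starRingEnd ℂ) α).re) ∂σ)
        + mixedVol μ ![K, K, K, dotBody N w] = formula b μ M N w K := fun hσ K w => by
    rw [hσ.2.2, two_mul_mixedVol]
    rfl
  refine ⟨⟨fun ⟨hc, ht, hv, hs⟩ => ?_, fun ⟨M, N, σ, hσ, h⟩ => ?_⟩,
    fun M₁ N₁ M₂ N₂ σ₁ σ₂ ⟨hσ₁, h₁⟩ ⟨hσ₂, h₂⟩ => unique_of_formula_eq μ b fun w K => ?_⟩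
  · obtain ⟨M, N, h⟩ := exists_formula_of_contravariant μ b hc ht hv hs
    obtain ⟨σ, hσ⟩ := exists_isSurfaceAreaMeasure M
    exact ⟨M, N, σ, hσ, fun K w => (h K w).trans (key hσ K w).symm⟩
  · exact contravariant_of_hSupp b (isEquivariant_formula b μ M N) (continuous_formula b μ M N)
      fun K w => (h K w).trans (key hσ K w)
  · rw [← key hσ₁, ← key hσ₂, ← h₁, ← h₂]
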